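/- Fix integers r ≥ 2 and 0 ≤ k ≤ r−2, a constant γ ≥ 1, and T > 0. Let (η, u) be a sufficiently smooth solution of (SSW) on [0,1]×[0,T] (it suffices that η, u ∈ C¹([0,T]; C^r[0,1])). Then there is a constant C, independent of the partition, such that for every partition of [0,1] that is quasiuniform with constant γ, the semidiscrete Galerkin problem: (∂_t η_h, φ) + (∂_x u_h, φ) + (1/2)(∂_x(η_h u_h), φ) = 0 for all φ ∈ S_h, (∂_t u_h, χ) + (∂_x η_h, χ) + (3/2)(u_h ∂_x u_h, χ) + (1/2)(η_h ∂_x η_h, χ) = 0 for all χ ∈ S_{h,0}, with η_h(0) = Pη₀, u_h(0) = P₀u₀, has a unique solution (η_h, u_h) on [0,T] satisfying max_{0≤t≤T} (‖η(·,t) − η_h(t)‖ + ‖u(·,t) − u_h(t)‖) ≤ C h^{r−1}. -/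

import Mathlib

noncomputable section
open Set

/-- The L²(0,1) inner product of two real functions. -/
def ip (f g : ℝ → ℝ) : ℝ := ∫ y in (0:ℝ)..1, f y * g y

/-- The L²(0,1) norm. -/
def nrm (f : ℝ → ℝ) : ℝ := Real.sqrt (∫ y in (0:ℝ)..1, (f y)^2)

/-- `g` is the L²(0,1)-orthogonal projection of `f` onto `S`. -/
def IsL2ProjOn (S : Set (ℝ → ℝ)) (f g : ℝ → ℝ) : Prop :=
  g ∈ S ∧ ∀ χ ∈ S, ip (fun y => f y - g y) χ = 0

/-- The space `S_h` of `C^k` piecewise polynomials of degree ≤ r-1 on the partition `x`. -/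
def Sh (N r k : ℕ) (x : ℕ → ℝ) : Set (ℝ → ℝ) :=
  {φ | ContDiffOn ℝ k φ (Icc (0:ℝ) 1) ∧
    ∀ j < N, ∃ p : Polynomial ℝ, p.natDegree ≤ r - 1 ∧
      ∀ y ∈ Icc (x j) (x (j+1)), φ y = Polynomial.eval y p}

/-- The subspace `S_{h,0}` of functions in `S_h` vanishing at 0 and 1. -/
def Sh0 (N r k : ℕ) (x : ℕ → ℝ) : Set (ℝ → ℝ) :=
  {φ | φ ∈ Sh N r k x ∧ φ 0 = 0 ∧ φ 1 = 0}

/-- `x 0 = 0 < x 1 < ⋯ < x N = 1` is a partition of `[0,1]`. -/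
def IsPartition (N : ℕ) (x : ℕ → ℝ) : Prop :=
  x 0 = 0 ∧ x N = 1 ∧ ∀ i < N, x i < x (i+1)

/-- `h` is the maximal meshlength of the partition `x`. -/
def IsMeshSize (N : ℕ) (x : ℕ → ℝ) (h : ℝ) : Prop :=
  (∀ i < N, x (i+1) - x i ≤ h) ∧ ∃ i < N, x (i+1) - x i = h

/-- The partition is quasiuniform with constant γ : `h ≤ γ · min meshlength`. -/
def QuasiUniform (N : ℕ) (x : ℕ → ℝ) (h γ : ℝ) : Prop :=
  ∀ i < N, h ≤ γ * (x (i+1) - x i)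

/-- `fs j` is the j-th time derivative of `fs 0` on `[0,1]×[0,T]` for `j ≤ m`,
each being r times continuously differentiable in space and jointly continuous:
an encoding of `fs 0 ∈ C^m([0,T]; C^r[0,1])`. -/
def SmoothChain (T : ℝ) (r m : ℕ) (fs : ℕ → ℝ → ℝ → ℝ) : Prop :=
  (∀ j < m, ∀ y ∈ Icc (0:ℝ) 1, ∀ t ∈ Icc (0:ℝ) T,
    HasDerivWithinAt (fun s => fs j y s) (fs (j+1) y t) (Icc (0:ℝ) T) t) ∧
  (∀ j ≤ m, ∀ t ∈ Icc (0:ℝ) T, ContDiffOn ℝ r (fun y => fs j y t) (Icc (0:ℝ) 1)) ∧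
  (∀ j ≤ m, ContinuousOn (fun p : ℝ × ℝ => fs j p.1 p.2) ((Icc (0:ℝ) 1) ×ˢ (Icc (0:ℝ) T)))

/-- `(η,u)` (with time derivatives `ηt`, `ut`) solves the symmetric shallow water
system on `[0,1]×[0,T]` with homogeneous boundary conditions for `u`. -/
def SSW (T : ℝ) (η u ηt ut : ℝ → ℝ → ℝ) : Prop :=
  (∀ y ∈ Icc (0:ℝ) 1, ∀ t ∈ Icc (0:ℝ) T,
    ηt y t + derivWithin (fun z => u z t) (Icc (0:ℝ) 1) y
      + (1/2) * derivWithin (fun z => η z t * u z t) (Icc (0:ℝ) 1) y = 0 ∧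
    ut y t + derivWithin (fun z => η z t) (Icc (0:ℝ) 1) y
      + (3/2) * (u y t * derivWithin (fun z => u z t) (Icc (0:ℝ) 1) y)
      + (1/2) * (η y t * derivWithin (fun z => η z t) (Icc (0:ℝ) 1) y) = 0) ∧
  (∀ t ∈ Icc (0:ℝ) T, u 0 t = 0 ∧ u 1 t = 0)

/-- `(ηh, uh)` (with time derivatives `dηh`, `duh`) is a `C¹` in time solution of the
standard Galerkin semidiscretization of the symmetric shallow water system in
`Sh N r k x × Sh0 N r k x` on `[0,T]`. -/
def SolvesSSWGalerkin (N r k : ℕ) (x : ℕ → ℝ) (T : ℝ)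
    (ηh uh dηh duh : ℝ → ℝ → ℝ) : Prop :=
  (∀ t ∈ Icc (0:ℝ) T, ηh t ∈ Sh N r k x ∧ uh t ∈ Sh0 N r k x ∧
      dηh t ∈ Sh N r k x ∧ duh t ∈ Sh0 N r k x) ∧
  (∀ y ∈ Icc (0:ℝ) 1, ∀ t ∈ Icc (0:ℝ) T,
      HasDerivWithinAt (fun s => ηh s y) (dηh t y) (Icc (0:ℝ) T) t ∧
      HasDerivWithinAt (fun s => uh s y) (duh t y) (Icc (0:ℝ) T) t) ∧
  (∀ y ∈ Icc (0:ℝ) 1, ContinuousOn (fun t => dηh t y) (Icc (0:ℝ) T) ∧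
      ContinuousOn (fun t => duh t y) (Icc (0:ℝ) T)) ∧
  (∀ t ∈ Icc (0:ℝ) T,
      (∀ φ ∈ Sh N r k x,
        ip (dηh t) φ + ip (deriv (uh t)) φ
          + (1/2) * ip (deriv (fun y => ηh t y * uh t y)) φ = 0) ∧
      (∀ χ ∈ Sh0 N r k x,
        ip (duh t) χ + ip (deriv (ηh t)) χ
          + (3/2) * ip (fun y => uh t y * deriv (uh t) y) χ
          + (1/2) * ip (fun y => ηh t y * deriv (ηh t) y) χ = 0))

open MeasureTheory intervalIntegral

/-- bounded measurable functions on `(a,b]`. -/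
def BI (a b : ℝ) (f : ℝ → ℝ) : Prop :=
  AEStronglyMeasurable f (volume.restrict (Ioc a b)) ∧
    ∃ M : ℝ, ∀ᵐ x ∂(volume.restrict (Ioc a b)), |f x| ≤ M

namespace BI
variable {a b : ℝ} {f g : ℝ → ℝ}

theorem add (hf : BI a b f) (hg : BI a b g) : BI a b (fun x => f x + g x) := by
  obtain ⟨h1, M, hM⟩ := hf
  obtain ⟨h2, N, hN⟩ := hg
  refine ⟨h1.add h2, M + N, ?_⟩
  filter_upwards [hM, hN] with x hx hy
  exact (abs_add_le _ _).trans (add_le_add hx hy)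

theorem mul (hf : BI a b f) (hg : BI a b g) : BI a b (fun x => f x * g x) := by
  obtain ⟨h1, M, hM⟩ := hf
  obtain ⟨h2, N, hN⟩ := hg
  refine ⟨h1.mul h2, M * N, ?_⟩
  filter_upwards [hM, hN] with x hx hy
  rw [abs_mul]
  exact mul_le_mul hx hy (abs_nonneg _) ((abs_nonneg _).trans hx)

theorem const (c : ℝ) : BI a b (fun _ => c) :=
  ⟨aestronglyMeasurable_const, |c|, Filter.Eventually.of_forall fun _ => le_rfl⟩

theorem const_mul (c : ℝ) (hf : BI a b f) : BI a b (fun x => c * f x) :=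
  (BI.const c).mul hf

theorem neg (hf : BI a b f) : BI a b (fun x => - f x) := by
  simpa using hf.const_mul (-1)

theorem sub (hf : BI a b f) (hg : BI a b g) : BI a b (fun x => f x - g x) := by
  simpa [sub_eq_add_neg] using hf.add hg.neg

theorem sq (hf : BI a b f) : BI a b (fun x => f x ^ 2) := by
  simpa [pow_two] using hf.mul hf

theorem sum {ι : Type*} (s : Finset ι) {F : ι → ℝ → ℝ} (h : ∀ i ∈ s, BI a b (F i)) :
    BI a b (fun x => ∑ i ∈ s, F i x) := by
  classical
  induction s using Finset.induction_on with
  | empty => simpa using BI.const (a := a) (b := b) 0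
  | insert i s hi ih =>
    simp only [Finset.sum_insert hi]
    exact (h i (Finset.mem_insert_self _ _)).add
      (ih fun j hj => h j (Finset.mem_insert_of_mem hj))

theorem of_continuousOn (h : ContinuousOn f (Icc a b)) : BI a b f := by
  refine ⟨(h.mono Ioc_subset_Icc_self).aestronglyMeasurable measurableSet_Ioc, ?_⟩
  obtain ⟨C, hC⟩ := isCompact_Icc.exists_bound_of_continuousOn h
  refine ⟨C, (ae_restrict_iff' measurableSet_Ioc).2 (Filter.Eventually.of_forall ?_)⟩
  intro x hx
  exact hC x (Ioc_subset_Icc_self hx)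

theorem of_continuous (h : Continuous f) : BI a b f := of_continuousOn h.continuousOn

theorem intervalIntegrable (hab : a ≤ b) (hf : BI a b f) : IntervalIntegrable f volume a b := by
  rw [intervalIntegrable_iff_integrableOn_Ioc_of_le hab]
  obtain ⟨h1, M, hM⟩ := hf
  haveI : IsFiniteMeasure (volume.restrict (Ioc a b)) := ⟨by simp⟩
  exact Integrable.of_bound h1 M (by simpa using hM)

theorem congr (hf : BI a b f) (h : ∀ᵐ x ∂(volume.restrict (Ioc a b)), f x = g x) : BI a b g := by
  obtain ⟨h1, M, hM⟩ := hf
  refine ⟨h1.congr h, M, ?_⟩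
  filter_upwards [hM, h] with x hx hy
  rwa [← hy]

theorem mono {c d : ℝ} (hf : BI a b f) (hac : a ≤ c) (hdb : d ≤ b) : BI c d f := by
  obtain ⟨h1, M, hM⟩ := hf
  have hs : Ioc c d ⊆ Ioc a b := Ioc_subset_Ioc hac hdb
  exact ⟨h1.mono_measure (Measure.restrict_mono hs le_rfl), M,
    ae_restrict_of_ae_restrict_of_subset hs hM⟩

end BI

section integrals
variable {a b : ℝ} {f g : ℝ → ℝ}

theorem int_congr_ae (hab : a ≤ b) (h : ∀ᵐ x ∂(volume.restrict (Ioc a b)), f x = g x) :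
    ∫ x in a..b, f x = ∫ x in a..b, g x := by
  rw [integral_of_le hab, integral_of_le hab]
  exact MeasureTheory.integral_congr_ae h

theorem int_mono_ae (hab : a ≤ b) (hf : BI a b f) (hg : BI a b g)
    (h : ∀ᵐ x ∂(volume.restrict (Ioc a b)), f x ≤ g x) :
    ∫ x in a..b, f x ≤ ∫ x in a..b, g x := by
  rw [integral_of_le hab, integral_of_le hab]
  exact MeasureTheory.integral_mono_ae
    ((intervalIntegrable_iff_integrableOn_Ioc_of_le hab).1 (hf.intervalIntegrable hab))
    ((intervalIntegrable_iff_integrableOn_Ioc_of_le hab).1 (hg.intervalIntegrable hab)) h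

theorem int_mono (hab : a ≤ b) (hf : BI a b f) (hg : BI a b g)
    (h : ∀ x ∈ Icc a b, f x ≤ g x) :
    ∫ x in a..b, f x ≤ ∫ x in a..b, g x :=
  int_mono_ae hab hf hg ((ae_restrict_iff' measurableSet_Ioc).2
    (Filter.Eventually.of_forall fun x hx => h x (Ioc_subset_Icc_self hx)))

theorem int_add (hab : a ≤ b) (hf : BI a b f) (hg : BI a b g) :
    ∫ x in a..b, (f x + g x) = (∫ x in a..b, f x) + ∫ x in a..b, g x :=
  intervalIntegral.integral_add (hf.intervalIntegrable hab) (hg.intervalIntegrable hab)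

theorem int_sub (hab : a ≤ b) (hf : BI a b f) (hg : BI a b g) :
    ∫ x in a..b, (f x - g x) = (∫ x in a..b, f x) - ∫ x in a..b, g x :=
  intervalIntegral.integral_sub (hf.intervalIntegrable hab) (hg.intervalIntegrable hab)

theorem int_sum {ι : Type*} (hab : a ≤ b) (s : Finset ι) {F : ι → ℝ → ℝ}
    (h : ∀ i ∈ s, BI a b (F i)) :
    ∫ x in a..b, (∑ i ∈ s, F i x) = ∑ i ∈ s, ∫ x in a..b, F i x :=
  intervalIntegral.integral_finsetSum fun i hi => (h i hi).intervalIntegrable hab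

theorem int_sq_nonneg (hab : a ≤ b) : 0 ≤ ∫ x in a..b, f x ^ 2 :=
  intervalIntegral.integral_nonneg hab fun x _ => sq_nonneg _

theorem cauchy_schwarz_sq (hab : a ≤ b) (hf : BI a b f) (hg : BI a b g) :
    (∫ x in a..b, f x * g x) ^ 2 ≤ (∫ x in a..b, f x ^ 2) * ∫ x in a..b, g x ^ 2 := by
  have key : ∀ l : ℝ, 0 ≤ (∫ x in a..b, g x ^ 2) * (l * l) + (2 * ∫ x in a..b, f x * g x) * l
      + ∫ x in a..b, f x ^ 2 := by
    intro l
    have h0 : 0 ≤ ∫ x in a..b, (f x + l * g x) ^ 2 := int_sq_nonneg hab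
    have h1 : ∫ x in a..b, (f x + l * g x) ^ 2
        = (∫ x in a..b, f x ^ 2) + (2 * l) * (∫ x in a..b, f x * g x)
          + l ^ 2 * ∫ x in a..b, g x ^ 2 := by
      rw [← intervalIntegral.integral_const_mul, ← intervalIntegral.integral_const_mul,
        ← int_add hab hf.sq ((hf.mul hg).const_mul _),
        ← int_add hab (hf.sq.add ((hf.mul hg).const_mul _)) (hg.sq.const_mul _)]
      congr 1
      ext x
      ring
    nlinarith
  have := discrim_le_zero key
  unfold discrim at this
  nlinarith

theorem cauchy_schwarz (hab : a ≤ b) (hf : BI a b f) (hg : BI a b g) :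
    |∫ x in a..b, f x * g x| ≤
      Real.sqrt (∫ x in a..b, f x ^ 2) * Real.sqrt (∫ x in a..b, g x ^ 2) := by
  rw [← Real.sqrt_mul (int_sq_nonneg hab)]
  exact Real.abs_le_sqrt (cauchy_schwarz_sq hab hf hg)

/-- Minkowski -/
theorem sqrt_int_add_le (hab : a ≤ b) (hf : BI a b f) (hg : BI a b g) :
    Real.sqrt (∫ x in a..b, (f x + g x) ^ 2) ≤
      Real.sqrt (∫ x in a..b, f x ^ 2) + Real.sqrt (∫ x in a..b, g x ^ 2) := by
  rw [Real.sqrt_le_left (by positivity)]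
  have h1 : ∫ x in a..b, (f x + g x) ^ 2
        = (∫ x in a..b, f x ^ 2) + 2 * (∫ x in a..b, f x * g x)
          + ∫ x in a..b, g x ^ 2 := by
    rw [← intervalIntegral.integral_const_mul, 
        ← int_add hab hf.sq ((hf.mul hg).const_mul _),
        ← int_add hab (hf.sq.add ((hf.mul hg).const_mul _)) hg.sq]
    congr 1
    ext x
    ring
  have h2 := (le_abs_self _).trans (cauchy_schwarz hab hf hg)
  rw [h1, add_sq, Real.sq_sqrt (int_sq_nonneg hab), Real.sq_sqrt (int_sq_nonneg hab)]
  linarith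

/-- `‖f g‖ ≤ M ‖f‖`. -/
theorem int_mul_sq_le (hab : a ≤ b) (hf : BI a b f) (hg : BI a b g) {M : ℝ}
    (h : ∀ x ∈ Icc a b, |g x| ≤ M) :
    ∫ x in a..b, (g x * f x) ^ 2 ≤ M ^ 2 * ∫ x in a..b, f x ^ 2 := by
  rw [← intervalIntegral.integral_const_mul]
  refine int_mono hab (hg.mul hf).sq (hf.sq.const_mul _) fun x hx => ?_
  rw [mul_pow]
  have := h x hx
  exact mul_le_mul_of_nonneg_right (sq_le_sq' (by linarith [abs_le.1 this]) (abs_le.1 this).2)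
    (sq_nonneg _)

end integrals

/-- continuous, piecewise `C^1` functions on `[a,b]`. -/
def PC (a b : ℝ) (f : ℝ → ℝ) : Prop :=
  ContinuousOn f (Icc a b) ∧ ∃ s : Set ℝ, s.Countable ∧ ∃ M : ℝ,
    ∀ x ∈ Ioo a b, x ∉ s → DifferentiableAt ℝ f x ∧ |deriv f x| ≤ M

namespace PC
variable {a b : ℝ} {f g : ℝ → ℝ}

theorem bi (hf : PC a b f) : BI a b f := BI.of_continuousOn hf.1

theorem ae_of (s : Set ℝ) (hs : s.Countable) {P : ℝ → Prop}
    (h : ∀ x ∈ Ioo a b, x ∉ s → P x) : ∀ᵐ x ∂(volume.restrict (Ioc a b)), P x := by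
  rw [ae_restrict_iff' measurableSet_Ioc]
  have h1 : ∀ᵐ x ∂(volume : Measure ℝ), x ∉ s ∪ {b} :=
    ((hs.union (countable_singleton b)).ae_notMem volume)
  filter_upwards [h1] with x hx hxI
  simp only [mem_union, mem_singleton_iff, not_or] at hx
  exact h x ⟨hxI.1, lt_of_le_of_ne hxI.2 hx.2⟩ hx.1

theorem ae_diff (hf : PC a b f) :
    ∀ᵐ x ∂(volume.restrict (Ioc a b)), DifferentiableAt ℝ f x := by
  obtain ⟨_, s, hs, M, h⟩ := hf
  exact ae_of s hs fun x hx hxs => (h x hx hxs).1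

theorem bi_deriv (hf : PC a b f) : BI a b (deriv f) := by
  obtain ⟨_, s, hs, M, h⟩ := hf
  exact ⟨(measurable_deriv f).aestronglyMeasurable, M,
    ae_of s hs fun x hx hxs => (h x hx hxs).2⟩

theorem const (c : ℝ) : PC a b (fun _ => c) :=
  ⟨continuousOn_const, ∅, countable_empty, 0, fun x _ _ => ⟨differentiableAt_const _, by simp⟩⟩

theorem add (hf : PC a b f) (hg : PC a b g) : PC a b (fun x => f x + g x) := by
  obtain ⟨h1, s, hs, M, h⟩ := hf
  obtain ⟨h2, s', hs', M', h'⟩ := hg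
  refine ⟨h1.add h2, s ∪ s', hs.union hs', M + M', fun x hx hxs => ?_⟩
  simp only [mem_union, not_or] at hxs
  obtain ⟨a1, a2⟩ := h x hx hxs.1
  obtain ⟨b1, b2⟩ := h' x hx hxs.2
  refine ⟨a1.add b1, ?_⟩
  rw [deriv_fun_add a1 b1]
  exact (abs_add_le _ _).trans (add_le_add a2 b2)

theorem mul (hf : PC a b f) (hg : PC a b g) : PC a b (fun x => f x * g x) := by
  obtain ⟨h1, s, hs, M, h⟩ := hf
  obtain ⟨h2, s', hs', M', h'⟩ := hg
  obtain ⟨C, hC⟩ := isCompact_Icc.exists_bound_of_continuousOn h1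
  obtain ⟨C', hC'⟩ := isCompact_Icc.exists_bound_of_continuousOn h2
  refine ⟨h1.mul h2, s ∪ s', hs.union hs', M * C' + C * M', fun x hx hxs => ?_⟩
  simp only [mem_union, not_or] at hxs
  obtain ⟨a1, a2⟩ := h x hx hxs.1
  obtain ⟨b1, b2⟩ := h' x hx hxs.2
  refine ⟨a1.mul b1, ?_⟩
  rw [deriv_fun_mul a1 b1]
  have c1 := hC x (Ioo_subset_Icc_self hx)
  have c2 := hC' x (Ioo_subset_Icc_self hx)
  rw [Real.norm_eq_abs] at c1 c2
  refine (abs_add_le _ _).trans (add_le_add ?_ ?_)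
  · rw [abs_mul]; exact mul_le_mul a2 c2 (abs_nonneg _) ((abs_nonneg _).trans a2)
  · rw [abs_mul]; exact mul_le_mul c1 b2 (abs_nonneg _) ((abs_nonneg _).trans c1)

theorem const_mul (c : ℝ) (hf : PC a b f) : PC a b (fun x => c * f x) := (PC.const c).mul hf

theorem neg (hf : PC a b f) : PC a b (fun x => - f x) := by
  simpa using hf.const_mul (-1)

theorem sub (hf : PC a b f) (hg : PC a b g) : PC a b (fun x => f x - g x) := by
  simpa [sub_eq_add_neg] using hf.add hg.neg

theorem sum {ι : Type*} (s : Finset ι) {F : ι → ℝ → ℝ} (h : ∀ i ∈ s, PC a b (F i)) :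
    PC a b (fun x => ∑ i ∈ s, F i x) := by
  classical
  induction s using Finset.induction_on with
  | empty => simpa using PC.const (a := a) (b := b) 0
  | insert i s hi ih =>
    simp only [Finset.sum_insert hi]
    exact (h i (Finset.mem_insert_self _ _)).add
      (ih fun j hj => h j (Finset.mem_insert_of_mem hj))

theorem of_contDiffOn (hab : a < b) (h : ContDiffOn ℝ 1 f (Icc a b)) : PC a b f := by
  refine ⟨h.continuousOn, ∅, countable_empty, ?_⟩
  have hc : ContinuousOn (derivWithin f (Icc a b)) (Icc a b) :=
    h.continuousOn_derivWithin (uniqueDiffOn_Icc hab) le_rfl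
  obtain ⟨C, hC⟩ := isCompact_Icc.exists_bound_of_continuousOn hc
  refine ⟨C, fun x hx _ => ?_⟩
  have hn : Icc a b ∈ nhds x := Icc_mem_nhds hx.1 hx.2
  refine ⟨(h.differentiableOn one_ne_zero x (Ioo_subset_Icc_self hx)).differentiableAt hn, ?_⟩
  have := hC x (Ioo_subset_Icc_self hx)
  rwa [derivWithin_of_mem_nhds hn] at this

theorem of_contDiff (h : ContDiff ℝ 1 f) : PC a b f := by
  obtain ⟨C, hC⟩ := isCompact_Icc.exists_bound_of_continuousOn
    (h.continuous_deriv le_rfl).continuousOn (s := Icc a b)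
  exact ⟨h.continuous.continuousOn, ∅, countable_empty, C, fun x hx _ =>
    ⟨h.differentiable one_ne_zero x, hC x (Ioo_subset_Icc_self hx)⟩⟩

theorem deriv_mul_ae (hf : PC a b f) (hg : PC a b g) :
    ∀ᵐ x ∂(volume.restrict (Ioc a b)),
      deriv (fun y => f y * g y) x = deriv f x * g x + f x * deriv g x := by
  filter_upwards [hf.ae_diff, hg.ae_diff] with x h1 h2
  exact deriv_fun_mul h1 h2

theorem deriv_add_ae (hf : PC a b f) (hg : PC a b g) :
    ∀ᵐ x ∂(volume.restrict (Ioc a b)),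
      deriv (fun y => f y + g y) x = deriv f x + deriv g x := by
  filter_upwards [hf.ae_diff, hg.ae_diff] with x h1 h2
  exact deriv_fun_add h1 h2

theorem deriv_sub_ae (hf : PC a b f) (hg : PC a b g) :
    ∀ᵐ x ∂(volume.restrict (Ioc a b)),
      deriv (fun y => f y - g y) x = deriv f x - deriv g x := by
  filter_upwards [hf.ae_diff, hg.ae_diff] with x h1 h2
  exact deriv_fun_sub h1 h2

theorem deriv_sum_ae {ι : Type*} (s : Finset ι) {F : ι → ℝ → ℝ} (h : ∀ i ∈ s, PC a b (F i)) :
    ∀ᵐ x ∂(volume.restrict (Ioc a b)),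
      deriv (fun y => ∑ i ∈ s, F i y) x = ∑ i ∈ s, deriv (F i) x := by
  have : ∀ᵐ x ∂(volume.restrict (Ioc a b)), ∀ i ∈ s, DifferentiableAt ℝ (F i) x :=
    (Filter.eventually_all_finset s).2 fun i hi => (h i hi).ae_diff
  filter_upwards [this] with x hx
  exact deriv_fun_sum hx

theorem int_deriv (hab : a ≤ b) (hf : PC a b f) : ∫ x in a..b, deriv f x = f b - f a := by
  have hi := hf.bi_deriv.intervalIntegrable hab
  obtain ⟨h1, s, hs, M, h⟩ := hf
  exact integral_eq_of_hasDerivAt_off_countable_of_le f (deriv f) hab hs h1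
    (fun x hx => (h x hx.1 hx.2).1.hasDerivAt) hi

theorem by_parts (hab : a ≤ b) (hf : PC a b f) (hg : PC a b g) :
    ∫ x in a..b, deriv f x * g x = f b * g b - f a * g a - ∫ x in a..b, f x * deriv g x := by
  have h := (hf.mul hg).int_deriv hab
  rw [int_congr_ae hab (hf.deriv_mul_ae hg),
    int_add hab (hf.bi_deriv.mul hg.bi) (hf.bi.mul hg.bi_deriv)] at h
  linarith

end PC

/-! ## Energy preserving ODEs -/
section ode
variable {E : Type*} [NormedAddCommGroup E] [InnerProductSpace ℝ E] 

theorem energy_const {T : ℝ} {F : E → E} {c : ℝ → E}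
    (hF : ∀ v, inner ℝ v (F v) = 0)
    (hc : ∀ t ∈ Icc (0:ℝ) T, HasDerivWithinAt c (F (c t)) (Icc (0:ℝ) T) t) :
    ∀ t ∈ Icc (0:ℝ) T, ‖c t‖ = ‖c 0‖ := by
  intro t ht
  have hT : 0 ≤ T := ht.1.trans ht.2
  have h0 : ∀ s ∈ Icc (0:ℝ) T, HasDerivWithinAt (fun s => ‖c s‖ ^ 2) 0 (Icc (0:ℝ) T) s := by
    intro s hs
    have := (hc s hs).norm_sq
    rwa [hF, mul_zero] at this
  have := constant_of_has_deriv_right_zero (f := fun s => ‖c s‖ ^ 2) (a := 0) (b := T)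
    (fun s hs => (h0 s hs).continuousWithinAt)
    (fun s hs => ((h0 s (Ico_subset_Icc_self hs)).mono_of_mem_nhdsWithin
      (Icc_mem_nhdsGE_of_mem hs))) t ht
  have h2 : ‖c t‖ ^ 2 = ‖c 0‖ ^ 2 := this
  exact (pow_left_inj₀ (norm_nonneg _) (norm_nonneg _) two_ne_zero).1 h2

theorem ode_exists [FiniteDimensional ℝ E] {T : ℝ} (hT : 0 ≤ T) {F : E → E} (hFs : ContDiff ℝ 1 F)
    (hF : ∀ v, inner ℝ v (F v) = 0) (c0 : E) :
    ∃ c : ℝ → E, c 0 = c0 ∧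
      ∀ t ∈ Icc (0:ℝ) T, HasDerivWithinAt c (F (c t)) (Icc (0:ℝ) T) t := by
  let χ : ContDiffBump (0:E) := ⟨‖c0‖ + 1, ‖c0‖ + 2, by positivity, by linarith⟩
  let G : E → E := fun v => χ v • F v
  have hGs : ContDiff ℝ 1 G := (χ.contDiff).smul hFs
  have hGc : HasCompactSupport G := χ.hasCompactSupport.smul_right
  obtain ⟨K, hK⟩ := ContDiff.lipschitzWith_of_hasCompactSupport hGc hGs (by simp)
  obtain ⟨M, hM⟩ := hGc.exists_bound_of_continuous hGs.continuous
  have hM0 : 0 ≤ M := (norm_nonneg _).trans (hM 0)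
  have hPL : IsPicardLindelof (fun _ => G) (tmin := 0) (tmax := T) ⟨0, le_rfl, hT⟩ c0
      (⟨M * T, by positivity⟩ : NNReal) 0 ⟨M, hM0⟩ K := by
    refine ⟨fun t _ => hK.lipschitzOnWith, fun x _ => continuousOn_const, fun t _ x _ => hM x, ?_⟩
    simp only [sub_zero, sub_self, NNReal.coe_zero]
    rw [max_eq_left hT]; exact le_rfl
  obtain ⟨c, h0, hc⟩ := hPL.exists_eq_forall_mem_Icc_hasDerivWithinAt₀
  refine ⟨c, h0, ?_⟩
  have hen := energy_const (F := G) (fun v => by simp [G, inner_smul_right, hF]) hc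
  intro t ht
  have h1 := hc t ht
  have : G (c t) = F (c t) := by
    have h2 : χ (c t) = 1 := by
      apply χ.one_of_mem_closedBall
      rw [mem_closedBall_zero_iff, hen t ht, show c 0 = c0 from h0]
      change ‖c0‖ ≤ ‖c0‖ + 1
      linarith
    simp [G, h2]
  simpa [this] using h1

theorem ode_unique [FiniteDimensional ℝ E] {T : ℝ} {F : E → E} (hFs : ContDiff ℝ 1 F)
    (hF : ∀ v, inner ℝ v (F v) = 0) {c d : ℝ → E} (h0 : c 0 = d 0)
    (hc : ∀ t ∈ Icc (0:ℝ) T, HasDerivWithinAt c (F (c t)) (Icc (0:ℝ) T) t)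
    (hd : ∀ t ∈ Icc (0:ℝ) T, HasDerivWithinAt d (F (d t)) (Icc (0:ℝ) T) t) :
    ∀ t ∈ Icc (0:ℝ) T, c t = d t := by
  let χ : ContDiffBump (0:E) := ⟨‖c 0‖ + 1, ‖c 0‖ + 2, by positivity, by linarith⟩
  let G : E → E := fun v => χ v • F v
  have hGs : ContDiff ℝ 1 G := (χ.contDiff).smul hFs
  have hGc : HasCompactSupport G := χ.hasCompactSupport.smul_right
  obtain ⟨K, hK⟩ := ContDiff.lipschitzWith_of_hasCompactSupport hGc hGs (by simp)
  have key : ∀ c' : ℝ → E, c' 0 = c 0 →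
      (∀ t ∈ Icc (0:ℝ) T, HasDerivWithinAt c' (F (c' t)) (Icc (0:ℝ) T) t) →
      ∀ t ∈ Icc (0:ℝ) T, HasDerivWithinAt c' (G (c' t)) (Icc (0:ℝ) T) t := by
    intro c' h h' t ht
    have : G (c' t) = F (c' t) := by
      have h2 : χ (c' t) = 1 := by
        apply χ.one_of_mem_closedBall
        rw [mem_closedBall_zero_iff, energy_const hF h' t ht, h]
        change ‖c 0‖ ≤ ‖c 0‖ + 1
        linarith
      simp [G, h2]
    rw [this]; exact h' t ht
  have hc' := key c rfl hc
  have hd' := key d h0.symm hd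
  have aux : ∀ c' : ℝ → E,
      (∀ t ∈ Icc (0:ℝ) T, HasDerivWithinAt c' (G (c' t)) (Icc (0:ℝ) T) t) →
      ∀ t ∈ Ico (0:ℝ) T, HasDerivWithinAt c' (G (c' t)) (Ici t) t :=
    fun c' h t ht => (h t (Ico_subset_Icc_self ht)).mono_of_mem_nhdsWithin (Icc_mem_nhdsGE_of_mem ht)
  exact ODE_solution_unique_of_mem_Icc_right (v := fun _ => G) (s := fun _ => univ) (K := K)
    (fun t _ => hK.lipschitzOnWith) (fun t ht => (hc' t ht).continuousWithinAt) (aux c hc')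
    (fun _ _ => mem_univ _) (fun t ht => (hd' t ht).continuousWithinAt) (aux d hd')
    (fun _ _ => mem_univ _) h0
end ode

/-! ## Abstract Galerkin system -/
section galerkin
variable {ι κ : Type*} [Fintype ι] [Fintype κ]

/-- finite linear combination of functions -/
def lin (e : ι → ℝ → ℝ) (c : ι → ℝ) : ℝ → ℝ := fun x => ∑ i, c i * e i x

theorem lin_PC {a b : ℝ} {e : ι → ℝ → ℝ} (he : ∀ i, PC a b (e i)) (c : ι → ℝ) : PC a b (lin e c) :=
  PC.sum _ fun i _ => (he i).const_mul _

theorem lin_deriv_ae {a b : ℝ} {e : ι → ℝ → ℝ} (he : ∀ i, PC a b (e i)) (c : ι → ℝ) :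
    ∀ᵐ x ∂(volume.restrict (Ioc a b)), deriv (lin e c) x = ∑ i, c i * deriv (e i) x := by
  have h1 := PC.deriv_sum_ae (a := a) (b := b) Finset.univ (F := fun i x => c i * e i x)
    (fun i _ => (he i).const_mul _)
  filter_upwards [h1] with x hx
  rw [show deriv (lin e c) x = deriv (fun x => ∑ i, c i * e i x) x from rfl, hx]
  exact Finset.sum_congr rfl fun i _ => by
    rw [deriv_const_mul_field]

theorem lin_ortho {a b : ℝ} (hab : a ≤ b) [DecidableEq ι] {e : ι → ℝ → ℝ} (he : ∀ i, BI a b (e i))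
    (ho : ∀ i j, ∫ x in a..b, e i x * e j x = if i = j then 1 else 0) (c : ι → ℝ) (j : ι) :
    ∫ x in a..b, lin e c x * e j x = c j := by
  have : ∀ x, lin e c x * e j x = ∑ i, c i * (e i x * e j x) := by
    intro x; rw [lin, Finset.sum_mul]; exact Finset.sum_congr rfl fun i _ => by ring
  simp_rw [this]
  rw [int_sum hab _ (fun i _ => ((he i).mul (he j)).const_mul _)]
  simp_rw [intervalIntegral.integral_const_mul, ho]
  simp

theorem lin_BI {a b : ℝ} {e : ι → ℝ → ℝ} (he : ∀ i, BI a b (e i)) (c : ι → ℝ) : BI a b (lin e c) :=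
  BI.sum _ fun i _ => (he i).const_mul _

theorem int_lin_mul {a b : ℝ} (hab : a ≤ b) {e : ι → ℝ → ℝ} (he : ∀ i, BI a b (e i)) {g : ℝ → ℝ}
    (hg : BI a b g) (c : ι → ℝ) :
    ∫ x in a..b, g x * lin e c x = ∑ i, c i * ∫ x in a..b, g x * e i x := by
  have : ∀ x, g x * lin e c x = ∑ i, c i * (g x * e i x) := by
    intro x; rw [lin, Finset.mul_sum]; exact Finset.sum_congr rfl fun i _ => by ring
  simp_rw [this]
  rw [int_sum hab _ (fun i _ => (hg.mul (he i)).const_mul _)]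
  simp_rw [intervalIntegral.integral_const_mul]

theorem lin_norm {a b : ℝ} (hab : a ≤ b) [DecidableEq ι] {e : ι → ℝ → ℝ} (he : ∀ i, BI a b (e i))
    (ho : ∀ i j, ∫ x in a..b, e i x * e j x = if i = j then 1 else 0) (c d : ι → ℝ) :
    ∫ x in a..b, lin e c x * lin e d x = ∑ i, c i * d i := by
  rw [int_lin_mul hab he (lin_BI he c)]
  exact Finset.sum_congr rfl fun i _ => by rw [lin_ortho hab he ho]; ring

/-- right-hand side of the Galerkin ODE -/
def galG (a b : ℝ) (e : ι → ℝ → ℝ) (f : κ → ℝ → ℝ) (v : EuclideanSpace ℝ (ι ⊕ κ)) :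
    EuclideanSpace ℝ (ι ⊕ κ) :=
  WithLp.toLp 2 (Sum.elim
    (fun i => ∫ x in a..b, (1/2) * (lin e (fun i => v (Sum.inl i)) x * lin f (fun j => v (Sum.inr j)) x)
      * deriv (e i) x)
    (fun j => ∫ x in a..b, ((1/4) * lin e (fun i => v (Sum.inl i)) x ^ 2
      + (3/4) * lin f (fun j => v (Sum.inr j)) x ^ 2) * deriv (f j) x))

theorem quad_contDiff {a b : ℝ} (hab : a ≤ b) {ι' κ' : Type*} [Fintype ι'] [Fintype κ']
    {e : ι' → ℝ → ℝ} {f : κ' → ℝ → ℝ}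
    (he : ∀ i, BI a b (e i)) (hf : ∀ i, BI a b (f i)) {g : ℝ → ℝ} (hg : BI a b g)
    (p : ι' → ι ⊕ κ) (q : κ' → ι ⊕ κ) :
    ContDiff ℝ 1 (fun v : EuclideanSpace ℝ (ι ⊕ κ) => ∫ x in a..b,
      (lin e (fun i => v (p i)) x * lin f (fun i => v (q i)) x) * g x) := by
  have : (fun v : EuclideanSpace ℝ (ι ⊕ κ) => ∫ x in a..b,
      (lin e (fun i => v (p i)) x * lin f (fun i => v (q i)) x) * g x) =
      fun v => ∑ i, ∑ j, v (p i) * v (q j) * ∫ x in a..b, e i x * f j x * g x := by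
    funext v
    have h1 : ∀ x, (lin e (fun i => v (p i)) x * lin f (fun i => v (q i)) x) * g x =
        ∑ i, ∑ j, v (p i) * v (q j) * (e i x * f j x * g x) := by
      intro x
      rw [lin, lin, Finset.sum_mul_sum, Finset.sum_mul]
      refine Finset.sum_congr rfl fun i _ => ?_
      rw [Finset.sum_mul]
      exact Finset.sum_congr rfl fun j _ => by ring
    simp_rw [h1]
    rw [int_sum hab _ (fun i _ => BI.sum _ fun j _ => (((he i).mul (hf j)).mul hg).const_mul _)]
    refine Finset.sum_congr rfl fun i _ => ?_
    rw [int_sum hab _ (fun j _ => (((he i).mul (hf j)).mul hg).const_mul _)]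
    simp_rw [intervalIntegral.integral_const_mul]
  rw [this]
  refine ContDiff.sum fun i _ => ContDiff.sum fun j _ => ?_
  refine ContDiff.mul (ContDiff.mul ?_ ?_) contDiff_const
  · exact (EuclideanSpace.proj (𝕜 := ℝ) (p i)).contDiff
  · exact (EuclideanSpace.proj (𝕜 := ℝ) (q j)).contDiff

variable {a b : ℝ} {e : ι → ℝ → ℝ} {f : κ → ℝ → ℝ}

theorem galG_contDiff (hab : a ≤ b) (he : ∀ i, PC a b (e i)) (hf : ∀ i, PC a b (f i)) :
    ContDiff ℝ 1 (galG a b e f) := by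
  rw [contDiff_euclidean]
  rintro (i | j)
  · have := quad_contDiff (ι := ι) (κ := κ) hab (fun i => (he i).bi) (fun i => (hf i).bi)
      ((he i).bi_deriv.const_mul (1/2)) Sum.inl Sum.inr
    have h2 : (fun v => galG a b e f v (Sum.inl i)) = _ := funext fun v => show _ = (∫ x in a..b,
      (lin e (fun i => v (Sum.inl i)) x * lin f (fun i => v (Sum.inr i)) x)
        * (1/2 * deriv (e i) x)) from by
      change (∫ x in a..b, _) = ∫ x in a..b, _
      congr 1; funext x; ring
    rw [h2]; exact this
  · have h1 := quad_contDiff (ι := ι) (κ := κ) hab (fun i => (he i).bi) (fun i => (he i).bi)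
      ((hf j).bi_deriv.const_mul (1/4)) Sum.inl Sum.inl
    have h2 := quad_contDiff (ι := ι) (κ := κ) hab (fun i => (hf i).bi) (fun i => (hf i).bi)
      ((hf j).bi_deriv.const_mul (3/4)) Sum.inr Sum.inr
    have h3 : (fun v => galG a b e f v (Sum.inr j)) = _ := funext fun v => show _ =
        (∫ x in a..b, (lin e (fun i => v (Sum.inl i)) x * lin e (fun i => v (Sum.inl i)) x)
          * (1/4 * deriv (f j) x)) +
        (∫ x in a..b, (lin f (fun i => v (Sum.inr i)) x * lin f (fun i => v (Sum.inr i)) x)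
          * (3/4 * deriv (f j) x)) from by
      have b1 := lin_BI (fun i => (he i).bi) (fun i => v (Sum.inl i))
      have b2 := lin_BI (fun i => (hf i).bi) (fun i => v (Sum.inr i))
      rw [← int_add hab ((b1.mul b1).mul ((hf j).bi_deriv.const_mul (1/4)))
        ((b2.mul b2).mul ((hf j).bi_deriv.const_mul (3/4)))]
      change (∫ x in a..b, _) = ∫ x in a..b, _
      congr 1; funext x; ring
    rw [h3]; exact h1.add h2

theorem lin_zero_of {x : ℝ} (h : ∀ i, e i x = 0) (c : ι → ℝ) : lin e c x = 0 := by
  simp [lin, h]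

theorem int_mul_deriv_lin (hab : a ≤ b) (he : ∀ i, PC a b (e i)) {g : ℝ → ℝ} (hg : BI a b g)
    (c : ι → ℝ) :
    ∫ x in a..b, g x * deriv (lin e c) x = ∑ i, c i * ∫ x in a..b, g x * deriv (e i) x := by
  rw [← int_lin_mul hab (fun i => (he i).bi_deriv) hg]
  apply int_congr_ae hab
  filter_upwards [lin_deriv_ae he c] with x hx
  rw [hx]; rfl

theorem galG_inner (hab : a ≤ b) (he : ∀ i, PC a b (e i)) (hf : ∀ i, PC a b (f i))
    (hfa : ∀ j, f j a = 0) (hfb : ∀ j, f j b = 0) (v : EuclideanSpace ℝ (ι ⊕ κ)) :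
    inner ℝ v (galG a b e f v) = 0 := by
  rw [PiLp.inner_apply, Fintype.sum_sum_type]
  simp only [galG, Sum.elim_inl, Sum.elim_inr]
  set c : ι → ℝ := fun i => v (Sum.inl i) with hc
  set d : κ → ℝ := fun i => v (Sum.inr i) with hd
  have hZ := lin_PC he c
  have hU := lin_PC hf d
  have e1 : ∑ i, inner ℝ (v (Sum.inl i)) (∫ x in a..b, 1/2 * (lin e c x * lin f d x) * deriv (e i) x)
      = ∫ x in a..b, (1/2 * (lin e c x * lin f d x)) * deriv (lin e c) x := by
    rw [int_mul_deriv_lin hab he ((hZ.mul hU).const_mul (1/2)).bi]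
    exact Finset.sum_congr rfl fun i _ => by simp [hc, mul_comm]
  have e2 : ∑ i, inner ℝ (v (Sum.inr i)) (∫ x in a..b, (1/4 * lin e c x ^ 2 + 3/4 * lin f d x ^ 2)
        * deriv (f i) x)
      = ∫ x in a..b, (1/4 * lin e c x ^ 2 + 3/4 * lin f d x ^ 2) * deriv (lin f d) x := by
    rw [int_mul_deriv_lin hab hf ((hZ.bi.sq.const_mul (1/4)).add (hU.bi.sq.const_mul (3/4)))]
    exact Finset.sum_congr rfl fun i _ => by simp [hd, mul_comm]
  rw [e1, e2, ← int_add hab (((hZ.mul hU).const_mul (1/2)).bi.mul hZ.bi_deriv)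
    (((hZ.bi.sq.const_mul (1/4)).add (hU.bi.sq.const_mul (3/4))).mul hU.bi_deriv)]
  have hQ : PC a b (fun x => (1/4) * ((lin e c x * lin e c x + lin f d x * lin f d x) * lin f d x)) :=
    (((hZ.mul hZ).add (hU.mul hU)).mul hU).const_mul _
  have := hQ.int_deriv hab
  rw [show lin f d b = 0 from lin_zero_of hfb d, show lin f d a = 0 from lin_zero_of hfa d] at this
  simp only [mul_zero, sub_zero] at this
  rw [← this]
  apply int_congr_ae hab
  filter_upwards [hZ.ae_diff, hU.ae_diff] with x hx hy
  have := ((((hx.hasDerivAt.mul hx.hasDerivAt).add (hy.hasDerivAt.mul hy.hasDerivAt)).mul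
    hy.hasDerivAt).const_mul (1/4)).deriv
  rw [show deriv (fun x => (1/4) * ((lin e c x * lin e c x + lin f d x * lin f d x) * lin f d x)) x
    = _ from this]
  simp only [Pi.add_apply, Pi.mul_apply]
  ring
end galerkin

/-! ## L2-orthonormal families in finite dimensional function spaces -/
theorem ortho_exists {a b : ℝ} (hab : a < b) (S : Submodule ℝ (ℝ → ℝ))
    (hS : ∀ φ ∈ S, ContinuousOn φ (Icc a b)) {M : ℕ} (pts : Fin M → ℝ)
    (hpts : ∀ φ ∈ S, (∀ k, φ (pts k) = 0) → ∀ y ∈ Icc a b, φ y = 0)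
    (hptsI : ∀ k, pts k ∈ Icc a b) :
    ∃ (n : ℕ) (e : Fin n → ℝ → ℝ), (∀ i, e i ∈ S) ∧
      (∀ i j, ∫ x in a..b, e i x * e j x = if i = j then 1 else 0) ∧
      (∀ φ ∈ S, ∀ y ∈ Icc a b, φ y = lin e (fun i => ∫ x in a..b, φ x * e i x) y) ∧
      ∃ α : Fin n → Fin M → ℝ, ∀ φ ∈ S, ∀ i, ∫ x in a..b, φ x * e i x = ∑ k, α i k * φ (pts k) := by
  classical
  let ev : S →ₗ[ℝ] (Fin M → ℝ) :=
    { toFun := fun φ k => φ.1 (pts k), map_add' := fun _ _ => rfl, map_smul' := fun _ _ => rfl }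
  obtain ⟨g, hg⟩ := ev.rangeRestrict.exists_rightInverse_of_surjective ev.range_rangeRestrict
  have hg' : ∀ y : LinearMap.range ev, ev (g y) = y := fun y => by
    have := congrArg (fun L => (L y : Fin M → ℝ)) hg
    simpa using this
  have hcont : ∀ φ : S, BI a b φ.1 := fun φ => BI.of_continuousOn (hS _ φ.2)
  let B : LinearMap.BilinForm ℝ (LinearMap.range ev) := LinearMap.mk₂ ℝ
    (fun x y => ∫ s in a..b, (g x).1 s * (g y).1 s)
    (fun x y z => by
      rw [← int_add hab.le ((hcont _).mul (hcont _)) ((hcont _).mul (hcont _))]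
      congr 1; ext s; simp [add_mul])
    (fun c x y => by
      rw [smul_eq_mul, ← intervalIntegral.integral_const_mul]
      congr 1; ext s; simp [mul_assoc])
    (fun x y z => by
      rw [← int_add hab.le ((hcont _).mul (hcont _)) ((hcont _).mul (hcont _))]
      congr 1; ext s; simp [mul_add])
    (fun c x y => by
      rw [smul_eq_mul, ← intervalIntegral.integral_const_mul]
      congr 1; ext s; simp; ring)
  have hB : ∀ x y, B x y = ∫ s in a..b, (g x).1 s * (g y).1 s := fun x y => rfl
  have hsym : LinearMap.IsSymm B := ⟨fun x y => by
    simp only [hB, RingHom.id_apply]; congr 1; ext s; ring⟩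
  have hpos : ∀ x, x ≠ 0 → 0 < B x x := by
    intro x hx
    by_contra hle
    have h0 : ∫ s in a..b, (g x).1 s ^ 2 = 0 := by
      have h1 := int_sq_nonneg hab.le (f := (g x).1)
      have h2 : B x x = ∫ s in a..b, (g x).1 s ^ 2 := by rw [hB]; congr 1; ext s; ring
      linarith
    have hz : ∀ y ∈ Icc a b, (g x).1 y = 0 := by
      by_contra hne
      push Not at hne
      obtain ⟨y, hy, hy'⟩ := hne
      have := intervalIntegral.integral_pos hab (f := fun s => (g x).1 s ^ 2)
        ((hS _ (g x).2).pow 2) (fun s _ => sq_nonneg _) ⟨y, hy, by positivity⟩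
      linarith
    apply hx
    apply Subtype.ext
    rw [← hg' x]
    ext k
    exact hz _ (hptsI k)
  obtain ⟨v, hv⟩ := LinearMap.BilinForm.exists_orthogonal_basis (K := ℝ) (B := B) hsym
  have hvpos : ∀ i, 0 < B (v i) (v i) := fun i => hpos _ (v.ne_zero i)
  let e : Fin (Module.finrank ℝ (LinearMap.range ev)) → ℝ → ℝ :=
    fun i => (((Real.sqrt (B (v i) (v i)))⁻¹ • g (v i) : S) : ℝ → ℝ)
  have heS : ∀ i, e i ∈ S := fun i => Subtype.property _
  have hebi : ∀ i, BI a b (e i) := fun i => BI.of_continuousOn (hS _ (heS i))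
  have ho : ∀ i j, ∫ x in a..b, e i x * e j x = if i = j then 1 else 0 := by
    intro i j
    have h1 : ∫ x in a..b, e i x * e j x =
        (Real.sqrt (B (v i) (v i)))⁻¹ * (Real.sqrt (B (v j) (v j)))⁻¹ * B (v i) (v j) := by
      rw [hB (v i) (v j), ← intervalIntegral.integral_const_mul]
      congr 1; ext s; simp only [e, Submodule.coe_smul, Pi.smul_apply, smul_eq_mul]; ring
    rw [h1]
    split_ifs with hij
    · subst hij
      have := Real.mul_self_sqrt (hvpos i).le
      have h2 := Real.sqrt_pos.2 (hvpos i)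
      field_simp
      nlinarith
    · have : B (v i) (v j) = 0 := hv hij
      rw [this, mul_zero]
  -- expansion
  have hexp : ∀ φ (hφ : φ ∈ S), ∀ y ∈ Icc a b, φ y = lin e (fun i =>
      v.repr (ev.rangeRestrict ⟨φ, hφ⟩) i * Real.sqrt (B (v i) (v i))) y := by
    intro φ hφ
    let y0 : LinearMap.range ev := ev.rangeRestrict ⟨φ, hφ⟩
    intro y hy
    have h1 : φ y - (g y0).1 y = 0 := by
      have := hpts (φ - (g y0).1) (S.sub_mem hφ (g y0).2) ?_ y hy
      · simpa using this
      · intro k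
        have h2 := congrFun (hg' y0) k
        have h3 : (g y0).1 (pts k) = φ (pts k) := h2
        simp [h3]
    have h2 : (g y0).1 y = lin e (fun i => v.repr y0 i * Real.sqrt (B (v i) (v i))) y := by
      have h3 : g y0 = ∑ i, v.repr y0 i • g (v i) := by
        conv_lhs => rw [← v.sum_repr y0]
        rw [map_sum]
        exact Finset.sum_congr rfl fun i _ => map_smul _ _ _
      have h4 : (g y0).1 y = ∑ i, v.repr y0 i * (g (v i)).1 y := by
        conv_lhs => rw [h3]
        simp [Finset.sum_apply]
      rw [h4, lin]
      refine Finset.sum_congr rfl fun i _ => ?_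
      have h5 := (Real.sqrt_pos.2 (hvpos i)).ne'
      simp only [e, Submodule.coe_smul, Pi.smul_apply, smul_eq_mul]
      field_simp
    linarith
  have hco : ∀ φ ∈ S, ∀ c, (∀ y ∈ Icc a b, φ y = lin e c y) →
      ∀ i, ∫ x in a..b, φ x * e i x = c i := by
    intro φ hφ c hc i
    rw [← lin_ortho hab.le hebi ho c i]
    apply intervalIntegral.integral_congr
    intro x hx
    rw [uIcc_of_le hab.le] at hx
    simp only [hc x hx]
  refine ⟨_, e, heS, ho, ?_, ?_⟩
  · intro φ hφ y hy
    have hc := hexp φ hφ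
    have : (fun i => ∫ x in a..b, φ x * e i x) = _ := funext fun i => hco φ hφ _ hc i
    rw [this]; exact hc y hy
  · have hex : ∀ i, ∃ w : Fin M → ℝ, ∀ φ ∈ S, ∫ x in a..b, φ x * e i x = ∑ k, w k * φ (pts k) := by
      intro i
      let L : LinearMap.range ev →ₗ[ℝ] ℝ :=
        Real.sqrt (B (v i) (v i)) • (v.coord i)
      obtain ⟨L', hL'⟩ := LinearMap.exists_extend L
      refine ⟨fun k => L' (Pi.single k 1), fun φ hφ => ?_⟩
      have h1 : L' (ev ⟨φ, hφ⟩) = L (ev.rangeRestrict ⟨φ, hφ⟩) := by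
        rw [← hL']; rfl
      have h2 : L' (ev ⟨φ, hφ⟩) = ∑ k, L' (Pi.single k 1) * φ (pts k) := by
        conv_lhs => rw [← LinearMap.sum_single_apply (fun _ => ℝ) (ev ⟨φ, hφ⟩)]
        rw [map_sum]
        refine Finset.sum_congr rfl fun k _ => ?_
        have : (Pi.single k (ev ⟨φ, hφ⟩ k) : Fin M → ℝ) = φ (pts k) • Pi.single k 1 := by
          rw [← Pi.single_smul]; simp [ev]
        simp only [LinearMap.coe_single, this, map_smul, smul_eq_mul]
        ring
      rw [← h2, h1]
      rw [hco φ hφ _ (hexp φ hφ)]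
      simp only [L, LinearMap.smul_apply, Module.Basis.coord_apply, smul_eq_mul]
      ring
    choose α hα using hex
    exact ⟨α, fun φ hφ i => hα i φ hφ⟩

theorem PC.mono {a b c d : ℝ} {f : ℝ → ℝ} (hf : PC a b f) (hac : a ≤ c) (hdb : d ≤ b) : PC c d f := by
  obtain ⟨h1, s, hs, M, h⟩ := hf
  exact ⟨h1.mono (Icc_subset_Icc hac hdb), s, hs, M,
    fun x hx hxs => h x (Ioo_subset_Ioo hac hdb hx) hxs⟩

theorem BI.abs {a b : ℝ} {f : ℝ → ℝ} (hf : BI a b f) : BI a b (fun x => |f x|) := by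
  obtain ⟨h1, M, h⟩ := hf
  refine ⟨h1.norm, M, ?_⟩
  filter_upwards [h] with x hx
  simpa using hx

/-- sharp one dimensional Sobolev inequality -/
theorem sobolev_sharp {a b : ℝ} (hab : 1 ≤ b - a) {f : ℝ → ℝ} (hf : PC a b f) {x : ℝ}
    (hx : x ∈ Icc a b) :
    f x ^ 2 ≤ (∫ y in a..b, f y ^ 2) +
      2 * (Real.sqrt (∫ y in a..b, f y ^ 2) * Real.sqrt (∫ y in a..b, deriv f y ^ 2)) := by
  have hab' : a ≤ b := by linarith
  set S := 2 * (Real.sqrt (∫ y in a..b, f y ^ 2) * Real.sqrt (∫ y in a..b, deriv f y ^ 2)) with hS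
  have hS0 : 0 ≤ S := by positivity
  have hA : ∫ y in a..b, |f y| * |deriv f y| ≤
      Real.sqrt (∫ y in a..b, f y ^ 2) * Real.sqrt (∫ y in a..b, deriv f y ^ 2) := by
    have := (le_abs_self _).trans (cauchy_schwarz hab' hf.bi.abs hf.bi_deriv.abs)
    simpa only [sq_abs] using this
  have key : ∀ y ∈ Icc a b, ∀ z ∈ Icc a b, y ≤ z → |f z ^ 2 - f y ^ 2| ≤ S := by
    intro y hy z hz hyz
    have hp := hf.mono hy.1 hz.2
    have h1 := (hp.mul hp).int_deriv hyz
    have h2 : f z ^ 2 - f y ^ 2 = ∫ s in y..z, 2 * (f s * deriv f s) := by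
      rw [pow_two, pow_two, ← h1]
      refine int_congr_ae hyz ?_
      filter_upwards [hp.deriv_mul_ae hp] with s hs
      rw [hs]; ring
    rw [h2, intervalIntegral.integral_const_mul, abs_mul, abs_two, hS]
    refine mul_le_mul_of_nonneg_left (le_trans ?_ hA) (by norm_num)
    refine (abs_integral_le_integral_abs hyz).trans ?_
    simp only [abs_mul]
    refine integral_mono_interval hy.1 hyz hz.2 ?_ ?_
    · exact Filter.Eventually.of_forall fun s => by positivity
    · exact (hf.bi.abs.mul hf.bi_deriv.abs).intervalIntegrable hab'
  have key2 : ∀ y ∈ Icc a b, f x ^ 2 ≤ f y ^ 2 + S := by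
    intro y hy
    rcases le_total x y with h | h
    · linarith [(abs_le.1 (key x hx y hy h)).1]
    · linarith [(abs_le.1 (key y hy x hx h)).2]
  have h3 := int_mono hab' (BI.const (f x ^ 2)) (hf.bi.sq.add (BI.const S)) key2
  rw [int_add hab' hf.bi.sq (BI.const S)] at h3
  simp only [intervalIntegral.integral_const, smul_eq_mul] at h3
  have h4 := int_sq_nonneg (f := f) hab'
  nlinarith

theorem sobolev {a b : ℝ} (hab : 1 ≤ b - a) {f : ℝ → ℝ} (hf : PC a b f) {x : ℝ}
    (hx : x ∈ Icc a b) :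
    f x ^ 2 ≤ 2 * ((∫ y in a..b, f y ^ 2) + ∫ y in a..b, deriv f y ^ 2) := by
  have hab' : a ≤ b := by linarith
  have h := sobolev_sharp hab hf hx
  have h1 := Real.sq_sqrt (int_sq_nonneg (f := f) hab')
  have h2 := Real.sq_sqrt (int_sq_nonneg (f := deriv f) hab')
  nlinarith [sq_nonneg (Real.sqrt (∫ y in a..b, f y ^ 2) - Real.sqrt (∫ y in a..b, deriv f y ^ 2)),
    int_sq_nonneg (f := deriv f) hab']

/-- smooth functions -/
def Sm (f : ℝ → ℝ) : Prop := ContDiff ℝ (⊤ : ℕ∞) f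

namespace Sm
variable {f g : ℝ → ℝ}

theorem cd (hf : Sm f) (n : ℕ) : ContDiff ℝ n f := ContDiff.of_le hf (by exact_mod_cast le_top)
theorem cont (hf : Sm f) : Continuous f := ContDiff.continuous hf
theorem diff (hf : Sm f) : Differentiable ℝ f := (hf.cd 1).differentiable (by norm_num)
theorem add (hf : Sm f) (hg : Sm g) : Sm (fun x => f x + g x) := ContDiff.add hf hg
theorem sub (hf : Sm f) (hg : Sm g) : Sm (fun x => f x - g x) := ContDiff.sub hf hg
theorem mul (hf : Sm f) (hg : Sm g) : Sm (fun x => f x * g x) := ContDiff.mul hf hg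
theorem const (c : ℝ) : Sm (fun _ => c) := contDiff_const
theorem const_mul (c : ℝ) (hf : Sm f) : Sm (fun x => c * f x) := (const c).mul hf
theorem sum {ι : Type*} {s : Finset ι} {F : ι → ℝ → ℝ} (h : ∀ i ∈ s, Sm (F i)) :
    Sm (fun x => ∑ i ∈ s, F i x) := ContDiff.sum h
theorem deriv (hf : Sm f) : Sm (deriv f) := (contDiff_infty_iff_deriv.1 hf).2
theorem iter (hf : Sm f) (n : ℕ) : Sm (iteratedDeriv n f) := by
  induction n with
  | zero => simpa using hf
  | succ n ih => rw [iteratedDeriv_succ]; exact ih.deriv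
theorem pc {a b : ℝ} (hf : Sm f) : PC a b f := PC.of_contDiff (hf.cd 1)
theorem bi {a b : ℝ} (hf : Sm f) : BI a b f := BI.of_continuous hf.cont
theorem iter_mul (hf : Sm f) (hg : Sm g) (n : ℕ) (x : ℝ) :
    iteratedDeriv n (fun x => f x * g x) x = ∑ i ∈ Finset.range (n + 1),
      n.choose i * iteratedDeriv i f x * iteratedDeriv (n - i) g x :=
  iteratedDeriv_mul (hf.cd n).contDiffAt (hg.cd n).contDiffAt
theorem iter_add (hf : Sm f) (hg : Sm g) (n : ℕ) (x : ℝ) :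
    iteratedDeriv n (fun x => f x + g x) x = iteratedDeriv n f x + iteratedDeriv n g x :=
  iteratedDeriv_add (hf.cd n).contDiffAt (hg.cd n).contDiffAt
theorem iter_sub (hf : Sm f) (hg : Sm g) (n : ℕ) (x : ℝ) :
    iteratedDeriv n (fun x => f x - g x) x = iteratedDeriv n f x - iteratedDeriv n g x :=
  iteratedDeriv_sub (hf.cd n).contDiffAt (hg.cd n).contDiffAt
end Sm

/-- reflection parity at both ends -/
def Par (a b s : ℝ) (f : ℝ → ℝ) : Prop := ∀ x, f (2 * a - x) = s * f x ∧ f (2 * b - x) = s * f x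

namespace Par
variable {a b s s' : ℝ} {f g : ℝ → ℝ}

theorem mul (hf : Par a b s f) (hg : Par a b s' g) : Par a b (s * s') (fun x => f x * g x) :=
  fun x => ⟨by simp only [(hf x).1, (hg x).1]; ring, by simp only [(hf x).2, (hg x).2]; ring⟩
theorem add (hf : Par a b s f) (hg : Par a b s g) : Par a b s (fun x => f x + g x) :=
  fun x => ⟨by simp only [(hf x).1, (hg x).1]; ring, by simp only [(hf x).2, (hg x).2]; ring⟩
theorem const_mul (c : ℝ) (hf : Par a b s f) : Par a b s (fun x => c * f x) :=
  fun x => ⟨by simp only [(hf x).1]; ring, by simp only [(hf x).2]; ring⟩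
theorem sum {ι : Type*} {t : Finset ι} {F : ι → ℝ → ℝ} (h : ∀ i ∈ t, Par a b s (F i)) :
    Par a b s (fun x => ∑ i ∈ t, F i x) := fun x => by
  constructor
  · rw [Finset.mul_sum]; exact Finset.sum_congr rfl fun i hi => (h i hi x).1
  · rw [Finset.mul_sum]; exact Finset.sum_congr rfl fun i hi => (h i hi x).2
theorem deriv (hf : Par a b s f) (hd : Differentiable ℝ f) : Par a b (-s) (deriv f) := by
  have : ∀ c, (∀ x, f (2 * c - x) = s * f x) → ∀ x, _root_.deriv f (2 * c - x) = -s * _root_.deriv f x := by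
    intro c hc x
    have h1 : HasDerivAt (fun y => f (2 * c - y)) (- _root_.deriv f (2 * c - x)) x := by
      have := HasDerivAt.comp x (hd (2 * c - x)).hasDerivAt ((hasDerivAt_id x).const_sub (2 * c))
      rw [mul_neg, mul_one] at this
      exact this
    have h2 : HasDerivAt (fun y => f (2 * c - y)) (s * _root_.deriv f x) x := by
      have := (hd x).hasDerivAt.const_mul s
      exact this.congr_of_eventuallyEq (Filter.Eventually.of_forall hc)
    have := h1.unique h2
    linarith
  exact fun x => ⟨this a (fun x => (hf x).1) x, this b (fun x => (hf x).2) x⟩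
theorem iter (hf : Par a b s f) (hs : Sm f) (n : ℕ) :
    Par a b ((-1) ^ n * s) (iteratedDeriv n f) := by
  induction n with
  | zero => simpa using hf
  | succ n ih =>
    rw [iteratedDeriv_succ]
    have := ih.deriv (hs.iter n).diff
    convert this using 1; ring
theorem zero (hf : Par a b s f) (hs : s ≠ 1) : f a = 0 ∧ f b = 0 := by
  have h1 := (hf a).1
  have h2 := (hf b).2
  rw [show 2 * a - a = a by ring] at h1
  rw [show 2 * b - b = b by ring] at h2
  constructor
  · have : (1 - s) * f a = 0 := by linarith
    exact (mul_eq_zero.1 this).resolve_left (by intro h; apply hs; linarith)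
  · have : (1 - s) * f b = 0 := by linarith
    exact (mul_eq_zero.1 this).resolve_left (by intro h; apply hs; linarith)
end Par

/-- moving derivatives: same parity. -/
theorem par_by_parts {a b s : ℝ} (hab : a ≤ b) {f g : ℝ → ℝ} (hf : Sm f) (hg : Sm g)
    (hpf : Par a b s f) (hpg : Par a b s g) (hs : s ^ 2 = 1) :
    ∫ x in a..b, deriv f x * deriv g x = - ∫ x in a..b, deriv (deriv f) x * g x := by
  have h := PC.by_parts hab hf.deriv.pc hg.pc (f := deriv f) (g := g)
  have hz := ((hpf.deriv hf.diff).mul hpg).zero (by nlinarith)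
  rw [h, hz.1, hz.2]
  ring

theorem par_by_parts_iter {a b : ℝ} (hab : a ≤ b) (m : ℕ) : ∀ {s : ℝ} {f g : ℝ → ℝ},
    Sm f → Sm g → Par a b s f → Par a b s g → s ^ 2 = 1 →
    ∫ x in a..b, iteratedDeriv m f x * iteratedDeriv m g x
      = (-1) ^ m * ∫ x in a..b, iteratedDeriv (2 * m) f x * g x := by
  induction m with
  | zero => intro s f g hf hg _ _ _; simp
  | succ m ih =>
    intro s f g hf hg hpf hpg hs
    rw [show 2 * (m + 1) = 2 * m + 1 + 1 by ring, iteratedDeriv_succ', iteratedDeriv_succ',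
      iteratedDeriv_succ', iteratedDeriv_succ',
      ih hf.deriv hg.deriv (hpf.deriv hf.diff) (hpg.deriv hg.diff) (by linarith [neg_sq s])]
    have e : iteratedDeriv (2 * m) (deriv f) = deriv (iteratedDeriv (2 * m) f) := by
      rw [← iteratedDeriv_succ', iteratedDeriv_succ]
    have e2 : iteratedDeriv (2 * m) (deriv (deriv f)) = deriv (deriv (iteratedDeriv (2 * m) f)) := by
      rw [← iteratedDeriv_succ', ← iteratedDeriv_succ', iteratedDeriv_succ, iteratedDeriv_succ]
    have hp := hpf.iter hf (2 * m)
    rw [show ((-1:ℝ)) ^ (2 * m) * s = s by simp] at hp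
    rw [e, e2, par_by_parts hab (hf.iter _) hg hp hpg hs]
    ring

/-- squared Sobolev norm -/
def HS (a b : ℝ) (m : ℕ) (f : ℝ → ℝ) : ℝ :=
  ∑ j ∈ Finset.range (m + 1), ∫ x in a..b, iteratedDeriv j f x ^ 2

section HS
variable {a b : ℝ} {f g : ℝ → ℝ} {m s : ℕ}

theorem HS_nonneg (hab : a ≤ b) : 0 ≤ HS a b m f :=
  Finset.sum_nonneg fun _ _ => int_sq_nonneg hab

theorem HS_mono (hab : a ≤ b) (h : s ≤ m) : HS a b s f ≤ HS a b m f :=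
  Finset.sum_le_sum_of_subset_of_nonneg (Finset.range_mono (by omega))
    fun _ _ _ => int_sq_nonneg hab

theorem HS_term (hab : a ≤ b) {j : ℕ} (h : j ≤ m) :
    ∫ x in a..b, iteratedDeriv j f x ^ 2 ≤ HS a b m f :=
  Finset.single_le_sum (f := fun j => ∫ x in a..b, iteratedDeriv j f x ^ 2)
    (fun _ _ => int_sq_nonneg hab) (Finset.mem_range.2 (by omega))

theorem HS_two_terms (hab : a ≤ b) {j : ℕ} (h : j + 1 ≤ m) :
    (∫ x in a..b, iteratedDeriv j f x ^ 2) + ∫ x in a..b, iteratedDeriv (j + 1) f x ^ 2 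
      ≤ HS a b m f := by
  rw [← Finset.sum_pair (f := fun j => ∫ x in a..b, iteratedDeriv j f x ^ 2) (by omega : j ≠ j + 1)]
  refine Finset.sum_le_sum_of_subset_of_nonneg ?_ fun _ _ _ => int_sq_nonneg hab
  intro i hi
  simp only [Finset.mem_insert, Finset.mem_singleton] at hi
  rw [Finset.mem_range]; omega

theorem contDiff_iter {n : ℕ} (hf : ContDiff ℝ n f) {j i : ℕ} (h : j + i ≤ n) :
    ContDiff ℝ i (iteratedDeriv j f) := by
  rw [iteratedDeriv_eq_iterate]
  exact ContDiff.iterate_deriv' i j (hf.of_le (by exact_mod_cast (by omega : i + j ≤ n)))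

theorem HS_sup (hab : 1 ≤ b - a) {j : ℕ} (hf : ContDiff ℝ m f) (h : j + 1 ≤ m) {x : ℝ}
    (hx : x ∈ Icc a b) : iteratedDeriv j f x ^ 2 ≤ 2 * HS a b m f := by
  have hp : PC a b (iteratedDeriv j f) := PC.of_contDiff (by exact_mod_cast contDiff_iter hf h)
  refine (sobolev hab hp hx).trans ?_
  rw [← iteratedDeriv_succ]
  exact mul_le_mul_of_nonneg_left (HS_two_terms (by linarith) h) (by norm_num)

theorem HS_prod (hab : 1 ≤ b - a) (hf : Sm f) (hg : Sm g) (hs : 2 ≤ s) (hsm : s ≤ m) (hms : m ≤ s + 1)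
    {Ys Ym : ℝ} (hfs : HS a b s f ≤ Ys) (hgs : HS a b s g ≤ Ys) (hfm : HS a b m f ≤ Ym)
    (hgm : HS a b m g ≤ Ym) {p q : ℕ} (hp : 1 ≤ p) (hq : 1 ≤ q) (hpq : p + q ≤ m + 1) :
    ∫ x in a..b, (iteratedDeriv p f x * iteratedDeriv q g x) ^ 2 ≤ 2 * Ys * Ym := by
  have hab' : a ≤ b := by linarith
  have hYs : 0 ≤ Ys := (HS_nonneg hab').trans hfs
  have hYm : 0 ≤ Ym := (HS_nonneg hab').trans hfm
  have aux : ∀ {k : ℕ} {f g : ℝ → ℝ} {p q : ℕ} {A B : ℝ}, Sm f → Sm g → 0 ≤ A → 0 ≤ B → 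
      p + 1 ≤ k → HS a b k f ≤ A → (∫ x in a..b, iteratedDeriv q g x ^ 2) ≤ B →
      ∫ x in a..b, (iteratedDeriv p f x * iteratedDeriv q g x) ^ 2 ≤ 2 * A * B := by
    intro k f g p q A B hf hg hA hB hk h1 h2
    have := int_mul_sq_le hab' (hg.iter q).bi (hf.iter p).bi (M := Real.sqrt (2 * A)) (fun x hx => by
      refine Real.abs_le_sqrt ((HS_sup hab (hf.cd k) hk hx).trans ?_)
      linarith)
    rw [Real.sq_sqrt (by positivity)] at this
    exact this.trans (mul_le_mul_of_nonneg_left h2 (by positivity))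
  by_cases c1 : p + 1 ≤ s
  · exact aux hf hg hYs hYm c1 hfs ((HS_term hab' (by omega)).trans hgm)
  · by_cases c2 : q + 1 ≤ s
    · have := aux hg hf hYs hYm c2 hgs ((HS_term hab' (by omega : p ≤ m)).trans hfm)
      simpa only [mul_comm] using this
    · have := aux (q := q) hf hg hYm hYs (by omega : p + 1 ≤ m) hfm
        ((HS_term hab' (by omega : q ≤ s)).trans hgs)
      linarith

theorem sqrt_int_sum_le {ι : Type*} (hab : a ≤ b) (t : Finset ι) {F : ι → ℝ → ℝ}
    (h : ∀ i ∈ t, BI a b (F i)) :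
    Real.sqrt (∫ x in a..b, (∑ i ∈ t, F i x) ^ 2) ≤ ∑ i ∈ t, Real.sqrt (∫ x in a..b, F i x ^ 2) := by
  classical
  induction t using Finset.induction_on with
  | empty => simp
  | insert i t hi ih =>
    have h1 := sqrt_int_add_le hab (h i (Finset.mem_insert_self _ _))
      (BI.sum t fun j hj => h j (Finset.mem_insert_of_mem hj))
    simp only [Finset.sum_insert hi]
    exact h1.trans (by gcongr; exact ih fun j hj => h j (Finset.mem_insert_of_mem hj))

theorem sqrt_int_const_mul (c : ℝ) : Real.sqrt (∫ x in a..b, (c * f x) ^ 2)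
    = |c| * Real.sqrt (∫ x in a..b, f x ^ 2) := by
  simp only [mul_pow]
  rw [intervalIntegral.integral_const_mul, Real.sqrt_mul (sq_nonneg _), Real.sqrt_sq_eq_abs]

/-- commutator -/
def Qc (j : ℕ) (f g : ℝ → ℝ) (x : ℝ) : ℝ :=
  iteratedDeriv j (fun y => f y * deriv g y) x - f x * iteratedDeriv (j + 1) g x

theorem Qc_bi (hf : Sm f) (hg : Sm g) {j : ℕ} : BI a b (Qc j f g) :=
  (((hf.mul hg.deriv).iter j).bi).sub ((hf.mul (hg.iter (j + 1))).bi)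

theorem Qc_eq (hf : Sm f) (hg : Sm g) (j : ℕ) (x : ℝ) : Qc j f g x = ∑ i ∈ Finset.range j,
    (j.choose (i + 1) : ℝ) * (iteratedDeriv (i + 1) f x * iteratedDeriv (j - i) g x) := by
  unfold Qc
  rw [hf.iter_mul hg.deriv, Finset.sum_range_succ']
  simp only [Nat.choose_zero_right, Nat.cast_one, iteratedDeriv_zero, one_mul, Nat.sub_zero,
    ← iteratedDeriv_succ']
  rw [add_sub_cancel_right]
  refine Finset.sum_congr rfl fun i hi => ?_
  rw [Finset.mem_range] at hi
  rw [show j - (i + 1) + 1 = j - i by omega]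
  ring

theorem Qc_bound (hab : 1 ≤ b - a) (hf : Sm f) (hg : Sm g) (hs : 2 ≤ s) (hsm : s ≤ m) (hms : m ≤ s + 1)
    {Ys Ym : ℝ} (hfs : HS a b s f ≤ Ys) (hgs : HS a b s g ≤ Ys) (hfm : HS a b m f ≤ Ym)
    (hgm : HS a b m g ≤ Ym) {j : ℕ} (hj : j ≤ m) :
    Real.sqrt (∫ x in a..b, Qc j f g x ^ 2) ≤ 2 ^ m * Real.sqrt (2 * Ys * Ym) := by
  have hab' : a ≤ b := by linarith
  simp only [Qc_eq hf hg]
  have hbi : ∀ i, BI a b (fun x => (iteratedDeriv (i + 1) f x * iteratedDeriv (j - i) g x)) :=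
    fun i => ((hf.iter _).mul (hg.iter _)).bi
  refine (sqrt_int_sum_le hab' _ fun i _ => (hbi i).const_mul _).trans ?_
  have : ∀ i ∈ Finset.range j, Real.sqrt (∫ x in a..b, ((j.choose (i + 1) : ℝ) *
      (iteratedDeriv (i + 1) f x * iteratedDeriv (j - i) g x)) ^ 2)
      ≤ (j.choose (i + 1) : ℝ) * Real.sqrt (2 * Ys * Ym) := by
    intro i hi
    rw [Finset.mem_range] at hi
    rw [sqrt_int_const_mul, Nat.abs_cast]
    refine mul_le_mul_of_nonneg_left (Real.sqrt_le_sqrt ?_) (by positivity)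
    exact HS_prod hab hf hg hs hsm hms hfs hgs hfm hgm (by omega) (by omega) (by omega)
  refine (Finset.sum_le_sum this).trans ?_
  rw [← Finset.sum_mul]
  refine mul_le_mul_of_nonneg_right ?_ (Real.sqrt_nonneg _)
  have h1 : ∑ i ∈ Finset.range j, (j.choose (i + 1) : ℝ) ≤ 2 ^ j := by
    have := Nat.sum_range_choose j
    rw [Finset.sum_range_succ'] at this
    have h2 : ∑ i ∈ Finset.range j, j.choose (i + 1) ≤ 2 ^ j := by omega
    exact_mod_cast h2
  exact h1.trans (pow_le_pow_right₀ (by norm_num) hj)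

end HS

/-- spatial operator, mass equation -/
def Gz (f g : ℝ → ℝ) (x : ℝ) : ℝ := (1 / 2) * (f x * deriv g x + g x * deriv f x)
/-- spatial operator, momentum equation -/
def Gu (f g : ℝ → ℝ) (x : ℝ) : ℝ := (1 / 2) * (f x * deriv f x) + (3 / 2) * (g x * deriv g x)

section energy
variable {a b : ℝ} {f g : ℝ → ℝ} {m s : ℕ}

theorem Gz_sm (hf : Sm f) (hg : Sm g) : Sm (Gz f g) :=
  ((hf.mul hg.deriv).add (hg.mul hf.deriv)).const_mul _
theorem Gu_sm (hf : Sm f) (hg : Sm g) : Sm (Gu f g) :=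
  ((hf.mul hf.deriv).const_mul _).add ((hg.mul hg.deriv).const_mul _)

theorem Gz_par (hf : Sm f) (hg : Sm g) (pf : Par a b 1 f) (pg : Par a b (-1) g) :
    Par a b 1 (Gz f g) := by
  have h1 := pf.mul (pg.deriv hg.diff)
  have h2 := pg.mul (pf.deriv hf.diff)
  norm_num at h1 h2
  exact (h1.add h2).const_mul _

theorem Gu_par (hf : Sm f) (hg : Sm g) (pf : Par a b 1 f) (pg : Par a b (-1) g) :
    Par a b (-1) (Gu f g) := by
  have h1 := pf.mul (pf.deriv hf.diff)
  have h2 := pg.mul (pg.deriv hg.diff)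
  norm_num at h1 h2
  exact (h1.const_mul _).add (h2.const_mul _)

theorem Gz_iter (hf : Sm f) (hg : Sm g) (j : ℕ) (x : ℝ) : iteratedDeriv j (Gz f g) x =
    (1 / 2) * ((f x * iteratedDeriv (j + 1) g x + g x * iteratedDeriv (j + 1) f x)
      + (Qc j f g x + Qc j g f x)) := by
  have : Gz f g = fun x => (1 / 2) * ((fun x => f x * deriv g x + g x * deriv f x) x) := rfl
  rw [this, iteratedDeriv_const_mul_field, (hf.mul hg.deriv).iter_add (hg.mul hf.deriv)]
  unfold Qc; ring

theorem Gu_iter (hf : Sm f) (hg : Sm g) (j : ℕ) (x : ℝ) : iteratedDeriv j (Gu f g) x =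
    ((1 / 2) * (f x * iteratedDeriv (j + 1) f x) + (3 / 2) * (g x * iteratedDeriv (j + 1) g x))
      + ((1 / 2) * Qc j f f x + (3 / 2) * Qc j g g x) := by
  have : Gu f g = fun x => (fun x => (1 / 2) * ((fun x => f x * deriv f x) x)) x
    + (fun x => (3 / 2) * ((fun x => g x * deriv g x) x)) x := rfl
  rw [this, ((hf.mul hf.deriv).const_mul _).iter_add ((hg.mul hg.deriv).const_mul _),
    iteratedDeriv_const_mul_field, iteratedDeriv_const_mul_field]
  unfold Qc; ring

/-- principal part of the energy estimate -/
theorem principal (hab : a ≤ b) {A B : ℝ → ℝ} (hf : Sm f) (hg : Sm g) (hA : Sm A) (hB : Sm B)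
    (hg0 : g a = 0 ∧ g b = 0) (hAB : A a * B a = 0 ∧ A b * B b = 0) :
    (∫ x in a..b, ((1 / 2) * (f x * deriv B x + g x * deriv A x)) * A x
      + ((1 / 2) * (f x * deriv A x) + (3 / 2) * (g x * deriv B x)) * B x)
    = - ∫ x in a..b, (1 / 2) * (deriv f x * (A x * B x)) + (1 / 4) * (deriv g x * A x ^ 2)
        + (3 / 4) * (deriv g x * B x ^ 2) := by
  have h1 := (((hf.mul (hA.mul hB)).const_mul (1 / 2)).add
    (((hg.mul (hA.mul hA)).const_mul (1 / 4)).add ((hg.mul (hB.mul hB)).const_mul (3 / 4))))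
  have h2 := (h1.pc (a := a) (b := b)).int_deriv hab
  have h3 : ∀ x, deriv (fun x => (1 / 2) * (f x * (A x * B x)) + ((1 / 4) * (g x * (A x * A x))
      + (3 / 4) * (g x * (B x * B x)))) x =
      (((1 / 2) * (f x * deriv B x + g x * deriv A x)) * A x
      + ((1 / 2) * (f x * deriv A x) + (3 / 2) * (g x * deriv B x)) * B x)
      + ((1 / 2) * (deriv f x * (A x * B x)) + (1 / 4) * (deriv g x * A x ^ 2)
        + (3 / 4) * (deriv g x * B x ^ 2)) := by
    intro x
    have hfx := (hf.diff x).hasDerivAt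
    have hgx := (hg.diff x).hasDerivAt
    have hAx := (hA.diff x).hasDerivAt
    have hBx := (hB.diff x).hasDerivAt
    have := ((hfx.mul (hAx.mul hBx)).const_mul (1 / 2 : ℝ)).add
      (((hgx.mul (hAx.mul hAx)).const_mul (1 / 4 : ℝ)).add ((hgx.mul (hBx.mul hBx)).const_mul (3 / 4 : ℝ)))
    refine this.deriv.trans ?_
    simp only [Pi.mul_apply]
    ring
  simp only [h3] at h2
  rw [int_add hab ?_ ?_, hg0.1, hg0.2, hAB.1, hAB.2] at h2
  · linarith
  · exact ((((hf.mul hB.deriv).add (hg.mul hA.deriv)).const_mul _).mul hA).add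
      ((((hf.mul hA.deriv).const_mul _).add ((hg.mul hB.deriv).const_mul _)).mul hB) |>.bi
  · have := (((hf.deriv.mul (hA.mul hB)).const_mul (1 / 2)).add
      ((hg.deriv.mul (hA.mul hA)).const_mul (1 / 4))).add ((hg.deriv.mul (hB.mul hB)).const_mul (3 / 4))
    simpa only [pow_two] using this.bi

set_option maxHeartbeats 1000000 in
theorem energy_est (hab : 1 ≤ b - a) (hf : Sm f) (hg : Sm g) (pf : Par a b 1 f) (pg : Par a b (-1) g)
    (hs : 2 ≤ s) (hsm : s ≤ m) (hms : m ≤ s + 1)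
    {Ys Ym : ℝ} (hfs : HS a b s f ≤ Ys) (hgs : HS a b s g ≤ Ys) (hfm : HS a b m f ≤ Ym)
    (hgm : HS a b m g ≤ Ym) {j : ℕ} (hj : j ≤ m) :
    |(∫ x in a..b, iteratedDeriv j (Gz f g) x * iteratedDeriv j f x)
      + ∫ x in a..b, iteratedDeriv j (Gu f g) x * iteratedDeriv j g x| 
      ≤ 8 * 2 ^ m * (Real.sqrt Ys * Ym) := by
  have hab' : a ≤ b := by linarith
  have hYs : 0 ≤ Ys := (HS_nonneg hab').trans hfs
  have hYm : 0 ≤ Ym := (HS_nonneg hab').trans hfm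
  set A := iteratedDeriv j f with hA
  set B := iteratedDeriv j g with hB
  have sA : Sm A := hf.iter j
  have sB : Sm B := hg.iter j
  have hAB : A a * B a = 0 ∧ A b * B b = 0 := by
    have := ((pf.iter hf j).mul (pg.iter hg j)).zero (by
      have : ((-1:ℝ) ^ j) * (-1) ^ j = 1 := by rw [← mul_pow]; norm_num
      intro h
      nlinarith)
    exact this
  have hg0 := pg.zero (by norm_num)
  have hpr := principal hab' hf hg sA sB hg0 hAB
  have hA2 : ∫ x in a..b, A x ^ 2 ≤ Ym := (HS_term hab' hj).trans hfm
  have hB2 : ∫ x in a..b, B x ^ 2 ≤ Ym := (HS_term hab' hj).trans hgm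
  -- principal bound
  have hM : ∀ {f : ℝ → ℝ}, Sm f → HS a b s f ≤ Ys → ∀ x ∈ Icc a b, |deriv f x| ≤ Real.sqrt (2 * Ys) := by
    intro f hf hfs x hx
    have := HS_sup hab (hf.cd s) (by omega : 1 + 1 ≤ s) hx
    rw [iteratedDeriv_one] at this
    exact Real.abs_le_sqrt (by linarith)
  set M := Real.sqrt (2 * Ys) with hMdef
  have hM0 : 0 ≤ M := Real.sqrt_nonneg _
  have hP : |∫ x in a..b, (1 / 2) * (deriv f x * (A x * B x)) + (1 / 4) * (deriv g x * A x ^ 2)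
        + (3 / 4) * (deriv g x * B x ^ 2)| ≤ M * (Ym + Ym) := by
    have h1 : ∀ x ∈ Icc a b, |(1 / 2) * (deriv f x * (A x * B x)) + (1 / 4) * (deriv g x * A x ^ 2)
        + (3 / 4) * (deriv g x * B x ^ 2)| ≤ M * (A x ^ 2 + B x ^ 2) := by
      intro x hx
      have e1 := abs_le.1 (hM hf hfs x hx)
      have e2 := abs_le.1 (hM hg hgs x hx)
      have e3 : |A x * B x| ≤ (A x ^ 2 + B x ^ 2) / 2 := by
        rw [abs_le]; constructor <;> nlinarith [sq_nonneg (A x - B x), sq_nonneg (A x + B x)]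
      have e4 : |deriv f x * (A x * B x)| ≤ M * ((A x ^ 2 + B x ^ 2) / 2) := by
        rw [abs_mul]; exact mul_le_mul (hM hf hfs x hx) e3 (abs_nonneg _) hM0
      have e5 := abs_le.1 e4
      rw [abs_le]
      constructor <;> nlinarith [sq_nonneg (A x), sq_nonneg (B x)]
    have hbi : BI a b (fun x => (1 / 2) * (deriv f x * (A x * B x)) + (1 / 4) * (deriv g x * A x ^ 2)
        + (3 / 4) * (deriv g x * B x ^ 2)) :=
      (((hf.deriv.bi.mul (sA.bi.mul sB.bi)).const_mul _).add ((hg.deriv.bi.mul sA.bi.sq).const_mul _)).add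
        ((hg.deriv.bi.mul sB.bi.sq).const_mul _)
    refine (abs_integral_le_integral_abs hab').trans ?_
    refine (int_mono hab' hbi.abs ((sA.bi.sq.add sB.bi.sq).const_mul M) h1).trans ?_
    rw [intervalIntegral.integral_const_mul, int_add hab' sA.bi.sq sB.bi.sq]
    gcongr
  -- commutators
  have hQ : ∀ {p q F : ℝ → ℝ}, Sm p → Sm q → HS a b s p ≤ Ys → HS a b s q ≤ Ys → HS a b m p ≤ Ym →
      HS a b m q ≤ Ym → Sm F → (∫ x in a..b, F x ^ 2) ≤ Ym →
      |∫ x in a..b, Qc j p q x * F x| ≤ 2 ^ m * (M * Ym) := by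
    intro p q F hp hq h1 h2 h3 h4 hF h5
    refine (cauchy_schwarz hab' (Qc_bi hp hq) hF.bi).trans ?_
    calc _ ≤ (2 ^ m * Real.sqrt (2 * Ys * Ym)) * Real.sqrt Ym :=
          mul_le_mul (Qc_bound hab hp hq hs hsm hms h1 h2 h3 h4 hj) (Real.sqrt_le_sqrt h5)
            (Real.sqrt_nonneg _) (by positivity)
      _ = 2 ^ m * (M * (Real.sqrt Ym * Real.sqrt Ym)) := by
          rw [Real.sqrt_mul (by positivity)]; ring
      _ = _ := by rw [Real.mul_self_sqrt hYm]
  have q1 := hQ hf hg hfs hgs hfm hgm sA hA2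
  have q2 := hQ hg hf hgs hfs hgm hfm sA hA2
  have q3 := hQ hf hf hfs hfs hfm hfm sB hB2
  have q4 := hQ hg hg hgs hgs hgm hgm sB hB2
  have b1 : BI a b (fun x => Qc j f g x * A x) := (Qc_bi hf hg).mul sA.bi
  have b2 : BI a b (fun x => Qc j g f x * A x) := (Qc_bi hg hf).mul sA.bi
  have b3 : BI a b (fun x => Qc j f f x * B x) := (Qc_bi hf hf).mul sB.bi
  have b4 : BI a b (fun x => Qc j g g x * B x) := (Qc_bi hg hg).mul sB.bi
  have b0 : BI a b (fun x => ((1 / 2) * (f x * deriv B x + g x * deriv A x)) * A x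
      + ((1 / 2) * (f x * deriv A x) + (3 / 2) * (g x * deriv B x)) * B x) :=
    ((((hf.mul sB.deriv).add (hg.mul sA.deriv)).const_mul _).mul sA).add
      ((((hf.mul sA.deriv).const_mul _).add ((hg.mul sB.deriv).const_mul _)).mul sB) |>.bi
  have hsplit : (∫ x in a..b, iteratedDeriv j (Gz f g) x * A x)
      + ∫ x in a..b, iteratedDeriv j (Gu f g) x * B x
      = (∫ x in a..b, ((1 / 2) * (f x * deriv B x + g x * deriv A x)) * A x
      + ((1 / 2) * (f x * deriv A x) + (3 / 2) * (g x * deriv B x)) * B x)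
      + ((1 / 2) * (∫ x in a..b, Qc j f g x * A x) + (1 / 2) * (∫ x in a..b, Qc j g f x * A x)
      + (1 / 2) * (∫ x in a..b, Qc j f f x * B x) + (3 / 2) * (∫ x in a..b, Qc j g g x * B x)) := by
    rw [← int_add hab' (((Gz_sm hf hg).iter j).bi.mul sA.bi) (((Gu_sm hf hg).iter j).bi.mul sB.bi),
      ← intervalIntegral.integral_const_mul, ← intervalIntegral.integral_const_mul,
      ← intervalIntegral.integral_const_mul, ← intervalIntegral.integral_const_mul,
      ← int_add hab' (b1.const_mul _) (b2.const_mul _),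
      ← int_add hab' ((b1.const_mul _).add (b2.const_mul _)) (b3.const_mul _),
      ← int_add hab' (((b1.const_mul _).add (b2.const_mul _)).add (b3.const_mul _)) (b4.const_mul _),
      ← int_add hab' b0 ((((b1.const_mul _).add (b2.const_mul _)).add (b3.const_mul _)).add (b4.const_mul _))]
    refine intervalIntegral.integral_congr fun x _ => ?_
    simp only [Gz_iter hf hg, Gu_iter hf hg, hA, hB, ← iteratedDeriv_succ]
    ring
  rw [hsplit, hpr]
  have hfin : M ≤ (3 / 2) * Real.sqrt Ys := by
    rw [hMdef, Real.sqrt_mul (by norm_num)]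
    gcongr
    rw [Real.sqrt_le_left (by norm_num)]; norm_num
  have h2m : (1:ℝ) ≤ 2 ^ m := one_le_pow₀ (by norm_num)
  have hk : M * Ym ≤ (3 / 2) * (Real.sqrt Ys * Ym) := by
    have := mul_le_mul_of_nonneg_right hfin hYm
    linarith
  have hk0 : 0 ≤ M * Ym := by positivity
  have hk1 : M * Ym ≤ 2 ^ m * (M * Ym) := by nlinarith
  have hk2 : 2 ^ m * (M * Ym) ≤ 2 ^ m * ((3 / 2) * (Real.sqrt Ys * Ym)) := by gcongr
  have e0 := abs_le.1 hP
  have e1 := abs_le.1 q1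
  have e2 := abs_le.1 q2
  have e3 := abs_le.1 q3
  have e4 := abs_le.1 q4
  rw [abs_le]
  have hk3 : 0 ≤ 2 ^ m * (Real.sqrt Ys * Ym) := by positivity
  constructor <;> linarith

end energy

/-- boundary parity up to order `< m` -/
def BPar (a b s : ℝ) (m : ℕ) (g : ℝ → ℝ) : Prop :=
  ∀ i < m, (-1) ^ i * s = -1 → iteratedDeriv i g a = 0 ∧ iteratedDeriv i g b = 0

theorem Par.bpar {a b s : ℝ} {g : ℝ → ℝ} (h : Par a b s g) (hg : Sm g) (m : ℕ) : BPar a b s m g :=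
  fun i _ hs => (h.iter hg i).zero (by rw [hs]; norm_num)

theorem BPar.mono {a b s : ℝ} {m n : ℕ} {g : ℝ → ℝ} (h : BPar a b s m g) (hn : n ≤ m) : BPar a b s n g :=
  fun i hi => h i (by omega)

/-- parity sign -/
def IsSgn (s : ℝ) : Prop := s = 1 ∨ s = -1

theorem IsSgn.pow (s : ℝ) (hs : IsSgn s) (j : ℕ) : IsSgn ((-1) ^ j * s) := by
  rcases neg_one_pow_eq_or ℝ j with h | h <;> rcases hs with rfl | rfl <;> rw [h] <;> norm_num [IsSgn]

theorem IsSgn.neg {s : ℝ} (hs : IsSgn s) : IsSgn (-s) := by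
  rcases hs with rfl | rfl <;> norm_num [IsSgn]

theorem bpar_by_parts {a b s : ℝ} (hab : a ≤ b) (hs : IsSgn s) {m : ℕ} {g : ℝ → ℝ}
    (hg : ContDiff ℝ m g) (hb : BPar a b s m g) (j : ℕ) : j ≤ m → ∀ F : ℝ → ℝ, Sm F →
    Par a b ((-1) ^ j * s) F → ∫ x in a..b, F x * iteratedDeriv j g x
      = (-1) ^ j * ∫ x in a..b, iteratedDeriv j F x * g x := by
  induction j with
  | zero => intro _ F _ _; simp
  | succ j ih =>
    intro hj F hF hp
    have hG : PC a b (iteratedDeriv j g) :=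
      PC.of_contDiff (by exact_mod_cast contDiff_iter hg hj)
    have h := PC.by_parts hab hG hF.pc
    have hz : F a * iteratedDeriv j g a = 0 ∧ F b * iteratedDeriv j g b = 0 := by
      rcases IsSgn.pow s hs j with h1 | h1
      · have := hp.zero (by rw [pow_succ]; nlinarith)
        rw [this.1, this.2]; simp
      · have := hb j (by omega) h1
        rw [this.1, this.2]; simp
    have h2 := ih (by omega) (deriv F) hF.deriv (by
      have := hp.deriv hF.diff
      rwa [show -((-1:ℝ) ^ (j + 1) * s) = (-1) ^ j * s by ring] at this)
    rw [iteratedDeriv_succ, iteratedDeriv_succ']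
    calc ∫ x in a..b, F x * deriv (iteratedDeriv j g) x
        = ∫ x in a..b, deriv (iteratedDeriv j g) x * F x := by simp only [mul_comm]
      _ = - ∫ x in a..b, deriv F x * iteratedDeriv j g x := by
          rw [h]
          have : ∫ x in a..b, iteratedDeriv j g x * deriv F x 
              = ∫ x in a..b, deriv F x * iteratedDeriv j g x := by simp only [mul_comm]
          rw [this]; linarith [hz.1, hz.2]
      _ = _ := by rw [h2]; ring

section EF
variable {ι : Type*} [Fintype ι]

/-- orthonormal eigenfunctions family -/
structure EF [DecidableEq ι] (a b s : ℝ) (e : ι → ℝ → ℝ) (κ : ι → ℝ) : Prop where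
  sg : IsSgn s
  sm : ∀ i, Sm (e i)
  par : ∀ i, Par a b s (e i)
  orth : ∀ i j, ∫ x in a..b, e i x * e j x = if i = j then 1 else 0
  eig : ∀ i x, deriv (deriv (e i)) x = - κ i ^ 2 * e i x

/-- projection -/
def prj (a b : ℝ) (e : ι → ℝ → ℝ) (g : ℝ → ℝ) : ℝ → ℝ := lin e (fun i => ∫ x in a..b, g x * e i x)

variable {a b s : ℝ} {e : ι → ℝ → ℝ} {κ : ι → ℝ} {g : ℝ → ℝ} {m : ℕ}

theorem lin_sm (he : ∀ i, Sm (e i)) (c : ι → ℝ) : Sm (lin e c) := Sm.sum fun i _ => (he i).const_mul _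

theorem lin_par (he : ∀ i, Par a b s (e i)) (c : ι → ℝ) : Par a b s (lin e c) :=
  Par.sum fun i _ => (he i).const_mul _

theorem lin_iter (he : ∀ i, Sm (e i)) (c : ι → ℝ) (j : ℕ) :
    iteratedDeriv j (lin e c) = lin (fun i => iteratedDeriv j (e i)) c := by
  induction j with
  | zero => simp
  | succ j ih =>
    rw [iteratedDeriv_succ, ih]
    ext x
    unfold lin
    rw [deriv_fun_sum (fun i _ => (((he i).iter j).const_mul _).diff x)]
    refine Finset.sum_congr rfl fun i _ => ?_
    simp only [deriv_const_mul_field, iteratedDeriv_succ]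

namespace EF
variable [DecidableEq ι]

theorem iter2 (h : EF a b s e κ) (i : ι) (m : ℕ) :
    iteratedDeriv (2 * m) (e i) = fun x => (-1) ^ m * κ i ^ (2 * m) * e i x := by
  induction m with
  | zero => simp
  | succ m ih =>
    rw [show 2 * (m + 1) = 2 * m + 1 + 1 by ring, iteratedDeriv_succ, iteratedDeriv_succ, ih]
    ext x
    have : deriv (fun x => (-1) ^ m * κ i ^ (2 * m) * e i x)
        = fun x => (-1) ^ m * κ i ^ (2 * m) * deriv (e i) x := by
      ext y; rw [deriv_const_mul_field]
    rw [this, deriv_const_mul_field, h.eig]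
    ring

theorem testD (h : EF a b s e κ) (hab : a ≤ b) (hg : ContDiff ℝ m g) (hb : BPar a b s m g) {j : ℕ}
    (hj : j ≤ m) (c : ι → ℝ) :
    ∫ x in a..b, iteratedDeriv j (lin e c) x * iteratedDeriv j g x
      = ∑ i, κ i ^ (2 * j) * c i * ∫ x in a..b, g x * e i x := by
  have hs := lin_sm h.sm c
  have hp := (lin_par h.par c).iter hs j
  rw [bpar_by_parts hab h.sg hg hb j hj _ (hs.iter j) hp]
  have : iteratedDeriv j (iteratedDeriv j (lin e c)) = lin e (fun i => (-1) ^ j * κ i ^ (2 * j) * c i) := by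
    rw [iteratedDeriv_eq_iterate, iteratedDeriv_eq_iterate, ← Function.iterate_add_apply,
      ← iteratedDeriv_eq_iterate, ← two_mul, lin_iter h.sm]
    ext x
    unfold lin
    refine Finset.sum_congr rfl fun i _ => ?_
    simp only [h.iter2]; ring
  rw [this]
  have e1 : ∫ x in a..b, lin e (fun i => (-1) ^ j * κ i ^ (2 * j) * c i) x * g x
      = ∫ x in a..b, g x * lin e (fun i => (-1) ^ j * κ i ^ (2 * j) * c i) x := by
    simp only [mul_comm]
  rw [e1, int_lin_mul hab (fun i => (h.sm i).bi) (BI.of_continuous hg.continuous), Finset.mul_sum]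
  refine Finset.sum_congr rfl fun i _ => ?_
  have : ((-1:ℝ) ^ j) * (-1) ^ j = 1 := by rw [← mul_pow]; norm_num
  linear_combination (κ i ^ (2 * j) * c i * ∫ x in a..b, g x * e i x) * this

theorem normD (h : EF a b s e κ) (hab : a ≤ b) (j : ℕ) (c d : ι → ℝ) :
    ∫ x in a..b, iteratedDeriv j (lin e c) x * iteratedDeriv j (lin e d) x
      = ∑ i, κ i ^ (2 * j) * c i * d i := by
  rw [h.testD hab ((lin_sm h.sm d).cd j) ((lin_par h.par d).bpar (lin_sm h.sm d) j) le_rfl]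
  refine Finset.sum_congr rfl fun i _ => ?_
  rw [lin_ortho hab (fun i => (h.sm i).bi) h.orth]

theorem prj_sm (h : EF a b s e κ) : Sm (prj a b e g) := lin_sm h.sm _
theorem prj_par (h : EF a b s e κ) : Par a b s (prj a b e g) := lin_par h.par _

theorem prj_testD (h : EF a b s e κ) (hab : a ≤ b) (hg : ContDiff ℝ m g) (hb : BPar a b s m g) {j : ℕ}
    (hj : j ≤ m) :
    ∫ x in a..b, iteratedDeriv j (prj a b e g) x * iteratedDeriv j g x
      = ∫ x in a..b, iteratedDeriv j (prj a b e g) x ^ 2 := by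
  simp only [pow_two]
  unfold prj
  rw [h.testD hab hg hb hj, h.normD hab]

theorem int_sub_sq {f g : ℝ → ℝ} (hab : a ≤ b) (hf : BI a b f) (hg : BI a b g) :
    ∫ x in a..b, (f x - g x) ^ 2 = (∫ x in a..b, f x ^ 2) - 2 * (∫ x in a..b, g x * f x)
      + ∫ x in a..b, g x ^ 2 := by
  rw [← intervalIntegral.integral_const_mul, ← int_sub hab hf.sq ((hg.mul hf).const_mul 2),
    ← int_add hab (hf.sq.sub ((hg.mul hf).const_mul 2)) hg.sq]
  refine intervalIntegral.integral_congr fun x _ => ?_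
  ring

theorem prj_pyth (h : EF a b s e κ) (hab : a ≤ b) (hg : ContDiff ℝ m g) (hb : BPar a b s m g) {j : ℕ}
    (hj : j ≤ m) :
    ∫ x in a..b, (iteratedDeriv j g x - iteratedDeriv j (prj a b e g) x) ^ 2
      = (∫ x in a..b, iteratedDeriv j g x ^ 2) - ∫ x in a..b, iteratedDeriv j (prj a b e g) x ^ 2 := by
  have hG : BI a b (iteratedDeriv j g) := BI.of_continuous (by
    have := contDiff_iter hg (i := 0) (by omega : j + 0 ≤ m)
    exact this.continuous)
  rw [int_sub_sq hab hG (h.prj_sm.iter j).bi, h.prj_testD hab hg hb hj]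
  ring

theorem prj_le (h : EF a b s e κ) (hab : a ≤ b) (hg : ContDiff ℝ m g) (hb : BPar a b s m g) {j : ℕ}
    (hj : j ≤ m) :
    ∫ x in a..b, iteratedDeriv j (prj a b e g) x ^ 2 ≤ ∫ x in a..b, iteratedDeriv j g x ^ 2 := by
  have := h.prj_pyth hab hg hb hj
  have h2 := int_sq_nonneg (f := fun x => iteratedDeriv j g x - iteratedDeriv j (prj a b e g) x) hab
  linarith

/-- best approximation -/
theorem prj_best (h : EF a b s e κ) (hab : a ≤ b) (hg : BI a b g) (c : ι → ℝ) :
    ∫ x in a..b, (g x - prj a b e g x) ^ 2 ≤ ∫ x in a..b, (g x - lin e c x) ^ 2 := by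
  have hl := lin_BI (fun i => (h.sm i).bi (a := a) (b := b)) 
  have e1 : ∀ d : ι → ℝ, ∫ x in a..b, lin e d x * g x = ∑ i, d i * ∫ x in a..b, g x * e i x := by
    intro d
    rw [← int_lin_mul hab (fun i => (h.sm i).bi) hg]; simp only [mul_comm]
  have e2 : ∀ d : ι → ℝ, ∫ x in a..b, lin e d x ^ 2 = ∑ i, d i * d i := by
    intro d; simp only [pow_two]; exact lin_norm hab (fun i => (h.sm i).bi) h.orth d d
  unfold prj
  rw [int_sub_sq hab hg (hl _), int_sub_sq hab hg (hl _), e1, e1, e2, e2]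
  have : 0 ≤ ∑ i, (c i - ∫ x in a..b, g x * e i x) ^ 2 := Finset.sum_nonneg fun _ _ => sq_nonneg _
  have e3 : ∑ i, (c i - ∫ x in a..b, g x * e i x) ^ 2 = (∑ i, c i * c i) 
      - 2 * (∑ i, c i * ∫ x in a..b, g x * e i x)
      + ∑ i, (∫ x in a..b, g x * e i x) * (∫ x in a..b, g x * e i x) := by
    rw [Finset.mul_sum, ← Finset.sum_sub_distrib, ← Finset.sum_add_distrib]
    exact Finset.sum_congr rfl fun i _ => by ring
  linarith

end EF
end EF

/-! ### trigonometric families -/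

/-- frequency -/
def tw (a b : ℝ) : ℝ := Real.pi / (b - a)
/-- cosines -/
def ce (a b : ℝ) (k : ℕ) (x : ℝ) : ℝ :=
  (if k = 0 then Real.sqrt (1 / (b - a)) else Real.sqrt (2 / (b - a))) * Real.cos (k * tw a b * (x - a))
/-- sines -/
def se (a b : ℝ) (k : ℕ) (x : ℝ) : ℝ := Real.sqrt (2 / (b - a)) * Real.sin (k * tw a b * (x - a))

section trig
variable {a b : ℝ}

theorem tw_pos (hab : a < b) : 0 < tw a b := div_pos Real.pi_pos (by linarith)

theorem ce_sm (k : ℕ) : Sm (ce a b k) := by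
  unfold Sm ce
  fun_prop
theorem se_sm (k : ℕ) : Sm (se a b k) := by
  unfold Sm se
  fun_prop

theorem ce_deriv (k : ℕ) (x : ℝ) : deriv (ce a b k) x = - (k * tw a b) * se a b k x := by
  have h : HasDerivAt (fun x => k * tw a b * (x - a)) (k * tw a b) x := by
    simpa using ((hasDerivAt_id x).sub_const a).const_mul (k * tw a b)
  have h2 := (h.cos.const_mul (if k = 0 then Real.sqrt (1 / (b - a)) else Real.sqrt (2 / (b - a)))).deriv
  refine h2.trans ?_
  unfold se
  split_ifs with hk
  · subst hk; simp
  · ring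

theorem se_deriv (k : ℕ) (x : ℝ) : deriv (se a b k) x = (k * tw a b) * ce a b k x := by
  have h : HasDerivAt (fun x => k * tw a b * (x - a)) (k * tw a b) x := by
    simpa using ((hasDerivAt_id x).sub_const a).const_mul (k * tw a b)
  have h2 := (h.sin.const_mul (Real.sqrt (2 / (b - a)))).deriv
  refine h2.trans ?_
  unfold ce
  split_ifs with hk
  · subst hk; simp
  · ring

theorem tw_mul (hab : a < b) (k : ℕ) : k * tw a b * (2 * b - 2 * a) = k * (2 * Real.pi) := by
  unfold tw
  have : b - a ≠ 0 := by linarith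
  field_simp

theorem ce_par (hab : a < b) (k : ℕ) : Par a b 1 (ce a b k) := by
  intro x
  unfold ce
  constructor
  · rw [show (k:ℝ) * tw a b * (2 * a - x - a) = -(k * tw a b * (x - a)) by ring, Real.cos_neg, one_mul]
  · rw [show (k:ℝ) * tw a b * (2 * b - x - a) = k * tw a b * (2 * b - 2 * a) - (k * tw a b * (x - a)) by ring,
      tw_mul hab, Real.cos_nat_mul_two_pi_sub, one_mul]

theorem se_par (hab : a < b) (k : ℕ) : Par a b (-1) (se a b k) := by
  intro x
  unfold se
  constructor
  · rw [show (k:ℝ) * tw a b * (2 * a - x - a) = -(k * tw a b * (x - a)) by ring, Real.sin_neg]; ring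
  · rw [show (k:ℝ) * tw a b * (2 * b - x - a) = k * tw a b * (2 * b - 2 * a) - (k * tw a b * (x - a)) by ring,
      tw_mul hab, Real.sin_nat_mul_two_pi_sub]; ring

theorem ce_eig (k : ℕ) (x : ℝ) : deriv (deriv (ce a b k)) x = - (k * tw a b) ^ 2 * ce a b k x := by
  rw [show deriv (ce a b k) = fun x => - (k * tw a b) * se a b k x from funext (ce_deriv k),
    deriv_const_mul_field, se_deriv]; ring
theorem se_eig (k : ℕ) (x : ℝ) : deriv (deriv (se a b k)) x = - (k * tw a b) ^ 2 * se a b k x := by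
  rw [show deriv (se a b k) = fun x => (k * tw a b) * ce a b k x from funext (se_deriv k),
    deriv_const_mul_field, ce_deriv]; ring

theorem eig_orth {a b s : ℝ} (hab : a < b) (hs : s ^ 2 = 1) {f g : ℝ → ℝ} (hf : Sm f) (hg : Sm g) (pf : Par a b s f)
    (pg : Par a b s g) {k l : ℝ} (ef : ∀ x, deriv (deriv f) x = - k ^ 2 * f x)
    (eg : ∀ x, deriv (deriv g) x = - l ^ 2 * g x) (hkl : k ^ 2 ≠ l ^ 2) :
    ∫ x in a..b, f x * g x = 0 := by
  have h1 := par_by_parts hab.le hf hg pf pg hs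
  have h2 := par_by_parts hab.le hg hf pg pf hs
  simp only [ef, eg, mul_assoc, intervalIntegral.integral_const_mul] at h1 h2
  have h3 : ∫ x in a..b, deriv f x * deriv g x = ∫ x in a..b, deriv g x * deriv f x := by
    simp only [mul_comm]
  have h4 : ∫ x in a..b, g x * f x = ∫ x in a..b, f x * g x := by
    simp only [mul_comm]
  rw [h4] at h2
  have : (k ^ 2 - l ^ 2) * ∫ x in a..b, f x * g x = 0 := by linarith
  exact (mul_eq_zero.1 this).resolve_left (sub_ne_zero.2 hkl)

theorem tw_sq_ne (hab : a < b) {k l : ℕ} (h : k ≠ l) : ((k:ℝ) * tw a b) ^ 2 ≠ (l * tw a b) ^ 2 := by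
  intro h2
  have ht := tw_pos hab
  have := (pow_left_inj₀ (by positivity) (by positivity) two_ne_zero).1 h2
  exact h (by exact_mod_cast mul_right_cancel₀ ht.ne' this)

theorem trig_norm (hab : a < b) {k : ℕ} (hk : k ≠ 0) :
    (∫ x in a..b, ce a b k x * ce a b k x) = 1 ∧ (∫ x in a..b, se a b k x * se a b k x) = 1 := by
  have h := PC.by_parts hab.le (se_sm (a := a) (b := b) k).pc (ce_sm (a := a) (b := b) k).pc (a := a) (b := b)
  have hz := (se_par hab k).zero (by norm_num)
  simp only [hz.1, hz.2, se_deriv, ce_deriv, zero_mul, sub_zero, zero_sub] at h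
  have e1 : ∀ x, (k:ℝ) * tw a b * ce a b k x * ce a b k x = k * tw a b * (ce a b k x * ce a b k x) := by
    intro x; ring
  have e2 : ∀ x, se a b k x * (-(k * tw a b) * se a b k x) = -(k * tw a b) * (se a b k x * se a b k x) := by
    intro x; ring
  simp only [e1, e2, intervalIntegral.integral_const_mul] at h
  have hc : (k:ℝ) * tw a b ≠ 0 := by
    have := tw_pos hab
    positivity
  have h1 : (∫ x in a..b, ce a b k x * ce a b k x) = ∫ x in a..b, se a b k x * se a b k x := by
    apply mul_left_cancel₀ hc; linarith
  have h2 : (∫ x in a..b, ce a b k x * ce a b k x) + ∫ x in a..b, se a b k x * se a b k x = 2 := by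
    rw [← int_add hab.le ((ce_sm k).mul (ce_sm k)).bi ((se_sm k).mul (se_sm k)).bi]
    have : ∀ x, ce a b k x * ce a b k x + se a b k x * se a b k x = 2 / (b - a) := by
      intro x
      unfold ce se
      rw [if_neg hk]
      have h3 : Real.sqrt (2 / (b - a)) ^ 2 = 2 / (b - a) :=
        Real.sq_sqrt (div_nonneg (by norm_num) (by linarith))
      have h4 := Real.sin_sq_add_cos_sq (k * tw a b * (x - a))
      linear_combination h3 + Real.sqrt (2 / (b - a)) ^ 2 * h4
    simp only [this, intervalIntegral.integral_const, smul_eq_mul]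
    have : b - a ≠ 0 := by linarith
    field_simp
  constructor <;> linarith

theorem ce_norm (hab : a < b) (k : ℕ) : (∫ x in a..b, ce a b k x * ce a b k x) = 1 := by
  by_cases hk : k = 0
  · subst hk
    have h3 : Real.sqrt (1 / (b - a)) * Real.sqrt (1 / (b - a)) = 1 / (b - a) :=
      Real.mul_self_sqrt (div_nonneg (by norm_num) (by linarith))
    have : b - a ≠ 0 := by linarith
    simp only [ce, if_true, Nat.cast_zero, zero_mul, Real.cos_zero, mul_one, h3,
      intervalIntegral.integral_const, smul_eq_mul]
    field_simp
  · exact (trig_norm hab hk).1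

/-- cosine family -/
def eC (a b : ℝ) (n : ℕ) (i : Fin (n + 1)) : ℝ → ℝ := ce a b i
/-- sine family -/
def eS (a b : ℝ) (n : ℕ) (i : Fin n) : ℝ → ℝ := se a b (i + 1)

theorem eC_EF (hab : a < b) (n : ℕ) : EF a b 1 (eC a b n) (fun i => (i:ℕ) * tw a b) where
  sg := Or.inl rfl
  sm i := ce_sm _
  par i := ce_par hab _
  orth i j := by
    split_ifs with h
    · subst h; exact ce_norm hab _
    · exact eig_orth hab (by norm_num) (ce_sm _) (ce_sm _) (ce_par hab _) (ce_par hab _) (ce_eig _) (ce_eig _)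
        (tw_sq_ne hab (fun h' => h (Fin.ext h')))
  eig i x := ce_eig _ x

theorem eS_EF (hab : a < b) (n : ℕ) : EF a b (-1) (eS a b n) (fun i => ((i:ℕ) + 1 : ℕ) * tw a b) where
  sg := Or.inr rfl
  sm i := se_sm _
  par i := se_par hab _
  orth i j := by
    split_ifs with h
    · subst h; exact (trig_norm hab (by omega)).2
    · exact eig_orth hab (by norm_num) (se_sm _) (se_sm _) (se_par hab _) (se_par hab _) (se_eig _) (se_eig _)
        (tw_sq_ne hab (fun h' => h (Fin.ext (by omega))))
  eig i x := se_eig _ x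

end trig

section compl
variable {a b : ℝ}

/-- span of cosines -/
def cspan (a b : ℝ) : Submodule ℝ (ℝ → ℝ) := Submodule.span ℝ (Set.range (ce a b))

theorem cos_mem (hab : a < b) (k : ℕ) : (fun x => Real.cos (k * tw a b * (x - a))) ∈ cspan a b := by
  have h : ce a b k ∈ cspan a b := Submodule.subset_span ⟨k, rfl⟩
  have hne : (if k = 0 then Real.sqrt (1 / (b - a)) else Real.sqrt (2 / (b - a))) ≠ 0 := by
    have : 0 < b - a := by linarith
    split_ifs <;> positivity
  have h2 := (cspan a b).smul_mem (if k = 0 then Real.sqrt (1 / (b - a)) else Real.sqrt (2 / (b - a)))⁻¹ h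
  convert h2 using 1
  ext x
  simp only [Pi.smul_apply, smul_eq_mul, ce]
  rw [inv_mul_cancel_left₀ hne]

theorem cos_mul_mem (hab : a < b) {f : ℝ → ℝ} (hf : f ∈ cspan a b) :
    (fun x => Real.cos (tw a b * (x - a)) * f x) ∈ cspan a b := by
  induction hf using Submodule.span_induction with
  | mem f hf =>
    obtain ⟨k, rfl⟩ := hf
    have key : (fun x => Real.cos (tw a b * (x - a)) * Real.cos (k * tw a b * (x - a))) ∈ cspan a b := by
      rcases k with _ | k
      · have := cos_mem hab 1
        simpa using this
      · have h1 := cos_mem hab (k + 2)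
        have h2 := cos_mem hab k
        have h3 := (cspan a b).smul_mem (1/2) ((cspan a b).add_mem h1 h2)
        convert h3 using 1
        ext x
        simp only [Pi.smul_apply, Pi.add_apply, smul_eq_mul]
        push_cast
        rw [show ((k:ℝ) + 2) * tw a b * (x - a) = ((k:ℝ) + 1) * tw a b * (x - a) + tw a b * (x - a) by ring,
          show ((k:ℝ)) * tw a b * (x - a) = ((k:ℝ) + 1) * tw a b * (x - a) - tw a b * (x - a) by ring,
          Real.cos_add, Real.cos_sub]
        ring
    have h3 := (cspan a b).smul_mem (if k = 0 then Real.sqrt (1 / (b - a)) else Real.sqrt (2 / (b - a))) key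
    convert h3 using 1
    ext x
    simp only [Pi.smul_apply, smul_eq_mul, ce]
    ring
  | zero => convert (cspan a b).zero_mem using 1; ext x; simp
  | add f g _ _ hf hg =>
    convert (cspan a b).add_mem hf hg using 1
    ext x; simp only [Pi.add_apply]; ring
  | smul c f _ hf =>
    convert (cspan a b).smul_mem c hf using 1
    ext x; simp only [Pi.smul_apply, smul_eq_mul]; ring

theorem poly_mem (hab : a < b) (p : Polynomial ℝ) :
    (fun x => p.eval (Real.cos (tw a b * (x - a)))) ∈ cspan a b := by
  induction p using Polynomial.induction_on' with
  | add p q hp hq =>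
    convert (cspan a b).add_mem hp hq using 1
    ext x; simp
  | monomial n c =>
    have : (fun x => Real.cos (tw a b * (x - a)) ^ n) ∈ cspan a b := by
      induction n with
      | zero => simpa using cos_mem hab 0
      | succ n ih =>
        convert cos_mul_mem hab ih using 1
        ext x; ring
    convert (cspan a b).smul_mem c this using 1
    ext x; simp

theorem cspan_lin {f : ℝ → ℝ} (hf : f ∈ cspan a b) :
    ∃ N, ∀ n ≥ N, ∃ c, f = lin (eC a b n) c := by
  obtain ⟨c, hc⟩ := (Finsupp.mem_span_range_iff_exists_finsupp).1 hf
  refine ⟨c.support.sup id, fun n hn => ⟨fun i => c i, ?_⟩⟩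
  rw [← hc]
  ext x
  unfold lin eC
  rw [Fin.sum_univ_eq_sum_range (fun i => c i * ce a b i x) (n + 1),
    Finsupp.sum_of_support_subset c (s := Finset.range (n + 1)) _ _ (by simp)]
  · simp [Finset.sum_apply]
  · intro i hi
    have : i ≤ c.support.sup id := Finset.le_sup (f := id) hi
    simp; omega

theorem cos_complete (hab : a < b) {g : ℝ → ℝ} (hg : Continuous g) {ε : ℝ} (hε : 0 < ε) :
    ∃ N, ∀ n ≥ N, ∫ x in a..b, (g x - prj a b (eC a b n) g x) ^ 2 ≤ ε := by
  have htw := tw_pos hab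
  set G : ℝ → ℝ := fun c => g (a + Real.arccos c / tw a b)
  have hG : ContinuousOn G (Icc (-1) 1) := by
    refine Continuous.continuousOn ?_
    exact hg.comp (continuous_const.add (Real.continuous_arccos.div_const _))
  have hL : 0 < b - a := by linarith
  obtain ⟨p, hp⟩ := exists_polynomial_near_of_continuousOn (-1) 1 G hG (Real.sqrt (ε / (b - a)))
    (by positivity)
  obtain ⟨N, hN⟩ := cspan_lin (poly_mem hab p)
  refine ⟨N, fun n hn => ?_⟩
  obtain ⟨c, hc⟩ := hN n hn
  refine ((eC_EF hab n).prj_best hab.le (BI.of_continuous hg) c).trans ?_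
  have key : ∀ x ∈ Icc a b, (g x - lin (eC a b n) c x) ^ 2 ≤ ε / (b - a) := by
    intro x hx
    have h1 := congrFun hc x
    rw [← h1]
    have h2 := hp (Real.cos (tw a b * (x - a))) ⟨Real.neg_one_le_cos _, Real.cos_le_one _⟩
    have h3 : G (Real.cos (tw a b * (x - a))) = g x := by
      simp only [G]
      rw [Real.arccos_cos (mul_nonneg htw.le (by linarith [hx.1]))]
      · rw [mul_div_cancel_left₀ _ htw.ne']; congr 1; ring
      · unfold tw
        rw [div_mul_eq_mul_div, div_le_iff₀ hL]
        exact mul_le_mul_of_nonneg_left (by linarith [hx.2]) Real.pi_pos.le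
    rw [h3, abs_lt] at h2
    have h4 := Real.sq_sqrt (show 0 ≤ ε / (b - a) by positivity)
    nlinarith [h2.1, h2.2]
  calc ∫ x in a..b, (g x - lin (eC a b n) c x) ^ 2 ≤ ∫ x in a..b, ε / (b - a) := by
        refine intervalIntegral.integral_mono_on hab.le ?_ (by simp) key
        exact (((hg.sub (lin_sm (eC_EF hab n).sm c).cont).pow 2)).intervalIntegrable _ _
    _ = ε := by rw [intervalIntegral.integral_const, smul_eq_mul]; field_simp

theorem sin_complete (hab : a < b) {g : ℝ → ℝ} (hg : ContDiff ℝ 1 g) (ga : g a = 0) (gb : g b = 0)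
    {ε : ℝ} (hε : 0 < ε) :
    ∃ N, ∀ n ≥ N, ∫ x in a..b, (g x - prj a b (eS a b n) g x) ^ 2 ≤ ε := by
  have htw := tw_pos hab
  have hL : 0 < b - a := by linarith
  have hg' : Continuous (deriv g) := hg.continuous_deriv le_rfl
  obtain ⟨N, hN⟩ := cos_complete hab hg' (ε := ε / (b - a) ^ 2) (by positivity)
  refine ⟨N, fun n hn => ?_⟩
  have h1 := hN n hn
  set c : Fin (n + 1) → ℝ := fun i => ∫ x in a..b, deriv g x * eC a b n i x with hcdef
  set d : Fin n → ℝ := fun i => c i.succ / (((i:ℕ) + 1 : ℕ) * tw a b) with hd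
  refine ((eS_EF hab n).prj_best hab.le (BI.of_continuous hg.continuous) d).trans ?_
  have hsm := lin_sm (eS_EF hab n).sm d
  have c0 : c 0 = 0 := by
    simp only [hcdef, eC, Fin.val_zero, ce, if_true, Nat.cast_zero, zero_mul, Real.cos_zero, mul_one,
      intervalIntegral.integral_mul_const]
    rw [intervalIntegral.integral_deriv_eq_sub (fun x _ => (hg.differentiable one_ne_zero) x)
      (hg'.intervalIntegrable _ _), ga, gb]
    simp
  have hder : ∀ x, deriv (lin (eS a b n) d) x = prj a b (eC a b n) (deriv g) x := by
    intro x
    have := congrFun (lin_iter (eS_EF hab n).sm d 1) x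
    rw [iteratedDeriv_one] at this
    rw [this]
    unfold prj
    unfold lin
    have c0' : (fun i => ∫ x in a..b, deriv g x * eC a b n i x) (0 : Fin (n+1)) = 0 := c0
    rw [Fin.sum_univ_succ, c0', zero_mul, zero_add]
    refine Finset.sum_congr rfl fun i _ => ?_
    simp only [iteratedDeriv_one, eS, se_deriv, eC, hd, Fin.val_succ, hcdef]
    have : (((i:ℕ) + 1 : ℕ) : ℝ) * tw a b ≠ 0 := by positivity
    field_simp
  set f := fun x => g x - lin (eS a b n) d x with hf
  have hfc : ContDiff ℝ 1 f := hg.sub (hsm.cd 1)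
  have hfd : ∀ x, deriv f x = deriv g x - prj a b (eC a b n) (deriv g) x := by
    intro x
    rw [hf, deriv_fun_sub ((hg.differentiable one_ne_zero) x) (hsm.diff x), hder]
  have hfa : f a = 0 := by
    simp only [hf, ga]
    have := ((lin_par (eS_EF hab n).par d).zero (by norm_num)).1
    rw [this]; simp
  have key : ∀ x ∈ Icc a b, f x ^ 2 ≤ ε / (b - a) := by
    intro x hx
    have hi : ∫ y in a..x, deriv f y * 1 = f x := by
      simp only [mul_one]
      rw [intervalIntegral.integral_deriv_eq_sub (fun x _ => (hfc.differentiable one_ne_zero) x)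
        ((hfc.continuous_deriv le_rfl).intervalIntegrable _ _), hfa, sub_zero]
    have hcs := cauchy_schwarz_sq hx.1 (BI.of_continuous (a := a) (b := x) (hfc.continuous_deriv le_rfl))
      (BI.const (a := a) (b := x) (1:ℝ))
    rw [hi] at hcs
    have h5 : ∫ y in a..x, deriv f y ^ 2 ≤ ε / (b - a) ^ 2 := by
      refine le_trans ?_ h1
      simp only [← hfd]
      refine intervalIntegral.integral_mono_interval le_rfl hx.1 hx.2 (Filter.Eventually.of_forall fun y => sq_nonneg _) ?_
      exact (((hfc.continuous_deriv le_rfl)).pow 2).intervalIntegrable _ _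
    have h6 : (∫ y in a..x, (1:ℝ) ^ 2) = x - a := by simp
    rw [h6] at hcs
    calc f x ^ 2 ≤ _ := hcs
      _ ≤ (ε / (b - a) ^ 2) * (b - a) := by
          apply mul_le_mul h5 (by linarith [hx.2]) (by linarith [hx.1]) (by positivity)
      _ = ε / (b - a) := by field_simp
  calc ∫ x in a..b, f x ^ 2 ≤ ∫ x in a..b, ε / (b - a) := by
        refine intervalIntegral.integral_mono_on hab.le ?_ (by simp) key
        exact ((hfc.continuous.pow 2)).intervalIntegrable _ _
    _ = ε := by rw [intervalIntegral.integral_const, smul_eq_mul]; field_simp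

theorem resid {s : ℝ} {E : ℕ → ℝ → ℝ} {κ : ℕ → ℝ} (hab : a < b)
    (hE : ∀ n, EF a b s (fun i : Fin n => E i) (fun i => κ i)) (hκ : Monotone κ) {g : ℝ → ℝ}
    (hg : ContDiff ℝ 1 g) (hb : BPar a b s 1 g)
    (hd : ∀ ε > 0, ∃ N, ∀ n ≥ N, ∫ x in a..b, (g x - prj a b (fun i : Fin n => E i) g x) ^ 2 ≤ ε)
    (n : ℕ) (hn : 0 < κ n) :
    ∫ x in a..b, (g x - prj a b (fun i : Fin n => E i) g x) ^ 2 ≤ (∫ x in a..b, deriv g x ^ 2) / κ n ^ 2 := by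
  have hg0 : ContDiff ℝ (1:ℕ) g := by exact_mod_cast hg
  set c : ℕ → ℝ := fun i => ∫ x in a..b, g x * E i x
  have e1 : ∀ n j, ∫ x in a..b, iteratedDeriv j (prj a b (fun i : Fin n => E i) g) x ^ 2
      = ∑ i ∈ Finset.range n, κ i ^ (2 * j) * c i * c i := by
    intro n j
    simp only [pow_two (iteratedDeriv _ _ _)]
    unfold prj
    rw [(hE n).normD hab.le j, Finset.sum_range]
  have e0 : ∀ n, ∫ x in a..b, (g x - prj a b (fun i : Fin n => E i) g x) ^ 2
      = (∫ x in a..b, g x ^ 2) - ∑ i ∈ Finset.range n, c i ^ 2 := by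
    intro n
    have := (hE n).prj_pyth hab.le hg0 hb (Nat.zero_le 1)
    rw [e1] at this
    simp only [iteratedDeriv_zero] at this
    rw [this]; simp [pow_two]
  have e2 : ∀ n, ∑ i ∈ Finset.range n, κ i ^ 2 * c i ^ 2 ≤ ∫ x in a..b, deriv g x ^ 2 := by
    intro n
    have := (hE n).prj_le hab.le hg0 hb le_rfl
    rw [e1] at this
    simp only [iteratedDeriv_one] at this
    refine le_trans (le_of_eq ?_) this
    refine Finset.sum_congr rfl fun i _ => by ring
  refine le_of_forall_pos_le_add fun ε hε => ?_
  obtain ⟨N, hN⟩ := hd ε hε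
  have h1 := hN (max N n) (le_max_left _ _)
  rw [e0] at h1 ⊢
  have h2 : ∑ i ∈ Finset.range (max N n), c i ^ 2 = (∑ i ∈ Finset.range n, c i ^ 2) +
      ∑ i ∈ Finset.Ico n (max N n), c i ^ 2 := (Finset.sum_range_add_sum_Ico _ (le_max_right _ _)).symm
  have h3 : ∑ i ∈ Finset.Ico n (max N n), c i ^ 2 ≤ (∫ x in a..b, deriv g x ^ 2) / κ n ^ 2 := by
    rw [le_div_iff₀ (by positivity), Finset.sum_mul]
    refine le_trans ?_ (e2 (max N n))
    calc ∑ i ∈ Finset.Ico n (max N n), c i ^ 2 * κ n ^ 2 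
        ≤ ∑ i ∈ Finset.Ico n (max N n), κ i ^ 2 * c i ^ 2 := by
          refine Finset.sum_le_sum fun i hi => ?_
          have := hκ (Finset.mem_Ico.1 hi).1
          rw [mul_comm]
          gcongr
      _ ≤ _ := by
          refine Finset.sum_le_sum_of_subset_of_nonneg ?_ fun i _ _ => by positivity
          intro i hi; simp at hi ⊢; omega
  linarith

theorem eC_res (hab : a < b) {g : ℝ → ℝ} (hg : ContDiff ℝ 1 g) (n : ℕ) :
    ∫ x in a..b, (g x - prj a b (eC a b n) g x) ^ 2 
      ≤ (∫ x in a..b, deriv g x ^ 2) / (((n + 1 : ℕ) : ℝ) * tw a b) ^ 2 := by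
  have htw := tw_pos hab
  refine resid (E := ce a b) (κ := fun k => k * tw a b) (s := 1) hab (fun n => ?_) (fun i j h => ?_) hg ?_ (fun ε hε => ?_)
    (n + 1) (by positivity)
  · constructor
    · exact Or.inl rfl
    · exact fun i => ce_sm _
    · exact fun i => ce_par hab _
    · intro i j
      split_ifs with h
      · subst h; exact ce_norm hab _
      · exact eig_orth hab (by norm_num) (ce_sm _) (ce_sm _) (ce_par hab _) (ce_par hab _) (ce_eig _) (ce_eig _)
          (tw_sq_ne hab (fun h' => h (Fin.ext h')))
    · exact fun i x => ce_eig _ x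
  · have : (i:ℝ) ≤ j := by exact_mod_cast h
    simp only; gcongr
  · intro i hi h; have : i = 0 := by omega
    subst this; norm_num at h
  · obtain ⟨N, hN⟩ := cos_complete hab hg.continuous hε
    refine ⟨N + 1, fun n hn => ?_⟩
    obtain ⟨k, rfl⟩ : ∃ k, n = k + 1 := ⟨n - 1, by omega⟩
    exact hN k (by omega)

theorem eS_res (hab : a < b) {g : ℝ → ℝ} (hg : ContDiff ℝ 1 g) (ga : g a = 0) (gb : g b = 0) (n : ℕ) :
    ∫ x in a..b, (g x - prj a b (eS a b n) g x) ^ 2 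
      ≤ (∫ x in a..b, deriv g x ^ 2) / (((n + 1 : ℕ) : ℝ) * tw a b) ^ 2 := by
  have htw := tw_pos hab
  refine resid (E := fun k => se a b (k + 1)) (κ := fun k => ((k + 1 : ℕ) : ℝ) * tw a b) (s := -1) hab (fun n => eS_EF hab n)
    (fun i j h => ?_) hg ?_ (fun ε hε => sin_complete hab hg ga gb hε)
    n (by positivity)
  · have : (i:ℝ) ≤ j := by exact_mod_cast h
    simp only; push_cast; gcongr
  · intro i hi h; have : i = 0 := by omega
    subst this; exact ⟨ga, gb⟩

end compl

theorem anti_of_deriv {T : ℝ} {f f' : ℝ → ℝ}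
    (hd : ∀ t ∈ Icc (0:ℝ) T, HasDerivWithinAt f (f' t) (Icc (0:ℝ) T) t)
    (h : ∀ t ∈ Icc (0:ℝ) T, f' t ≤ 0) : ∀ t ∈ Icc (0:ℝ) T, f t ≤ f 0 := by
  have hanti : AntitoneOn f (Icc 0 T) := by
    apply antitoneOn_of_deriv_nonpos (convex_Icc 0 T)
    · exact fun t ht => (hd t ht).continuousWithinAt
    · intro t ht
      rw [interior_Icc] at ht
      exact ((hd t (Ioo_subset_Icc_self ht)).hasDerivAt (Icc_mem_nhds ht.1 ht.2)).differentiableAt.differentiableWithinAt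
    · intro t ht
      rw [interior_Icc] at ht
      rw [((hd t (Ioo_subset_Icc_self ht)).hasDerivAt (Icc_mem_nhds ht.1 ht.2)).deriv]
      exact h t (Ioo_subset_Icc_self ht)
  exact fun t ht => hanti ⟨le_rfl, ht.1.trans ht.2⟩ ht ht.1

theorem gronwall_lin {T K ε : ℝ} (hK : 0 ≤ K) (hε : 0 ≤ ε) {f f' : ℝ → ℝ}
    (hd : ∀ t ∈ Icc (0:ℝ) T, HasDerivWithinAt f (f' t) (Icc (0:ℝ) T) t)
    (h : ∀ t ∈ Icc (0:ℝ) T, f' t ≤ K * f t + ε) :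
    ∀ t ∈ Icc (0:ℝ) T, f t ≤ (f 0 + ε * t) * Real.exp (K * t) := by
  intro t ht
  have hexp : ∀ s, HasDerivAt (fun s => Real.exp (-(K * s))) (Real.exp (-(K * s)) * (-K)) s := by
    intro s
    have : HasDerivAt (fun s => -(K * s)) (-K) s := by simpa using ((hasDerivAt_id s).const_mul K).fun_neg
    exact this.exp
  have := anti_of_deriv (T := T) (f := fun s => f s * Real.exp (-(K * s)) - ε * s)
    (f' := fun s => f' s * Real.exp (-(K * s)) + f s * (Real.exp (-(K * s)) * (-K)) - ε)
    (fun s hs => by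
      have h2 : HasDerivWithinAt (fun s => ε * s) ε (Icc 0 T) s := by
        simpa using ((hasDerivAt_id s).const_mul ε).hasDerivWithinAt
      exact ((hd s hs).mul (hexp s).hasDerivWithinAt).sub h2)
    (fun s hs => by
      have h1 := h s hs
      have h2 : Real.exp (-(K * s)) ≤ 1 := Real.exp_le_one_iff.2 (by nlinarith [hs.1])
      have h3 := Real.exp_pos (-(K * s))
      nlinarith) t ht
  simp only [mul_zero, neg_zero, Real.exp_zero, mul_one, sub_zero] at this
  have h4 : Real.exp (-(K * t)) * Real.exp (K * t) = 1 := by rw [← Real.exp_add]; simp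
  have h5 : f t * Real.exp (-(K * t)) ≤ f 0 + ε * t := by linarith
  calc f t = f t * Real.exp (-(K * t)) * Real.exp (K * t) := by rw [mul_assoc, h4, mul_one]
    _ ≤ _ := mul_le_mul_of_nonneg_right h5 (Real.exp_pos _).le

section tg
variable {α β : ℝ}

theorem eS_zero (hab : α < β) (n : ℕ) (i : Fin n) : eS α β n i α = 0 ∧ eS α β n i β = 0 :=
  ((eS_EF hab n).par i).zero (by norm_num)

/-- elevation component -/
def tA (α β : ℝ) (n : ℕ) (v : EuclideanSpace ℝ (Fin (n + 1) ⊕ Fin n)) : ℝ → ℝ :=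
  lin (eC α β n) (fun i => v (Sum.inl i))
/-- velocity component -/
def tB (α β : ℝ) (n : ℕ) (v : EuclideanSpace ℝ (Fin (n + 1) ⊕ Fin n)) : ℝ → ℝ :=
  lin (eS α β n) (fun i => v (Sum.inr i))

theorem tA_sm (n : ℕ) (v) : Sm (tA α β n v) := lin_sm (fun _ => ce_sm _) _
theorem tB_sm (n : ℕ) (v) : Sm (tB α β n v) := lin_sm (fun _ => se_sm _) _
theorem tA_par (hab : α < β) (n : ℕ) (v) : Par α β 1 (tA α β n v) := lin_par (fun _ => ce_par hab _) _
theorem tB_par (hab : α < β) (n : ℕ) (v) : Par α β (-1) (tB α β n v) := lin_par (fun _ => se_par hab _) _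

theorem galG_inl (hab : α < β) (n : ℕ) (v) (i) :
    galG α β (eC α β n) (eS α β n) v (Sum.inl i) 
      = - ∫ x in α..β, Gz (tA α β n v) (tB α β n v) x * eC α β n i x := by
  have hA := tA_sm (α := α) (β := β) n v
  have hB := tB_sm (α := α) (β := β) n v
  have h := PC.by_parts hab.le ((hA.mul hB).const_mul (1/2)).pc ((eC_EF hab n).sm i).pc
  have hz := (tB_par hab n v).zero (by norm_num)
  simp only [hz.1, hz.2, mul_zero, zero_mul, sub_zero, zero_sub] at h
  change (∫ x in α..β, (1/2) * (tA α β n v x * tB α β n v x) * deriv (eC α β n i) x) = _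
  have h2 : ∀ x, deriv (fun x => (1/2) * (tA α β n v x * tB α β n v x)) x = Gz (tA α β n v) (tB α β n v) x := by
    intro x
    rw [deriv_const_mul_field, deriv_fun_mul (hA.diff x) (hB.diff x)]
    unfold Gz; ring
  simp only [h2] at h
  linarith

theorem galG_inr (hab : α < β) (n : ℕ) (v) (i) :
    galG α β (eC α β n) (eS α β n) v (Sum.inr i) 
      = - ∫ x in α..β, Gu (tA α β n v) (tB α β n v) x * eS α β n i x := by
  have hA := tA_sm (α := α) (β := β) n v
  have hB := tB_sm (α := α) (β := β) n v
  have hA2 : Sm (fun x => (1/4) * tA α β n v x ^ 2) := by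
    simpa only [pow_two] using (hA.mul hA).const_mul (1/4)
  have hB2 : Sm (fun x => (3/4) * tB α β n v x ^ 2) := by
    simpa only [pow_two] using (hB.mul hB).const_mul (3/4)
  have h := PC.by_parts hab.le (hA2.add hB2).pc ((eS_EF hab n).sm i).pc
  have hz := eS_zero hab n i
  simp only [hz.1, hz.2, mul_zero, sub_zero, zero_sub] at h
  change (∫ x in α..β, ((1/4) * tA α β n v x ^ 2 + (3/4) * tB α β n v x ^ 2) * deriv (eS α β n i) x) = _
  have h2 : ∀ x, deriv (fun x => (1/4) * tA α β n v x ^ 2 + (3/4) * tB α β n v x ^ 2) x 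
      = Gu (tA α β n v) (tB α β n v) x := by
    intro x
    rw [deriv_fun_add (hA2.diff x) (hB2.diff x), deriv_const_mul_field, deriv_const_mul_field, 
      deriv_fun_pow (hA.diff x), deriv_fun_pow (hB.diff x)]
    unfold Gu; push_cast; ring
  simp only [h2] at h
  linarith

/-- the Galerkin ODE -/
def IsTG (α β δ : ℝ) (n : ℕ) (c : ℝ → EuclideanSpace ℝ (Fin (n + 1) ⊕ Fin n)) : Prop :=
  ∀ t ∈ Icc (0:ℝ) δ, HasDerivWithinAt c (galG α β (eC α β n) (eS α β n) (c t)) (Icc (0:ℝ) δ) t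

/-- squared norm -/
def tY (α β : ℝ) (n m : ℕ) (v : EuclideanSpace ℝ (Fin (n + 1) ⊕ Fin n)) : ℝ :=
  HS α β m (tA α β n v) + HS α β m (tB α β n v)

theorem IsTG.coord {δ : ℝ} {n : ℕ} {c} (h : IsTG α β δ n c) {t : ℝ} (ht : t ∈ Icc (0:ℝ) δ) (i) :
    HasDerivWithinAt (fun s => c s i) (galG α β (eC α β n) (eS α β n) (c t) i) (Icc (0:ℝ) δ) t :=
  (EuclideanSpace.proj (𝕜 := ℝ) i : _ →L[ℝ] ℝ).hasFDerivAt.comp_hasDerivWithinAt t (h t ht)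

theorem tY_nonneg (hab : α < β) (n m : ℕ) (v) : 0 ≤ tY α β n m v :=
  add_nonneg (HS_nonneg hab.le) (HS_nonneg hab.le)

/-- derivative of tY -/
def tY' (α β : ℝ) (n m : ℕ) (v : EuclideanSpace ℝ (Fin (n + 1) ⊕ Fin n)) : ℝ :=
  ∑ j ∈ Finset.range (m + 1), (-2) * ((∫ x in α..β, iteratedDeriv j (Gz (tA α β n v) (tB α β n v)) x 
    * iteratedDeriv j (tA α β n v) x) + ∫ x in α..β, iteratedDeriv j (Gu (tA α β n v) (tB α β n v)) x
      * iteratedDeriv j (tB α β n v) x)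

theorem deriv_sumsq {δ t : ℝ} {ι : Type*} [Fintype ι] {w : ι → ℝ} {c : ℝ → ι → ℝ} {c' : ι → ℝ}
    (h : ∀ i, HasDerivWithinAt (fun s => c s i) (c' i) (Icc (0:ℝ) δ) t) :
    HasDerivWithinAt (fun s => ∑ i, w i * c s i * c s i) (2 * ∑ i, w i * c t i * c' i) (Icc (0:ℝ) δ) t := by
  rw [Finset.mul_sum]
  refine HasDerivWithinAt.fun_sum fun i _ => ?_
  exact (((h i).const_mul (w i)).fun_mul (h i)).congr_deriv (by ring)

theorem IsTG.deriv_tY (hab : α < β) {δ : ℝ} {n : ℕ} {c} (h : IsTG α β δ n c) (m : ℕ) {t : ℝ}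
    (ht : t ∈ Icc (0:ℝ) δ) :
    HasDerivWithinAt (fun s => tY α β n m (c s)) (tY' α β n m (c t)) (Icc (0:ℝ) δ) t := by
  unfold tY tY' HS
  simp only [← Finset.sum_add_distrib]
  refine HasDerivWithinAt.fun_sum fun j _ => ?_
  have hA := tA_sm (α := α) (β := β) n (c t)
  have hB := tB_sm (α := α) (β := β) n (c t)
  have pA := tA_par hab n (c t)
  have pB := tB_par hab n (c t)
  have gz := Gz_sm hA hB
  have gu := Gu_sm hA hB
  have e1 : ∀ v, ∫ x in α..β, iteratedDeriv j (tA α β n v) x ^ 2 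
      = ∑ i : Fin (n + 1), ((i:ℕ) * tw α β) ^ (2 * j) * v (Sum.inl i) * v (Sum.inl i) := by
    intro v; simp only [pow_two]; exact (eC_EF hab n).normD hab.le j _ _
  have e2 : ∀ v, ∫ x in α..β, iteratedDeriv j (tB α β n v) x ^ 2 
      = ∑ i : Fin n, (((i:ℕ) + 1 : ℕ) * tw α β) ^ (2 * j) * v (Sum.inr i) * v (Sum.inr i) := by
    intro v; simp only [pow_two]; exact (eS_EF hab n).normD hab.le j _ _
  simp only [e1, e2]
  have f1 := (eC_EF hab n).testD hab.le (gz.cd j) ((Gz_par hA hB pA pB).bpar gz j) le_rfl 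
    (fun i => (c t) (Sum.inl i))
  have f2 := (eS_EF hab n).testD hab.le (gu.cd j) ((Gu_par hA hB pA pB).bpar gu j) le_rfl 
    (fun i => (c t) (Sum.inr i))
  have g1 : ∫ x in α..β, iteratedDeriv j (Gz (tA α β n (c t)) (tB α β n (c t))) x 
    * iteratedDeriv j (tA α β n (c t)) x = ∑ i : Fin (n+1), ((i:ℕ)*tw α β)^(2*j) * (c t) (Sum.inl i) * 
        ∫ x in α..β, Gz (tA α β n (c t)) (tB α β n (c t)) x * eC α β n i x := by
    simp only [mul_comm (iteratedDeriv j (Gz _ _) _)]; exact f1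
  have g2 : ∫ x in α..β, iteratedDeriv j (Gu (tA α β n (c t)) (tB α β n (c t))) x 
    * iteratedDeriv j (tB α β n (c t)) x = ∑ i : Fin n, (((i:ℕ)+1:ℕ)*tw α β)^(2*j) * (c t) (Sum.inr i) * 
        ∫ x in α..β, Gu (tA α β n (c t)) (tB α β n (c t)) x * eS α β n i x := by
    simp only [mul_comm (iteratedDeriv j (Gu _ _) _)]; exact f2
  rw [g1, g2]
  have k1 := deriv_sumsq (w := fun i : Fin (n + 1) => ((i:ℕ) * tw α β) ^ (2 * j)) (fun i => h.coord ht (Sum.inl i))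
  have k2 := deriv_sumsq (w := fun i : Fin n => (((i:ℕ) + 1 : ℕ) * tw α β) ^ (2 * j)) (fun i => h.coord ht (Sum.inr i))
  refine (k1.add k2).congr_deriv ?_
  simp only [galG_inl hab, galG_inr hab, mul_neg, Finset.sum_neg_distrib]
  ring

theorem tY'_le (hab : 1 ≤ β - α) {n m s : ℕ} (hs : 2 ≤ s) (hsm : s ≤ m) (hms : m ≤ s + 1) (v) :
    tY' α β n m v ≤ 16 * (m + 1) * 2 ^ m * Real.sqrt (tY α β n s v) * tY α β n m v := by
  have hab' : α < β := by linarith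
  unfold tY'
  have h0 : ∀ m, 0 ≤ HS α β m (tA α β n v) := fun m => HS_nonneg hab'.le
  have h1 : ∀ m, 0 ≤ HS α β m (tB α β n v) := fun m => HS_nonneg hab'.le
  have := fun j (hj : j ≤ m) => energy_est hab (tA_sm n v) (tB_sm n v) (tA_par hab' n v) (tB_par hab' n v)
    hs hsm hms (Ys := tY α β n s v) (Ym := tY α β n m v)
    (by unfold tY; linarith [h1 s]) (by unfold tY; linarith [h0 s]) 
    (by unfold tY; linarith [h1 m]) (by unfold tY; linarith [h0 m]) hj
  calc _ ≤ ∑ j ∈ Finset.range (m + 1), 2 * (8 * 2 ^ m * (Real.sqrt (tY α β n s v) * tY α β n m v)) := by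
        refine Finset.sum_le_sum fun j hj => ?_
        have := (abs_le.1 (this j (by simp at hj; omega))).1
        linarith
    _ = _ := by rw [Finset.sum_const, Finset.card_range, nsmul_eq_mul]; push_cast; ring

/-- existence time -/
def dlt (M : ℝ) : ℝ := (Real.sqrt (M + 1))⁻¹ / 192

theorem dlt_pos {M : ℝ} (hM : 0 ≤ M) : 0 < dlt M := by unfold dlt; positivity

theorem IsTG.Y2 (hab : 1 ≤ β - α) {n : ℕ} {M : ℝ} {c} (h : IsTG α β (dlt M) n c)
    (h0 : tY α β n 2 (c 0) ≤ M) : ∀ t ∈ Icc (0:ℝ) (dlt M), tY α β n 2 (c t) ≤ 4 * (M + 1) := by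
  intro t ht
  have hab' : α < β := by linarith
  have hM : 0 ≤ M := (tY_nonneg hab' _ _ _).trans h0
  set Y := fun s => tY α β n 2 (c s) with hY
  have hYn : ∀ s, 0 ≤ Y s := fun s => tY_nonneg hab' _ _ _
  have hd : ∀ s ∈ Icc (0:ℝ) (dlt M), HasDerivWithinAt (fun s => - (Real.sqrt (Y s + 1))⁻¹ - 96 * s) 
      ((tY' α β n 2 (c s) / (2 * Real.sqrt (Y s + 1))) / (Real.sqrt (Y s + 1)) ^ 2 - 96) (Icc (0:ℝ) (dlt M)) s := by
    intro s hs
    have h1 := ((h.deriv_tY hab' 2 hs).add_const 1).sqrt (by have := hYn s; simp only [hY] at this; positivity)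
    have hne : Real.sqrt (Y s + 1) ≠ 0 := by have := hYn s; positivity
    have h2 := (h1.inv hne).neg
    have h3 : HasDerivWithinAt (fun s : ℝ => 96 * s) 96 (Icc (0:ℝ) (dlt M)) s := by
      simpa using ((hasDerivAt_id s).const_mul (96:ℝ)).hasDerivWithinAt
    refine (h2.sub h3).congr_deriv ?_
    simp only [hY]; ring
  have hle := anti_of_deriv hd (fun s hs => by
    have h1 := tY'_le hab (n := n) (m := 2) (s := 2) le_rfl le_rfl (by omega) (c s)
    norm_num at h1
    have hp : 0 < Real.sqrt (Y s + 1) := by have := hYn s; positivity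
    set q := Real.sqrt (Y s + 1) with hq
    have hq2 : q ^ 2 = Y s + 1 := Real.sq_sqrt (by linarith [hYn s])
    have h2 : Real.sqrt (Y s) ≤ q := Real.sqrt_le_sqrt (by linarith)
    have h3 : tY' α β n 2 (c s) ≤ 192 * q ^ 3 := by
      refine h1.trans ?_
      calc 192 * Real.sqrt (tY α β n 2 (c s)) * tY α β n 2 (c s) ≤ 192 * q * q ^ 2 := by
            apply mul_le_mul _ _ (hYn s) (by positivity)
            · exact mul_le_mul_of_nonneg_left h2 (by norm_num)
            · rw [hq2]; simp only [hY]; linarith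
        _ = _ := by ring
    rw [sub_nonpos, div_div, div_le_iff₀ (by positivity)]
    linarith [h3, show 96 * (2 * q * q ^ 2) = 192 * q ^ 3 by ring]) t ht
  simp only [mul_zero, sub_zero] at hle
  have h5 : (Real.sqrt (M + 1))⁻¹ ≤ (Real.sqrt (Y 0 + 1))⁻¹ := by
    apply inv_anti₀ (by have := hYn 0; positivity)
    exact Real.sqrt_le_sqrt (by simp only [hY]; linarith)
  have h6 : 96 * t ≤ (Real.sqrt (M + 1))⁻¹ / 2 := by
    have := ht.2; unfold dlt at this; linarith
  have h7 : (Real.sqrt (M + 1))⁻¹ / 2 ≤ (Real.sqrt (Y t + 1))⁻¹ := by linarith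
  have hp : 0 < Real.sqrt (Y t + 1) := by have := hYn t; positivity
  have hp2 : 0 < Real.sqrt (M + 1) := by positivity
  have h8 : Real.sqrt (Y t + 1) ≤ 2 * Real.sqrt (M + 1) := by
    rw [div_le_iff₀ (by norm_num), inv_mul_eq_div, inv_le_iff_one_le_mul₀ hp2, div_mul_eq_mul_div, le_div_iff₀ hp] at h7
    linarith
  have h9 := Real.sq_sqrt (show 0 ≤ Y t + 1 by linarith [hYn t])
  have h10 := Real.sq_sqrt (show 0 ≤ M + 1 by linarith)
  show Y t ≤ _
  nlinarith

/-- coefficients of the projected data -/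
def tW (α β : ℝ) (n : ℕ) (Wz Wu : ℝ → ℝ) : EuclideanSpace ℝ (Fin (n + 1) ⊕ Fin n) :=
  WithLp.toLp 2 (Sum.elim (fun i => ∫ x in α..β, Wz x * eC α β n i x) (fun i => ∫ x in α..β, Wu x * eS α β n i x))

theorem tA_tW (n : ℕ) (Wz Wu : ℝ → ℝ) : tA α β n (tW α β n Wz Wu) = prj α β (eC α β n) Wz := rfl
theorem tB_tW (n : ℕ) (Wz Wu : ℝ → ℝ) : tB α β n (tW α β n Wz Wu) = prj α β (eS α β n) Wu := rfl

theorem tY_tW (hab : α < β) (n : ℕ) {m : ℕ} {Wz Wu : ℝ → ℝ} (hz : ContDiff ℝ m Wz) (hu : ContDiff ℝ m Wu)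
    (bz : BPar α β 1 m Wz) (bu : BPar α β (-1) m Wu) :
    tY α β n m (tW α β n Wz Wu) ≤ HS α β m Wz + HS α β m Wu := by
  unfold tY
  rw [tA_tW, tB_tW]
  refine add_le_add (Finset.sum_le_sum fun j hj => ?_) (Finset.sum_le_sum fun j hj => ?_)
  · exact (eC_EF hab n).prj_le hab.le hz bz (by simp at hj; omega)
  · exact (eS_EF hab n).prj_le hab.le hu bu (by simp at hj; omega)

theorem tg_bound (hab : 1 ≤ β - α) {M : ℝ} {Wz Wu : ℝ → ℝ} (hM : HS α β 2 Wz + HS α β 2 Wu ≤ M) (m : ℕ) :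
    2 ≤ m → ContDiff ℝ m Wz → ContDiff ℝ m Wu → BPar α β 1 m Wz → BPar α β (-1) m Wu →
    ∃ K, ∀ n c, IsTG α β (dlt M) n c → c 0 = tW α β n Wz Wu → ∀ t ∈ Icc (0:ℝ) (dlt M),
      tY α β n m (c t) ≤ K := by
  have hab' : α < β := by linarith
  induction m with
  | zero => intro h; omega
  | succ m ih =>
    intro hm hz hu bz bu
    rcases Nat.lt_or_ge m 2 with h2 | h2
    · have : m = 1 := by omega
      subst this
      refine ⟨4 * (M + 1), fun n c h h0 => h.Y2 hab ?_⟩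
      rw [h0]
      exact (tY_tW hab' n hz hu bz bu).trans hM
    · obtain ⟨K, hK⟩ := ih h2 (hz.of_le (by exact_mod_cast Nat.le_succ m)) (hu.of_le (by exact_mod_cast Nat.le_succ m))
        (bz.mono (Nat.le_succ m)) (bu.mono (Nat.le_succ m))
      set L := 16 * (((m + 1 : ℕ) : ℝ) + 1) * 2 ^ (m + 1) * Real.sqrt K with hL
      have hLn : 0 ≤ L := by positivity
      refine ⟨(HS α β (m + 1) Wz + HS α β (m + 1) Wu) * Real.exp (L * dlt M), fun n c h h0 t ht => ?_⟩
      have hg := gronwall_lin (ε := 0) hLn le_rfl (fun s hs => h.deriv_tY hab' (m + 1) hs) (fun s hs => by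
        refine (tY'_le hab (s := m) h2 (Nat.le_succ m) le_rfl (c s)).trans ?_
        rw [add_zero]
        refine mul_le_mul_of_nonneg_right ?_ (tY_nonneg hab' _ _ _)
        refine mul_le_mul_of_nonneg_left (Real.sqrt_le_sqrt (hK n c h h0 s hs)) (by positivity)) t ht
      refine hg.trans ?_
      rw [zero_mul, add_zero, h0]
      have := tY_tW hab' n hz hu bz bu
      have hnn : 0 ≤ HS α β (m + 1) Wz + HS α β (m + 1) Wu := add_nonneg (HS_nonneg hab'.le) (HS_nonneg hab'.le)
      apply mul_le_mul this _ (Real.exp_pos _).le hnn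
      exact Real.exp_le_exp.2 (mul_le_mul_of_nonneg_left ht.2 hLn)

end tg

theorem sup_small {a b : ℝ} (hab : 1 ≤ b - a) (L : ℝ) {ε : ℝ} (hε : 0 < ε) :
    ∃ d > 0, ∀ f, PC a b f → (∫ x in a..b, f x ^ 2) ≤ d → (∫ x in a..b, deriv f x ^ 2) ≤ L →
      ∀ x ∈ Icc a b, |f x| ≤ ε := by
  have hab' : a ≤ b := by linarith
  refine ⟨min (ε ^ 2 / 2) (ε ^ 4 / (16 * (|L| + 1))), by positivity, fun f hf h1 h2 x hx => ?_⟩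
  have h3 := sobolev_sharp hab hf hx
  have e1 := h1.trans (min_le_left _ _)
  have e2 := h1.trans (min_le_right _ _)
  rw [← Real.sqrt_mul (int_sq_nonneg hab')] at h3
  have e3 : Real.sqrt ((∫ x in a..b, f x ^ 2) * (∫ x in a..b, deriv f x ^ 2)) ≤ ε ^ 2 / 4 := by
    apply Real.sqrt_le_iff.2 ⟨by positivity, ?_⟩
    calc (∫ x in a..b, f x ^ 2) * (∫ x in a..b, deriv f x ^ 2) ≤ (ε ^ 4 / (16 * (|L| + 1))) * (|L| + 1) :=
          mul_le_mul e2 (by linarith [le_abs_self L]) (int_sq_nonneg hab') (by positivity)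
      _ = (ε ^ 2 / 4) ^ 2 := by have : |L| + 1 ≠ 0 := by positivity
                                field_simp; norm_num
  exact abs_le_of_sq_le_sq (by linarith) hε.le

section
variable {α β : ℝ}

theorem Gz_deriv_bound (hab : 1 ≤ β - α) {f g : ℝ → ℝ} (hf : Sm f) (hg : Sm g) {K : ℝ}
    (hK : HS α β 2 f + HS α β 2 g ≤ K) :
    (∫ x in α..β, deriv (Gz f g) x ^ 2) ≤ 36 * K ^ 2 ∧ (∫ x in α..β, deriv (Gu f g) x ^ 2) ≤ 36 * K ^ 2 := by
  have hab' : α ≤ β := by linarith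
  have nf : 0 ≤ HS α β 2 f := HS_nonneg hab'
  have ng : 0 ≤ HS α β 2 g := HS_nonneg hab'
  have s0 : ∀ x ∈ Icc α β, f x ^ 2 ≤ 2 * K ∧ g x ^ 2 ≤ 2 * K ∧ deriv f x ^ 2 ≤ 2 * K ∧ deriv g x ^ 2 ≤ 2 * K := by
    intro x hx
    have a0 := HS_sup hab (j := 0) (hf.cd 2) (by omega) hx
    have a1 := HS_sup hab (j := 1) (hf.cd 2) (by omega) hx
    have b0 := HS_sup hab (j := 0) (hg.cd 2) (by omega) hx
    have b1 := HS_sup hab (j := 1) (hg.cd 2) (by omega) hx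
    simp only [iteratedDeriv_zero, iteratedDeriv_one] at *
    refine ⟨?_, ?_, ?_, ?_⟩ <;> linarith
  have hKn : 0 ≤ K := by linarith
  have dz : ∀ x, deriv (Gz f g) x = deriv f x * deriv g x + 1/2 * (f x * deriv (deriv g) x) 
      + 1/2 * (g x * deriv (deriv f) x) := by
    intro x
    have : HasDerivAt (Gz f g) ((1/2) * ((deriv f x * deriv g x + f x * deriv (deriv g) x) 
       + (deriv g x * deriv f x + g x * deriv (deriv f) x))) x :=
      (((hf.diff x).hasDerivAt.fun_mul (hg.deriv.diff x).hasDerivAt).fun_add 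
        ((hg.diff x).hasDerivAt.fun_mul (hf.deriv.diff x).hasDerivAt)).const_mul (1/2)
    rw [this.deriv]; ring
  have du : ∀ x, deriv (Gu f g) x = 1/2 * deriv f x ^ 2 + 1/2 * (f x * deriv (deriv f) x) 
      + 3/2 * deriv g x ^ 2 + 3/2 * (g x * deriv (deriv g) x) := by
    intro x
    have : HasDerivAt (Gu f g) ((1/2) * (deriv f x * deriv f x + f x * deriv (deriv f) x) 
       + (3/2) * (deriv g x * deriv g x + g x * deriv (deriv g) x)) x :=
      (((hf.diff x).hasDerivAt.fun_mul (hf.deriv.diff x).hasDerivAt).const_mul (1/2)).fun_add 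
        (((hg.diff x).hasDerivAt.fun_mul (hg.deriv.diff x).hasDerivAt).const_mul (3/2))
    rw [this.deriv]; ring
  set R : ℝ → ℝ := fun x => (iteratedDeriv 1 f x ^ 2 + iteratedDeriv 2 f x ^ 2) 
    + (iteratedDeriv 1 g x ^ 2 + iteratedDeriv 2 g x ^ 2) with hR
  have b1 := (hf.iter 1).bi.sq (a := α) (b := β)
  have b2 := (hf.iter 2).bi.sq (a := α) (b := β)
  have b3 := (hg.iter 1).bi.sq (a := α) (b := β)
  have b4 := (hg.iter 2).bi.sq (a := α) (b := β)
  have bR : BI α β R := (b1.add b2).add (b3.add b4)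
  have iR : ∫ x in α..β, R x ≤ K := by
    simp only [hR]
    rw [int_add hab' (b1.add b2) (b3.add b4), int_add hab' b1 b2, int_add hab' b3 b4]
    have := HS_two_terms hab' (f := f) (j := 1) (m := 2) (by omega)
    have := HS_two_terms hab' (f := g) (j := 1) (m := 2) (by omega)
    norm_num at *
    linarith
  have i2 : ∀ (f : ℝ → ℝ) (x : ℝ), iteratedDeriv 2 f x = deriv (deriv f) x := by
    intro f x; rw [iteratedDeriv_succ, iteratedDeriv_one]
  have key : ∀ F : ℝ → ℝ, BI α β F → (∀ x ∈ Icc α β, F x ^ 2 ≤ 36 * K * R x) → (∫ x in α..β, F x ^ 2) ≤ 36 * K ^ 2 := by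
    intro F hF h
    calc _ ≤ ∫ x in α..β, 36 * K * R x := int_mono hab' hF.sq (bR.const_mul _) (fun x hx => h x hx)
      _ = 36 * K * ∫ x in α..β, R x := intervalIntegral.integral_const_mul _ _
      _ ≤ 36 * K * K := mul_le_mul_of_nonneg_left iR (by positivity)
      _ = _ := by ring
  constructor
  · refine key _ (Gz_sm hf hg).deriv.bi fun x hx => ?_
    obtain ⟨a, b, c, d⟩ := s0 x hx
    rw [dz]; simp only [hR, iteratedDeriv_one, i2]
    have m1 := mul_le_mul_of_nonneg_right a (sq_nonneg (deriv (deriv g) x))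
    have m2 := mul_le_mul_of_nonneg_right b (sq_nonneg (deriv (deriv f) x))
    have m3 := mul_le_mul_of_nonneg_right c (sq_nonneg (deriv g x))
    have n1 := mul_nonneg hKn (sq_nonneg (deriv f x))
    have n2 := mul_nonneg hKn (sq_nonneg (deriv g x))
    have n3 := mul_nonneg hKn (sq_nonneg (deriv (deriv f) x))
    have n4 := mul_nonneg hKn (sq_nonneg (deriv (deriv g) x))
    set X := deriv f x * deriv g x
    have : X ^ 2 = deriv f x ^ 2 * deriv g x ^ 2 := by simp only [X]; ring
    nlinarith [sq_nonneg (X - 1/2 * (f x * deriv (deriv g) x)), sq_nonneg (X - 1/2 * (g x * deriv (deriv f) x)),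
      sq_nonneg (1/2 * (f x * deriv (deriv g) x) - 1/2 * (g x * deriv (deriv f) x))]
  · refine key _ (Gu_sm hf hg).deriv.bi fun x hx => ?_
    obtain ⟨a, b, c, d⟩ := s0 x hx
    rw [du]; simp only [hR, iteratedDeriv_one, i2]
    have m1 := mul_le_mul_of_nonneg_right a (sq_nonneg (deriv (deriv f) x))
    have m2 := mul_le_mul_of_nonneg_right b (sq_nonneg (deriv (deriv g) x))
    have m3 := mul_le_mul_of_nonneg_right c (sq_nonneg (deriv f x))
    have m4 := mul_le_mul_of_nonneg_right d (sq_nonneg (deriv g x))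
    have n1 := mul_nonneg hKn (sq_nonneg (deriv f x))
    have n2 := mul_nonneg hKn (sq_nonneg (deriv g x))
    have n3 := mul_nonneg hKn (sq_nonneg (deriv (deriv f) x))
    have n4 := mul_nonneg hKn (sq_nonneg (deriv (deriv g) x))
    have four : ∀ p q r s : ℝ, (p + q + r + s) ^ 2 ≤ 4 * (p ^ 2 + q ^ 2 + r ^ 2 + s ^ 2) := by
      intro p q r s
      nlinarith [sq_nonneg (p - q), sq_nonneg (p - r), sq_nonneg (p - s), sq_nonneg (q - r), sq_nonneg (q - s), sq_nonneg (r - s)]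
    refine (four _ _ _ _).trans ?_
    ring_nf at *
    linarith

/-- approximate solutions -/
structure ApxSol (α β δ : ℝ) (m : ℕ) (K ε : ℝ) (Wz Wu : ℝ → ℝ) (A B A1 B1 : ℝ → ℝ → ℝ) : Prop where
  smA : ∀ t, Sm (A t)
  smB : ∀ t, Sm (B t)
  parA : ∀ t, Par α β 1 (A t)
  parB : ∀ t, Par α β (-1) (B t)
  dA : ∀ t ∈ Icc (0:ℝ) δ, ∀ x, HasDerivWithinAt (fun s => A s x) (A1 t x) (Icc (0:ℝ) δ) t
  dB : ∀ t ∈ Icc (0:ℝ) δ, ∀ x, HasDerivWithinAt (fun s => B s x) (B1 t x) (Icc (0:ℝ) δ) t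
  cA : ContinuousOn (fun p : ℝ × ℝ => A p.1 p.2) (Icc (0:ℝ) δ ×ˢ univ)
  cB : ContinuousOn (fun p : ℝ × ℝ => B p.1 p.2) (Icc (0:ℝ) δ ×ˢ univ)
  cA1 : ContinuousOn (fun p : ℝ × ℝ => A1 p.1 p.2) (Icc (0:ℝ) δ ×ˢ univ)
  cB1 : ContinuousOn (fun p : ℝ × ℝ => B1 p.1 p.2) (Icc (0:ℝ) δ ×ˢ univ)
  hs : ∀ t ∈ Icc (0:ℝ) δ, HS α β m (A t) + HS α β m (B t) ≤ K
  r1 : ∀ t ∈ Icc (0:ℝ) δ, ∀ x ∈ Icc α β, |A1 t x + Gz (A t) (B t) x| ≤ ε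
  r2 : ∀ t ∈ Icc (0:ℝ) δ, ∀ x ∈ Icc α β, |B1 t x + Gu (A t) (B t) x| ≤ ε
  i1 : ∀ x ∈ Icc α β, |A 0 x - Wz x| ≤ ε
  i2 : ∀ x ∈ Icc α β, |B 0 x - Wu x| ≤ ε

theorem lin_jcont {δ : ℝ} {ι : Type*} [Fintype ι] {e : ι → ℝ → ℝ} (he : ∀ i, Sm (e i)) {c : ℝ → ι → ℝ}
    (hc : ∀ i, ContinuousOn (fun t => c t i) (Icc (0:ℝ) δ)) :
    ContinuousOn (fun p : ℝ × ℝ => lin e (c p.1) p.2) (Icc (0:ℝ) δ ×ˢ univ) := by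
  unfold lin
  refine continuousOn_finsetSum _ fun i _ => ?_
  exact ((hc i).comp continuousOn_fst fun p hp => hp.1).mul ((he i).cont.comp continuous_snd).continuousOn

theorem lin_hasDeriv {δ t : ℝ} {ι : Type*} [Fintype ι] {e : ι → ℝ → ℝ} {c : ℝ → ι → ℝ} {c' : ι → ℝ}
    (hc : ∀ i, HasDerivWithinAt (fun s => c s i) (c' i) (Icc (0:ℝ) δ) t) (x : ℝ) :
    HasDerivWithinAt (fun s => lin e (c s) x) (lin e c' x) (Icc (0:ℝ) δ) t := by
  unfold lin
  exact HasDerivWithinAt.fun_sum fun i _ => (hc i).mul_const (e i x)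

/-- projection error of C¹ data with boundary parity -/
theorem prj_err_deriv {s : ℝ} {ι : Type*} [Fintype ι] [DecidableEq ι] {e : ι → ℝ → ℝ} {κ : ι → ℝ}
    (h : EF α β s e κ) (hab : α ≤ β) {g : ℝ → ℝ} (hg : ContDiff ℝ 1 g) (hb : BPar α β s 1 g) :
    (∫ x in α..β, deriv (fun x => g x - prj α β e g x) x ^ 2) ≤ ∫ x in α..β, deriv g x ^ 2 := by
  have h1 := h.prj_pyth hab (m := 1) (by exact_mod_cast hg) hb (j := 1) le_rfl
  have h2 := int_sq_nonneg (f := iteratedDeriv 1 (prj α β e g)) hab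
  have h3 : ∀ x, deriv (fun x => g x - prj α β e g x) x = iteratedDeriv 1 g x - iteratedDeriv 1 (prj α β e g) x := by
    intro x
    rw [iteratedDeriv_one, iteratedDeriv_one]
    exact deriv_fun_sub (hg.differentiable (by norm_num) x) (h.prj_sm.diff x)
  simp only [h3]
  rw [h1]; simp only [iteratedDeriv_one] at *; linarith

theorem bpar_one {g : ℝ → ℝ} : BPar α β 1 1 g := by
  intro i hi h
  have : i = 0 := by omega
  subst this; norm_num at h

theorem thmG (hab : 1 ≤ β - α) {M : ℝ} {Wz Wu : ℝ → ℝ} (hM : HS α β 2 Wz + HS α β 2 Wu ≤ M) {m : ℕ}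
    (hm : 2 ≤ m) (hz : ContDiff ℝ m Wz) (hu : ContDiff ℝ m Wu) (bz : BPar α β 1 m Wz) (bu : BPar α β (-1) m Wu) :
    ∃ K, ∀ ε > 0, ∃ A B A1 B1, ApxSol α β (dlt M) m K ε Wz Wu A B A1 B1 := by
  have hab' : α < β := by linarith
  have hM0 : 0 ≤ M := le_trans (add_nonneg (HS_nonneg hab'.le) (HS_nonneg hab'.le)) hM
  have hδ := dlt_pos hM0
  obtain ⟨K, hK⟩ := tg_bound hab hM m hm hz hu bz bu
  refine ⟨K, fun ε hε => ?_⟩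
  have hz1 : ContDiff ℝ 1 Wz := hz.of_le (by exact_mod_cast (by omega : 1 ≤ m))
  have hu1 : ContDiff ℝ 1 Wu := hu.of_le (by exact_mod_cast (by omega : 1 ≤ m))
  obtain ⟨d1, hd1, H1⟩ := sup_small hab (36 * K ^ 2) hε
  obtain ⟨d2, hd2, H2⟩ := sup_small hab (∫ x in α..β, deriv Wz x ^ 2) hε
  obtain ⟨d3, hd3, H3⟩ := sup_small hab (∫ x in α..β, deriv Wu x ^ 2) hε
  have hu0 : Wu α = 0 ∧ Wu β = 0 := by simpa using bu 0 (by omega) (by norm_num)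
  obtain ⟨n2, hn2⟩ := cos_complete hab' hz1.continuous hd2
  obtain ⟨n3, hn3⟩ := sin_complete hab' hu1 hu0.1 hu0.2 hd3
  obtain ⟨n1, hn1⟩ : ∃ n1 : ℕ, ∀ n ≥ n1, 36 * K ^ 2 / (((n + 1 : ℕ) : ℝ) * tw α β) ^ 2 ≤ d1 := by
    have htw := tw_pos hab'
    obtain ⟨n1, h⟩ := exists_nat_gt (36 * K ^ 2 / (tw α β ^ 2 * d1))
    refine ⟨n1, fun n hn => ?_⟩
    rw [div_le_iff₀ (by positivity)]
    rw [div_lt_iff₀ (by positivity)] at h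
    have h1 : (n1 : ℝ) ≤ ((n + 1 : ℕ) : ℝ) ^ 2 := by
      have : (n1:ℝ) ≤ n := by exact_mod_cast hn
      push_cast; nlinarith
    have := mul_le_mul_of_nonneg_right h1 (by positivity : 0 ≤ tw α β ^ 2 * d1)
    nlinarith
  set n := max n1 (max n2 n3) with hn
  have hnn1 : n1 ≤ n := le_max_left _ _
  have hnn2 : n2 ≤ n := (le_max_left _ _).trans (le_max_right _ _)
  have hnn3 : n3 ≤ n := (le_max_right _ _).trans (le_max_right _ _)
  have pE : ∀ i, PC α β (eC α β n i) := fun i => ((eC_EF hab' n).sm i).pc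
  have pF : ∀ i, PC α β (eS α β n i) := fun i => ((eS_EF hab' n).sm i).pc
  obtain ⟨c, hc0, hc⟩ := ode_exists hδ.le (galG_contDiff hab'.le pE pF) 
    (galG_inner hab'.le pE pF (fun j => (eS_zero hab' n j).1) (fun j => (eS_zero hab' n j).2)) (tW α β n Wz Wu)
  have htg : IsTG α β (dlt M) n c := hc
  have hbd := hK n c htg hc0
  set v' := fun t => galG α β (eC α β n) (eS α β n) (c t) with hv'
  have ccont : ∀ i, ContinuousOn (fun t => c t i) (Icc (0:ℝ) (dlt M)) := fun i t ht => (htg.coord ht i).continuousWithinAt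
  have vcont : ∀ i, ContinuousOn (fun t => v' t i) (Icc (0:ℝ) (dlt M)) := by
    intro i
    have h1 : ContinuousOn v' (Icc (0:ℝ) (dlt M)) :=
      (galG_contDiff hab'.le pE pF).continuous.comp_continuousOn fun t ht => (hc t ht).continuousWithinAt
    exact (EuclideanSpace.proj (𝕜 := ℝ) i : _ →L[ℝ] ℝ).continuous.comp_continuousOn h1
  have hA1 : ∀ t, tA α β n (v' t) = fun x => - prj α β (eC α β n) (Gz (tA α β n (c t)) (tB α β n (c t))) x := by
    intro t; funext x
    simp only [tA, prj, lin, hv', ← Finset.sum_neg_distrib]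
    refine Finset.sum_congr rfl fun i _ => ?_
    rw [galG_inl hab']; simp only [tA, tB]; ring
  have hB1 : ∀ t, tB α β n (v' t) = fun x => - prj α β (eS α β n) (Gu (tA α β n (c t)) (tB α β n (c t))) x := by
    intro t; funext x
    simp only [tB, prj, lin, hv', ← Finset.sum_neg_distrib]
    refine Finset.sum_congr rfl fun i _ => ?_
    rw [galG_inr hab']; simp only [tA, tB]; ring
  have hK2 : ∀ t ∈ Icc (0:ℝ) (dlt M), HS α β 2 (tA α β n (c t)) + HS α β 2 (tB α β n (c t)) ≤ K := fun t ht =>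
    le_trans (add_le_add (HS_mono hab'.le hm) (HS_mono hab'.le hm)) (hbd t ht)
  refine ⟨fun t => tA α β n (c t), fun t => tB α β n (c t), fun t => tA α β n (v' t), fun t => tB α β n (v' t), ?_⟩
  refine ⟨fun t => tA_sm _ _, fun t => tB_sm _ _, fun t => tA_par hab' _ _, fun t => tB_par hab' _ _, 
    fun t ht x => lin_hasDeriv (fun i => htg.coord ht _) x, fun t ht x => lin_hasDeriv (fun i => htg.coord ht _) x,
    lin_jcont (eC_EF hab' n).sm (fun i => ccont _), lin_jcont (eS_EF hab' n).sm (fun i => ccont _),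
    lin_jcont (eC_EF hab' n).sm (fun i => vcont _), lin_jcont (eS_EF hab' n).sm (fun i => vcont _), hbd, ?_, ?_, ?_, ?_⟩
  · intro t ht x hx
    have hA := tA_sm (α := α) (β := β) n (c t)
    have hB := tB_sm (α := α) (β := β) n (c t)
    have gs := Gz_sm hA hB
    have gp := Gz_par hA hB (tA_par hab' n (c t)) (tB_par hab' n (c t))
    have gb := (Gz_deriv_bound hab hA hB (hK2 t ht)).1
    rw [hA1]
    refine le_trans (le_of_eq ?_) (H1 (fun x => Gz (tA α β n (c t)) (tB α β n (c t)) x 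
      - prj α β (eC α β n) (Gz (tA α β n (c t)) (tB α β n (c t))) x) (gs.sub (eC_EF hab' n).prj_sm).pc ?_ ?_ x hx)
    · congr 1; ring
    · refine (eC_res hab' (gs.cd 1) n).trans (le_trans ?_ (hn1 n hnn1))
      gcongr
    · exact (prj_err_deriv (eC_EF hab' n) hab'.le (gs.cd 1) (gp.bpar gs 1)).trans gb
  · intro t ht x hx
    have hA := tA_sm (α := α) (β := β) n (c t)
    have hB := tB_sm (α := α) (β := β) n (c t)
    have gs := Gu_sm hA hB
    have gp := Gu_par hA hB (tA_par hab' n (c t)) (tB_par hab' n (c t))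
    have gb := (Gz_deriv_bound hab hA hB (hK2 t ht)).2
    have g0 := gp.zero (by norm_num)
    rw [hB1]
    refine le_trans (le_of_eq ?_) (H1 (fun x => Gu (tA α β n (c t)) (tB α β n (c t)) x 
      - prj α β (eS α β n) (Gu (tA α β n (c t)) (tB α β n (c t))) x) (gs.sub (eS_EF hab' n).prj_sm).pc ?_ ?_ x hx)
    · congr 1; ring
    · refine (eS_res hab' (gs.cd 1) g0.1 g0.2 n).trans (le_trans ?_ (hn1 n hnn1))
      gcongr
    · exact (prj_err_deriv (eS_EF hab' n) hab'.le (gs.cd 1) (gp.bpar gs 1)).trans gb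
  · intro x hx
    show |tA α β n (c 0) x - Wz x| ≤ ε
    rw [hc0, tA_tW, abs_sub_comm]
    exact H2 (fun x => Wz x - prj α β (eC α β n) Wz x) ((PC.of_contDiff hz1).sub (eC_EF hab' n).prj_sm.pc) (hn2 n hnn2)
      (prj_err_deriv (eC_EF hab' n) hab'.le hz1 (bz.mono (by omega))) x hx
  · intro x hx
    show |tB α β n (c 0) x - Wu x| ≤ ε
    rw [hc0, tB_tW, abs_sub_comm]
    exact H3 (fun x => Wu x - prj α β (eS α β n) Wu x) ((PC.of_contDiff hu1).sub (eS_EF hab' n).prj_sm.pc) (hn3 n hnn3)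
      (prj_err_deriv (eS_EF hab' n) hab'.le hu1 (bu.mono (by omega))) x hx
end

/-- differentiation under the integral sign -/
theorem int_hasDeriv {δ : ℝ} {f f1 : ℝ → ℝ → ℝ}
    (hd : ∀ t ∈ Icc (0:ℝ) δ, ∀ x ∈ Icc (0:ℝ) 1, HasDerivWithinAt (fun s => f s x) (f1 t x) (Icc (0:ℝ) δ) t)
    (hc : ContinuousOn (fun p : ℝ × ℝ => f1 p.1 p.2) (Icc (0:ℝ) δ ×ˢ Icc (0:ℝ) 1))
    (hf : ∀ t ∈ Icc (0:ℝ) δ, ContinuousOn (f t) (Icc (0:ℝ) 1)) :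
    ∀ t ∈ Icc (0:ℝ) δ, HasDerivWithinAt (fun s => ∫ x in (0:ℝ)..1, f s x) (∫ x in (0:ℝ)..1, f1 t x) (Icc (0:ℝ) δ) t := by
  intro t ht
  have h01 : (0:ℝ) ≤ 1 := by norm_num
  have hf1 : ∀ t ∈ Icc (0:ℝ) δ, BI 0 1 (f1 t) := fun t ht => BI.of_continuousOn 
    (hc.comp (by fun_prop : ContinuousOn (fun x => (t, x)) (Icc (0:ℝ) 1)) fun x hx => ⟨ht, hx⟩)
  rw [hasDerivWithinAt_iff_isLittleO, Asymptotics.isLittleO_iff]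
  intro c hcpos
  have huc := (isCompact_Icc.prod isCompact_Icc).uniformContinuousOn_of_continuous hc
  rw [Metric.uniformContinuousOn_iff] at huc
  obtain ⟨d, hd0, hd1⟩ := huc c hcpos
  have hmem : Metric.ball t d ∩ Icc (0:ℝ) δ ∈ nhdsWithin t (Icc (0:ℝ) δ) :=
    Filter.inter_mem (mem_nhdsWithin_of_mem_nhds (Metric.ball_mem_nhds t hd0)) self_mem_nhdsWithin
  filter_upwards [hmem] with s hs
  have hpt : ∀ x ∈ Icc (0:ℝ) 1, |f s x - f t x - (s - t) * f1 t x| ≤ c * |s - t| := by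
    intro x hx
    have hconv : Convex ℝ (Metric.ball t d ∩ Icc (0:ℝ) δ) := (convex_ball t d).inter (convex_Icc 0 δ)
    have := hconv.norm_image_sub_le_of_norm_hasDerivWithin_le (f := fun s => f s x - s * f1 t x)
      (f' := fun s => f1 s x - f1 t x) (C := c) (x := t) (y := s) (fun w hw => by
        refine ((hd w hw.2 x hx).mono inter_subset_right).sub ?_
        simpa using ((hasDerivAt_id w).mul_const (f1 t x)).hasDerivWithinAt) 
      (fun w hw => by
        have := hd1 (w, x) ⟨hw.2, hx⟩ (t, x) ⟨ht, hx⟩ (by 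
          rw [Prod.dist_eq]; simpa using hw.1)
        exact this.le) ⟨Metric.mem_ball_self hd0, ht⟩ hs
    rw [Real.norm_eq_abs, Real.norm_eq_abs] at this
    refine le_trans (le_of_eq ?_) this
    congr 1; ring
  have bs := BI.of_continuousOn (hf s hs.2)
  have bt := BI.of_continuousOn (hf t ht)
  have b1 := hf1 t ht
  rw [smul_eq_mul, ← intervalIntegral.integral_const_mul, ← int_sub h01 bs bt, ← int_sub h01 (bs.sub bt) (b1.const_mul _)]
  have := intervalIntegral.norm_integral_le_of_norm_le_const (a := 0) (b := 1) (C := c * |s - t|) 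
    (f := fun x => f s x - f t x - (s - t) * f1 t x) (fun x hx => by
      rw [uIoc_of_le h01] at hx
      exact hpt x ⟨hx.1.le, hx.2⟩)
  simpa using this

/-- classical solutions -/
structure Sol (T : ℝ) (r : ℕ) (Z U Z1 U1 : ℝ → ℝ → ℝ) : Prop where
  cz : ∀ t ∈ Icc (0:ℝ) T, ContDiff ℝ r (Z t)
  cu : ∀ t ∈ Icc (0:ℝ) T, ContDiff ℝ r (U t)
  dz : ∀ t ∈ Icc (0:ℝ) T, ∀ x ∈ Icc (0:ℝ) 1, HasDerivWithinAt (fun s => Z s x) (Z1 t x) (Icc (0:ℝ) T) t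
  du : ∀ t ∈ Icc (0:ℝ) T, ∀ x ∈ Icc (0:ℝ) 1, HasDerivWithinAt (fun s => U s x) (U1 t x) (Icc (0:ℝ) T) t
  jz : ContinuousOn (fun p : ℝ × ℝ => Z p.1 p.2) (Icc (0:ℝ) T ×ˢ Icc (0:ℝ) 1)
  ju : ContinuousOn (fun p : ℝ × ℝ => U p.1 p.2) (Icc (0:ℝ) T ×ˢ Icc (0:ℝ) 1)
  jz1 : ContinuousOn (fun p : ℝ × ℝ => Z1 p.1 p.2) (Icc (0:ℝ) T ×ˢ Icc (0:ℝ) 1)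
  ju1 : ContinuousOn (fun p : ℝ × ℝ => U1 p.1 p.2) (Icc (0:ℝ) T ×ˢ Icc (0:ℝ) 1)
  pz : ∀ t ∈ Icc (0:ℝ) T, ∀ x ∈ Icc (0:ℝ) 1, Z1 t x = - Gz (Z t) (U t) x
  pu : ∀ t ∈ Icc (0:ℝ) T, ∀ x ∈ Icc (0:ℝ) 1, U1 t x = - Gu (Z t) (U t) x
  b0 : ∀ t ∈ Icc (0:ℝ) T, U t 0 = 0
  b1 : ∀ t ∈ Icc (0:ℝ) T, U t 1 = 0

namespace Sol
variable {T : ℝ} {r : ℕ} {Z U Z1 U1 : ℝ → ℝ → ℝ}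

theorem shift (h : Sol T r Z U Z1 U1) {t0 d : ℝ} (h0 : 0 ≤ t0) (h1 : t0 + d ≤ T) :
    Sol d r (fun s => Z (t0 + s)) (fun s => U (t0 + s)) (fun s => Z1 (t0 + s)) (fun s => U1 (t0 + s)) := by
  have hm : ∀ s ∈ Icc (0:ℝ) d, t0 + s ∈ Icc (0:ℝ) T := fun s hs => ⟨by linarith [hs.1], by linarith [hs.2]⟩
  have hj : MapsTo (fun p : ℝ × ℝ => (t0 + p.1, p.2)) (Icc (0:ℝ) d ×ˢ Icc (0:ℝ) 1) (Icc (0:ℝ) T ×ˢ Icc (0:ℝ) 1) :=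
    fun p hp => ⟨hm _ hp.1, hp.2⟩
  have hjc : ContinuousOn (fun p : ℝ × ℝ => (t0 + p.1, p.2)) (Icc (0:ℝ) d ×ˢ Icc (0:ℝ) 1) := by fun_prop
  have hdd : ∀ {F : ℝ → ℝ} {F' s : ℝ}, HasDerivWithinAt F F' (Icc (0:ℝ) T) (t0 + s) → 
      HasDerivWithinAt (fun s => F (t0 + s)) F' (Icc (0:ℝ) d) s := by
    intro F F' s hF
    have := HasDerivWithinAt.comp s (h₂ := F) (h := fun s => t0 + s) hF 
      (((hasDerivAt_id s).const_add t0).hasDerivWithinAt (s := Icc (0:ℝ) d)) hm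
    simpa [Function.comp_def] using this
  exact ⟨fun t ht => h.cz _ (hm t ht), fun t ht => h.cu _ (hm t ht), 
    fun t ht x hx => hdd (F := fun s => Z s x) (h.dz _ (hm t ht) x hx), 
    fun t ht x hx => hdd (F := fun s => U s x) (h.du _ (hm t ht) x hx), 
    h.jz.comp hjc hj, h.ju.comp hjc hj, h.jz1.comp hjc hj, h.ju1.comp hjc hj,
    fun t ht => h.pz _ (hm t ht), fun t ht => h.pu _ (hm t ht), fun t ht => h.b0 _ (hm t ht), fun t ht => h.b1 _ (hm t ht)⟩

theorem rev (h : Sol T r Z U Z1 U1) {t0 d : ℝ} (h0 : d ≤ t0) (h1 : t0 ≤ T) :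
    Sol d r (fun s => Z (t0 - s)) (fun s x => - U (t0 - s) x) (fun s x => - Z1 (t0 - s) x) (fun s => U1 (t0 - s)) := by
  have hm : ∀ s ∈ Icc (0:ℝ) d, t0 - s ∈ Icc (0:ℝ) T := fun s hs => ⟨by linarith [hs.2], by linarith [hs.1]⟩
  have hj : MapsTo (fun p : ℝ × ℝ => (t0 - p.1, p.2)) (Icc (0:ℝ) d ×ˢ Icc (0:ℝ) 1) (Icc (0:ℝ) T ×ˢ Icc (0:ℝ) 1) :=
    fun p hp => ⟨hm _ hp.1, hp.2⟩
  have hjc : ContinuousOn (fun p : ℝ × ℝ => (t0 - p.1, p.2)) (Icc (0:ℝ) d ×ˢ Icc (0:ℝ) 1) := by fun_prop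
  have hdd : ∀ {F : ℝ → ℝ} {F' s : ℝ}, HasDerivWithinAt F F' (Icc (0:ℝ) T) (t0 - s) → 
      HasDerivWithinAt (fun s => F (t0 - s)) (-F') (Icc (0:ℝ) d) s := by
    intro F F' s hF
    have := HasDerivWithinAt.comp s (h₂ := F) (h := fun s => t0 - s) hF 
      (((hasDerivAt_id s).const_sub t0).hasDerivWithinAt (s := Icc (0:ℝ) d)) hm
    simpa [Function.comp_def] using this
  exact ⟨fun t ht => h.cz _ (hm t ht), fun t ht => (h.cu _ (hm t ht)).neg, 
    fun t ht x hx => hdd (F := fun s => Z s x) (h.dz _ (hm t ht) x hx), 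
    fun t ht x hx => by simpa using (hdd (F := fun s => U s x) (h.du _ (hm t ht) x hx)).fun_neg, 
    h.jz.comp hjc hj, (h.ju.comp hjc hj).neg, (h.jz1.comp hjc hj).neg, h.ju1.comp hjc hj,
    fun t ht x hx => by
      rw [h.pz _ (hm t ht) x hx]; unfold Gz
      rw [show deriv (fun x => - U (t0 - t) x) x = - deriv (U (t0 - t)) x from deriv.fun_neg]; ring, 
    fun t ht x hx => by
      rw [h.pu _ (hm t ht) x hx]; unfold Gu
      rw [show deriv (fun x => - U (t0 - t) x) x = - deriv (U (t0 - t)) x from deriv.fun_neg]; ring, 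
    fun t ht => by simp [h.b0 _ (hm t ht)], fun t ht => by simp [h.b1 _ (hm t ht)]⟩
end Sol

/-- flux identity -/
theorem flux_identity {z u a b : ℝ → ℝ} (hz : ContDiff ℝ 1 z) (hu : ContDiff ℝ 1 u) (ha : ContDiff ℝ 1 a)
    (hb : ContDiff ℝ 1 b) :
    (∫ x in (0:ℝ)..1, ((z x - a x) * (Gz z u x - Gz a b x) + (u x - b x) * (Gu z u x - Gu a b x))
      - ((1/2) * deriv a x * ((z x - a x) * (u x - b x)) + (1/4) * deriv b x * (z x - a x) ^ 2 
        + (3/4) * deriv b x * (u x - b x) ^ 2))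
    = (fun x => (1/2) * (z x - a x) ^ 2 * (u x - b x) + (1/2) * (u x - b x) ^ 3 + (1/2) * a x * (z x - a x) * (u x - b x)
        + (1/4) * b x * (z x - a x) ^ 2 + (3/4) * b x * (u x - b x) ^ 2) 1
     - (fun x => (1/2) * (z x - a x) ^ 2 * (u x - b x) + (1/2) * (u x - b x) ^ 3 + (1/2) * a x * (z x - a x) * (u x - b x)
        + (1/4) * b x * (z x - a x) ^ 2 + (3/4) * b x * (u x - b x) ^ 2) 0 := by
  have hc : ContDiff ℝ 1 (fun x => (1/2) * (z x - a x) ^ 2 * (u x - b x) + (1/2) * (u x - b x) ^ 3 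
      + (1/2) * a x * (z x - a x) * (u x - b x) + (1/4) * b x * (z x - a x) ^ 2 + (3/4) * b x * (u x - b x) ^ 2) := by
    fun_prop
  rw [← (PC.of_contDiff hc).int_deriv (by norm_num : (0:ℝ) ≤ 1)]
  refine intervalIntegral.integral_congr fun x _ => ?_
  have Hz := (hz.differentiable (by norm_num) x).hasDerivAt
  have Hu := (hu.differentiable (by norm_num) x).hasDerivAt
  have Ha := (ha.differentiable (by norm_num) x).hasDerivAt
  have Hb := (hb.differentiable (by norm_num) x).hasDerivAt
  have Hp := Hz.fun_sub Ha
  have Hq := Hu.fun_sub Hb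
  have := ((((((Hp.fun_pow 2).const_mul (1/2)).fun_mul Hq).fun_add ((Hq.fun_pow 3).const_mul (1/2))).fun_add 
    (((Ha.const_mul (1/2)).fun_mul Hp).fun_mul Hq)).fun_add ((Hb.const_mul (1/4)).fun_mul (Hp.fun_pow 2))).fun_add 
    ((Hb.const_mul (3/4)).fun_mul (Hq.fun_pow 2))
  rw [this.deriv]
  unfold Gz Gu
  push_cast
  ring

section
variable {α β δ K ε : ℝ} {m : ℕ} {Wz Wu : ℝ → ℝ} {A B A1 B1 : ℝ → ℝ → ℝ}

theorem ApxSol.sup (h : ApxSol α β δ m K ε Wz Wu A B A1 B1) (hab : 1 ≤ β - α) (hm : 2 ≤ m) {t : ℝ}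
    (ht : t ∈ Icc (0:ℝ) δ) {x : ℝ} (hx : x ∈ Icc α β) :
    |A t x| ≤ Real.sqrt (2 * K) ∧ |B t x| ≤ Real.sqrt (2 * K) ∧ |deriv (A t) x| ≤ Real.sqrt (2 * K)
      ∧ |deriv (B t) x| ≤ Real.sqrt (2 * K) := by
  have hab' : α ≤ β := by linarith
  have nf : 0 ≤ HS α β m (A t) := HS_nonneg hab'
  have ng : 0 ≤ HS α β m (B t) := HS_nonneg hab'
  have hK := h.hs t ht
  have a0 := HS_sup hab (j := 0) ((h.smA t).cd m) (by omega) hx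
  have a1 := HS_sup hab (j := 1) ((h.smA t).cd m) (by omega) hx
  have b0 := HS_sup hab (j := 0) ((h.smB t).cd m) (by omega) hx
  have b1 := HS_sup hab (j := 1) ((h.smB t).cd m) (by omega) hx
  simp only [iteratedDeriv_zero, iteratedDeriv_one] at *
  refine ⟨?_, ?_, ?_, ?_⟩ <;> exact Real.abs_le_sqrt (by linarith)

theorem hasDerivWithin_Icc_mono {f : ℝ → ℝ} {f' t τ δ : ℝ} (h : HasDerivWithinAt f f' (Icc (0:ℝ) δ) t) (hτ : τ ≤ δ) :
    HasDerivWithinAt f f' (Icc (0:ℝ) τ) t := h.mono (Icc_subset_Icc_right hτ)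

/-- smallness at a degenerate end -/
theorem ApxSol.endSmall (h : ApxSol α β δ m K ε Wz Wu A B A1 B1) (hε : 0 ≤ ε) (hab : 1 ≤ β - α) (hm : 2 ≤ m) {x : ℝ}
    (hx : x ∈ Icc α β) (hz : Wz x = 0) (hu : Wu x = 0) :
    ∀ t ∈ Icc (0:ℝ) δ, A t x ^ 2 + B t x ^ 2 ≤ 
      (2 * ε ^ 2 + 2 * ε ^ 2 * t) * Real.exp ((4 * Real.sqrt (2 * K) + 1) * t) := by
  intro t ht
  set L := Real.sqrt (2 * K) with hL
  have hLn : 0 ≤ L := Real.sqrt_nonneg _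
  have hd : ∀ s ∈ Icc (0:ℝ) δ, HasDerivWithinAt (fun s => A s x ^ 2 + B s x ^ 2)
      (2 * A s x * A1 s x + 2 * B s x * B1 s x) (Icc (0:ℝ) δ) s := by
    intro s hs
    refine (((h.dA s hs x).fun_pow 2).fun_add ((h.dB s hs x).fun_pow 2)).congr_deriv ?_
    push_cast; ring
  have hg := gronwall_lin (K := 4 * L + 1) (ε := 2 * ε ^ 2) (by positivity) (by positivity) hd (fun s hs => by
    obtain ⟨s1, s2, s3, s4⟩ := h.sup hab hm hs hx
    have r1 := h.r1 s hs x hx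
    have r2 := h.r2 s hs x hx
    set e1 := A1 s x + Gz (A s) (B s) x with he1
    set e2 := B1 s x + Gu (A s) (B s) x with he2
    have q1 : e1 ^ 2 ≤ ε ^ 2 := sq_le_sq' (abs_le.1 r1).1 (abs_le.1 r1).2
    have q2 : e2 ^ 2 ≤ ε ^ 2 := sq_le_sq' (abs_le.1 r2).1 (abs_le.1 r2).2
    set a := A s x
    set b := B s x
    set a' := deriv (A s) x
    set b' := deriv (B s) x
    have ea : A1 s x = e1 - (1/2) * (a * b' + b * a') := by rw [he1]; unfold Gz; ring
    have eb : B1 s x = e2 - ((1/2) * (a * a') + (3/2) * (b * b')) := by rw [he2]; unfold Gu; ring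
    rw [ea, eb]
    have m1 : -(a ^ 2 * b') ≤ a ^ 2 * L := by nlinarith [(abs_le.1 s4).1, sq_nonneg a]
    have m2 : -(b ^ 2 * b') ≤ b ^ 2 * L := by nlinarith [(abs_le.1 s4).1, sq_nonneg b]
    have m3 : -(a * b * a') ≤ (a ^ 2 + b ^ 2) / 2 * L := by
      have : |a * b * a'| ≤ (a ^ 2 + b ^ 2) / 2 * L := by
        rw [abs_mul]
        refine mul_le_mul ?_ s3 (abs_nonneg _) (by positivity)
        rw [abs_le]; constructor <;> nlinarith [sq_nonneg (a + b), sq_nonneg (a - b)]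
      linarith [(abs_le.1 this).1]
    nlinarith [sq_nonneg (a - e1), sq_nonneg (b - e2), mul_nonneg hLn (sq_nonneg a), mul_nonneg hLn (sq_nonneg b)]) t ht
  refine hg.trans ?_
  refine mul_le_mul_of_nonneg_right ?_ (Real.exp_pos _).le
  have i1 := h.i1 x hx
  have i2 := h.i2 x hx
  rw [hz, sub_zero] at i1
  rw [hu, sub_zero] at i2
  have q1 : A 0 x ^ 2 ≤ ε ^ 2 := sq_le_sq' (abs_le.1 i1).1 (abs_le.1 i1).2
  have q2 : B 0 x ^ 2 ≤ ε ^ 2 := sq_le_sq' (abs_le.1 i2).1 (abs_le.1 i2).2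
  linarith

theorem phi_bound {z a b κ Q L : ℝ} (hκ : |b| ≤ κ) (hz : |z| ≤ Q) (ha : |a| ≤ L) (hb : |b| ≤ L) :
    |(1/2) * (z - a) ^ 2 * (0 - b) + (1/2) * (0 - b) ^ 3 + (1/2) * a * (z - a) * (0 - b)
        + (1/4) * b * (z - a) ^ 2 + (3/4) * b * (0 - b) ^ 2| ≤ κ * (Q + L) ^ 2 := by
  have : (1/2) * (z - a) ^ 2 * (0 - b) + (1/2) * (0 - b) ^ 3 + (1/2) * a * (z - a) * (0 - b)
        + (1/4) * b * (z - a) ^ 2 + (3/4) * b * (0 - b) ^ 2 = b * ((1/4) * b ^ 2 - (1/4) * (z - a) ^ 2 - (1/2) * (a * (z - a))) := by ring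
  rw [this, abs_mul]
  refine mul_le_mul hκ ?_ (abs_nonneg _) ((abs_nonneg _).trans hκ)
  have hQ := (abs_nonneg _).trans hz
  have hL := (abs_nonneg _).trans ha
  have h1 : |z - a| ≤ Q + L := (abs_sub _ _).trans (by linarith)
  have h2 : (z - a) ^ 2 ≤ (Q + L) ^ 2 := sq_le_sq' (abs_le.1 h1).1 (abs_le.1 h1).2
  have h3 : b ^ 2 ≤ (Q + L) ^ 2 := sq_le_sq' (by linarith [(abs_le.1 hb).1]) (by linarith [(abs_le.1 hb).2])
  have h4 : |a * (z - a)| ≤ (Q + L) * (Q + L) := by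
    rw [abs_mul]; exact mul_le_mul (by linarith) h1 (abs_nonneg _) (by linarith)
  rw [abs_le] at h4 ⊢
  constructor <;> nlinarith [sq_nonneg b, sq_nonneg (z - a)]

theorem comp_pt {p q a' b' e1 e2 ε L gz ga gu gb : ℝ} (hLn : 0 ≤ L) (s3 : |a'| ≤ L) (s4 : |b'| ≤ L) 
    (q1 : e1 ^ 2 ≤ ε ^ 2) (q2 : e2 ^ 2 ≤ ε ^ 2) :
    p * (-gz - (e1 - ga)) + q * (-gu - (e2 - gb)) + (p * (gz - ga) + q * (gu - gb) 
      - ((1/2) * a' * (p * q) + (1/4) * b' * p ^ 2 + (3/4) * b' * q ^ 2)) ≤ (2 * L + 1) * ((1/2) * p ^ 2 + (1/2) * q ^ 2) + ε ^ 2 := by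
  have m1 : -(p ^ 2 * b') ≤ p ^ 2 * L := by nlinarith [(abs_le.1 s4).1, sq_nonneg p]
  have m2 : -(q ^ 2 * b') ≤ q ^ 2 * L := by nlinarith [(abs_le.1 s4).1, sq_nonneg q]
  have m3 : -(p * q * a') ≤ (p ^ 2 + q ^ 2) / 2 * L := by
    have : |p * q * a'| ≤ (p ^ 2 + q ^ 2) / 2 * L := by
      rw [abs_mul]
      refine mul_le_mul ?_ s3 (abs_nonneg _) (by positivity)
      rw [abs_le]; constructor <;> nlinarith [sq_nonneg (p + q), sq_nonneg (p - q)]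
    linarith [(abs_le.1 this).1]
  have m4 : -(p * e1) ≤ (1/2) * p ^ 2 + (1/2) * e1 ^ 2 := by nlinarith [sq_nonneg (p + e1)]
  have m5 : -(q * e2) ≤ (1/2) * q ^ 2 + (1/2) * e2 ^ 2 := by nlinarith [sq_nonneg (q + e2)]
  have n1 := mul_nonneg hLn (sq_nonneg p)
  have n2 := mul_nonneg hLn (sq_nonneg q)
  linarith

set_option maxHeartbeats 1000000 in
/-- weak-strong comparison -/
theorem compare {T : ℝ} {r : ℕ} {Z U Z1 U1 : ℝ → ℝ → ℝ} (hS : Sol T r Z U Z1 U1) (hr : 1 ≤ r)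
    (h : ApxSol α β δ m K ε Wz Wu A B A1 B1) (hα : α ≤ 0) (hβ : 1 ≤ β) (hm : 2 ≤ m)
    {τ : ℝ} (hτδ : τ ≤ δ) (hτT : τ ≤ T) (hi : ∀ x ∈ Icc (0:ℝ) 1, Wz x = Z 0 x ∧ Wu x = U 0 x) {κ Q : ℝ}
    (hκn : 0 ≤ κ) 
    (hκ : ∀ t ∈ Icc (0:ℝ) τ, |B t 0| ≤ κ ∧ |B t 1| ≤ κ) (hQ : ∀ t ∈ Icc (0:ℝ) τ, |Z t 0| ≤ Q ∧ |Z t 1| ≤ Q) :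
    ∀ t ∈ Icc (0:ℝ) τ, ∫ x in (0:ℝ)..1, ((1/2) * (Z t x - A t x) ^ 2 + (1/2) * (U t x - B t x) ^ 2) ≤
      (ε ^ 2 + (ε ^ 2 + 2 * (κ * (Q + Real.sqrt (2 * K)) ^ 2)) * t) * Real.exp ((2 * Real.sqrt (2 * K) + 1) * t) := by
  intro t ht
  have h01 : (0:ℝ) ≤ 1 := by norm_num
  have hab : 1 ≤ β - α := by linarith
  have hsub : ∀ {x}, x ∈ Icc (0:ℝ) 1 → x ∈ Icc α β := fun hx => ⟨hα.trans hx.1, hx.2.trans hβ⟩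
  have hT : ∀ {s}, s ∈ Icc (0:ℝ) τ → s ∈ Icc (0:ℝ) T := fun hs => ⟨hs.1, hs.2.trans hτT⟩
  have hD : ∀ {s}, s ∈ Icc (0:ℝ) τ → s ∈ Icc (0:ℝ) δ := fun hs => ⟨hs.1, hs.2.trans hτδ⟩
  set L := Real.sqrt (2 * K) with hL
  have hLn : 0 ≤ L := Real.sqrt_nonneg _
  have sT : Icc (0:ℝ) τ ×ˢ Icc (0:ℝ) 1 ⊆ Icc (0:ℝ) T ×ˢ Icc (0:ℝ) 1 := prod_mono (Icc_subset_Icc_right hτT) le_rfl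
  have sD : Icc (0:ℝ) τ ×ˢ Icc (0:ℝ) 1 ⊆ Icc (0:ℝ) δ ×ˢ univ := prod_mono (Icc_subset_Icc_right hτδ) (subset_univ _)
  have jp := (hS.jz.mono sT).sub (h.cA.mono sD)
  have jq := (hS.ju.mono sT).sub (h.cB.mono sD)
  have jp1 := (hS.jz1.mono sT).sub (h.cA1.mono sD)
  have jq1 := (hS.ju1.mono sT).sub (h.cB1.mono sD)
  have hz1 : ∀ s ∈ Icc (0:ℝ) τ, ContDiff ℝ 1 (Z s) := fun s hs => (hS.cz s (hT hs)).of_le (by exact_mod_cast hr)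
  have hu1 : ∀ s ∈ Icc (0:ℝ) τ, ContDiff ℝ 1 (U s) := fun s hs => (hS.cu s (hT hs)).of_le (by exact_mod_cast hr)
  have ha1 : ∀ s, ContDiff ℝ 1 (A s) := fun s => (h.smA s).cd 1
  have hb1 : ∀ s, ContDiff ℝ 1 (B s) := fun s => (h.smB s).cd 1
  have hE := int_hasDeriv (δ := τ) (f := fun s x => (1/2) * (Z s x - A s x) ^ 2 + (1/2) * (U s x - B s x) ^ 2)
    (f1 := fun s x => (Z s x - A s x) * (Z1 s x - A1 s x) + (U s x - B s x) * (U1 s x - B1 s x))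
    (fun s hs x hx => by
      have H1 := ((hS.dz s (hT hs) x hx).mono (Icc_subset_Icc_right hτT)).fun_sub ((h.dA s (hD hs) x).mono (Icc_subset_Icc_right hτδ))
      have H2 := ((hS.du s (hT hs) x hx).mono (Icc_subset_Icc_right hτT)).fun_sub ((h.dB s (hD hs) x).mono (Icc_subset_Icc_right hτδ))
      refine (((H1.fun_pow 2).const_mul (1/2)).fun_add ((H2.fun_pow 2).const_mul (1/2))).congr_deriv ?_
      push_cast; ring)
    ((jp.mul jp1).add (jq.mul jq1))
    (fun s hs => by
      have := (hz1 s hs).continuous; have := (hu1 s hs).continuous; have := (ha1 s).continuous; have := (hb1 s).continuous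
      fun_prop)
  refine (gronwall_lin (K := 2 * L + 1) (ε := ε ^ 2 + 2 * (κ * (Q + L) ^ 2)) (by positivity) (by positivity) hE ?_ t ht).trans ?_
  · intro s hs
    have cz := (hz1 s hs).continuous
    have cu := (hu1 s hs).continuous
    have ca := (ha1 s).continuous
    have cb := (hb1 s).continuous
    have cz' := (hz1 s hs).continuous_deriv le_rfl
    have cu' := (hu1 s hs).continuous_deriv le_rfl
    have ca' := (ha1 s).continuous_deriv le_rfl
    have cb' := (hb1 s).continuous_deriv le_rfl
    have cgz : Continuous (Gz (Z s) (U s)) := by unfold Gz; fun_prop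
    have cgu : Continuous (Gu (Z s) (U s)) := by unfold Gu; fun_prop
    have cga : Continuous (Gz (A s) (B s)) := by unfold Gz; fun_prop
    have cgb : Continuous (Gu (A s) (B s)) := by unfold Gu; fun_prop
    have hfl := flux_identity (hz1 s hs) (hu1 s hs) (ha1 s) (hb1 s)
    simp only [hS.b0 s (hT hs), hS.b1 s (hT hs)] at hfl
    have hQs := hQ s hs
    have hκs := hκ s hs
    have s0 := h.sup hab hm (hD hs) (hsub (left_mem_Icc.2 h01))
    have s1 := h.sup hab hm (hD hs) (hsub (right_mem_Icc.2 h01))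
    have f0 := phi_bound hκs.1 hQs.1 s0.1 s0.2.1
    have f1 := phi_bound hκs.2 hQs.2 s1.1 s1.2.1
    set I := ∫ x in (0:ℝ)..1, ((Z s x - A s x) * (Gz (Z s) (U s) x - Gz (A s) (B s) x) + (U s x - B s x) * (Gu (Z s) (U s) x - Gu (A s) (B s) x))
      - ((1/2) * deriv (A s) x * ((Z s x - A s x) * (U s x - B s x)) + (1/4) * deriv (B s) x * (Z s x - A s x) ^ 2 
        + (3/4) * deriv (B s) x * (U s x - B s x) ^ 2) with hI
    have hIb : -I ≤ 2 * (κ * (Q + L) ^ 2) := by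
      rw [hfl]
      have := (abs_le.1 f0).2; have := (abs_le.1 f1).1
      linarith
    have bq := ((jp.mul jp1).add (jq.mul jq1)).comp (by fun_prop : ContinuousOn (fun x : ℝ => (s, x)) (Icc (0:ℝ) 1)) 
      (fun x hx => (⟨hs, hx⟩ : (s, x) ∈ Icc (0:ℝ) τ ×ˢ Icc (0:ℝ) 1))
    have bF : BI 0 1 (fun x => (Z s x - A s x) * (Z1 s x - A1 s x) + (U s x - B s x) * (U1 s x - B1 s x)) :=
      BI.of_continuousOn bq
    have bI : BI 0 1 (fun x => ((Z s x - A s x) * (Gz (Z s) (U s) x - Gz (A s) (B s) x) + (U s x - B s x) * (Gu (Z s) (U s) x - Gu (A s) (B s) x))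
      - ((1/2) * deriv (A s) x * ((Z s x - A s x) * (U s x - B s x)) + (1/4) * deriv (B s) x * (Z s x - A s x) ^ 2 
        + (3/4) * deriv (B s) x * (U s x - B s x) ^ 2)) := BI.of_continuous (by fun_prop)
    have bE : BI 0 1 (fun x => (1/2) * (Z s x - A s x) ^ 2 + (1/2) * (U s x - B s x) ^ 2) := BI.of_continuous (by fun_prop)
    have key : (∫ x in (0:ℝ)..1, ((Z s x - A s x) * (Z1 s x - A1 s x) + (U s x - B s x) * (U1 s x - B1 s x))) + I
        ≤ ∫ x in (0:ℝ)..1, ((2 * L + 1) * ((1/2) * (Z s x - A s x) ^ 2 + (1/2) * (U s x - B s x) ^ 2) + ε ^ 2) := by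
      rw [hI, ← int_add h01 bF bI]
      refine int_mono h01 (bF.add bI) ((bE.const_mul _).add (BI.const _)) fun x hx => ?_
      obtain ⟨s1, s2, s3, s4⟩ := h.sup hab hm (hD hs) (hsub hx)
      have r1 := h.r1 s (hD hs) x (hsub hx)
      have r2 := h.r2 s (hD hs) x (hsub hx)
      rw [hS.pz s (hT hs) x hx, hS.pu s (hT hs) x hx]
      set e1 := A1 s x + Gz (A s) (B s) x with he1
      set e2 := B1 s x + Gu (A s) (B s) x with he2
      have q1 : e1 ^ 2 ≤ ε ^ 2 := sq_le_sq' (abs_le.1 r1).1 (abs_le.1 r1).2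
      have q2 : e2 ^ 2 ≤ ε ^ 2 := sq_le_sq' (abs_le.1 r2).1 (abs_le.1 r2).2
      have ea : A1 s x = e1 - Gz (A s) (B s) x := by rw [he1]; ring
      have eb : B1 s x = e2 - Gu (A s) (B s) x := by rw [he2]; ring
      rw [ea, eb]
      set p := Z s x - A s x
      set q := U s x - B s x
      set a' := deriv (A s) x
      set b' := deriv (B s) x
      exact comp_pt hLn s3 s4 q1 q2
    rw [int_add h01 (bE.const_mul _) (BI.const _), intervalIntegral.integral_const_mul, intervalIntegral.integral_const] at key
    simp only [sub_zero, one_smul] at key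
    linarith
  · refine mul_le_mul_of_nonneg_right ?_ (Real.exp_pos _).le
    have : ∫ x in (0:ℝ)..1, ((1/2) * (Z 0 x - A 0 x) ^ 2 + (1/2) * (U 0 x - B 0 x) ^ 2) ≤ ∫ x in (0:ℝ)..1, ε ^ 2 := by
      have h0 : (0:ℝ) ∈ Icc (0:ℝ) τ := ⟨le_rfl, ht.1.trans ht.2⟩
      have cz := (hz1 0 h0).continuous
      have cu := (hu1 0 h0).continuous
      have ca := (ha1 0).continuous
      have cb := (hb1 0).continuous
      refine int_mono h01 (BI.of_continuous (by fun_prop)) (BI.const _) fun x hx => ?_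
      have i1 := h.i1 x (hsub hx)
      have i2 := h.i2 x (hsub hx)
      rw [(hi x hx).1, abs_sub_comm] at i1
      rw [(hi x hx).2, abs_sub_comm] at i2
      have q1 := sq_le_sq' (abs_le.1 i1).1 (abs_le.1 i1).2
      have q2 := sq_le_sq' (abs_le.1 i2).1 (abs_le.1 i2).2
      linarith
    rw [intervalIntegral.integral_const] at this
    simp only [sub_zero, one_smul] at this
    linarith
end

section limit

theorem HS_iter_bi {a b : ℝ} {m i : ℕ} {f : ℝ → ℝ} (hf : ContDiff ℝ m f) (hi : i ≤ m) : BI a b (iteratedDeriv i f) :=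
  BI.of_continuous (contDiff_iter hf (i := 0) (by omega : i + 0 ≤ m)).continuous

theorem iter_pc {a b : ℝ} {m i : ℕ} {f : ℝ → ℝ} (hf : ContDiff ℝ m f) (hi : i + 1 ≤ m) : PC a b (iteratedDeriv i f) :=
  PC.of_contDiff (by exact_mod_cast contDiff_iter hf hi)

theorem interp_small {m : ℕ} (K : ℝ) (i : ℕ) : i < m → ∀ η > 0, ∃ d > 0, ∀ h : ℝ → ℝ, ContDiff ℝ m h →
    HS 0 1 m h ≤ K → (∫ x in (0:ℝ)..1, h x ^ 2) ≤ d → ∀ x ∈ Icc (0:ℝ) 1, |iteratedDeriv i h x| ≤ η := by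
  have h01 : (0:ℝ) ≤ 1 := by norm_num
  have h1 : (1:ℝ) ≤ 1 - 0 := by norm_num
  induction i with
  | zero =>
    intro hm η hη
    obtain ⟨d, hd, H⟩ := sup_small h1 K hη
    refine ⟨d, hd, fun h hh hK hs x hx => ?_⟩
    have := HS_term h01 (f := h) (j := 1) (m := m) (by omega)
    rw [iteratedDeriv_zero]
    rw [iteratedDeriv_one] at this
    exact H h (PC.of_contDiff (hh.of_le (by exact_mod_cast hm))) hs (this.trans hK) x hx
  | succ i ih =>
    intro hm η hη
    obtain ⟨d', hd', H⟩ := sup_small h1 K hη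
    set L := 3 * Real.sqrt (2 * K) + 1 with hL
    have hLp : 0 < L := by positivity
    obtain ⟨d, hd, H2⟩ := ih (by omega) (d' / L) (by positivity)
    refine ⟨d, hd, fun h hh hK hs => ?_⟩
    have s1 := H2 h hh hK hs
    have hKn : 0 ≤ K := le_trans (HS_nonneg h01) hK
    refine H _ (iter_pc hh (by omega)) ?_ (by
      rw [← iteratedDeriv_succ]; exact (HS_term h01 (by omega)).trans hK)
    have bp := PC.by_parts h01 (iter_pc hh (by omega : i + 1 ≤ m)) (iter_pc hh (by omega : (i + 1) + 1 ≤ m))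
    simp only [← iteratedDeriv_succ] at bp
    simp only [pow_two]
    rw [bp]
    have cs := cauchy_schwarz h01 (HS_iter_bi (a := 0) (b := 1) hh (by omega : i ≤ m)) (HS_iter_bi hh (by omega : i + 1 + 1 ≤ m))
    have i1 : (∫ x in (0:ℝ)..1, iteratedDeriv i h x ^ 2) ≤ (d' / L) ^ 2 := by
      have := int_mono h01 (HS_iter_bi hh (by omega : i ≤ m)).sq (BI.const ((d' / L) ^ 2)) (fun x hx => 
        sq_le_sq' (abs_le.1 (s1 x hx)).1 (abs_le.1 (s1 x hx)).2)
      rw [intervalIntegral.integral_const] at this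
      simpa using this
    have i2 : Real.sqrt (∫ x in (0:ℝ)..1, iteratedDeriv i h x ^ 2) ≤ d' / L := 
      Real.sqrt_le_iff.2 ⟨by positivity, i1⟩
    have i3 : Real.sqrt (∫ x in (0:ℝ)..1, iteratedDeriv (i + 1 + 1) h x ^ 2) ≤ Real.sqrt (2 * K) :=
      Real.sqrt_le_sqrt (((HS_term h01 (by omega)).trans hK).trans (by linarith))
    have i4 := mul_le_mul i2 i3 (Real.sqrt_nonneg _) (by positivity : 0 ≤ d' / L)
    have e : ∀ x ∈ Icc (0:ℝ) 1, |iteratedDeriv i h x * iteratedDeriv (i + 1) h x| ≤ d' / L * Real.sqrt (2 * K) := by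
      intro x hx
      rw [abs_mul]
      refine mul_le_mul (s1 x hx) (Real.abs_le_sqrt ((HS_sup h1 hh (by omega) hx).trans (by linarith))) (abs_nonneg _) (by positivity)
    have e0 := abs_le.1 (e 0 (by simp))
    have e1 := abs_le.1 (e 1 (by simp))
    have cs' := abs_le.1 (cs.trans i4)
    have : d' / L * (3 * Real.sqrt (2 * K)) ≤ d' := by
      rw [div_mul_eq_mul_div, div_le_iff₀ hLp]; nlinarith
    linarith [cs'.1, e0.1, e1.2]

theorem HS_sub_le {a b : ℝ} (hab : a ≤ b) {m : ℕ} {f g : ℝ → ℝ} (hf : ContDiff ℝ m f) (hg : ContDiff ℝ m g) :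
    HS a b m (fun x => f x - g x) ≤ 2 * HS a b m f + 2 * HS a b m g := by
  unfold HS
  rw [Finset.mul_sum, Finset.mul_sum, ← Finset.sum_add_distrib]
  refine Finset.sum_le_sum fun j hj => ?_
  have hj' : j ≤ m := by simp at hj; omega
  have bf := HS_iter_bi (a := a) (b := b) hf hj'
  have bg := HS_iter_bi (a := a) (b := b) hg hj'
  rw [← intervalIntegral.integral_const_mul, ← intervalIntegral.integral_const_mul, 
    ← int_add hab (bf.sq.const_mul 2) (bg.sq.const_mul 2)]
  have hd : ∀ x, iteratedDeriv j (fun x => f x - g x) x = iteratedDeriv j f x - iteratedDeriv j g x := fun x =>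
    iteratedDeriv_fun_sub (hf.contDiffAt.of_le (by exact_mod_cast hj')) (hg.contDiffAt.of_le (by exact_mod_cast hj'))
  simp only [hd]
  refine int_mono hab (bf.sub bg).sq ((bf.sq.const_mul 2).add (bg.sq.const_mul 2)) fun x _ => ?_
  nlinarith [sq_nonneg (iteratedDeriv j f x + iteratedDeriv j g x)]

theorem lim_close {m : ℕ} {f : ℝ → ℝ} (hf : ContDiff ℝ m f) (K : ℝ) {i : ℕ} (hi : i < m) {η : ℝ} (hη : 0 < η) :
    ∃ d > 0, ∀ g : ℝ → ℝ, ContDiff ℝ m g → HS 0 1 m g ≤ K → (∫ x in (0:ℝ)..1, (f x - g x) ^ 2) ≤ d → 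
      ∀ x ∈ Icc (0:ℝ) 1, |iteratedDeriv i f x - iteratedDeriv i g x| ≤ η := by
  obtain ⟨d, hd, H⟩ := interp_small (2 * HS 0 1 m f + 2 * K) i hi η hη
  refine ⟨d, hd, fun g hg hK hs x hx => ?_⟩
  have := H (fun x => f x - g x) (hf.sub hg) ((HS_sub_le (by norm_num) hf hg).trans (by linarith)) hs x hx
  rwa [iteratedDeriv_fun_sub (hf.contDiffAt.of_le (by exact_mod_cast hi.le)) 
    (hg.contDiffAt.of_le (by exact_mod_cast hi.le))] at this

theorem lsc_lower {m : ℕ} {f : ℝ → ℝ} (hf : ContDiff ℝ m f) {K : ℝ} {i : ℕ} (hi : i < m)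
    (H : ∀ d > 0, ∃ g : ℝ → ℝ, ContDiff ℝ m g ∧ HS 0 1 m g ≤ K ∧ (∫ x in (0:ℝ)..1, (f x - g x) ^ 2) ≤ d) :
    (∫ x in (0:ℝ)..1, iteratedDeriv i f x ^ 2) ≤ K := by
  have h01 : (0:ℝ) ≤ 1 := by norm_num
  have hKn : 0 ≤ K := by
    obtain ⟨g, _, h, _⟩ := H 1 one_pos
    exact (HS_nonneg h01).trans h
  rw [← Real.sqrt_le_sqrt_iff hKn]
  refine le_of_forall_pos_le_add fun η hη => ?_
  obtain ⟨d, hd, H2⟩ := lim_close hf K hi hη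
  obtain ⟨g, hg, hK, hs⟩ := H d hd
  have h1 := H2 g hg hK hs
  have bf := HS_iter_bi (a := 0) (b := 1) hf hi.le
  have bg := HS_iter_bi (a := 0) (b := 1) hg hi.le
  have tri := sqrt_int_add_le h01 bg (bf.sub bg)
  simp only [add_sub_cancel] at tri
  refine tri.trans (add_le_add (Real.sqrt_le_sqrt ((HS_term h01 hi.le).trans hK)) ?_)
  refine Real.sqrt_le_iff.2 ⟨hη.le, ?_⟩
  have := int_mono h01 (bf.sub bg).sq (BI.const (η ^ 2)) (fun x hx => 
        sq_le_sq' (abs_le.1 (h1 x hx)).1 (abs_le.1 (h1 x hx)).2)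
  rw [intervalIntegral.integral_const] at this
  simpa using this

theorem lsc_top {m : ℕ} (hm : 1 ≤ m) {f : ℝ → ℝ} (hf : ContDiff ℝ m f) {K : ℝ}
    (H : ∀ d > 0, ∃ g : ℝ → ℝ, ContDiff ℝ m g ∧ HS 0 1 m g ≤ K ∧ (∫ x in (0:ℝ)..1, (f x - g x) ^ 2) ≤ d) :
    (∫ x in (0:ℝ)..1, iteratedDeriv m f x ^ 2) ≤ K := by
  have h01 : (0:ℝ) ≤ 1 := by norm_num
  have hKn : 0 ≤ K := by
    obtain ⟨g, _, h, _⟩ := H 1 one_pos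
    exact (HS_nonneg h01).trans h
  set F := iteratedDeriv m f with hF
  have hFc : Continuous F := (contDiff_iter hf (i := 0) (by omega : m + 0 ≤ m)).continuous
  have bF : BI 0 1 F := BI.of_continuous hFc
  set N := Real.sqrt (∫ x in (0:ℝ)..1, F x ^ 2) with hN
  have hNn : 0 ≤ N := Real.sqrt_nonneg _
  have hN2 : N ^ 2 = ∫ x in (0:ℝ)..1, F x ^ 2 := Real.sq_sqrt (int_sq_nonneg h01)
  set S := Real.sqrt (2 * HS 0 1 m f + 2 * K) with hS
  have hSn : 0 ≤ S := Real.sqrt_nonneg _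
  -- key : N^2 ≤ N √K + η for all η
  have key : N ^ 2 ≤ N * Real.sqrt K := by
    refine le_of_forall_pos_le_add fun η hη => ?_
    obtain ⟨p, hp⟩ := exists_polynomial_near_of_continuousOn 0 1 F hFc.continuousOn (η / (2 * (S + 1))) (by positivity)
    have hpS : Sm (fun x => p.eval x) := by unfold Sm; exact mod_cast p.contDiff_aeval (𝕜 := ℝ) (⊤:ℕ∞)
    obtain ⟨C, hC⟩ : ∃ C, ∀ x ∈ Icc (0:ℝ) 1, |p.eval x| ≤ C ∧ |deriv (fun x => p.eval x) x| ≤ C := by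
      obtain ⟨C1, h1⟩ := isCompact_Icc.exists_bound_of_continuousOn (hpS.cont.continuousOn (s := Icc (0:ℝ) 1))
      obtain ⟨C2, h2⟩ := isCompact_Icc.exists_bound_of_continuousOn (hpS.deriv.cont.continuousOn (s := Icc (0:ℝ) 1))
      exact ⟨max C1 C2, fun x hx => ⟨(h1 x hx).trans (le_max_left _ _), (h2 x hx).trans (le_max_right _ _)⟩⟩
    have hCn : 0 ≤ C := (abs_nonneg _).trans (hC 0 (by simp)).1
    obtain ⟨d, hd, H2⟩ := lim_close hf K (by omega : m - 1 < m) (η := η / (2 * (3 * C + 1))) (by positivity)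
    obtain ⟨g, hg, hK, hs⟩ := H d hd
    have h1 := H2 g hg hK hs
    set h := fun x => f x - g x with hh
    have hhc : ContDiff ℝ m h := hf.sub hg
    have hhi : ∀ i ≤ m, ∀ x, iteratedDeriv i h x = iteratedDeriv i f x - iteratedDeriv i g x := fun i hi x =>
      iteratedDeriv_fun_sub (hf.contDiffAt.of_le (by exact_mod_cast hi)) (hg.contDiffAt.of_le (by exact_mod_cast hi))
    have h2 : ∀ x ∈ Icc (0:ℝ) 1, |iteratedDeriv (m - 1) h x| ≤ η / (2 * (3 * C + 1)) := fun x hx => by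
      rw [hhi _ (by omega)]; exact h1 x hx
    have bH := HS_iter_bi (a := 0) (b := 1) hhc le_rfl
    have bH1 := HS_iter_bi (a := 0) (b := 1) hhc (by omega : m - 1 ≤ m)
    have bG := HS_iter_bi (a := 0) (b := 1) hg le_rfl
    have hbp := PC.by_parts h01 (iter_pc hhc (by omega : m - 1 + 1 ≤ m)) (hpS.pc (a := 0) (b := 1))
    rw [← iteratedDeriv_succ, Nat.sub_add_cancel hm] at hbp
    set c := η / (2 * (3 * C + 1)) with hc
    have hcp : 0 < c := by positivity
    have e : ∀ x ∈ Icc (0:ℝ) 1, |iteratedDeriv (m - 1) h x * p.eval x| ≤ c * C := fun x hx => by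
      rw [abs_mul]; exact mul_le_mul (h2 x hx) (hC x hx).1 (abs_nonneg _) hcp.le
    have e' : |∫ x in (0:ℝ)..1, iteratedDeriv (m - 1) h x * deriv (fun x => p.eval x) x| ≤ c * C := by
      have := intervalIntegral.norm_integral_le_of_norm_le_const (a := 0) (b := 1) (C := c * C) 
        (f := fun x => iteratedDeriv (m - 1) h x * deriv (fun x => p.eval x) x) (fun x hx => by
          rw [uIoc_of_le h01] at hx
          have hx' : x ∈ Icc (0:ℝ) 1 := ⟨hx.1.le, hx.2⟩
          rw [norm_mul]
          exact mul_le_mul (h2 x hx') (hC x hx').2 (abs_nonneg _) hcp.le)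
      simpa using this
    have hfirst : |∫ x in (0:ℝ)..1, iteratedDeriv m h x * p.eval x| ≤ η / 2 := by
      rw [hbp]
      have e0 := abs_le.1 (e 0 (by simp))
      have e1 := abs_le.1 (e 1 (by simp))
      have e2 := abs_le.1 e'
      have : c * (3 * C) ≤ η / 2 := by
        rw [hc, div_mul_eq_mul_div, div_le_div_iff₀ (by positivity) (by norm_num)]
        nlinarith
      rw [abs_le]; constructor <;> linarith [e0.1, e0.2, e1.1, e1.2, e2.1, e2.2]
    -- second piece
    have hsec : |∫ x in (0:ℝ)..1, iteratedDeriv m h x * (F x - p.eval x)| ≤ η / 2 := by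
      refine (cauchy_schwarz h01 bH (bF.sub hpS.bi)).trans ?_
      have k1 : Real.sqrt (∫ x in (0:ℝ)..1, iteratedDeriv m h x ^ 2) ≤ S := 
        Real.sqrt_le_sqrt (((HS_term h01 le_rfl).trans (HS_sub_le h01 hf hg)).trans (by linarith))
      have k2 : Real.sqrt (∫ x in (0:ℝ)..1, (F x - p.eval x) ^ 2) ≤ η / (2 * (S + 1)) := by
        refine Real.sqrt_le_iff.2 ⟨by positivity, ?_⟩
        have := int_mono h01 (bF.sub hpS.bi).sq (BI.const ((η / (2 * (S + 1))) ^ 2)) (fun x hx => by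
          have := (hp x hx).le
          rw [abs_sub_comm] at this
          exact sq_le_sq' (abs_le.1 this).1 (abs_le.1 this).2)
        rw [intervalIntegral.integral_const] at this
        simpa using this
      refine (mul_le_mul k1 k2 (Real.sqrt_nonneg _) hSn).trans ?_
      rw [mul_div_assoc', div_le_div_iff₀ (by positivity) (by norm_num)]
      nlinarith
    have hthird : |∫ x in (0:ℝ)..1, F x * iteratedDeriv m g x| ≤ N * Real.sqrt K := by
      refine (cauchy_schwarz h01 bF bG).trans ?_
      exact mul_le_mul_of_nonneg_left (Real.sqrt_le_sqrt ((HS_term h01 le_rfl).trans hK)) hNn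
    have hsum : N ^ 2 = (∫ x in (0:ℝ)..1, F x * iteratedDeriv m g x) + ((∫ x in (0:ℝ)..1, iteratedDeriv m h x * p.eval x)
       + ∫ x in (0:ℝ)..1, iteratedDeriv m h x * (F x - p.eval x)) := by
      rw [hN2, ← int_add h01 (bH.mul hpS.bi) (bH.mul (bF.sub hpS.bi)), ← int_add h01 (bF.mul bG) 
        ((bH.mul hpS.bi).add (bH.mul (bF.sub hpS.bi)))]
      refine intervalIntegral.integral_congr fun x _ => ?_
      simp only [hhi m le_rfl, ← hF]; ring
    linarith [(abs_le.1 hfirst).2, (abs_le.1 hsec).2, (abs_le.1 hthird).2]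
  rw [← hN2]
  have hsk := Real.sqrt_nonneg K
  have hNK : N ≤ Real.sqrt K := by
    by_contra hcon
    push Not at hcon
    nlinarith
  calc N ^ 2 ≤ Real.sqrt K ^ 2 := by gcongr
    _ = K := Real.sq_sqrt hKn

theorem lsc_HS {m : ℕ} (hm : 1 ≤ m) {f : ℝ → ℝ} (hf : ContDiff ℝ m f) {K : ℝ}
    (H : ∀ d > 0, ∃ g : ℝ → ℝ, ContDiff ℝ m g ∧ HS 0 1 m g ≤ K ∧ (∫ x in (0:ℝ)..1, (f x - g x) ^ 2) ≤ d) :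
    HS 0 1 m f ≤ (m + 1) * K := by
  unfold HS
  calc _ ≤ ∑ j ∈ Finset.range (m + 1), K := by
        refine Finset.sum_le_sum fun j hj => ?_
        rcases Nat.lt_or_ge j m with h | h
        · exact lsc_lower hf h H
        · have : j = m := by simp at hj; omega
          subst this
          exact lsc_top hm hf H
    _ = _ := by simp
end limit

theorem prim_hasDeriv {G : ℝ → ℝ} (hG : Continuous G) (c x : ℝ) :
    HasDerivAt (fun x => c + ∫ y in (0:ℝ)..x, G y) (G x) x := by
  simpa using (intervalIntegral.integral_hasDerivAt_right (hG.intervalIntegrable _ _)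
    (hG.stronglyMeasurableAtFilter _ _) hG.continuousAt).const_add c

theorem prim_contDiff {n : ℕ} {G : ℝ → ℝ} (hG : ContDiff ℝ n G) (c : ℝ) :
    ContDiff ℝ (n + 1 : ℕ) (fun x => c + ∫ y in (0:ℝ)..x, G y) := by
  have hd := prim_hasDeriv hG.continuous c
  have : ((n + 1 : ℕ) : WithTop ℕ∞) = (n : WithTop ℕ∞) + 1 := by push_cast; rfl
  rw [this, contDiff_succ_iff_deriv]
  refine ⟨fun x => (hd x).differentiableAt, by simp, ?_⟩
  rwa [show deriv (fun x => c + ∫ y in (0:ℝ)..x, G y) = G from funext fun x => (hd x).deriv]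

theorem ext_contDiff (r : ℕ) : ∀ f : ℝ → ℝ, ContDiffOn ℝ r f (Icc (0:ℝ) 1) →
    ∃ g : ℝ → ℝ, ContDiff ℝ r g ∧ ∀ x ∈ Icc (0:ℝ) 1, g x = f x := by
  induction r with
  | zero =>
    intro f hf
    have hc : ContinuousOn f (Icc (0:ℝ) 1) := by
      have := hf.continuousOn; exact this
    refine ⟨IccExtend (zero_le_one) ((Icc (0:ℝ) 1).domRestrict f), ?_, fun x hx => ?_⟩
    · have : Continuous (IccExtend (zero_le_one' ℝ) ((Icc (0:ℝ) 1).domRestrict f)) :=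
        Continuous.Icc_extend' (continuousOn_iff_continuous_domRestrict.1 hc)
      exact_mod_cast contDiff_zero.2 this
    · rw [IccExtend_of_mem _ _ hx]; rfl
  | succ n ih =>
    intro f hf
    have e : ((n + 1 : ℕ) : WithTop ℕ∞) = (n : WithTop ℕ∞) + 1 := by push_cast; rfl
    rw [e, contDiffOn_succ_iff_derivWithin (uniqueDiffOn_Icc_zero_one)] at hf
    obtain ⟨G, hG, hGe⟩ := ih _ hf.2.2
    refine ⟨_, prim_contDiff hG (f 0), fun x hx => ?_⟩
    have := intervalIntegral.integral_eq_sub_of_hasDerivAt_of_le hx.1 (f := f) (f' := G)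
      (hf.1.continuousOn.mono (Icc_subset_Icc_right hx.2)) (fun y hy => by
        have hy' : y ∈ Icc (0:ℝ) 1 := ⟨hy.1.le, hy.2.le.trans hx.2⟩
        rw [hGe y hy']
        exact ((hf.1 y hy').hasDerivWithinAt).hasDerivAt (Icc_mem_nhds hy.1 (hy.2.trans_le hx.2)))
      (hG.continuous.intervalIntegrable _ _)
    rw [this]; ring

theorem poin {w : ℝ → ℝ} (hw : Continuous w) (c : ℝ) {x : ℝ} (hx : x ∈ Icc (-1:ℝ) 2) :
    (c + ∫ y in (0:ℝ)..x, w y) ^ 2 ≤ 2 * c ^ 2 + 4 * ∫ y in (-1:ℝ)..2, w y ^ 2 := by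
  have hI : 0 ≤ ∫ y in (-1:ℝ)..2, w y ^ 2 := int_sq_nonneg (by norm_num)
  have sub : ∀ a b : ℝ, -1 ≤ a → a ≤ b → b ≤ 2 → (∫ y in a..b, w y ^ 2) ≤ ∫ y in (-1:ℝ)..2, w y ^ 2 := by
    intro a b ha hab hb
    exact intervalIntegral.integral_mono_interval ha hab hb (Filter.Eventually.of_forall fun _ => sq_nonneg _)
      ((hw.pow 2).intervalIntegrable _ _)
  have key : ∀ a b : ℝ, -1 ≤ a → a ≤ b → b ≤ 2 → b - a ≤ 2 → (∫ y in a..b, w y) ^ 2 ≤ 2 * ∫ y in (-1:ℝ)..2, w y ^ 2 := by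
    intro a b ha hab hb h2
    have := cauchy_schwarz_sq hab (BI.const (a := a) (b := b) (1:ℝ)) (BI.of_continuous hw)
    simp only [one_mul, one_pow] at this
    rw [intervalIntegral.integral_const] at this
    simp only [smul_eq_mul, mul_one] at this
    refine this.trans ?_
    exact mul_le_mul h2 (sub a b ha hab hb) (int_sq_nonneg hab) (by norm_num)
  have : (∫ y in (0:ℝ)..x, w y) ^ 2 ≤ 2 * ∫ y in (-1:ℝ)..2, w y ^ 2 := by
    rcases le_total 0 x with h | h
    · exact key 0 x (by norm_num) h hx.2 (by linarith [hx.2])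
    · rw [intervalIntegral.integral_symm, neg_sq]
      exact key x 0 hx.1 h (by norm_num) (by linarith [hx.1])
  nlinarith [sq_nonneg (c - ∫ y in (0:ℝ)..x, w y)]

/-- cutoff -/
def cutf (ε x : ℝ) : ℝ := Real.smoothTransition (1 + x / ε) * Real.smoothTransition (1 + (1 - x) / ε)

theorem cutf_sm (ε : ℝ) : Sm (cutf ε) := by
  unfold Sm cutf
  have h1 : ContDiff ℝ (⊤:ℕ∞) (fun x : ℝ => 1 + x / ε) := contDiff_const.add (contDiff_id.div_const _)
  have h2 : ContDiff ℝ (⊤:ℕ∞) (fun x : ℝ => 1 + (1 - x) / ε) :=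
    contDiff_const.add ((contDiff_const.sub contDiff_id).div_const _)
  exact (Real.smoothTransition.contDiff.comp h1).mul (Real.smoothTransition.contDiff.comp h2)

theorem cutf_one {ε x : ℝ} (hε : 0 < ε) (hx : x ∈ Icc (0:ℝ) 1) : cutf ε x = 1 := by
  unfold cutf
  rw [Real.smoothTransition.one_of_one_le, Real.smoothTransition.one_of_one_le, mul_one]
  · have : 0 ≤ (1 - x) / ε := div_nonneg (by linarith [hx.2]) hε.le
    linarith
  · have : 0 ≤ x / ε := div_nonneg hx.1 hε.le
    linarith

theorem cutf_left {ε x : ℝ} (hε : 0 < ε) (hx : x ≤ -ε) : cutf ε x = 0 := by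
  unfold cutf
  rw [Real.smoothTransition.zero_of_nonpos, zero_mul]
  have : x / ε ≤ -1 := by rw [div_le_iff₀ hε]; linarith
  linarith

theorem cutf_right {ε x : ℝ} (hε : 0 < ε) (hx : 1 + ε ≤ x) : cutf ε x = 0 := by
  unfold cutf
  rw [mul_comm, Real.smoothTransition.zero_of_nonpos, zero_mul]
  have : (1 - x) / ε ≤ -1 := by rw [div_le_iff₀ hε]; linarith
  linarith

theorem cutf_mem (ε x : ℝ) : 0 ≤ cutf ε x ∧ cutf ε x ≤ 1 :=
  ⟨mul_nonneg (Real.smoothTransition.nonneg _) (Real.smoothTransition.nonneg _),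
   mul_le_one₀ (Real.smoothTransition.le_one _) (Real.smoothTransition.nonneg _) (Real.smoothTransition.le_one _)⟩

theorem cut_small {F : ℝ → ℝ} (hF : Continuous F) : ∃ ε > 0,
    (∫ y in (-1:ℝ)..2, (cutf ε y * F y) ^ 2) ≤ (∫ y in (0:ℝ)..1, F y ^ 2) + 1 := by
  obtain ⟨G, hG⟩ := isCompact_Icc.exists_bound_of_continuousOn (hF.continuousOn (s := Icc (-1:ℝ) 2))
  have hGn : 0 ≤ G := (norm_nonneg _).trans (hG 0 (by norm_num))
  set ε := 1 / (2 * (G ^ 2 + 1)) with hε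
  have hp : 0 < ε := by positivity
  have hle : ε ≤ 1 / 2 := by
    rw [hε]; apply one_div_le_one_div_of_le (by norm_num); nlinarith [sq_nonneg G]
  have hεG : 2 * ε * G ^ 2 ≤ 1 := by
    rw [hε]; field_simp; nlinarith
  have hc : Continuous fun y => (cutf ε y * F y) ^ 2 := ((cutf_sm ε).cont.mul hF).pow 2
  have ii : ∀ a b, IntervalIntegrable (fun y => (cutf ε y * F y) ^ 2) volume a b := fun a b => hc.intervalIntegrable a b
  refine ⟨ε, hp, ?_⟩
  rw [← intervalIntegral.integral_add_adjacent_intervals (ii (-1) (-ε)) (ii _ _),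
    ← intervalIntegral.integral_add_adjacent_intervals (ii (-ε) 0) (ii _ _),
    ← intervalIntegral.integral_add_adjacent_intervals (ii 0 1) (ii _ _),
    ← intervalIntegral.integral_add_adjacent_intervals (ii 1 (1 + ε)) (ii _ _)]
  have e1 : (∫ y in (-1:ℝ)..(-ε), (cutf ε y * F y) ^ 2) = 0 := by
    rw [intervalIntegral.integral_congr (g := fun _ => (0:ℝ)) (fun y hy => by
      rw [uIcc_of_le (by linarith)] at hy
      simp [cutf_left hp hy.2])]; simp
  have e5 : (∫ y in (1 + ε)..(2:ℝ), (cutf ε y * F y) ^ 2) = 0 := by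
    rw [intervalIntegral.integral_congr (g := fun _ => (0:ℝ)) (fun y hy => by
      rw [uIcc_of_le (by linarith)] at hy
      simp [cutf_right hp hy.1])]; simp
  have e3 : (∫ y in (0:ℝ)..1, (cutf ε y * F y) ^ 2) = ∫ y in (0:ℝ)..1, F y ^ 2 := by
    refine intervalIntegral.integral_congr fun y hy => ?_
    rw [uIcc_of_le (by linarith)] at hy
    simp [cutf_one hp hy]
  have pt : ∀ y ∈ Icc (-1:ℝ) 2, (cutf ε y * F y) ^ 2 ≤ G ^ 2 := by
    intro y hy
    have h1 := cutf_mem ε y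
    have h2 := hG y hy
    rw [← sq_abs, abs_mul]
    refine pow_le_pow_left₀ (by positivity) ?_ 2
    rw [abs_of_nonneg h1.1]
    exact (mul_le_of_le_one_left (abs_nonneg _) h1.2).trans h2
  have seg : ∀ a, -1 ≤ a → a + ε ≤ 2 → (∫ y in a..(a + ε), (cutf ε y * F y) ^ 2) ≤ ε * G ^ 2 := by
    intro a h1 h2
    have := int_mono (by linarith : a ≤ a + ε) (BI.of_continuous hc) (BI.const (G ^ 2)) (fun x hx => 
      pt x ⟨h1.trans hx.1, hx.2.trans h2⟩)
    rw [intervalIntegral.integral_const] at this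
    simpa using this
  have e2 := seg (-ε) (by linarith) (by linarith)
  rw [neg_add_cancel] at e2
  have e4 := seg 1 (by linarith) (by linarith)
  rw [e1, e3, e5]; linarith

theorem sq3 (a b c : ℝ) : (a + b + c) ^ 2 ≤ 3 * (a ^ 2 + b ^ 2 + c ^ 2) := by
  nlinarith [sq_nonneg (a - b), sq_nonneg (b - c), sq_nonneg (a - c)]

theorem data_ext : ∃ C : ℝ, 0 ≤ C ∧ ∀ (r : ℕ) (f : ℝ → ℝ), 2 ≤ r → ContDiff ℝ r f → ∃ W : ℝ → ℝ, ContDiff ℝ r W ∧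
    (∀ x ∈ Icc (0:ℝ) 1, W x = f x) ∧ (∀ x ≤ -(1/2), W x = 0) ∧ (∀ x ≥ 1 + 1/2, W x = 0) ∧
    HS (-1) 2 2 W ≤ C * (HS 0 1 2 f + 1) := by
  set χ := cutf (1/2) with hχ
  have hS : Sm χ := cutf_sm _
  obtain ⟨c, hc0, hc⟩ : ∃ c, 0 ≤ c ∧ ∀ x ∈ Icc (-1:ℝ) 2, χ x ^ 2 ≤ c ∧ deriv χ x ^ 2 ≤ c ∧ deriv (deriv χ) x ^ 2 ≤ c := by
    have cc : Continuous fun x => χ x ^ 2 + deriv χ x ^ 2 + deriv (deriv χ) x ^ 2 :=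
      ((hS.cont.pow 2).add (hS.deriv.cont.pow 2)).add (hS.deriv.deriv.cont.pow 2)
    obtain ⟨c, h⟩ := isCompact_Icc.exists_bound_of_continuousOn (cc.continuousOn (s := Icc (-1:ℝ) 2))
    refine ⟨c, (norm_nonneg _).trans (h 0 (by norm_num)), fun x hx => ?_⟩
    have := (le_abs_self _).trans (h x hx)
    refine ⟨?_, ?_, ?_⟩ <;> nlinarith [sq_nonneg (χ x), sq_nonneg (deriv χ x), sq_nonneg (deriv (deriv χ) x)]
  refine ⟨3000 * c, by positivity, fun r f hr hf => ?_⟩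
  have hF : ContDiff ℝ (r - 2 : ℕ) (deriv (deriv f)) := by
    have := contDiff_iter hf (j := 2) (i := r - 2) (by omega)
    rwa [iteratedDeriv_succ, iteratedDeriv_one] at this
  obtain ⟨ε, hε, hcut⟩ := cut_small hF.continuous
  set ψ := fun y => cutf ε y * deriv (deriv f) y with hψ
  have ψc : ContDiff ℝ (r - 2 : ℕ) ψ := ((cutf_sm ε).cd _).mul hF
  set V := fun x => deriv f 0 + ∫ y in (0:ℝ)..x, ψ y with hV
  have Vc := prim_contDiff ψc (deriv f 0)
  set W0 := fun x => f 0 + ∫ y in (0:ℝ)..x, V y with hW0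
  have W0c : ContDiff ℝ r W0 := by
    have := prim_contDiff Vc (f 0)
    rwa [show r - 2 + 1 + 1 = r by omega] at this
  have dV : ∀ x, HasDerivAt V (ψ x) x := prim_hasDeriv ψc.continuous _
  have dW : ∀ x, HasDerivAt W0 (V x) x := prim_hasDeriv Vc.continuous _
  have hf2 : ContDiff ℝ 2 f := hf.of_le (by exact_mod_cast hr)
  have hf1 : ContDiff ℝ 1 (deriv f) := by
    have := contDiff_iter hf (j := 1) (i := 1) (by omega)
    rwa [iteratedDeriv_one] at this
  have hVe : ∀ x ∈ Icc (0:ℝ) 1, V x = deriv f x := by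
    intro x hx
    have : (∫ y in (0:ℝ)..x, ψ y) = ∫ y in (0:ℝ)..x, deriv (deriv f) y := by
      refine intervalIntegral.integral_congr fun y hy => ?_
      rw [uIcc_of_le hx.1] at hy
      simp only [hψ]
      rw [cutf_one hε ⟨hy.1, hy.2.trans hx.2⟩, one_mul]
    simp only [hV]
    rw [this, intervalIntegral.integral_deriv_eq_sub (fun y _ => (hf1.differentiable (by simp)) y)
      (hF.continuous.intervalIntegrable _ _)]
    ring
  have hWe : ∀ x ∈ Icc (0:ℝ) 1, W0 x = f x := by
    intro x hx
    have : (∫ y in (0:ℝ)..x, V y) = ∫ y in (0:ℝ)..x, deriv f y := by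
      refine intervalIntegral.integral_congr fun y hy => ?_
      rw [uIcc_of_le hx.1] at hy
      exact hVe y ⟨hy.1, hy.2.trans hx.2⟩
    simp only [hW0]
    rw [this, intervalIntegral.integral_deriv_eq_sub (fun y _ => (hf2.differentiable (by simp)) y)
      (hf1.continuous.intervalIntegrable _ _)]
    ring
  set E := HS 0 1 2 f + 1 with hE
  have hHn : 0 ≤ HS 0 1 2 f := HS_nonneg (by norm_num)
  have hE0 : 0 ≤ E := by linarith
  have iψ : (∫ y in (-1:ℝ)..2, ψ y ^ 2) ≤ E := by
    refine hcut.trans ?_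
    have := HS_term (f := f) (m := 2) (by norm_num : (0:ℝ) ≤ 1) (le_refl 2)
    rw [iteratedDeriv_succ, iteratedDeriv_one] at this
    linarith
  have s0 : f 0 ^ 2 ≤ 2 * E := by
    have := HS_sup (by norm_num : (1:ℝ) ≤ 1 - 0) (j := 0) (m := 2) (by exact_mod_cast hf2) (by norm_num) (x := 0) (by simp)
    rw [iteratedDeriv_zero] at this; linarith
  have s1 : deriv f 0 ^ 2 ≤ 2 * E := by
    have := HS_sup (by norm_num : (1:ℝ) ≤ 1 - 0) (j := 1) (m := 2) (by exact_mod_cast hf2) (by norm_num) (x := 0) (by simp)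
    rw [iteratedDeriv_one] at this; linarith
  have pV : ∀ x ∈ Icc (-1:ℝ) 2, V x ^ 2 ≤ 8 * E := fun x hx => by
    have := poin ψc.continuous (deriv f 0) hx
    simp only [hV]; linarith
  have h12 : (-1:ℝ) ≤ 2 := by norm_num
  have iV : (∫ y in (-1:ℝ)..2, V y ^ 2) ≤ 24 * E := by
    have := int_mono h12 (BI.of_continuous Vc.continuous).sq (BI.const (8 * E)) pV
    rw [intervalIntegral.integral_const, smul_eq_mul] at this
    linarith
  have pW : ∀ x ∈ Icc (-1:ℝ) 2, W0 x ^ 2 ≤ 100 * E := fun x hx => by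
    have := poin Vc.continuous (f 0) hx
    simp only [hW0]; linarith
  have dχ : ∀ x, HasDerivAt χ (deriv χ x) x := fun x => (hS.diff x).hasDerivAt
  have dχ' : ∀ x, HasDerivAt (deriv χ) (deriv (deriv χ) x) x := fun x => (hS.deriv.diff x).hasDerivAt
  have D1 : deriv (fun x => χ x * W0 x) = fun x => deriv χ x * W0 x + χ x * V x :=
    funext fun x => ((dχ x).mul (dW x)).deriv
  have D2 : deriv (fun x => deriv χ x * W0 x + χ x * V x) = fun x => deriv (deriv χ) x * W0 x + 2 * (deriv χ x * V x) + χ x * ψ x :=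
    funext fun x => by
      refine ((((dχ' x).mul (dW x)).add ((dχ x).mul (dV x))).congr_deriv ?_).deriv
      ring
  refine ⟨fun x => χ x * W0 x, (hS.cd _).mul W0c, fun x hx => ?_, fun x hx => ?_, fun x hx => ?_, ?_⟩
  · show χ x * W0 x = f x
    rw [hχ, cutf_one (by norm_num) hx, one_mul, hWe x hx]
  · show χ x * W0 x = 0
    rw [hχ, cutf_left (by norm_num) hx, zero_mul]
  · show χ x * W0 x = 0
    rw [hχ, cutf_right (by norm_num) hx, zero_mul]
  · unfold HS
    rw [Finset.sum_range_succ, Finset.sum_range_succ, Finset.sum_range_one, iteratedDeriv_zero, iteratedDeriv_one, iteratedDeriv_succ,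
      iteratedDeriv_one, D1, D2]
    have bχ : BI (-1) 2 χ := BI.of_continuous hS.cont
    have bχ1 : BI (-1) 2 (deriv χ) := BI.of_continuous hS.deriv.cont
    have bχ2 : BI (-1) 2 (deriv (deriv χ)) := BI.of_continuous hS.deriv.deriv.cont
    have bW : BI (-1) 2 W0 := BI.of_continuous W0c.continuous
    have bV : BI (-1) 2 V := BI.of_continuous Vc.continuous
    have bψ : BI (-1) 2 ψ := BI.of_continuous ψc.continuous
    have pr : ∀ a b A B : ℝ, 0 ≤ A → a ^ 2 ≤ A → b ^ 2 ≤ B → (a * b) ^ 2 ≤ A * B := fun a b A B hA ha hb => by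
      rw [mul_pow]; exact mul_le_mul ha hb (sq_nonneg _) hA
    have i0 := int_mono h12 (bχ.mul bW).sq (BI.const (c * (100 * E))) (fun x hx => pr _ _ _ _ hc0 (hc x hx).1 (pW x hx))
    have i1 := int_mono h12 ((bχ1.mul bW).add (bχ.mul bV)).sq (BI.const (2 * (c * (100 * E)) + 2 * (c * (8 * E)))) (fun x hx => by
      have h1 := pr _ _ _ _ hc0 (hc x hx).2.1 (pW x hx)
      have h2 := pr _ _ _ _ hc0 (hc x hx).1 (pV x hx)
      nlinarith [sq_nonneg (deriv χ x * W0 x - χ x * V x)])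
    have i2 := int_mono h12 (((bχ2.mul bW).add ((bχ1.mul bV).const_mul 2)).add (bχ.mul bψ)).sq 
      ((BI.const (3 * (c * (100 * E)) + 12 * (c * (8 * E)))).add (bψ.sq.const_mul (3 * c))) (fun x hx => by
      have h1 := pr _ _ _ _ hc0 (hc x hx).2.2 (pW x hx)
      have h2 := pr _ _ _ _ hc0 (hc x hx).2.1 (pV x hx)
      have h3 := pr _ _ _ _ hc0 (hc x hx).1 (le_refl (ψ x ^ 2))
      refine (sq3 _ _ _).trans ?_
      rw [mul_pow 2 (deriv χ x * V x)]
      linarith)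
    rw [int_add h12 (BI.const _) (bψ.sq.const_mul _), intervalIntegral.integral_const_mul] at i2
    simp only [intervalIntegral.integral_const, smul_eq_mul] at i0 i1 i2
    have := mul_le_mul_of_nonneg_left iψ hc0
    have := mul_nonneg hc0 hE0
    nlinarith

theorem iter_eq_of_eqOn {r i : ℕ} (hi : i ≤ r) {f g : ℝ → ℝ} (hf : ContDiff ℝ r f) (hg : ContDiff ℝ r g) 
    (h : ∀ x ∈ Icc (0:ℝ) 1, f x = g x) : ∀ x ∈ Icc (0:ℝ) 1, iteratedDeriv i f x = iteratedDeriv i g x := by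
  have cf : Continuous (iteratedDeriv i f) := (contDiff_iter hf (i := 0) (by omega)).continuous
  have cg : Continuous (iteratedDeriv i g) := (contDiff_iter hg (i := 0) (by omega)).continuous
  have h1 : EqOn (iteratedDeriv i f) (iteratedDeriv i g) (Ioo (0:ℝ) 1) := fun x hx => by
    apply Filter.EventuallyEq.iteratedDeriv_eq
    filter_upwards [Ioo_mem_nhds hx.1 hx.2] with y hy using h y ⟨hy.1.le, hy.2.le⟩
  have h2 := h1.closure cf cg
  rw [closure_Ioo (by norm_num)] at h2
  exact h2

theorem HS_congr01 {m : ℕ} {f g : ℝ → ℝ} (hf : ContDiff ℝ m f) (hg : ContDiff ℝ m g) 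
    (h : ∀ x ∈ Icc (0:ℝ) 1, f x = g x) : HS 0 1 m f = HS 0 1 m g := by
  refine Finset.sum_congr rfl fun j hj => intervalIntegral.integral_congr fun x hx => ?_
  rw [uIcc_of_le (by norm_num)] at hx
  show _ ^ 2 = _ ^ 2
  rw [iter_eq_of_eqOn (by have := Finset.mem_range.1 hj; omega) hf hg h x hx]

theorem HS_sub_interval {a b c d : ℝ} {m : ℕ} {f : ℝ → ℝ} (hf : ContDiff ℝ m f) (h1 : c ≤ a) (h2 : a ≤ b) (h3 : b ≤ d) :
    HS a b m f ≤ HS c d m f := by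
  refine Finset.sum_le_sum fun j hj => ?_
  have : Continuous (iteratedDeriv j f) := 
    (contDiff_iter hf (i := 0) (by have := Finset.mem_range.1 hj; omega)).continuous
  exact intervalIntegral.integral_mono_interval h1 h2 h3 (Filter.Eventually.of_forall fun _ => sq_nonneg _)
      ((this.pow 2).intervalIntegrable _ _)

/-- parity below order `m` at `e` -/
def Nend (m : ℕ) (e : ℝ) (z u : ℝ → ℝ) : Prop :=
  ∀ i < m, ((-1:ℝ) ^ i * 1 = -1 → iteratedDeriv i z e = 0) ∧ ((-1:ℝ) ^ i * (-1) = -1 → iteratedDeriv i u e = 0)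

/-- end condition -/
def Pend (m : ℕ) (e : ℝ) (z u : ℝ → ℝ) : Prop := z e = 0 ∨ Nend m e z u

theorem iter_zero_of_eventually {f : ℝ → ℝ} {x : ℝ} (i : ℕ) (h : f =ᶠ[nhds x] fun _ => 0) : iteratedDeriv i f x = 0 := by
  rw [h.iteratedDeriv_eq]; simp

/-- approximations on one time slab -/
theorem approx_seq {T : ℝ} {r m : ℕ} {Z U Z1 U1 : ℝ → ℝ → ℝ} (hS : Sol T r Z U Z1 U1) (hT : 0 ≤ T) (hm : 2 ≤ m) (hmr : m ≤ r)
    {α β : ℝ} (hα : (α = 0 ∧ Nend m 0 (Z 0) (U 0)) ∨ (α = -1 ∧ Z 0 0 = 0))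
    (hβ : (β = 1 ∧ Nend m 1 (Z 0) (U 0)) ∨ (β = 2 ∧ Z 0 1 = 0)) {C0 M : ℝ}
    (hC0 : ∀ (r : ℕ) (f : ℝ → ℝ), 2 ≤ r → ContDiff ℝ r f → ∃ W : ℝ → ℝ, ContDiff ℝ r W ∧
      (∀ x ∈ Icc (0:ℝ) 1, W x = f x) ∧ (∀ x ≤ -(1/2), W x = 0) ∧ (∀ x ≥ 1 + 1/2, W x = 0) ∧
      HS (-1) 2 2 W ≤ C0 * (HS 0 1 2 f + 1))
    (hC : 0 ≤ C0) (hM : HS 0 1 2 (Z 0) + HS 0 1 2 (U 0) ≤ M) :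
    ∃ K X : ℝ, 0 ≤ X ∧ ∀ ε > 0, ε ≤ 1 → ∃ A B : ℝ → ℝ → ℝ, ∀ t ∈ Icc (0:ℝ) (min (dlt (C0 * (M + 2))) T),
      Sm (A t) ∧ Sm (B t) ∧ HS 0 1 m (A t) + HS 0 1 m (B t) ≤ K ∧ 
      (∫ x in (0:ℝ)..1, (Z t x - A t x) ^ 2) ≤ ε * X ∧ (∫ x in (0:ℝ)..1, (U t x - B t x) ^ 2) ≤ ε * X ∧
      (α = 0 → Nend m 0 (A t) (B t)) ∧ (α = -1 → |A t 0| ≤ ε * X) ∧ 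
      (β = 1 → Nend m 1 (A t) (B t)) ∧ (β = 2 → |A t 1| ≤ ε * X) := by
  have h00 : (0:ℝ) ∈ Icc (0:ℝ) T := ⟨le_rfl, hT⟩
  have cz0 : ContDiff ℝ m (Z 0) := (hS.cz 0 h00).of_le (by exact_mod_cast hmr)
  have cu0 : ContDiff ℝ m (U 0) := (hS.cu 0 h00).of_le (by exact_mod_cast hmr)
  obtain ⟨Wz, wz, ez, lz, rz, bz⟩ := hC0 m (Z 0) hm cz0
  obtain ⟨Wu, wu, eu, lu, ru, bu⟩ := hC0 m (U 0) hm cu0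
  have hα0 : α ≤ 0 := by rcases hα with h | h <;> linarith [h.1]
  have hα1 : -1 ≤ α := by rcases hα with h | h <;> linarith [h.1]
  have hβ0 : 1 ≤ β := by rcases hβ with h | h <;> linarith [h.1]
  have hβ1 : β ≤ 2 := by rcases hβ with h | h <;> linarith [h.1]
  have hab : 1 ≤ β - α := by linarith
  have h2m : ContDiff ℝ (2:ℕ) Wz := wz.of_le (by exact_mod_cast hm)
  have h2m' : ContDiff ℝ (2:ℕ) Wu := wu.of_le (by exact_mod_cast hm)
  have hMW : HS α β 2 Wz + HS α β 2 Wu ≤ C0 * (M + 2) := by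
    have h1 := (HS_sub_interval h2m hα1 (by linarith) hβ1).trans bz
    have h2 := (HS_sub_interval h2m' hα1 (by linarith) hβ1).trans bu
    nlinarith
  have leftz : ∀ i, iteratedDeriv i Wz (-1) = 0 := fun i => iter_zero_of_eventually i (by
    filter_upwards [Iio_mem_nhds (by norm_num : (-1:ℝ) < -(1/2))] with y hy using lz y (le_of_lt hy))
  have leftu : ∀ i, iteratedDeriv i Wu (-1) = 0 := fun i => iter_zero_of_eventually i (by
    filter_upwards [Iio_mem_nhds (by norm_num : (-1:ℝ) < -(1/2))] with y hy using lu y (le_of_lt hy))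
  have rightz : ∀ i, iteratedDeriv i Wz 2 = 0 := fun i => iter_zero_of_eventually i (by
    filter_upwards [Ioi_mem_nhds (by norm_num : (1:ℝ) + 1/2 < 2)] with y hy using rz y (le_of_lt hy))
  have rightu : ∀ i, iteratedDeriv i Wu 2 = 0 := fun i => iter_zero_of_eventually i (by
    filter_upwards [Ioi_mem_nhds (by norm_num : (1:ℝ) + 1/2 < 2)] with y hy using ru y (le_of_lt hy))
  have bpz : BPar α β 1 m Wz := by
    intro i hi hs
    constructor
    · rcases hα with ⟨rfl, h⟩ | ⟨rfl, h⟩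
      · rw [iter_eq_of_eqOn hi.le wz cz0 ez 0 (by simp)]; exact (h i hi).1 hs
      · exact leftz i
    · rcases hβ with ⟨rfl, h⟩ | ⟨rfl, h⟩
      · rw [iter_eq_of_eqOn hi.le wz cz0 ez 1 (by simp)]; exact (h i hi).1 hs
      · exact rightz i
  have bpu : BPar α β (-1) m Wu := by
    intro i hi hs
    constructor
    · rcases hα with ⟨rfl, h⟩ | ⟨rfl, h⟩
      · rw [iter_eq_of_eqOn hi.le wu cu0 eu 0 (by simp)]; exact (h i hi).2 hs
      · exact leftu i
    · rcases hβ with ⟨rfl, h⟩ | ⟨rfl, h⟩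
      · rw [iter_eq_of_eqOn hi.le wu cu0 eu 1 (by simp)]; exact (h i hi).2 hs
      · exact rightu i
  obtain ⟨K, hK⟩ := thmG hab hMW hm wz wu bpz bpu
  set δ := dlt (C0 * (M + 2)) with hδ
  set τ := min δ T with hτ
  have hMn : 0 ≤ M := le_trans (add_nonneg (HS_nonneg (by norm_num)) (HS_nonneg (by norm_num))) hM
  have hδp : 0 < δ := dlt_pos (by positivity)
  have hτ0 : 0 ≤ τ := le_min hδp.le hT
  obtain ⟨Q, hQ⟩ : ∃ Q, ∀ t ∈ Icc (0:ℝ) T, |Z t 0| ≤ Q ∧ |Z t 1| ≤ Q := by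
    obtain ⟨Q, h⟩ := (isCompact_Icc.prod isCompact_Icc).exists_bound_of_continuousOn hS.jz
    exact ⟨Q, fun t ht => ⟨h (t, 0) ⟨ht, by simp⟩, h (t, 1) ⟨ht, by simp⟩⟩⟩
  set L := Real.sqrt (2 * K) with hL
  set κ1 := Real.sqrt ((2 + 2 * δ) * Real.exp ((4 * L + 1) * δ)) with hκ1
  have hκn1 : 0 ≤ κ1 := Real.sqrt_nonneg _
  have hLn : 0 ≤ L := Real.sqrt_nonneg _
  set X0 := (1 + (1 + 2 * (κ1 * (Q + L) ^ 2)) * δ) * Real.exp ((2 * L + 1) * δ) with hX0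
  have hX0n : 0 ≤ X0 := by positivity
  refine ⟨K, 2 * X0 + κ1, by positivity, fun ε hε hε1 => ?_⟩
  obtain ⟨A, B, A1, B1, h⟩ := hK ε hε
  have tδ : ∀ {t}, t ∈ Icc (0:ℝ) τ → t ∈ Icc (0:ℝ) δ := fun ht => ⟨ht.1, ht.2.trans (min_le_left _ _)⟩
  have tT : ∀ {t}, t ∈ Icc (0:ℝ) τ → t ∈ Icc (0:ℝ) T := fun ht => ⟨ht.1, ht.2.trans (min_le_right _ _)⟩
  have small : ∀ e ∈ Icc (0:ℝ) 1, Z 0 e = 0 → U 0 e = 0 → ∀ t ∈ Icc (0:ℝ) τ, |A t e| ≤ ε * κ1 ∧ |B t e| ≤ ε * κ1 := by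
    intro e he hz hu t ht
    have hs := h.endSmall hε.le hab hm (x := e) ⟨hα0.trans he.1, he.2.trans hβ0⟩ ((ez e he).trans hz) ((eu e he).trans hu) t (tδ ht)
    have : A t e ^ 2 + B t e ^ 2 ≤ (ε * κ1) ^ 2 := by
      refine hs.trans ?_
      rw [mul_pow, hκ1, Real.sq_sqrt (by positivity)]
      have e1 : Real.exp ((4 * L + 1) * t) ≤ Real.exp ((4 * L + 1) * δ) := 
        Real.exp_le_exp.2 (mul_le_mul_of_nonneg_left (tδ ht).2 (by positivity))
      have e2 : 2 * ε ^ 2 + 2 * ε ^ 2 * t ≤ ε ^ 2 * (2 + 2 * δ) := by nlinarith [(tδ ht).2, sq_nonneg ε]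
      calc _ ≤ ε ^ 2 * (2 + 2 * δ) * Real.exp ((4 * L + 1) * δ) := 
            mul_le_mul e2 e1 (Real.exp_pos _).le (by positivity)
        _ = _ := by ring
    constructor
    · exact abs_le_of_sq_le_sq (by nlinarith [sq_nonneg (B t e)]) (by positivity)
    · exact abs_le_of_sq_le_sq (by nlinarith [sq_nonneg (A t e)]) (by positivity)
  have hκ : ∀ t ∈ Icc (0:ℝ) τ, |B t 0| ≤ ε * κ1 ∧ |B t 1| ≤ ε * κ1 := by
    intro t ht
    have pz := (h.parB t).zero (by norm_num)
    constructor
    · rcases hα with ⟨rfl, h'⟩ | ⟨rfl, h'⟩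
      · rw [pz.1, abs_zero]; positivity
      · exact (small 0 (by simp) h' (hS.b0 0 h00) t ht).2
    · rcases hβ with ⟨rfl, h'⟩ | ⟨rfl, h'⟩
      · rw [pz.2, abs_zero]; positivity
      · exact (small 1 (by simp) h' (hS.b1 0 h00) t ht).2
  have cmp := compare hS (by omega) h hα0 hβ0 hm (min_le_left δ T) (min_le_right δ T) 
    (fun x hx => ⟨ez x hx, eu x hx⟩) (κ := ε * κ1) (Q := Q) (by positivity) hκ (fun t ht => hQ t (tT ht))
  refine ⟨A, B, fun t ht => ⟨h.smA t, h.smB t, ?_, ?_⟩⟩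
  · have hA : HS 0 1 m (A t) ≤ HS α β m (A t) := HS_sub_interval ((h.smA t).cd m) hα0 (by norm_num) hβ0
    have hB : HS 0 1 m (B t) ≤ HS α β m (B t) := HS_sub_interval ((h.smB t).cd m) hα0 (by norm_num) hβ0
    linarith [h.hs t (tδ ht)]
  have h01 : (0:ℝ) ≤ 1 := by norm_num
  have cE : (∫ x in (0:ℝ)..1, ((1/2) * (Z t x - A t x) ^ 2 + (1/2) * (U t x - B t x) ^ 2)) ≤ ε * X0 := by
    refine (cmp t ht).trans ?_
    have e1 : Real.exp ((2 * L + 1) * t) ≤ Real.exp ((2 * L + 1) * δ) := 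
        Real.exp_le_exp.2 (mul_le_mul_of_nonneg_left (tδ ht).2 (by positivity))
    have e0 : ε ^ 2 ≤ ε := by nlinarith
    have hk : 0 ≤ 2 * (κ1 * (Q + L) ^ 2) := by positivity
    have e3 : ε ^ 2 + 2 * (ε * κ1 * (Q + L) ^ 2) ≤ ε * (1 + 2 * (κ1 * (Q + L) ^ 2)) := by nlinarith
    have e4 : (ε ^ 2 + 2 * (ε * κ1 * (Q + L) ^ 2)) * t ≤ ε * (1 + 2 * (κ1 * (Q + L) ^ 2)) * δ := 
      mul_le_mul e3 (tδ ht).2 ht.1 (by positivity)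
    calc _ ≤ (ε * (1 + (1 + 2 * (κ1 * (Q + L) ^ 2)) * δ)) * Real.exp ((2 * L + 1) * δ) := 
            mul_le_mul (by linarith) e1 (Real.exp_pos _).le (by positivity)
        _ = _ := by rw [hX0]; ring
  have bZ : BI 0 1 (fun x => Z t x - A t x) := BI.of_continuous ((hS.cz t (tT ht)).continuous.sub (h.smA t).cont)
  have bU : BI 0 1 (fun x => U t x - B t x) := BI.of_continuous ((hS.cu t (tT ht)).continuous.sub (h.smB t).cont)
  rw [int_add h01 (bZ.sq.const_mul _) (bU.sq.const_mul _), intervalIntegral.integral_const_mul, intervalIntegral.integral_const_mul] at cE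
  have n1 : 0 ≤ ∫ x in (0:ℝ)..1, (Z t x - A t x) ^ 2 := int_sq_nonneg h01
  have n2 : 0 ≤ ∫ x in (0:ℝ)..1, (U t x - B t x) ^ 2 := int_sq_nonneg h01
  have ek : 0 ≤ ε * κ1 := by positivity
  have ek0 : 0 ≤ ε * X0 := by positivity
  have pA := (h.parA t).bpar (h.smA t) m
  have pB := (h.parB t).bpar (h.smB t) m
  refine ⟨by linarith, by linarith, ?_, ?_, ?_, ?_⟩
  · rintro rfl
    exact fun i hi => ⟨fun hs => (pA i hi hs).1, fun hs => (pB i hi hs).1⟩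
  · rintro rfl
    rcases hα with ⟨h1, _⟩ | ⟨_, hz⟩
    · norm_num at h1
    · linarith [(small 0 (by simp) hz (hS.b0 0 h00) t ht).1]
  · rintro rfl
    exact fun i hi => ⟨fun hs => (pA i hi hs).2, fun hs => (pB i hi hs).2⟩
  · rintro rfl
    rcases hβ with ⟨h1, _⟩ | ⟨_, hz⟩
    · norm_num at h1
    · linarith [(small 1 (by simp) hz (hS.b1 0 h00) t ht).1]

theorem abs_zero_of_close {a : ℝ} (h : ∀ η > 0, |a| ≤ η) : a = 0 := by
  by_contra hne
  have := h (|a| / 2) (by positivity)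
  have : 0 < |a| := by positivity
  linarith

/-- Local theory: propagation of end conditions and Sobolev bounds. -/
theorem localT : ∃ C0 : ℝ, 0 ≤ C0 ∧ ∀ (T : ℝ) (r m : ℕ) (Z U Z1 U1 : ℝ → ℝ → ℝ) (M : ℝ), Sol T r Z U Z1 U1 → 0 ≤ T → 
    2 ≤ m → m ≤ r → Pend m 0 (Z 0) (U 0) → Pend m 1 (Z 0) (U 0) → HS 0 1 2 (Z 0) + HS 0 1 2 (U 0) ≤ M →
    ∃ K, ∀ t ∈ Icc (0:ℝ) (min (dlt (C0 * (M + 2))) T), Pend m 0 (Z t) (U t) ∧ Pend m 1 (Z t) (U t) ∧ 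
      HS 0 1 m (Z t) + HS 0 1 m (U t) ≤ K := by
  obtain ⟨C0, hC, hC0⟩ := data_ext
  refine ⟨C0, hC, fun T r m Z U Z1 U1 M hS hT hm hmr p0 p1 hM => ?_⟩
  obtain ⟨α, hα⟩ : ∃ α : ℝ, (α = 0 ∧ Nend m 0 (Z 0) (U 0)) ∨ (α = -1 ∧ Z 0 0 = 0) := by
    rcases p0 with h | h
    · exact ⟨-1, Or.inr ⟨rfl, h⟩⟩
    · exact ⟨0, Or.inl ⟨rfl, h⟩⟩
  obtain ⟨β, hβ⟩ : ∃ β : ℝ, (β = 1 ∧ Nend m 1 (Z 0) (U 0)) ∨ (β = 2 ∧ Z 0 1 = 0) := by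
    rcases p1 with h | h
    · exact ⟨2, Or.inr ⟨rfl, h⟩⟩
    · exact ⟨1, Or.inl ⟨rfl, h⟩⟩
  obtain ⟨K, X, hX, H⟩ := approx_seq hS hT hm hmr hα hβ hC0 hC hM
  have h01 : (0:ℝ) ≤ 1 := by norm_num
  refine ⟨(m + 1) * K + (m + 1) * K, fun t ht => ?_⟩
  have htT : t ∈ Icc (0:ℝ) T := ⟨ht.1, ht.2.trans (min_le_right _ _)⟩
  have cz : ContDiff ℝ m (Z t) := (hS.cz t htT).of_le (by exact_mod_cast hmr)
  have cu : ContDiff ℝ m (U t) := (hS.cu t htT).of_le (by exact_mod_cast hmr)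
  -- for each d, η an approximation
  have G : ∀ d > 0, ∃ A B : ℝ → ℝ, Sm A ∧ Sm B ∧ HS 0 1 m A ≤ K ∧ HS 0 1 m B ≤ K ∧ 
      (∫ x in (0:ℝ)..1, (Z t x - A x) ^ 2) ≤ d ∧ (∫ x in (0:ℝ)..1, (U t x - B x) ^ 2) ≤ d ∧
      (α = 0 → Nend m 0 A B) ∧ (α = -1 → |A 0| ≤ d) ∧ 
      (β = 1 → Nend m 1 A B) ∧ (β = 2 → |A 1| ≤ d) := by
    intro d hd
    set ε := min 1 (d / (X + 1)) with hε
    have he : 0 < ε := lt_min one_pos (by positivity)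
    have hed : ε * X ≤ d := by
      have h1 : ε ≤ d / (X + 1) := min_le_right _ _
      rw [le_div_iff₀ (by positivity)] at h1
      nlinarith
    obtain ⟨A, B, h⟩ := H ε he (min_le_left _ _)
    obtain ⟨a1, a2, a3, a4, a5, a6, a7, a8, a9⟩ := h t ht
    refine ⟨A t, B t, a1, a2, ?_, ?_, a4.trans hed, a5.trans hed, a6, fun h => (a7 h).trans hed, a8, 
      fun h => (a9 h).trans hed⟩
    · linarith [HS_nonneg (f := B t) (m := m) h01]
    · linarith [HS_nonneg (f := A t) (m := m) h01]
  have Dcase : ∀ e ∈ Icc (0:ℝ) 1, (∀ d > 0, ∃ A : ℝ → ℝ, Sm A ∧ HS 0 1 m A ≤ K ∧ (∫ x in (0:ℝ)..1, (Z t x - A x) ^ 2) ≤ d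
      ∧ |A e| ≤ d) → Z t e = 0 := by
    intro e he h
    refine abs_zero_of_close fun η hη => ?_
    obtain ⟨d, hd, h1⟩ := lim_close cz K (by omega : 0 < m) (half_pos hη)
    obtain ⟨A, sA, hA, hs, hb⟩ := h (min d (η / 2)) (lt_min hd (half_pos hη))
    have := h1 A (sA.cd m) hA (hs.trans (min_le_left _ _)) e he
    simp only [iteratedDeriv_zero] at this
    have h2 := abs_add_le (Z t e - A e) (A e)
    rw [sub_add_cancel] at h2
    linarith [hb.trans (min_le_right d (η / 2))]
  have Ncase : ∀ e ∈ Icc (0:ℝ) 1, (∀ d > 0, ∃ A B : ℝ → ℝ, Sm A ∧ Sm B ∧ HS 0 1 m A ≤ K ∧ HS 0 1 m B ≤ K ∧ 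
      (∫ x in (0:ℝ)..1, (Z t x - A x) ^ 2) ≤ d ∧ (∫ x in (0:ℝ)..1, (U t x - B x) ^ 2) ≤ d
      ∧ Nend m e A B) → Nend m e (Z t) (U t) := by
    intro e he h i hi
    constructor
    · intro hs
      refine abs_zero_of_close fun η hη => ?_
      obtain ⟨d, hd, h1⟩ := lim_close cz K hi hη
      obtain ⟨A, B, sA, sB, hA, hB, iA, iB, hN⟩ := h d hd
      have := h1 A (sA.cd m) hA iA e he
      rwa [(hN i hi).1 hs, sub_zero] at this
    · intro hs
      refine abs_zero_of_close fun η hη => ?_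
      obtain ⟨d, hd, h1⟩ := lim_close cu K hi hη
      obtain ⟨A, B, sA, sB, hA, hB, iA, iB, hN⟩ := h d hd
      have := h1 B (sB.cd m) hB iB e he
      rwa [(hN i hi).2 hs, sub_zero] at this
  refine ⟨?_, ?_, add_le_add (lsc_HS (by omega) cz fun d hd => ?_) (lsc_HS (by omega) cu fun d hd => ?_)⟩
  · rcases hα with ⟨h, _⟩ | ⟨h, _⟩
    · refine Or.inr (Ncase 0 (by simp) fun d hd => ?_)
      obtain ⟨A, B, a1, a2, a3, a4, a5, a6, a7, a8, a9, a10⟩ := G d hd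
      exact ⟨A, B, a1, a2, a3, a4, a5, a6, a7 h⟩
    · refine Or.inl (Dcase 0 (by simp) fun d hd => ?_)
      obtain ⟨A, B, a1, a2, a3, a4, a5, a6, a7, a8, a9, a10⟩ := G d hd
      exact ⟨A, a1, a3, a5, a8 h⟩
  · rcases hβ with ⟨h, _⟩ | ⟨h, _⟩
    · refine Or.inr (Ncase 1 (by simp) fun d hd => ?_)
      obtain ⟨A, B, a1, a2, a3, a4, a5, a6, a7, a8, a9, a10⟩ := G d hd
      exact ⟨A, B, a1, a2, a3, a4, a5, a6, a9 h⟩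
    · refine Or.inl (Dcase 1 (by simp) fun d hd => ?_)
      obtain ⟨A, B, a1, a2, a3, a4, a5, a6, a7, a8, a9, a10⟩ := G d hd
      exact ⟨A, a1, a3, a5, a10 h⟩
  · obtain ⟨A, B, a1, a2, a3, a4, a5, a6, _⟩ := G d hd
    exact ⟨A, a1.cd m, a3, a5⟩
  · obtain ⟨A, B, a1, a2, a3, a4, a5, a6, _⟩ := G d hd
    exact ⟨B, a2.cd m, a4, a6⟩

/-- forward difference with (signed) step `h` -/
def fd (h : ℝ) : ℕ → (ℝ → ℝ) → ℝ → ℝ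
  | 0, f, x => f x
  | k + 1, f, x => fd h k f (x + h) - fd h k f x

theorem fd_hasDeriv (h : ℝ) {f f' : ℝ → ℝ} (hf : ∀ x, HasDerivAt f (f' x) x) (k : ℕ) : ∀ x, 
    HasDerivAt (fd h k f) (fd h k f' x) x := by
  induction k with
  | zero => exact hf
  | succ k ih =>
    intro x
    exact ((ih (x + h)).comp_add_const x h).fun_sub (ih x)

theorem mvt_signed {F F' : ℝ → ℝ} (hF : ∀ x, HasDerivAt F (F' x) x) (x h : ℝ) :
    ∃ ξ, |ξ - x| ≤ |h| ∧ F (x + h) - F x = h * F' ξ := by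
  have hc : Continuous F := continuous_iff_continuousAt.2 fun x => (hF x).continuousAt
  rcases lt_trichotomy h 0 with hh | hh | hh
  · obtain ⟨ξ, h1, h2⟩ := exists_hasDerivAt_eq_slope F F' (by linarith : x + h < x) hc.continuousOn (fun y _ => hF y)
    refine ⟨ξ, ?_, ?_⟩
    · rw [abs_of_neg hh, abs_le]; constructor <;> linarith [h1.1, h1.2]
    · have hn : h ≠ 0 := hh.ne
      rw [h2, show x - (x + h) = -h by ring]; field_simp; ring
  · exact ⟨x, by simp, by simp [hh]⟩
  · obtain ⟨ξ, h1, h2⟩ := exists_hasDerivAt_eq_slope F F' (by linarith : x < x + h) hc.continuousOn (fun y _ => hF y)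
    refine ⟨ξ, ?_, ?_⟩
    · rw [abs_of_pos hh, abs_le]; constructor <;> linarith [h1.1, h1.2]
    · have hn : h ≠ 0 := hh.ne'
      rw [h2, show x + h - x = h by ring]; field_simp

theorem fd_mvt (h : ℝ) (k : ℕ) : ∀ (f : ℝ → ℝ), ContDiff ℝ k f → ∀ x, ∃ ξ, |ξ - x| ≤ k * |h| ∧ 
    fd h k f x = h ^ k * iteratedDeriv k f ξ := by
  induction k with
  | zero => intro f hf x; exact ⟨x, by simp, by simp [fd]⟩
  | succ k ih =>
    intro f hf x
    have hd : ∀ x, HasDerivAt f (deriv f x) x := fun x => 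
      ((hf.differentiable (by simp)) x).hasDerivAt
    obtain ⟨η, h1, h2⟩ := mvt_signed (fd_hasDeriv h hd k) x h
    have hf' : ContDiff ℝ k (deriv f) := by
      have := contDiff_iter hf (j := 1) (i := k) (by omega)
      rwa [iteratedDeriv_one] at this
    obtain ⟨ξ, h3, h4⟩ := ih (deriv f) hf' η
    refine ⟨ξ, ?_, ?_⟩
    · have := abs_sub_le ξ η x
      push_cast; linarith
    · rw [fd, h2, h4, iteratedDeriv_succ']; ring

theorem fd_congr (h : ℝ) {f g : ℝ → ℝ} (k : ℕ) : ∀ x, (∀ j ≤ k, f (x + j * h) = g (x + j * h)) → fd h k f x = fd h k g x := by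
  induction k with
  | zero => intro x H; simpa [fd] using H 0 le_rfl
  | succ k ih =>
    intro x H
    rw [fd, fd, ih x (fun j hj => H j (by omega)), ih (x + h) (fun j hj => by
      have := H (j + 1) (by omega)
      push_cast at this
      rwa [show x + (j + 1) * h = x + h + j * h by ring] at this)]

theorem fd_cont (h : ℝ) {F : ℝ → ℝ → ℝ} {s : Set ℝ} (k : ℕ) : ∀ x, (∀ j ≤ k, ContinuousOn (fun t => F t (x + j * h)) s) → 
    ContinuousOn (fun t => fd h k (F t) x) s := by
  induction k with
  | zero => intro x H; simpa [fd] using H 0 le_rfl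
  | succ k ih =>
    intro x H
    refine (ih (x + h) (fun j hj => ?_)).sub (ih x (fun j hj => H j (by omega)))
    have := H (j + 1) (by omega)
    push_cast at this
    rwa [show x + (j + 1) * h = x + h + j * h by ring] at this

theorem fd_time (h : ℝ) {F F1 : ℝ → ℝ → ℝ} {s : Set ℝ} {t : ℝ} (k : ℕ) : ∀ x, (∀ j ≤ k, 
      HasDerivWithinAt (fun t => F t (x + j * h)) (F1 t (x + j * h)) s t) → 
    HasDerivWithinAt (fun t => fd h k (F t) x) (fd h k (F1 t) x) s t := by
  induction k with
  | zero => intro x H; simpa [fd] using H 0 le_rfl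
  | succ k ih =>
    intro x H
    refine (ih (x + h) (fun j hj => ?_)).fun_sub (ih x (fun j hj => H j (by omega)))
    have := H (j + 1) (by omega)
    push_cast at this
    rwa [show x + (j + 1) * h = x + h + j * h by ring] at this

theorem fd_lim {k : ℕ} {f : ℝ → ℝ} (hf : ContDiff ℝ k f) (x : ℝ) {ε : ℝ} (hε : 0 < ε) : ∃ ρ > 0, ∀ h : ℝ, |h| ≤ ρ → 
    |fd h k f x - h ^ k * iteratedDeriv k f x| ≤ ε * |h| ^ k := by
  have hc : Continuous (iteratedDeriv k f) := (contDiff_iter hf (i := 0) (by omega)).continuous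
  obtain ⟨ρ, hρ, H⟩ := Metric.continuousAt_iff.1 (hc.continuousAt (x := x)) ε hε
  refine ⟨ρ / (k + 1), by positivity, fun h hh => ?_⟩
  obtain ⟨ξ, h1, h2⟩ := fd_mvt h k f hf x
  rw [h2, ← mul_sub, abs_mul, abs_pow, mul_comm]
  have : |ξ - x| < ρ := by
    rw [le_div_iff₀ (by positivity)] at hh
    rcases eq_or_lt_of_le (abs_nonneg h) with h0 | h0
    · rw [← h0] at h1; simp at h1; simpa [h1] using hρ
    · nlinarith
  have := (H (x := ξ) this).le
  rw [Real.dist_eq] at this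
  exact mul_le_mul_of_nonneg_right this (by positivity)

theorem baire_parity {T : ℝ} {k : ℕ} {g g1 q : ℝ → ℝ → ℝ} {zz : ℝ → ℝ} {e σ : ℝ} 
    (he : (e = 0 ∧ σ = 1) ∨ (e = 1 ∧ σ = -1))
    (hg : ∀ t ∈ Icc (0:ℝ) T, ContDiff ℝ k (g t)) (hq : ∀ t ∈ Icc (0:ℝ) T, ContDiff ℝ k (q t))
    (hd : ∀ t ∈ Icc (0:ℝ) T, ∀ x ∈ Icc (0:ℝ) 1, HasDerivWithinAt (fun s => g s x) (g1 t x) (Icc (0:ℝ) T) t)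
    (hc : ∀ x ∈ Icc (0:ℝ) 1, ContinuousOn (fun t => g1 t x) (Icc (0:ℝ) T))
    (hq1 : ∀ t ∈ Icc (0:ℝ) T, ∀ x ∈ Icc (0:ℝ) 1, g1 t x = q t x)
    (hz : ContinuousOn zz (Icc (0:ℝ) T)) (h0 : ∀ t ∈ Icc (0:ℝ) T, zz t ≠ 0 → iteratedDeriv k (g t) e = 0) :
    IsMeagre {t | t ∈ Icc (0:ℝ) T ∧ zz t ≠ 0 ∧ iteratedDeriv k (q t) e ≠ 0} := by
  have hσ : |σ| = 1 := by rcases he with h | h <;> simp [h.2]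
  have hσk : |σ ^ k| = 1 := by rw [abs_pow, hσ, one_pow]
  have mem : ∀ h : ℝ, 0 < h → h ≤ 1 / (k + 1) → ∀ j ≤ k, e + (j:ℝ) * (σ * h) ∈ Icc (0:ℝ) 1 := by
    intro h hp hh j hj
    have hj' : (j:ℝ) * h ≤ 1 := by
      rw [le_div_iff₀ (by positivity)] at hh
      have : (j:ℝ) ≤ k + 1 := by exact_mod_cast (by omega : j ≤ k + 1)
      nlinarith
    have hj0 : 0 ≤ (j:ℝ) * h := by positivity
    rcases he with h | h <;> rw [h.1, h.2] <;> constructor <;> linarith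
  set F : ℕ × Bool → Set ℝ := fun p => (Icc (0:ℝ) T ∩ zz ⁻¹' {x | 1 / ((p.1:ℝ) + 1) ≤ |x|}) ∩ 
    ⋂ h ∈ Ioc (0:ℝ) (1 / ((p.1 + 1) * (k + 1))), (Icc (0:ℝ) T ∩ (fun t => (if p.2 then (1:ℝ) else -1) * fd (σ * h) k (g1 t) e) ⁻¹' 
      Ici (h ^ k / (p.1 + 1))) with hF
  have hle : ∀ n : ℕ, (1:ℝ) / ((n + 1) * (k + 1)) ≤ 1 / (k + 1) := fun n => by
    apply one_div_le_one_div_of_le (by positivity)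
    nlinarith [(Nat.cast_nonneg n : (0:ℝ) ≤ n), (Nat.cast_nonneg k : (0:ℝ) ≤ k), mul_nonneg (Nat.cast_nonneg n : (0:ℝ) ≤ n) (Nat.cast_nonneg k : (0:ℝ) ≤ k)]
  have hcl : ∀ p, IsClosed (F p) := by
    intro p
    refine IsClosed.inter (hz.preimage_isClosed_of_isClosed isClosed_Icc (isClosed_le continuous_const continuous_abs)) ?_
    refine isClosed_biInter fun h hh => ?_
    refine ContinuousOn.preimage_isClosed_of_isClosed ?_ isClosed_Icc isClosed_Ici
    refine continuousOn_const.mul (fd_cont (σ * h) k e fun j hj => hc _ (mem h hh.1 (hh.2.trans (hle _)) j hj))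
  have hIntr : ∀ p, interior (F p) = ∅ := by
    intro p
    by_contra hne
    obtain ⟨t0, ht0⟩ := nonempty_iff_ne_empty.2 hne
    obtain ⟨ρ, hρ, hball⟩ := Metric.isOpen_iff.1 isOpen_interior t0 ht0
    have hsub : ∀ t ∈ Icc t0 (t0 + ρ / 2), t ∈ F p := fun t ht => interior_subset (hball (by
      rw [Metric.mem_ball, Real.dist_eq, abs_lt]; constructor <;> linarith [ht.1, ht.2]))
    set b := t0 + ρ / 2 with hb
    have hab : t0 ≤ b := by linarith
    set c : ℝ := if p.2 then (1:ℝ) else -1 with hcdef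
    have hcabs : |c| = 1 := by rw [hcdef]; split_ifs <;> simp
    have hIcc : ∀ t ∈ Icc t0 b, t ∈ Icc (0:ℝ) T := fun t ht => (hsub t ht).1.1
    have hzne : ∀ t ∈ Icc t0 b, zz t ≠ 0 := fun t ht h => by
      have := (hsub t ht).1.2
      rw [mem_preimage, mem_ofPred_eq, h, abs_zero] at this
      have : (0:ℝ) < 1 / ((p.1:ℝ) + 1) := by positivity
      linarith
    have ha' : t0 ∈ Icc t0 b := ⟨le_rfl, hab⟩
    have hb' : b ∈ Icc t0 b := ⟨hab, le_rfl⟩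
    set ε := (ρ / 2) / (4 * ((p.1:ℝ) + 1)) with hε
    have hεp : 0 < ε := by positivity
    obtain ⟨r1, hr1, H1⟩ := fd_lim (hg t0 (hIcc _ ha')) e hεp
    obtain ⟨r2, hr2, H2⟩ := fd_lim (hg b (hIcc _ hb')) e hεp
    set h := min (1 / (((p.1:ℝ) + 1) * (k + 1))) (min r1 r2) with hh
    have hhp : 0 < h := lt_min (by positivity) (lt_min hr1 hr2)
    have hh1 : h ≤ 1 / (((p.1:ℝ) + 1) * (k + 1)) := min_le_left _ _
    have habs : |σ * h| = h := by rw [abs_mul, hσ, one_mul, abs_of_pos hhp]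
    have e1 := H1 (σ * h) (by rw [habs]; exact (min_le_right _ _).trans (min_le_left _ _))
    have e2 := H2 (σ * h) (by rw [habs]; exact (min_le_right _ _).trans (min_le_right _ _))
    rw [habs, h0 _ (hIcc _ ha') (hzne _ ha'), mul_zero, sub_zero] at e1
    rw [habs, h0 _ (hIcc _ hb') (hzne _ hb'), mul_zero, sub_zero] at e2
    have der : ∀ t ∈ Icc t0 b, HasDerivWithinAt (fun t => c * fd (σ * h) k (g t) e - (h ^ k / (p.1 + 1)) * t) 
        (c * fd (σ * h) k (g1 t) e - (h ^ k / (p.1 + 1)) * 1) (Icc t0 b) t := by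
      intro t ht
      refine HasDerivWithinAt.fun_sub ?_ ((hasDerivWithinAt_id t _).const_mul _)
      exact ((fd_time (σ * h) k e fun j hj => hd t (hIcc t ht) _ (mem h hhp (hh1.trans (hle _)) j hj)).mono 
        (fun s hs => hIcc s hs)).const_mul c
    have mono : MonotoneOn (fun t => c * fd (σ * h) k (g t) e - (h ^ k / (p.1 + 1)) * t) (Icc t0 b) := by
      refine monotoneOn_of_hasDerivWithinAt_nonneg (convex_Icc _ _) (fun t ht => (der t ht).continuousWithinAt) 
        (fun t ht => (der t (interior_subset ht)).mono interior_subset) (fun t ht => ?_)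
      have := (hsub t (interior_subset ht)).2
      have := (mem_iInter₂.1 this h ⟨hhp, hh1⟩).2
      rw [mem_preimage, mem_Ici] at this
      linarith
    have m := mono ha' hb' hab
    simp only [] at m
    have f1 : |c * fd (σ * h) k (g t0) e| ≤ ε * h ^ k := by rw [abs_mul, hcabs, one_mul]; exact e1
    have f2 : |c * fd (σ * h) k (g b) e| ≤ ε * h ^ k := by rw [abs_mul, hcabs, one_mul]; exact e2
    have hk : 0 < h ^ k := by positivity
    have : h ^ k / ((p.1:ℝ) + 1) * (ρ / 2) ≤ 2 * (ε * h ^ k) := by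
      have : h ^ k / ((p.1:ℝ) + 1) * b = h ^ k / ((p.1:ℝ) + 1) * t0 + h ^ k / ((p.1:ℝ) + 1) * (ρ / 2) := by rw [hb]; ring
      linarith [(abs_le.1 f1).1, (abs_le.1 f2).2]
    have e3 : h ^ k / ((p.1:ℝ) + 1) * (ρ / 2) = 4 * (ε * h ^ k) := by rw [hε]; field_simp
    have : 0 < ε * h ^ k := by positivity
    linarith
  refine IsMeagre.mono ?_ (isMeagre_iUnion (f := F) fun p => IsNowhereDense.isMeagre ?_)
  · rintro t ⟨ht, hzt, hqt⟩
    set d := σ ^ k * iteratedDeriv k (q t) e with hdd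
    have hdne : 0 < |d| := by rw [hdd, abs_mul, hσk, one_mul]; positivity
    obtain ⟨ρ, hρ, H⟩ := fd_lim (hq t ht) e (half_pos hdne)
    obtain ⟨n, hn⟩ := exists_nat_gt (max (1 / |zz t|) (max (2 / |d|) (1 / ρ)))
    have hzp : 0 < |zz t| := by positivity
    have n1 : 1 / ((n:ℝ) + 1) ≤ |zz t| := by
      rw [div_le_iff₀ (by positivity)]
      have := (le_max_left _ _).trans hn.le
      rw [div_le_iff₀ hzp] at this
      nlinarith
    have n2 : 1 / ((n:ℝ) + 1) ≤ |d| / 2 := by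
      rw [div_le_iff₀ (by positivity)]
      have := ((le_max_left _ _).trans (le_max_right _ _)).trans hn.le
      rw [div_le_iff₀ hdne] at this
      nlinarith
    have n3 : 1 / (((n:ℝ) + 1) * (k + 1)) ≤ ρ := by
      have h1 : 1 / ((n:ℝ) + 1) ≤ ρ := by
        rw [div_le_iff₀ (by positivity)]
        have := ((le_max_right _ _).trans (le_max_right _ _)).trans hn.le
        rw [div_le_iff₀ hρ] at this
        nlinarith
      refine le_trans (one_div_le_one_div_of_le (by positivity) ?_) h1
      nlinarith [(Nat.cast_nonneg n : (0:ℝ) ≤ n), (Nat.cast_nonneg k : (0:ℝ) ≤ k), mul_nonneg (Nat.cast_nonneg n : (0:ℝ) ≤ n) (Nat.cast_nonneg k : (0:ℝ) ≤ k)]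
    refine mem_iUnion.2 ⟨(n, decide (0 < d)), ⟨⟨ht, n1⟩, mem_iInter₂.2 fun h hh => ⟨ht, ?_⟩⟩⟩
    have hhp : 0 < h := hh.1
    have habs : |σ * h| = h := by rw [abs_mul, hσ, one_mul, abs_of_pos hhp]
    have e1 := H (σ * h) (by rw [habs]; exact hh.2.trans n3)
    rw [habs, mul_pow, show σ ^ k * h ^ k * iteratedDeriv k (q t) e = h ^ k * d by rw [hdd]; ring] at e1
    rw [← fd_congr (σ * h) k e (fun j hj => hq1 t ht _ (mem h hhp (hh.2.trans (hle n)) j hj))] at e1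
    have hk : 0 < h ^ k := by positivity
    have goal1 : h ^ k / ((n:ℝ) + 1) ≤ h ^ k * (|d| / 2) := by
      rw [div_eq_mul_one_div]; exact mul_le_mul_of_nonneg_left n2 hk.le
    rw [mem_preimage, mem_Ici]
    refine goal1.trans ?_
    have e2 := abs_le.1 e1
    by_cases hd0 : 0 < d
    · simp only [hd0, decide_true, if_true]
      rw [abs_of_pos hd0] at e2 ⊢
      nlinarith [e2.1]
    · have hd0' : d < 0 := lt_of_le_of_ne (not_lt.1 hd0) (fun h => by rw [h] at hdne; simp at hdne)
      simp only [hd0, decide_false, Bool.false_eq_true, if_false]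
      rw [abs_of_neg hd0'] at e2 ⊢
      nlinarith [e2.2]
  · rw [IsNowhereDense, (hcl p).closure_eq]; exact hIntr p

theorem HS_neg {a b : ℝ} {m : ℕ} {f : ℝ → ℝ} : HS a b m (fun x => - f x) = HS a b m f := by
  unfold HS
  refine Finset.sum_congr rfl fun j _ => intervalIntegral.integral_congr fun x _ => ?_
  show _ ^ 2 = _ ^ 2
  rw [iteratedDeriv_fun_neg, neg_sq]

theorem Pend_neg {m : ℕ} {e : ℝ} {z u : ℝ → ℝ} : Pend m e z (fun x => - u x) ↔ Pend m e z u := by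
  unfold Pend Nend
  simp only [iteratedDeriv_fun_neg, neg_eq_zero]

section reg
variable {T : ℝ} {r : ℕ} {Z U Z1 U1 : ℝ → ℝ → ℝ}

theorem propag {C0 : ℝ} (hC : 0 ≤ C0) 
    (H : ∀ (T : ℝ) (r m : ℕ) (Z U Z1 U1 : ℝ → ℝ → ℝ) (M : ℝ), Sol T r Z U Z1 U1 → 0 ≤ T → 
    2 ≤ m → m ≤ r → Pend m 0 (Z 0) (U 0) → Pend m 1 (Z 0) (U 0) → HS 0 1 2 (Z 0) + HS 0 1 2 (U 0) ≤ M →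
    ∃ K, ∀ t ∈ Icc (0:ℝ) (min (dlt (C0 * (M + 2))) T), Pend m 0 (Z t) (U t) ∧ Pend m 1 (Z t) (U t) ∧ 
      HS 0 1 m (Z t) + HS 0 1 m (U t) ≤ K)
    (hS : Sol T r Z U Z1 U1) {m : ℕ} (hm : 2 ≤ m) (hmr : m ≤ r) {t0 M : ℝ} (ht0 : t0 ∈ Icc (0:ℝ) T)
    (p0 : Pend m 0 (Z t0) (U t0)) (p1 : Pend m 1 (Z t0) (U t0)) (hM : HS 0 1 2 (Z t0) + HS 0 1 2 (U t0) ≤ M) :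
    ∃ K, ∀ t ∈ Icc (0:ℝ) T, |t - t0| ≤ dlt (C0 * (M + 2)) → Pend m 0 (Z t) (U t) ∧ Pend m 1 (Z t) (U t) ∧ 
      HS 0 1 m (Z t) + HS 0 1 m (U t) ≤ K := by
  obtain ⟨K1, h1⟩ := H (T - t0) r m _ _ _ _ M (hS.shift ht0.1 (d := T - t0) (by linarith)) (by linarith [ht0.2]) hm hmr
    (by simpa using p0) (by simpa using p1) (by simpa using hM)
  obtain ⟨K2, h2⟩ := H t0 r m _ _ _ _ M (hS.rev (d := t0) le_rfl ht0.2) ht0.1 hm hmr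
    (by simpa [Pend_neg] using p0) (by simpa [Pend_neg] using p1) (by simpa [HS_neg] using hM)
  refine ⟨max K1 K2, fun t ht hd => ?_⟩
  rcases le_total t0 t with h | h
  · rw [abs_of_nonneg (by linarith)] at hd
    have := h1 (t - t0) ⟨by linarith, le_min hd (by linarith [ht.2])⟩
    rw [add_sub_cancel] at this
    exact ⟨this.1, this.2.1, this.2.2.trans (le_max_left _ _)⟩
  · rw [abs_of_nonpos (by linarith)] at hd
    have := h2 (t0 - t) ⟨by linarith, le_min (by linarith) (by linarith [ht.1])⟩
    rw [sub_sub_cancel, Pend_neg, Pend_neg, HS_neg] at this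
    exact ⟨this.1, this.2.1, this.2.2.trans (le_max_right _ _)⟩

theorem compact_bound {F : ℝ → ℝ} (h : ∀ t0 ∈ Icc (0:ℝ) T, ∃ δ > 0, ∃ K, ∀ t ∈ Icc (0:ℝ) T, |t - t0| ≤ δ → F t ≤ K) :
    ∃ K, ∀ t ∈ Icc (0:ℝ) T, F t ≤ K := by
  refine isCompact_Icc.induction_on (p := fun s => ∃ K, ∀ t ∈ s, F t ≤ K) ⟨0, by simp⟩ ?_ ?_ ?_
  · rintro s t hst ⟨K, hK⟩; exact ⟨K, fun x hx => hK x (hst hx)⟩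
  · rintro s t ⟨K, hK⟩ ⟨L, hL⟩
    exact ⟨max K L, fun x hx => hx.elim (fun h => (hK x h).trans (le_max_left _ _)) (fun h => (hL x h).trans (le_max_right _ _))⟩
  · intro t0 ht0
    obtain ⟨δ, hδ, K, hK⟩ := h t0 ht0
    refine ⟨Icc (0:ℝ) T ∩ Metric.closedBall t0 δ, inter_mem_nhdsWithin _ (Metric.closedBall_mem_nhds _ hδ), K, fun t ht => ?_⟩
    exact hK t ht.1 (by simpa [Real.dist_eq] using ht.2)

theorem pend_two (hS : Sol T r Z U Z1 U1) (hT : 0 < T) (hr : 2 ≤ r) {e : ℝ} (he : e ∈ Icc (0:ℝ) 1) 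
    (hb : ∀ t ∈ Icc (0:ℝ) T, U t e = 0) {t : ℝ} (ht : t ∈ Icc (0:ℝ) T) : Pend 2 e (Z t) (U t) := by
  have h1 : U1 t e = 0 := by
    have := hS.du t ht e he
    have h0 : HasDerivWithinAt (fun s => U s e) 0 (Icc (0:ℝ) T) t := 
      (hasDerivWithinAt_const t _ (0:ℝ)).congr (fun s hs => hb s hs) (hb t ht)
    exact (uniqueDiffOn_Icc hT t ht).eq_deriv _ this h0
  rw [hS.pu t ht e he, Gu, hb t ht] at h1
  have h2 : Z t e * deriv (Z t) e = 0 := by linarith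
  rcases mul_eq_zero.1 h2 with h | h
  · exact Or.inl h
  · refine Or.inr fun i hi => ?_
    interval_cases i
    · exact ⟨fun h => by norm_num at h, fun _ => by rw [iteratedDeriv_zero]; exact hb t ht⟩
    · exact ⟨fun _ => by rw [iteratedDeriv_one]; exact h, fun h => by norm_num at h⟩

theorem sgn_odd {i : ℕ} (h : Odd i) : (-1:ℝ) ^ i * 1 = -1 := by rw [h.neg_one_pow]; norm_num
theorem sgn_even {i : ℕ} (h : Even i) : (-1:ℝ) ^ i * (-1) = -1 := by rw [h.neg_one_pow]; norm_num

theorem Nend.z {m : ℕ} {e : ℝ} {z u : ℝ → ℝ} (h : Nend m e z u) {i : ℕ} (hi : i < m) (ho : Odd i) : iteratedDeriv i z e = 0 :=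
  (h i hi).1 (sgn_odd ho)
theorem Nend.u {m : ℕ} {e : ℝ} {z u : ℝ → ℝ} (h : Nend m e z u) {i : ℕ} (hi : i < m) (ho : Even i) : iteratedDeriv i u e = 0 :=
  (h i hi).2 (sgn_even ho)

theorem leib {k : ℕ} {f g : ℝ → ℝ} (hf : ContDiff ℝ k f) (hg : ContDiff ℝ (k + 1 : ℕ) g) (x : ℝ) :
    iteratedDeriv k (fun y => f y * deriv g y) x = 
      ∑ i ∈ Finset.range (k + 1), (k.choose i : ℝ) * iteratedDeriv i f x * iteratedDeriv (k - i + 1) g x := by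
  have hg' : ContDiff ℝ k (deriv g) := by
    have := contDiff_iter hg (j := 1) (i := k) (by omega)
    rwa [iteratedDeriv_one] at this
  have := iteratedDeriv_fun_mul (n := k) (x := x) hf.contDiffAt hg'.contDiffAt
  rw [this]
  exact Finset.sum_congr rfl fun i _ => by rw [← iteratedDeriv_succ']

theorem leib_cd {k : ℕ} {f g : ℝ → ℝ} (hf : ContDiff ℝ k f) (hg : ContDiff ℝ (k + 1 : ℕ) g) :
    ContDiff ℝ k (fun y => f y * deriv g y) := by
  have hg' : ContDiff ℝ k (deriv g) := by
    have := contDiff_iter hg (j := 1) (i := k) (by omega)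
    rwa [iteratedDeriv_one] at this
  exact hf.mul hg'

theorem Nend_succ_odd {k : ℕ} {e : ℝ} {z u : ℝ → ℝ} (hz : ContDiff ℝ (k + 1 : ℕ) z) (hu : ContDiff ℝ (k + 1 : ℕ) u) 
    (hk : Even k) (h : Nend (k + 1) e z u) (hne : z e ≠ 0) 
    (hq : iteratedDeriv k (fun x => - Gu z u x) e = 0) : Nend (k + 2) e z u := by
  have hz0 : ContDiff ℝ k z := hz.of_le (by exact_mod_cast (by omega : k ≤ k + 1))
  have hu0 : ContDiff ℝ k u := hu.of_le (by exact_mod_cast (by omega : k ≤ k + 1))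
  have hGu : Gu z u = fun x => (1/2) * (z x * deriv z x) + (3/2) * (u x * deriv u x) := rfl
  rw [iteratedDeriv_fun_neg, hGu, iteratedDeriv_fun_add ((contDiff_const.mul (leib_cd hz0 hz)).contDiffAt) 
    ((contDiff_const.mul (leib_cd hu0 hu)).contDiffAt), iteratedDeriv_const_mul_field, iteratedDeriv_const_mul_field, leib hz0 hz, leib hu0 hu] at hq
  have s1 : (∑ i ∈ Finset.range (k + 1), (k.choose i : ℝ) * iteratedDeriv i z e * iteratedDeriv (k - i + 1) z e) 
      = z e * iteratedDeriv (k + 1) z e := by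
    rw [Finset.sum_eq_single_of_mem 0 (by simp)]
    · simp
    · intro i hi h0
      have hi' := Finset.mem_range.1 hi
      rcases Nat.even_or_odd i with hp | hp
      · rw [h.z (by omega : k - i + 1 < k + 1) (by
          have : Even (k - i) := (Nat.even_sub (by omega)).2 (by tauto)
          exact this.add_one), mul_zero]
      · rw [h.z hi' hp]; ring
  have s2 : (∑ i ∈ Finset.range (k + 1), (k.choose i : ℝ) * iteratedDeriv i u e * iteratedDeriv (k - i + 1) u e) = 0 := by
    refine Finset.sum_eq_zero fun i hi => ?_
    have hi' := Finset.mem_range.1 hi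
    rcases Nat.even_or_odd i with hp | hp
    · rw [h.u hi' hp]; ring
    · have hi0 : 1 ≤ i := hp.pos
      rw [h.u (by omega : k - i + 1 < k + 1) (by
          have : Odd (k - i) := Nat.Even.sub_odd (by omega) hk hp
          exact this.add_one), mul_zero]
  rw [s1, s2] at hq
  have hfin : iteratedDeriv (k + 1) z e = 0 := by
    have : z e * iteratedDeriv (k + 1) z e = 0 := by linarith
    exact (mul_eq_zero.1 this).resolve_left hne
  intro i hi
  rcases Nat.lt_or_ge i (k + 1) with h1 | h1
  · exact h i h1
  · obtain rfl : i = k + 1 := by omega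
    refine ⟨fun _ => hfin, fun hs => ?_⟩
    rw [hk.add_one.neg_one_pow] at hs; norm_num at hs

theorem Nend_succ_even {k : ℕ} {e : ℝ} {z u : ℝ → ℝ} (hz : ContDiff ℝ (k + 1 : ℕ) z) (hu : ContDiff ℝ (k + 1 : ℕ) u) 
    (hk : Odd k) (h : Nend (k + 1) e z u) (hne : z e ≠ 0) 
    (hq : iteratedDeriv k (fun x => - Gz z u x) e = 0) : Nend (k + 2) e z u := by
  have hz0 : ContDiff ℝ k z := hz.of_le (by exact_mod_cast (by omega : k ≤ k + 1))
  have hu0 : ContDiff ℝ k u := hu.of_le (by exact_mod_cast (by omega : k ≤ k + 1))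
  have hGz : Gz z u = fun x => (1/2) * (z x * deriv u x + u x * deriv z x) := rfl
  rw [iteratedDeriv_fun_neg, hGz, iteratedDeriv_const_mul_field, iteratedDeriv_fun_add (leib_cd hz0 hu).contDiffAt 
    (leib_cd hu0 hz).contDiffAt, leib hz0 hu, leib hu0 hz] at hq
  have s1 : (∑ i ∈ Finset.range (k + 1), (k.choose i : ℝ) * iteratedDeriv i z e * iteratedDeriv (k - i + 1) u e) 
      = z e * iteratedDeriv (k + 1) u e := by
    rw [Finset.sum_eq_single_of_mem 0 (by simp)]
    · simp
    · intro i hi h0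
      have hi' := Finset.mem_range.1 hi
      rcases Nat.even_or_odd i with hp | hp
      · rw [h.u (by omega : k - i + 1 < k + 1) (by
          have : Odd (k - i) := Nat.Odd.sub_even (by omega) hk hp
          exact this.add_one), mul_zero]
      · rw [h.z hi' hp]; ring
  have s2 : (∑ i ∈ Finset.range (k + 1), (k.choose i : ℝ) * iteratedDeriv i u e * iteratedDeriv (k - i + 1) z e) = 0 := by
    refine Finset.sum_eq_zero fun i hi => ?_
    have hi' := Finset.mem_range.1 hi
    rcases Nat.even_or_odd i with hp | hp
    · rw [h.u hi' hp]; ring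
    · have hi0 : 1 ≤ i := hp.pos
      rw [h.z (by omega : k - i + 1 < k + 1) (by
          have : Even (k - i) := Nat.Odd.sub_odd hk hp
          exact this.add_one), mul_zero]
  rw [s1, s2] at hq
  have hfin : iteratedDeriv (k + 1) u e = 0 := by
    have : z e * iteratedDeriv (k + 1) u e = 0 := by linarith
    exact (mul_eq_zero.1 this).resolve_left hne
  intro i hi
  rcases Nat.lt_or_ge i (k + 1) with h1 | h1
  · exact h i h1
  · obtain rfl : i = k + 1 := by omega
    refine ⟨fun hs => ?_, fun _ => hfin⟩
    rw [hk.add_one.neg_one_pow] at hs; norm_num at hs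

/-- the bad times are meagre -/
theorem bad_meagre (hS : Sol T r Z U Z1 U1) {k : ℕ} (hk : k + 2 ≤ r) {e σ : ℝ} 
    (he : (e = 0 ∧ σ = 1) ∨ (e = 1 ∧ σ = -1)) (hP : ∀ t ∈ Icc (0:ℝ) T, Pend (k + 1) e (Z t) (U t)) :
    IsMeagre {t | t ∈ Icc (0:ℝ) T ∧ ¬ Pend (k + 2) e (Z t) (U t)} := by
  have heI : e ∈ Icc (0:ℝ) 1 := by rcases he with h | h <;> simp [h.1]
  have cz : ∀ t ∈ Icc (0:ℝ) T, ContDiff ℝ (k + 1 : ℕ) (Z t) := fun t ht => (hS.cz t ht).of_le (by exact_mod_cast (by omega : k + 1 ≤ r))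
  have cu : ∀ t ∈ Icc (0:ℝ) T, ContDiff ℝ (k + 1 : ℕ) (U t) := fun t ht => (hS.cu t ht).of_le (by exact_mod_cast (by omega : k + 1 ≤ r))
  have cz0 : ∀ t ∈ Icc (0:ℝ) T, ContDiff ℝ k (Z t) := fun t ht => (hS.cz t ht).of_le (by exact_mod_cast (by omega : k ≤ r))
  have cu0 : ∀ t ∈ Icc (0:ℝ) T, ContDiff ℝ k (U t) := fun t ht => (hS.cu t ht).of_le (by exact_mod_cast (by omega : k ≤ r))
  have slice : ∀ {F : ℝ → ℝ → ℝ}, ContinuousOn (fun p : ℝ × ℝ => F p.1 p.2) (Icc (0:ℝ) T ×ˢ Icc (0:ℝ) 1) → 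
      ∀ x ∈ Icc (0:ℝ) 1, ContinuousOn (fun t => F t x) (Icc (0:ℝ) T) := by
    intro F hF x hx
    exact hF.comp (f := fun t : ℝ => (t, x)) (by fun_prop) (fun t ht => ⟨ht, hx⟩)
  have nend : ∀ t ∈ Icc (0:ℝ) T, Z t e ≠ 0 → Nend (k + 1) e (Z t) (U t) := fun t ht h => (hP t ht).resolve_left h
  rcases Nat.even_or_odd k with hp | hp
  · refine IsMeagre.mono ?_ (baire_parity (g := U) (g1 := U1) (q := fun t x => - Gu (Z t) (U t) x) (zz := fun t => Z t e) (k := k) he 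
      cu0 (fun t ht => ?_) hS.du (slice hS.ju1) hS.pu (slice hS.jz e heI) 
      (fun t ht hne => (nend t ht hne).u (by omega) hp))
    · rintro t ⟨ht, hn⟩
      have hne : Z t e ≠ 0 := fun h => hn (Or.inl h)
      exact ⟨ht, hne, fun hq => hn (Or.inr (Nend_succ_odd (cz t ht) (cu t ht) hp (nend t ht hne) hne hq))⟩
    · exact ((contDiff_const.mul (leib_cd (cz0 t ht) (cz t ht))).add (contDiff_const.mul (leib_cd (cu0 t ht) (cu t ht)))).neg
  · refine IsMeagre.mono ?_ (baire_parity (g := Z) (g1 := Z1) (q := fun t x => - Gz (Z t) (U t) x) (zz := fun t => Z t e) (k := k) he 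
      cz0 (fun t ht => ?_) hS.dz (slice hS.jz1) hS.pz (slice hS.jz e heI) 
      (fun t ht hne => (nend t ht hne).z (by omega) hp))
    · rintro t ⟨ht, hn⟩
      have hne : Z t e ≠ 0 := fun h => hn (Or.inl h)
      exact ⟨ht, hne, fun hq => hn (Or.inr (Nend_succ_even (cz t ht) (cu t ht) hp (nend t ht hne) hne hq))⟩
    · exact (contDiff_const.mul ((leib_cd (cz0 t ht) (cu t ht)).add (leib_cd (cu0 t ht) (cz t ht)))).neg

/-- uniform-in-time regularity -/
theorem REG (hS : Sol T r Z U Z1 U1) (hT : 0 < T) (hr : 2 ≤ r) : 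
    ∃ K, ∀ t ∈ Icc (0:ℝ) T, HS 0 1 r (Z t) + HS 0 1 r (U t) ≤ K := by
  obtain ⟨C0, hC, H⟩ := localT
  have h01 : (0:ℝ) ≤ 1 := by norm_num
  have P2 : ∀ t ∈ Icc (0:ℝ) T, Pend 2 0 (Z t) (U t) ∧ Pend 2 1 (Z t) (U t) := fun t ht => 
    ⟨pend_two hS hT hr (by simp) hS.b0 ht, pend_two hS hT hr (by simp) hS.b1 ht⟩
  have dp : ∀ {M : ℝ}, 0 ≤ M → 0 < dlt (C0 * (M + 2)) := fun hM => dlt_pos (by positivity)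
  have nn : ∀ (m : ℕ) t, 0 ≤ HS 0 1 m (Z t) + HS 0 1 m (U t) := fun m t => add_nonneg (HS_nonneg h01) (HS_nonneg h01)
  have loc : ∀ m, 2 ≤ m → m ≤ r → (∀ t ∈ Icc (0:ℝ) T, Pend m 0 (Z t) (U t) ∧ Pend m 1 (Z t) (U t)) → 
      ∃ K, ∀ t ∈ Icc (0:ℝ) T, HS 0 1 m (Z t) + HS 0 1 m (U t) ≤ K := by
    intro m hm hmr hP
    refine compact_bound fun t0 ht0 => ?_
    obtain ⟨K, hK⟩ := propag hC H hS hm hmr ht0 (hP t0 ht0).1 (hP t0 ht0).2 le_rfl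
    exact ⟨_, dp (nn 2 t0), K, fun t ht hd => (hK t ht hd).2.2⟩
  obtain ⟨M, hM⟩ := loc 2 le_rfl hr P2
  have hMn : 0 ≤ M := (nn 2 0).trans (hM 0 ⟨le_rfl, hT.le⟩)
  set δ := dlt (C0 * (M + 2)) with hδ
  have hδp : 0 < δ := dp hMn
  have step : ∀ m, 2 ≤ m → m ≤ r → ∀ t ∈ Icc (0:ℝ) T, Pend m 0 (Z t) (U t) ∧ Pend m 1 (Z t) (U t) := by
    intro m hm
    induction m, hm using Nat.le_induction with
    | base => exact fun _ => P2
    | succ m hm ih =>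
      intro hmr
      have ihm := ih (by omega)
      obtain ⟨k, rfl⟩ : ∃ k, m = k + 1 := ⟨m - 1, by omega⟩
      have b0 := bad_meagre hS (k := k) (by omega) (Or.inl ⟨rfl, rfl⟩) (fun t ht => (ihm t ht).1)
      have b1 := bad_meagre hS (k := k) (by omega) (Or.inr ⟨rfl, rfl⟩) (fun t ht => (ihm t ht).2)
      have hnm := not_isMeagre_of_isOpen (isOpen_Ioo (a := (0:ℝ)) (b := T)) (nonempty_Ioo.2 hT)
      obtain ⟨t', ht', hg0, hg1⟩ : ∃ t' ∈ Icc (0:ℝ) T, Pend (k + 2) 0 (Z t') (U t') ∧ Pend (k + 2) 1 (Z t') (U t') := by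
        by_contra hcon
        push Not at hcon
        refine hnm ((b0.union b1).mono fun t ht => ?_)
        have htI : t ∈ Icc (0:ℝ) T := ⟨ht.1.le, ht.2.le⟩
        by_cases h : Pend (k + 2) 0 (Z t) (U t)
        · exact Or.inr ⟨htI, hcon t htI h⟩
        · exact Or.inl ⟨htI, h⟩
      have chain : ∀ n : ℕ, ∀ t ∈ Icc (0:ℝ) T, |t - t'| ≤ n * δ → Pend (k + 2) 0 (Z t) (U t) ∧ Pend (k + 2) 1 (Z t) (U t) := by
        intro n
        induction n with
        | zero =>
          intro t ht h
          have : t = t' := by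
            have : |t - t'| = 0 := le_antisymm (by simpa using h) (abs_nonneg _)
            linarith [abs_eq_zero.1 this]
          rw [this]; exact ⟨hg0, hg1⟩
        | succ n ihn =>
          intro t ht h
          -- intermediate point
          set s := t' + (n / (n + 1) : ℝ) * (t - t') with hs
          have hfr0 : 0 ≤ (n / (n + 1) : ℝ) := by positivity
          have hfr1 : (n / (n + 1) : ℝ) ≤ 1 := by rw [div_le_one (by positivity)]; linarith
          have hsI : s ∈ Icc (0:ℝ) T := by
            constructor
            · rw [hs]; nlinarith [ht'.1, ht.1, mul_nonneg hfr0 ht.1, mul_nonneg (sub_nonneg.2 hfr1) ht'.1]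
            · rw [hs]; nlinarith [ht'.2, ht.2, mul_nonneg hfr0 (sub_nonneg.2 ht.2), mul_nonneg (sub_nonneg.2 hfr1) (sub_nonneg.2 ht'.2)]
          have e1 : |s - t'| ≤ n * δ := by
            rw [hs, add_sub_cancel_left, abs_mul, abs_of_nonneg hfr0]
            calc (n / (n + 1) : ℝ) * |t - t'| ≤ (n / (n + 1) : ℝ) * ((n + 1 : ℕ) * δ) := mul_le_mul_of_nonneg_left h hfr0
              _ = n * δ := by push_cast; field_simp
          have e2 : |t - s| ≤ δ := by
            have : t - s = (1 / (n + 1) : ℝ) * (t - t') := by rw [hs]; field_simp; ring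
            rw [this, abs_mul, abs_of_nonneg (by positivity)]
            calc (1 / (n + 1) : ℝ) * |t - t'| ≤ (1 / (n + 1) : ℝ) * ((n + 1 : ℕ) * δ) := mul_le_mul_of_nonneg_left h (by positivity)
              _ = δ := by push_cast; field_simp
          have hPs := ihn s hsI e1
          obtain ⟨K, hK⟩ := propag hC H hS (by omega : 2 ≤ k + 2) hmr hsI hPs.1 hPs.2 (hM s hsI)
          exact ⟨(hK t ht e2).1, (hK t ht e2).2.1⟩
      intro t ht
      obtain ⟨n, hn⟩ := exists_nat_ge (|t - t'| / δ)
      exact chain n t ht ((div_le_iff₀ hδp).1 hn)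
  exact loc r hr le_rfl (step r hr le_rfl)

end reg

/-- truncated power -/
def pw (n : ℕ) (y : ℝ) : ℝ := if 0 < y then y ^ n else 0

theorem pw_pos {n : ℕ} {y : ℝ} (h : 0 < y) : pw n y = y ^ n := if_pos h
theorem pw_nonpos {n : ℕ} {y : ℝ} (h : y ≤ 0) : pw n y = 0 := if_neg (not_lt.2 h)
theorem pw_nonneg {n : ℕ} {y : ℝ} (h : 0 ≤ y) : pw (n+1) y = y ^ (n+1) := by
  rcases h.eq_or_lt with h | h
  · rw [← h, pw_nonpos le_rfl]; simp
  · exact pw_pos h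

theorem pw_abs (n : ℕ) (y : ℝ) : |pw n y| ≤ |y| ^ n := by
  rcases lt_or_ge 0 y with h | h
  · rw [pw_pos h, abs_pow]
  · rw [pw_nonpos h, abs_zero]; positivity

theorem pw_hasDeriv {n : ℕ} {y : ℝ} (h : y ≠ 0 ∨ 1 ≤ n) :
    HasDerivAt (pw (n+1)) ((n+1) * pw n y) y := by
  rcases lt_trichotomy y 0 with h1 | h1 | h1
  · rw [pw_nonpos h1.le, mul_zero]
    exact (hasDerivAt_const y (0:ℝ)).congr_of_eventuallyEq (by
      filter_upwards [Iio_mem_nhds h1] with z hz using pw_nonpos (le_of_lt hz))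
  · have hn : 1 ≤ n := h.resolve_left (not_not.2 h1)
    subst h1
    rw [pw_nonpos le_rfl, mul_zero, hasDerivAt_iff_isLittleO]
    simp only [pw_nonpos (le_refl (0:ℝ)), sub_zero, smul_zero]
    have h2 : (fun z : ℝ => z ^ (n+1)) =o[nhds 0] (fun z : ℝ => z) := by
      simpa using Asymptotics.isLittleO_pow_pow (𝕜 := ℝ) (show 1 < n + 1 by omega)
    refine (Asymptotics.IsBigO.of_bound 1 (Filter.Eventually.of_forall fun z => ?_)).trans_isLittleO h2
    rw [one_mul, Real.norm_eq_abs, Real.norm_eq_abs, abs_pow]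
    exact pw_abs _ _
  · rw [pw_pos h1]
    have := (hasDerivAt_pow (n+1) y).congr_of_eventuallyEq (f₁ := pw (n+1)) (by
      filter_upwards [Ioi_mem_nhds h1] with z hz using pw_pos hz)
    simpa using this

theorem pw_contDiff : ∀ n : ℕ, ContDiff ℝ n (pw (n+1))
  | 0 => by
    rw [Nat.cast_zero, contDiff_zero]
    have : pw (0+1) = fun y => max y 0 := by
      funext y
      rcases lt_or_ge 0 y with h | h
      · rw [pw_pos h, max_eq_left h.le]; simp
      · rw [pw_nonpos h, max_eq_right h]
    rw [this]; fun_prop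
  | n+1 => by
    push_cast
    rw [contDiff_succ_iff_deriv]
    refine ⟨fun y => (pw_hasDeriv (Or.inr (by omega))).differentiableAt, by simp, ?_⟩
    have : deriv (pw (n+1+1)) = fun y => ((n:ℝ)+1+1) * pw (n+1) y := by
      funext y
      rw [(pw_hasDeriv (n := n+1) (y := y) (Or.inr (by omega))).deriv]; push_cast; ring
    rw [this]
    exact contDiff_const.mul (pw_contDiff n)

theorem pw_measurable (n : ℕ) : Measurable (pw n) :=
  Measurable.ite measurableSet_Ioi (measurable_id.pow_const n) measurable_const

theorem pw_BI (a b : ℝ) (n : ℕ) (y : ℝ) : BI a b (fun t => pw n (y - t)) := by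
  have hc : Continuous (fun t : ℝ => |y - t| ^ n) := by fun_prop
  obtain ⟨_, M, hM⟩ := BI.of_continuous (a := a) (b := b) hc
  refine ⟨((pw_measurable n).comp (measurable_const.sub measurable_id)).aestronglyMeasurable, M, ?_⟩
  filter_upwards [hM] with t ht
  exact (pw_abs _ _).trans ((le_abs_self _).trans ht)

/-- Taylor formula with integral remainder -/
theorem peano (m : ℕ) {g : ℝ → ℝ} (hg : ContDiff ℝ (m+1 : ℕ) g) {x : ℝ} (hx : 0 ≤ x) :
    g x = (∑ l ∈ Finset.range (m+1), iteratedDeriv l g 0 / (l.factorial : ℝ) * x ^ l)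
      + ∫ t in (0:ℝ)..x, iteratedDeriv (m+1) g t * ((x - t) ^ m / (m.factorial : ℝ)) := by
  induction m with
  | zero =>
    have h1 : PC 0 x g := PC.of_contDiff (by exact_mod_cast hg)
    have h2 := h1.int_deriv hx
    simp [iteratedDeriv_one, h2]
  | succ m ih =>
    rw [ih (hg.of_le (by exact_mod_cast (by omega)))]
    rw [Finset.sum_range_succ _ (m+1), add_assoc]
    congr 1
    have hp : PC 0 x (iteratedDeriv (m+1) g) := PC.of_contDiff (by
      exact_mod_cast contDiff_iter (by exact_mod_cast hg) (show (m+1)+1 ≤ m+1+1 by omega))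
    have hder : ∀ t : ℝ, HasDerivAt (fun t : ℝ => (x - t) ^ (m+1) / ((m+1).factorial : ℝ))
        (-((x - t) ^ m / (m.factorial : ℝ))) t := by
      intro t
      have h1 := (((hasDerivAt_const t x).sub (hasDerivAt_id t)).fun_pow (m+1)).div_const
        ((m+1).factorial : ℝ)
      refine (h1.congr_deriv ?_)
      have : (m.factorial : ℝ) ≠ 0 := by positivity
      have : ((m:ℝ) + 1) ≠ 0 := by positivity
      simp only [Nat.factorial_succ, Nat.cast_mul, Nat.cast_add, Nat.cast_one]
      simp
      field_simp
    have hq : PC 0 x (fun t : ℝ => (x - t) ^ (m+1) / ((m+1).factorial : ℝ)) :=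
      PC.of_contDiff (by fun_prop)
    have hb := hp.by_parts hx hq
    simp only [fun t => (hder t).deriv] at hb
    rw [iteratedDeriv_succ (n := m+1), hb]
    simp only [sub_self, sub_zero, mul_neg, intervalIntegral.integral_neg]
    simp
    ring

/-- same, with the truncated kernel on `[0,1]` -/
theorem peano' (m : ℕ) {g : ℝ → ℝ} (hg : ContDiff ℝ (m+1 : ℕ) g) {x : ℝ} (hx : x ∈ Icc (0:ℝ) 1) :
    g x = (∑ l ∈ Finset.range (m+1), iteratedDeriv l g 0 / (l.factorial : ℝ) * x ^ l)
      + (1 / (m.factorial : ℝ)) * ∫ t in (0:ℝ)..1, iteratedDeriv (m+1) g t * pw m (x - t) := by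
  have hc : Continuous (iteratedDeriv (m+1) g) := hg.continuous_iteratedDeriv (m+1) (by simp)
  have hB : BI 0 1 (fun t => iteratedDeriv (m+1) g t * pw m (x - t)) :=
    (BI.of_continuous hc).mul (pw_BI _ _ _ _)
  conv_lhs => rw [peano m hg hx.1]
  congr 1
  rw [← integral_add_adjacent_intervals ((hB.mono le_rfl hx.2).intervalIntegrable hx.1)
    ((hB.mono hx.1 le_rfl).intervalIntegrable hx.2)]
  have e2 : ∫ t in x..1, iteratedDeriv (m+1) g t * pw m (x - t) = 0 := by
    rw [intervalIntegral.integral_congr (g := fun _ => (0:ℝ))]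
    · simp
    · intro t ht
      rw [uIcc_of_le hx.2] at ht
      simp only
      rw [pw_nonpos (by linarith [ht.1]), mul_zero]
  rw [e2, add_zero, ← intervalIntegral.integral_const_mul]
  apply int_congr_ae hx.1
  refine PC.ae_of ∅ countable_empty fun t ht _ => ?_
  rw [pw_pos (by linarith [ht.2])]
  ring

/-! partitions -/
section part
variable {N : ℕ} {x : ℕ → ℝ} {h γ : ℝ}

theorem IsPartition.mono (hp : IsPartition N x) {i j : ℕ} (hij : i ≤ j) (hj : j ≤ N) : x i ≤ x j := by
  induction j, hij using Nat.le_induction with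
  | base => exact le_rfl
  | succ j hij ih => exact (ih (by omega)).trans (hp.2.2 j (by omega)).le

theorem IsPartition.mem (hp : IsPartition N x) {i : ℕ} (hi : i ≤ N) : x i ∈ Icc (0:ℝ) 1 :=
  ⟨hp.1 ▸ hp.mono (Nat.zero_le _) hi, hp.2.1 ▸ hp.mono hi le_rfl⟩

theorem part_le (hm : IsMeshSize N x h) {i j : ℕ} (hij : i ≤ j) (hj : j ≤ N) :
    x j - x i ≤ (j - i : ℝ) * h := by
  induction j, hij using Nat.le_induction with
  | base => simp
  | succ j hij ih =>
    have h1 := ih (by omega)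
    have h2 := hm.1 j (by omega)
    push_cast
    linarith

theorem part_ge (hγ : 0 ≤ γ) (hp : IsPartition N x) (hq : QuasiUniform N x h γ) {i j : ℕ} (hij : i < j) (hj : j ≤ N) :
    h ≤ γ * (x j - x i) := by
  have h1 := hq i (by omega)
  have h2 := hp.mono (i := i+1) (j := j) (by omega) hj
  have h3 := hp.2.2 i (by omega)
  nlinarith

theorem mesh_pos (hp : IsPartition N x) (hm : IsMeshSize N x h) : 0 < h := by
  obtain ⟨i, hi, he⟩ := hm.2
  linarith [hp.2.2 i hi]

theorem mesh_le_one (hp : IsPartition N x) (hm : IsMeshSize N x h) : h ≤ 1 := by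
  obtain ⟨i, hi, he⟩ := hm.2
  have h1 := (hp.mem (i := i+1) (by omega)).2
  have h2 := (hp.mem (i := i) (by omega)).1
  linarith

/-- split an integral over the cells -/
theorem int_cells (hp : IsPartition N x) {f : ℝ → ℝ} (hf : BI 0 1 f) :
    ∫ t in (0:ℝ)..1, f t = ∑ j ∈ Finset.range N, ∫ t in (x j)..(x (j+1)), f t := by
  have := sum_integral_adjacent_intervals (f := f) (a := x) (n := N) (μ := volume) fun k hk =>
    (hf.mono (hp.mem (by omega : k ≤ N)).1 (hp.mem (by omega : k+1 ≤ N)).2).intervalIntegrable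
      (hp.2.2 k hk).le
  rw [this, hp.1, hp.2.1]
end part

/-- Lagrange weights at the knots `x m, …, x (m+r-1)` -/
def lam (r : ℕ) (x : ℕ → ℝ) (m i : ℕ) (t : ℝ) : ℝ :=
  (Lagrange.basis (Finset.range r) (fun l => x (m+l)) i).eval t

theorem lam_continuous (r : ℕ) (x : ℕ → ℝ) (m i : ℕ) : Continuous (lam r x m i) :=
  Polynomial.continuous _

theorem lam_sum {r : ℕ} {x : ℕ → ℝ} {m n : ℕ} (hn : n < r)
    (hx : ∀ i < r, ∀ j < r, x (m+i) = x (m+j) → i = j) (y t : ℝ) :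
    ∑ i ∈ Finset.range r, lam r x m i t * (y - x (m+i)) ^ n = (y - t) ^ n := by
  have hinj : Set.InjOn (fun l => x (m+l)) (Finset.range r : Set ℕ) := by
    intro i hi j hj hij
    exact hx i (by simpa using hi) j (by simpa using hj) hij
  let p : Polynomial ℝ := (Polynomial.C y - Polynomial.X) ^ n
  have hd : p.degree < (Finset.range r).card := by
    rw [Finset.card_range]
    have h1 : p.degree ≤ (n : ℕ) := by
      refine (Polynomial.degree_pow_le _ _).trans ?_
      have : (Polynomial.C y - Polynomial.X : Polynomial ℝ).degree ≤ 1 :=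
        (Polynomial.degree_sub_le _ _).trans (max_le (Polynomial.degree_C_le.trans (by norm_num)) Polynomial.degree_X_le)
      calc n • (Polynomial.C y - Polynomial.X : Polynomial ℝ).degree ≤ n • (1 : WithBot ℕ) :=
            nsmul_le_nsmul_right this n
        _ = n := by simp
    exact lt_of_le_of_lt h1 (by exact_mod_cast hn)
  have := Lagrange.eq_interpolate hinj hd
  have h2 := congrArg (Polynomial.eval t) this
  rw [Lagrange.interpolate_apply, Polynomial.eval_finsetSum] at h2
  simp only [p, Polynomial.eval_pow, Polynomial.eval_sub, Polynomial.eval_C, Polynomial.eval_X,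
    Polynomial.eval_mul] at h2
  rw [h2]
  exact Finset.sum_congr rfl fun i _ => mul_comm _ _

theorem lam_abs {r : ℕ} {x : ℕ → ℝ} {m i : ℕ} {h γ t : ℝ} (hh : 0 < h) (hγ : 0 < γ) (hi : i < r)
    (h1 : ∀ i < r, |t - x (m+i)| ≤ r * h)
    (h2 : ∀ i < r, ∀ j < r, i ≠ j → h ≤ γ * |x (m+i) - x (m+j)|) :
    |lam r x m i t| ≤ (r * γ) ^ (r-1) := by
  rw [lam, Lagrange.basis, Polynomial.eval_prod, Finset.abs_prod]
  have hcard : ((Finset.range r).erase i).card = r - 1 := by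
    rw [Finset.card_erase_of_mem (by simpa using hi), Finset.card_range]
  rw [← hcard, ← Finset.prod_const]
  refine Finset.prod_le_prod (fun _ _ => abs_nonneg _) fun j hj => ?_
  have hj' : j ≠ i ∧ j < r := by simpa using hj
  simp only [Lagrange.basisDivisor, Polynomial.eval_mul, Polynomial.eval_C, Polynomial.eval_sub,
    Polynomial.eval_X]
  rw [abs_mul, abs_inv]
  have h3 := h2 i hi j hj'.2 hj'.1.symm
  have h4 := h1 j hj'.2
  have hpos : 0 < |x (m+i) - x (m+j)| := by
    by_contra hc
    push Not at hc
    nlinarith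
  rw [inv_mul_le_iff₀ hpos]
  calc |t - x (m+j)| ≤ r * h := h4
    _ ≤ r * (γ * |x (m+i) - x (m+j)|) := by gcongr
    _ = _ := by ring

/-- kernel error -/
def kerE (r n : ℕ) (x : ℕ → ℝ) (m : ℕ) (y t : ℝ) : ℝ :=
  pw n (y - t) - ∑ i ∈ Finset.range r, lam r x m i t * pw n (y - x (m+i))

theorem kerE_BI (a b : ℝ) (r n : ℕ) (x : ℕ → ℝ) (m : ℕ) (y : ℝ) : BI a b (kerE r n x m y) := by
  refine (pw_BI a b n y).sub (BI.sum _ fun i _ => ?_)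
  exact BI.of_continuous ((lam_continuous r x m i).mul continuous_const)

/-- first knot index used for cell `j` -/
def mj (N r j : ℕ) : ℕ := min j (N + 1 - r)

section ker
variable {N r : ℕ} {x : ℕ → ℝ} {h γ : ℝ}

theorem mj_facts (hN : r ≤ N + 1) (hr : 2 ≤ r) {j : ℕ} (hj : j < N) :
    mj N r j ≤ j ∧ mj N r j + (r-1) ≤ N ∧ j + 2 ≤ mj N r j + r := by
  unfold mj; omega

theorem knot_inj (hp : IsPartition N x) {m : ℕ} (hm : m + (r-1) ≤ N) :
    ∀ i < r, ∀ j < r, x (m+i) = x (m+j) → i = j := by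
  have key : ∀ i < r, ∀ j < r, i < j → x (m+i) < x (m+j) := by
    intro i hi j hj hij
    exact (hp.2.2 (m+i) (by omega)).trans_le (hp.mono (by omega) (by omega))
  intro i hi j hj he
  rcases lt_trichotomy i j with h | h | h
  · exact absurd he (key i hi j hj h).ne
  · exact h
  · exact absurd he.symm (key j hj i hi h).ne

theorem kerE_zero (hr : 2 ≤ r) (hN : r ≤ N + 1) {n : ℕ} (hn : n < r) (hp : IsPartition N x)
    {i j : ℕ} (hi : i < N) (hj : j < N) (hij : j + r ≤ i ∨ i + r ≤ j) {y t : ℝ}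
    (hy : y ∈ Ioo (x i) (x (i+1))) (ht : t ∈ Icc (x j) (x (j+1))) :
    kerE r n x (mj N r j) y t = 0 := by
  obtain ⟨m1, m2, m3⟩ := mj_facts hN hr hj
  rcases hij with h | h
  · have e1 : 0 < y - t := by
      have := hp.mono (i := j+1) (j := i) (by omega) (by omega)
      linarith [hy.1, ht.2]
    rw [kerE, pw_pos e1, ← lam_sum hn (knot_inj hp m2), sub_eq_zero]
    refine Finset.sum_congr rfl fun l hl => ?_
    have hl' : l < r := by simpa using hl
    rw [pw_pos]
    have := hp.mono (i := mj N r j + l) (j := i) (by omega) (by omega)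
    linarith [hy.1]
  · have e1 : y - t ≤ 0 := by
      have := hp.mono (i := i+1) (j := j) (by omega) (by omega)
      linarith [hy.2, ht.1]
    rw [kerE, pw_nonpos e1, zero_sub, neg_eq_zero]
    refine Finset.sum_eq_zero fun l hl => ?_
    rw [pw_nonpos, mul_zero]
    have hl' : l < r := by simpa using hl
    have := hp.mono (i := i+1) (j := mj N r j + l) (by omega) (by omega)
    linarith [hy.2]

theorem knot_dist (hp : IsPartition N x) (hm : IsMeshSize N x h) {a b L : ℕ} (ha : a < N) (hb : b ≤ N)
    (h1 : b ≤ a + L) (h2 : a + 1 ≤ b + L) {t : ℝ} (ht : t ∈ Icc (x a) (x (a+1))) :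
    |t - x b| ≤ L * h := by
  have hh := mesh_pos hp hm
  rw [abs_le]
  constructor
  · rcases le_total a b with hab | hab
    · have := part_le hm hab hb
      have h3 : ((b:ℝ) - a) ≤ L := by
        have : (b:ℝ) ≤ a + L := by exact_mod_cast h1
        linarith
      nlinarith [ht.1]
    · have := hp.mono hab ha.le
      have : 0 ≤ (L:ℝ) * h := by positivity
      linarith [ht.1]
  · rcases le_total b (a+1) with hab | hab
    · have := part_le hm hab (by omega)
      have h3 : (((a+1:ℕ):ℝ) - b) ≤ L := by
        have : ((a+1:ℕ):ℝ) ≤ b + L := by exact_mod_cast h2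
        linarith
      nlinarith [ht.2]
    · have := hp.mono hab hb
      have : 0 ≤ (L:ℝ) * h := by positivity
      linarith [ht.2]

theorem kerE_abs (hr : 2 ≤ r) (hN : r ≤ N + 1) {n : ℕ} (hp : IsPartition N x)
    (hm : IsMeshSize N x h) (hq : QuasiUniform N x h γ) (hγ : 1 ≤ γ)
    {i j : ℕ} (hi : i < N) (hj : j < N) (hij : i < j + r ∧ j < i + r) {y t : ℝ}
    (hy : y ∈ Icc (x i) (x (i+1))) (ht : t ∈ Icc (x j) (x (j+1))) :
    |kerE r n x (mj N r j) y t| ≤ (1 + r * (r * γ) ^ (r-1)) * (2 * r * h) ^ n := by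
  obtain ⟨m1, m2, m3⟩ := mj_facts hN hr hj
  have hh := mesh_pos hp hm
  have a1 : |y - t| ≤ 2 * r * h := by
    have h1 := knot_dist hp hm (a := i) (b := j) (L := r) hi hj.le (by omega) (by omega) hy
    have h2 : |t - x j| ≤ h := by
      rw [abs_of_nonneg (by linarith [ht.1])]
      linarith [ht.2, hm.1 j hj]
    have h3 : |y - t| ≤ |y - x j| + |t - x j| := by
      have := abs_sub (y - x j) (t - x j)
      rwa [show y - x j - (t - x j) = y - t by ring] at this
    have : (1:ℝ) ≤ r := by exact_mod_cast (by omega)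
    nlinarith
  rw [kerE]
  refine (abs_sub _ _).trans ?_
  rw [add_mul, one_mul]
  have b1 : |pw n (y - t)| ≤ (2 * r * h) ^ n := (pw_abs _ _).trans (by gcongr)
  refine add_le_add b1 ((Finset.abs_sum_le_sum_abs _ _).trans ?_)
  have : ∀ l ∈ Finset.range r, |lam r x (mj N r j) l t * pw n (y - x (mj N r j + l))|
      ≤ (r * γ) ^ (r-1) * (2 * r * h) ^ n := by
    intro l hl
    have hl' : l < r := by simpa using hl
    rw [abs_mul]
    refine mul_le_mul ?_ ((pw_abs _ _).trans ?_) (abs_nonneg _) (by positivity)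
    · refine lam_abs hh (by linarith) hl' ?_ ?_
      · intro l hl
        exact knot_dist hp hm hj (by omega) (by omega) (by omega) ht
      · intro a ha b hb hab
        rcases lt_or_gt_of_ne hab with hab | hab
        · rw [abs_sub_comm]
          exact (part_ge (by linarith) hp hq (show mj N r j + a < mj N r j + b by omega) (by omega)).trans
            (mul_le_mul_of_nonneg_left (le_abs_self _) (by linarith))
        · exact (part_ge (by linarith) hp hq (show mj N r j + b < mj N r j + a by omega) (by omega)).trans
            (mul_le_mul_of_nonneg_left (le_abs_self _) (by linarith))
    · have := knot_dist hp hm (a := i) (b := mj N r j + l) (L := 2 * r) hi (by omega) (by omega) (by omega) hy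
      push_cast at this
      gcongr
  refine (Finset.sum_le_card_nsmul _ _ _ this).trans ?_
  rw [Finset.card_range, nsmul_eq_mul]
  exact le_of_eq (by ring)

theorem band_card {s : Finset ℕ} (r i : ℕ) : (s.filter (fun j => i < j + r ∧ j < i + r)).card ≤ 2 * r := by
  have : s.filter (fun j => i < j + r ∧ j < i + r) ⊆ Finset.Ico (i + 1 - r) (i + r) := by
    intro j hj
    simp only [Finset.mem_filter] at hj
    simp only [Finset.mem_Ico]; omega
  refine (Finset.card_le_card this).trans ?_
  rw [Nat.card_Ico]; omega

/-- discrete Schur estimate for the kernel error -/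
theorem schur (hr : 2 ≤ r) (hN : r ≤ N + 1) {n : ℕ} (hn : n < r) (hp : IsPartition N x)
    (hm : IsMeshSize N x h) (hq : QuasiUniform N x h γ) (hγ : 1 ≤ γ) {G F : ℝ → ℝ}
    (hG : Continuous G) (hF : BI 0 1 F)
    (hFG : ∀ i < N, ∀ y ∈ Ioo (x i) (x (i+1)), F y =
      ∑ j ∈ Finset.range N, ∫ t in (x j)..(x (j+1)), G t * kerE r n x (mj N r j) y t) :
    ∫ y in (0:ℝ)..1, F y ^ 2 ≤
      (2 * r * ((1 + r * (r * γ) ^ (r-1)) * (2 * r * h) ^ n)) ^ 2 * h ^ 2 * ∫ t in (0:ℝ)..1, G t ^ 2 := by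
  set M := (1 + r * (r * γ) ^ (r-1)) * (2 * r * h) ^ n with hM
  have hh := mesh_pos hp hm
  have hM0 : 0 ≤ M := by positivity
  set g : ℕ → ℝ := fun j => ∫ t in (x j)..(x (j+1)), G t ^ 2 with hg
  have hg0 : ∀ j < N, 0 ≤ g j := fun j hj => int_sq_nonneg (hp.2.2 j hj).le
  -- pointwise bound
  have hpt : ∀ i < N, ∀ y ∈ Ioo (x i) (x (i+1)), F y ^ 2 ≤
      2 * r * (M ^ 2 * h) * ∑ j ∈ (Finset.range N).filter (fun j => i < j + r ∧ j < i + r), g j := by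
    intro i hi y hy
    rw [hFG i hi y hy]
    have e1 : ∑ j ∈ Finset.range N, ∫ t in (x j)..(x (j+1)), G t * kerE r n x (mj N r j) y t
        = ∑ j ∈ (Finset.range N).filter (fun j => i < j + r ∧ j < i + r),
          ∫ t in (x j)..(x (j+1)), G t * kerE r n x (mj N r j) y t := by
      symm
      refine Finset.sum_filter_of_ne fun j hj hne => ?_
      by_contra hc
      apply hne
      have hj' : j < N := by simpa using hj
      rw [intervalIntegral.integral_congr (g := fun _ => (0:ℝ))]
      · simp
      · intro t ht
        rw [uIcc_of_le (hp.2.2 j hj').le] at ht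
        simp only
        rw [kerE_zero hr hN hn hp hi hj' (by omega) hy ht, mul_zero]
    rw [e1]
    refine sq_sum_le_card_mul_sum_sq.trans ?_
    have e2 : ∀ j ∈ (Finset.range N).filter (fun j => i < j + r ∧ j < i + r),
        (∫ t in (x j)..(x (j+1)), G t * kerE r n x (mj N r j) y t) ^ 2 ≤ (M ^ 2 * h) * g j := by
      intro j hj
      simp only [Finset.mem_filter, Finset.mem_range] at hj
      have hc := (hp.2.2 j hj.1).le
      refine (cauchy_schwarz_sq hc (BI.of_continuous hG) (kerE_BI _ _ _ _ _ _ _)).trans ?_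
      rw [mul_comm (M ^ 2 * h)]
      refine mul_le_mul_of_nonneg_left ?_ (hg0 j hj.1)
      have h5 := int_mono hc (kerE_BI _ _ r n x (mj N r j) y).sq (BI.const (M ^ 2)) fun t ht => by
        have := kerE_abs hr hN (n := n) hp hm hq hγ hi hj.1 hj.2 (Ioo_subset_Icc_self hy) ht
        rw [← sq_abs]
        gcongr
      refine h5.trans ?_
      rw [intervalIntegral.integral_const, smul_eq_mul, mul_comm]
      exact mul_le_mul_of_nonneg_left (hm.1 j hj.1) (by positivity)
    have e3 := Finset.sum_le_sum e2
    rw [← Finset.mul_sum] at e3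
    have h6 : (0:ℝ) ≤ ∑ j ∈ (Finset.range N).filter (fun j => i < j + r ∧ j < i + r), g j :=
      Finset.sum_nonneg fun j hj => hg0 j (by simp only [Finset.mem_filter, Finset.mem_range] at hj; exact hj.1)
    calc _ ≤ (((Finset.range N).filter (fun j => i < j + r ∧ j < i + r)).card : ℝ) *
          (M ^ 2 * h * ∑ j ∈ (Finset.range N).filter (fun j => i < j + r ∧ j < i + r), g j) := by gcongr
      _ ≤ (2 * r) * (M ^ 2 * h * ∑ j ∈ (Finset.range N).filter (fun j => i < j + r ∧ j < i + r), g j) := by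
          refine mul_le_mul_of_nonneg_right ?_ (by positivity)
          exact_mod_cast band_card r i
      _ = _ := by ring
  rw [int_cells hp hF.sq, int_cells hp (BI.of_continuous hG).sq]
  have hcell : ∀ i ∈ Finset.range N, ∫ y in (x i)..(x (i+1)), F y ^ 2 ≤
      2 * r * (M ^ 2 * h ^ 2) * ∑ j ∈ Finset.range N, if (i < j + r ∧ j < i + r) then g j else 0 := by
    intro i hi
    have hi' : i < N := by simpa using hi
    have hc := (hp.2.2 i hi').le
    rw [← Finset.sum_filter]
    have h6 : (0:ℝ) ≤ ∑ j ∈ (Finset.range N).filter (fun j => i < j + r ∧ j < i + r), g j :=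
      Finset.sum_nonneg fun j hj => hg0 j (by simp only [Finset.mem_filter, Finset.mem_range] at hj; exact hj.1)
    have h7 := int_mono_ae hc (hF.mono (hp.mem (by omega : i ≤ N)).1 (hp.mem (by omega : i+1 ≤ N)).2).sq
      (BI.const _) (PC.ae_of ∅ countable_empty fun y hy _ => hpt i hi' y hy)
    refine h7.trans ?_
    rw [intervalIntegral.integral_const, smul_eq_mul]
    refine (mul_le_mul_of_nonneg_right (hm.1 i hi') (by positivity)).trans (le_of_eq ?_)
    ring
  refine (Finset.sum_le_sum hcell).trans ?_
  rw [← Finset.mul_sum, Finset.sum_comm]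
  have h8 : ∀ j ∈ Finset.range N, ∑ i ∈ Finset.range N, (if (i < j + r ∧ j < i + r) then g j else 0)
      ≤ 2 * r * g j := by
    intro j hj
    rw [← Finset.sum_filter, Finset.sum_const, nsmul_eq_mul]
    refine mul_le_mul_of_nonneg_right ?_ (hg0 j (by simpa using hj))
    have := band_card (s := Finset.range N) r j
    have e : (Finset.range N).filter (fun i => i < j + r ∧ j < i + r)
        = (Finset.range N).filter (fun i => j < i + r ∧ i < j + r) := by
      congr 1; funext i; exact propext and_comm
    rw [e]
    exact_mod_cast this
  have h9 := Finset.sum_le_sum h8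
  rw [← Finset.mul_sum] at h9
  calc _ ≤ 2 * r * (M ^ 2 * h ^ 2) * (2 * r * ∑ j ∈ Finset.range N, g j) := by
        refine mul_le_mul_of_nonneg_left h9 (by positivity)
    _ = _ := by ring
end ker

/-! the finite element spaces as submodules -/
def ShS (N r k : ℕ) (x : ℕ → ℝ) : Submodule ℝ (ℝ → ℝ) where
  carrier := Sh N r k x
  zero_mem' := ⟨contDiffOn_const, fun j _ => ⟨0, by simp, by simp⟩⟩
  add_mem' := by
    rintro f g ⟨h1, h2⟩ ⟨h3, h4⟩
    refine ⟨h1.add h3, fun j hj => ?_⟩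
    obtain ⟨p, hp, hp'⟩ := h2 j hj
    obtain ⟨q, hq, hq'⟩ := h4 j hj
    refine ⟨p + q, (Polynomial.natDegree_add_le _ _).trans (max_le hp hq), fun y hy => ?_⟩
    rw [Pi.add_apply, hp' y hy, hq' y hy, Polynomial.eval_add]
  smul_mem' := by
    rintro c f ⟨h1, h2⟩
    refine ⟨contDiffOn_const.smul h1, fun j hj => ?_⟩
    obtain ⟨p, hp, hp'⟩ := h2 j hj
    refine ⟨c • p, (Polynomial.natDegree_smul_le _ _).trans hp, fun y hy => ?_⟩
    rw [Pi.smul_apply, hp' y hy, Polynomial.eval_smul]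

def Sh0S (N r k : ℕ) (x : ℕ → ℝ) : Submodule ℝ (ℝ → ℝ) where
  carrier := Sh0 N r k x
  zero_mem' := ⟨(ShS N r k x).zero_mem, rfl, rfl⟩
  add_mem' := by
    rintro f g ⟨h1, h2, h3⟩ ⟨h4, h5, h6⟩
    exact ⟨(ShS N r k x).add_mem h1 h4, by simp [h2, h5], by simp [h3, h6]⟩
  smul_mem' := by
    rintro c f ⟨h1, h2, h3⟩
    exact ⟨(ShS N r k x).smul_mem c h1, by simp [h2], by simp [h3]⟩

section
variable {N r k : ℕ} {x : ℕ → ℝ}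

theorem Sh_add {f g : ℝ → ℝ} (hf : f ∈ Sh N r k x) (hg : g ∈ Sh N r k x) :
    (fun y => f y + g y) ∈ Sh N r k x := (ShS N r k x).add_mem hf hg
theorem Sh_sub {f g : ℝ → ℝ} (hf : f ∈ Sh N r k x) (hg : g ∈ Sh N r k x) :
    (fun y => f y - g y) ∈ Sh N r k x := (ShS N r k x).sub_mem hf hg
theorem Sh_smul (c : ℝ) {f : ℝ → ℝ} (hf : f ∈ Sh N r k x) :
    (fun y => c * f y) ∈ Sh N r k x := (ShS N r k x).smul_mem c hf
theorem Sh_sum {ι : Type*} (s : Finset ι) {F : ι → ℝ → ℝ} (h : ∀ i ∈ s, F i ∈ Sh N r k x) :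
    (fun y => ∑ i ∈ s, F i y) ∈ Sh N r k x := by
  have := (ShS N r k x).sum_mem h
  have e : (∑ i ∈ s, F i) = fun y => ∑ i ∈ s, F i y := by funext y; simp
  rw [e] at this; exact this

theorem Sh_pow {l : ℕ} (hl : l ≤ r - 1) : (fun y : ℝ => y ^ l) ∈ Sh N r k x :=
  ⟨by fun_prop, fun j _ => ⟨Polynomial.X ^ l, by simpa using hl, by simp⟩⟩

theorem Sh_const (c : ℝ) : (fun _ : ℝ => c) ∈ Sh N r k x := by
  simpa using Sh_smul c (Sh_pow (N := N) (r := r) (k := k) (x := x) (l := 0) (by omega))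

theorem Sh_pw (hr : 2 ≤ r) (hk : k ≤ r - 2) (hp : IsPartition N x) {a : ℕ} (ha : a ≤ N) :
    (fun y : ℝ => pw (r-1) (y - x a)) ∈ Sh N r k x := by
  obtain ⟨q, rfl⟩ : ∃ q, r = q + 2 := ⟨r - 2, by omega⟩
  rw [show q + 2 - 1 = q + 1 by omega]
  refine ⟨?_, fun j hj => ?_⟩
  · have h1 : ContDiff ℝ k (pw (q+1)) := (pw_contDiff q).of_le (by exact_mod_cast (by omega))
    exact (h1.comp (contDiff_id.sub contDiff_const)).contDiffOn
  · rcases le_or_gt a j with haj | haj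
    · refine ⟨(Polynomial.X - Polynomial.C (x a)) ^ (q+1), ?_, fun y hy => ?_⟩
      · refine Polynomial.natDegree_pow_le.trans ?_
        rw [Polynomial.natDegree_X_sub_C]; omega
      · have := hp.mono haj hj.le
        show pw (q+1) (y - x a) = _
        rw [pw_nonneg (by linarith [hy.1])]; simp
    · refine ⟨0, by simp, fun y hy => ?_⟩
      have := hp.mono (i := j+1) (j := a) (by omega) ha
      show pw (q+1) (y - x a) = _
      rw [pw_nonpos (by linarith [hy.2])]; simp

theorem exists_cell (hp : IsPartition N x) {y : ℝ} (hy : y ∈ Icc (0:ℝ) 1) :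
    ∃ j < N, y ∈ Icc (x j) (x (j+1)) := by
  have hN : 0 < N := by
    rcases Nat.eq_zero_or_pos N with h | h
    · exfalso
      have h1 := hp.1; have h2 := hp.2.1
      rw [h, h1] at h2; norm_num at h2
    · exact h
  have key : ∀ n ≤ N, 0 < n → y ≤ x n → ∃ j < n, y ∈ Icc (x j) (x (j+1)) := by
    intro n
    induction n with
    | zero => intro _ h; omega
    | succ n ih =>
      intro hn _ hyn
      rcases le_total (x n) y with h | h
      · exact ⟨n, by omega, h, hyn⟩
      · rcases Nat.eq_zero_or_pos n with h0 | h0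
        · subst h0
          exact ⟨0, by omega, by rw [hp.1]; exact hy.1, hyn⟩
        · obtain ⟨j, hj, hj'⟩ := ih (by omega) h0 h
          exact ⟨j, by omega, hj'⟩
  exact key N le_rfl hN (hp.2.1 ▸ hy.2)

theorem Sh_PC (hp : IsPartition N x) {φ : ℝ → ℝ} (hφ : φ ∈ Sh N r k x) : PC 0 1 φ := by
  classical
  obtain ⟨h1, h2⟩ := hφ
  choose! p hp1 hp2 using h2
  have hb : ∀ j, ∃ M, ∀ y ∈ Icc (0:ℝ) 1, ‖deriv (fun y => (p j).eval y) y‖ ≤ M := fun j =>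
    isCompact_Icc.exists_bound_of_continuousOn (by
      have : deriv (fun y => (p j).eval y) = fun y => (p j).derivative.eval y := by
        funext y; exact Polynomial.deriv _
      rw [this]; exact (Polynomial.continuous _).continuousOn)
  choose M hM using hb
  refine ⟨h1.continuousOn, x '' (Finset.range (N+1) : Set ℕ), (Finset.countable_toSet _).image _,
    ∑ j ∈ Finset.range N, |M j|, fun y hy hys => ?_⟩
  obtain ⟨j, hj, hyj⟩ := exists_cell hp (Ioo_subset_Icc_self hy)
  have n1 : x j ≠ y := fun e => hys ⟨j, by simp; omega, e⟩
  have n2 : x (j+1) ≠ y := fun e => hys ⟨j+1, by simp; omega, e⟩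
  have hyo : y ∈ Ioo (x j) (x (j+1)) := ⟨lt_of_le_of_ne hyj.1 n1, lt_of_le_of_ne hyj.2 n2.symm⟩
  have he : φ =ᶠ[nhds y] fun y => (p j).eval y := by
    filter_upwards [Ioo_mem_nhds hyo.1 hyo.2] with z hz
    exact hp2 j hj z (Ioo_subset_Icc_self hz)
  refine ⟨((p j).differentiable y).congr_of_eventuallyEq he, ?_⟩
  rw [he.deriv_eq]
  refine (hM j y (Ioo_subset_Icc_self hy)).trans ((le_abs_self _).trans ?_)
  exact Finset.single_le_sum (f := fun j => |M j|) (fun _ _ => abs_nonneg _) (by simpa using hj)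

/-- a function of `Sh` is determined by its values at `N * r` points -/
theorem Sh_points (hr : 1 ≤ r) (hp : IsPartition N x) : ∃ pts : Fin (N * r) → ℝ,
    (∀ i, pts i ∈ Icc (0:ℝ) 1) ∧
    ∀ φ ∈ Sh N r k x, (∀ i, φ (pts i) = 0) → ∀ y ∈ Icc (0:ℝ) 1, φ y = 0 := by
  let P : Fin N × Fin r → ℝ := fun a =>
    x a.1 + ((a.2 : ℕ) : ℝ) / r * (x (a.1+1) - x a.1)
  have hr0 : (0:ℝ) < r := by exact_mod_cast hr
  have hPm : ∀ a, P a ∈ Icc (x a.1) (x (a.1+1)) := by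
    intro a
    have h1 := hp.2.2 a.1 a.1.2
    have h2 : ((a.2 : ℕ) : ℝ) / r ≤ 1 := by
      rw [div_le_one hr0]; exact_mod_cast a.2.2.le
    have h3 : 0 ≤ ((a.2 : ℕ) : ℝ) / r := by positivity
    constructor
    · have : 0 ≤ ((a.2 : ℕ) : ℝ) / r * (x (a.1+1) - x a.1) := mul_nonneg h3 (by linarith)
      simp only [P]; linarith
    · have : ((a.2 : ℕ) : ℝ) / r * (x (a.1+1) - x a.1) ≤ 1 * (x (a.1+1) - x a.1) :=
        mul_le_mul_of_nonneg_right h2 (by linarith)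
      simp only [P]; linarith
  refine ⟨fun i => P (finProdFinEquiv.symm i), fun i => ?_, fun φ hφ h0 y hy => ?_⟩
  · have h1 := hPm (finProdFinEquiv.symm i)
    set a := finProdFinEquiv.symm i
    exact ⟨(hp.mem (by omega : (a.1:ℕ) ≤ N)).1.trans h1.1, h1.2.trans (hp.mem (by omega : (a.1:ℕ)+1 ≤ N)).2⟩
  · obtain ⟨j, hj, hyj⟩ := exists_cell hp hy
    obtain ⟨p, hd, he⟩ := hφ.2 j hj
    rw [he y hyj]
    have hz : ∀ i : Fin r, p.eval (P (⟨j, hj⟩, i)) = 0 := by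
      intro i
      have := h0 (finProdFinEquiv (⟨j, hj⟩, i))
      simp only [Equiv.symm_apply_apply] at this
      rw [← he _ (hPm (⟨j, hj⟩, i)), this]
    have hinj : Function.Injective (fun i : Fin r => P (⟨j, hj⟩, i)) := by
      intro a b hab
      simp only [P] at hab
      have h1 : (0:ℝ) < x (j+1) - x j := by linarith [hp.2.2 j hj]
      have h2 := add_left_cancel hab
      have h3 := mul_right_cancel₀ h1.ne' h2
      rw [div_left_inj' hr0.ne'] at h3
      exact Fin.ext (by exact_mod_cast h3)
    have hp0 : p = 0 := by
      refine Polynomial.eq_zero_of_natDegree_lt_card_of_eval_eq_zero p hinj hz ?_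
      rw [Fintype.card_fin]; omega
    rw [hp0]; simp
end

section approx
variable {N r k : ℕ} {x : ℕ → ℝ} {h γ : ℝ}

/-- spline part of the quasi-interpolant -/
def spl (N r n : ℕ) (x : ℕ → ℝ) (G : ℝ → ℝ) (y : ℝ) : ℝ :=
  ∑ j ∈ Finset.range N, ∑ i ∈ Finset.range r,
    (∫ t in (x j)..(x (j+1)), G t * lam r x (mj N r j) i t) * pw n (y - x (mj N r j + i))

theorem spl_eq (hp : IsPartition N x) {G : ℝ → ℝ} (hG : Continuous G) (n : ℕ) (y : ℝ) :
    (∫ t in (0:ℝ)..1, G t * pw n (y - t)) - spl N r n x G y =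
      ∑ j ∈ Finset.range N, ∫ t in (x j)..(x (j+1)), G t * kerE r n x (mj N r j) y t := by
  rw [int_cells hp ((BI.of_continuous hG).mul (pw_BI _ _ _ _)), spl, ← Finset.sum_sub_distrib]
  refine Finset.sum_congr rfl fun j hj => ?_
  have hc := (hp.2.2 j (by simpa using hj)).le
  have e : ∀ t, G t * kerE r n x (mj N r j) y t = G t * pw n (y - t)
      - ∑ i ∈ Finset.range r, pw n (y - x (mj N r j + i)) * (G t * lam r x (mj N r j) i t) := by
    intro t
    rw [kerE, mul_sub, Finset.mul_sum]
    congr 1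
    exact Finset.sum_congr rfl fun i _ => by ring
  have hb : ∀ i ∈ Finset.range r, BI (x j) (x (j+1))
      (fun t => pw n (y - x (mj N r j + i)) * (G t * lam r x (mj N r j) i t)) := fun i _ =>
    (BI.of_continuous (hG.mul (lam_continuous _ _ _ _))).const_mul _
  simp only [e]
  rw [int_sub hc ((BI.of_continuous hG).mul (pw_BI _ _ _ _)) (BI.sum _ hb), int_sum hc _ hb]
  congr 1
  refine Finset.sum_congr rfl fun i _ => ?_
  rw [intervalIntegral.integral_const_mul, mul_comm]

theorem spl_Sh (hr : 2 ≤ r) (hN : r ≤ N + 1) (hk : k ≤ r - 2) (hp : IsPartition N x) (G : ℝ → ℝ) :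
    (fun y => spl N r (r-1) x G y) ∈ Sh N r k x := by
  refine Sh_sum _ fun j hj => Sh_sum _ fun i hi => Sh_smul _ (Sh_pw hr hk hp ?_)
  have h1 : j < N := by simpa using hj
  have h2 : i < r := by simpa using hi
  have := mj_facts hN hr h1
  omega

theorem spl_hasDeriv (n : ℕ) (G : ℝ → ℝ) {y : ℝ} (hr : 2 ≤ r) (hN : r ≤ N + 1)
    (hy : ∀ a ≤ N, y ≠ x a) :
    HasDerivAt (fun y => spl N r (n+1) x G y) ((n+1) * spl N r n x G y) y := by
  have : (n+1) * spl N r n x G y = ∑ j ∈ Finset.range N, ∑ i ∈ Finset.range r,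
      (∫ t in (x j)..(x (j+1)), G t * lam r x (mj N r j) i t)
        * ((n+1) * pw n (y - x (mj N r j + i))) := by
    rw [spl, Finset.mul_sum]
    refine Finset.sum_congr rfl fun j _ => ?_
    rw [Finset.mul_sum]
    exact Finset.sum_congr rfl fun i _ => by ring
  rw [this]
  refine HasDerivAt.fun_sum fun j hj => HasDerivAt.fun_sum fun i hi => HasDerivAt.const_mul _ ?_
  have h1 : j < N := by simpa using hj
  have h2 : i < r := by simpa using hi
  have := mj_facts hN hr h1
  have h3 := pw_hasDeriv (n := n) (y := y - x (mj N r j + i))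
    (Or.inl (sub_ne_zero.2 (hy _ (by omega))))
  exact h3.comp_sub_const y (x (mj N r j + i))

theorem kerE_one (hr : 2 ≤ r) (hN : r ≤ N + 1) (hp : IsPartition N x) {j : ℕ} (hj : j < N) {t : ℝ}
    (ht : t ≤ 1) : kerE r (r-1) x (mj N r j) 1 t = 0 := by
  obtain ⟨m1, m2, m3⟩ := mj_facts hN hr hj
  obtain ⟨q, rfl⟩ : ∃ q, r = q + 2 := ⟨r - 2, by omega⟩
  rw [show q + 2 - 1 = q + 1 by omega, kerE, pw_nonneg (by linarith),
    ← lam_sum (r := q + 2) (x := x) (m := mj N (q+2) j) (n := q+1) (by omega) (knot_inj hp m2), sub_eq_zero]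
  refine Finset.sum_congr rfl fun l hl => ?_
  have hl' : l < q + 2 := by simpa using hl
  rw [pw_nonneg]
  have := (hp.mem (i := mj N (q+2) j + l) (by omega)).2
  linarith

theorem not_knot (hp : IsPartition N x) {i : ℕ} (hi : i < N) {y : ℝ} (hy : y ∈ Ioo (x i) (x (i+1))) :
    ∀ a ≤ N, y ≠ x a := by
  rintro a ha rfl
  rcases le_or_gt a i with h | h
  · exact absurd (hp.mono h hi.le) (not_le.2 hy.1)
  · exact absurd (hp.mono (i := i+1) h ha) (not_le.2 hy.2)

theorem taylor_poly_deriv (c : ℕ → ℝ) (n : ℕ) (y : ℝ) :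
    HasDerivAt (fun y : ℝ => ∑ l ∈ Finset.range (n+2), c l / (l.factorial : ℝ) * y ^ l)
      (∑ l ∈ Finset.range (n+1), c (l+1) / (l.factorial : ℝ) * y ^ l) y := by
  have h1 : HasDerivAt (fun y : ℝ => ∑ l ∈ Finset.range (n+2), c l / (l.factorial : ℝ) * y ^ l)
      (∑ l ∈ Finset.range (n+2), c l / (l.factorial : ℝ) * ((l:ℝ) * y ^ (l-1))) y :=
    HasDerivAt.fun_sum fun l _ => (hasDerivAt_pow l y).const_mul _
  refine h1.congr_deriv ?_
  rw [Finset.sum_range_succ']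
  simp only [Nat.cast_zero, zero_mul, mul_zero, add_zero]
  refine Finset.sum_congr rfl fun l _ => ?_
  have : (l.factorial : ℝ) ≠ 0 := by positivity
  have : ((l:ℝ) + 1) ≠ 0 := by positivity
  rw [Nat.factorial_succ, Nat.add_sub_cancel]
  push_cast
  field_simp

theorem approx_big (hr : 2 ≤ r) (hN : r ≤ N + 1) (hk : k ≤ r - 2) (hγ : 1 ≤ γ) (hp : IsPartition N x)
    (hm : IsMeshSize N x h) (hq : QuasiUniform N x h γ) {f : ℝ → ℝ} (hf : ContDiff ℝ r f) :
    ∃ s ∈ Sh N r k x, s 0 = f 0 ∧ s 1 = f 1 ∧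
      ∫ y in (0:ℝ)..1, (f y - s y) ^ 2 ≤
        (2 * r * ((1 + r * (r * γ) ^ (r-1)) * (2 * r * h) ^ (r-1))) ^ 2 * h ^ 2 * HS 0 1 r f ∧
      ∫ y in (0:ℝ)..1, (deriv f y - deriv s y) ^ 2 ≤
        (2 * r * ((1 + r * (r * γ) ^ (r-1)) * (2 * r * h) ^ (r-2))) ^ 2 * h ^ 2 * HS 0 1 r f := by
  have hsp := spl_Sh (N := N) (r := r) (k := k) (x := x) hr hN hk hp
  have hsch := @schur N r x h γ hr hN
  have hone := @kerE_one N r x hr hN hp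
  have hspd := fun n G y => @spl_hasDeriv N r x n G y hr hN
  obtain ⟨q, hrq⟩ : ∃ q, r = q + 2 := ⟨r - 2, by omega⟩
  have r1 : r - 1 = q + 1 := by omega
  have r2 : r - 2 = q := by omega
  set G : ℝ → ℝ := iteratedDeriv r f with hGd
  have hG : Continuous G := hf.continuous_iteratedDeriv r (by simp)
  set c : ℕ → ℝ := fun l => iteratedDeriv l f 0 with hc
  set s : ℝ → ℝ := fun y => (∑ l ∈ Finset.range (q+2), c l / (l.factorial : ℝ) * y ^ l)
    + (1 / ((q+1).factorial : ℝ)) * spl N r (q+1) x G y with hs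
  have hsS : s ∈ Sh N r k x := by
    refine Sh_add (Sh_sum _ fun l hl => Sh_smul _ (Sh_pow ?_)) (Sh_smul _ ?_)
    · have : l < q + 2 := by simpa using hl
      omega
    · have := hsp G
      rwa [r1] at this
  have hdiff : ∀ y ∈ Icc (0:ℝ) 1, f y - s y = ∑ j ∈ Finset.range N, ∫ t in (x j)..(x (j+1)),
      ((1 / ((q+1).factorial : ℝ)) * G t) * kerE r (q+1) x (mj N r j) y t := by
    intro y hy
    have h1 := peano' (q+1) (g := f) (by exact_mod_cast hrq ▸ hf) hy
    have h2 := spl_eq (r := r) hp hG (q+1) y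
    rw [h1, show iteratedDeriv (q+1+1) f = G by rw [hGd, hrq], hs]
    simp only [mul_assoc, intervalIntegral.integral_const_mul]
    rw [← Finset.mul_sum, ← h2]
    ring
  have hdiff' : ∀ i < N, ∀ y ∈ Ioo (x i) (x (i+1)), deriv f y - deriv s y =
      ∑ j ∈ Finset.range N, ∫ t in (x j)..(x (j+1)),
      ((1 / (q.factorial : ℝ)) * G t) * kerE r q x (mj N r j) y t := by
    intro i hi y hy
    have hy1 : y ∈ Icc (0:ℝ) 1 := ⟨(hp.mem hi.le).1.trans hy.1.le, hy.2.le.trans (hp.mem (i := i+1) hi).2⟩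
    have hds : HasDerivAt s ((∑ l ∈ Finset.range (q+1), c (l+1) / (l.factorial : ℝ) * y ^ l)
        + (1 / ((q+1).factorial : ℝ)) * ((q+1) * spl N r q x G y)) y :=
      (taylor_poly_deriv c q y).add ((hspd q G y (not_knot hp hi hy)).const_mul _)
    have hf' : ContDiff ℝ (q+1 : ℕ) (deriv f) := by
      have h0 : ContDiff ℝ ((q+1:ℕ)+1) f := by
        rw [hrq] at hf; exact_mod_cast hf
      exact (contDiff_succ_iff_deriv.1 h0).2.2
    have h1 := peano' q (g := deriv f) hf' hy1
    have h2 := spl_eq (r := r) hp hG q y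
    rw [h1, show iteratedDeriv (q+1) (deriv f) = G by rw [hGd, hrq, ← iteratedDeriv_succ'], hds.deriv]
    simp only [mul_assoc, intervalIntegral.integral_const_mul, ← iteratedDeriv_succ']
    rw [← Finset.mul_sum, ← h2]
    have e1 : (1 / ((q+1).factorial : ℝ)) * ((q+1) * spl N r q x G y)
        = (1 / (q.factorial : ℝ)) * spl N r q x G y := by
      have : (q.factorial : ℝ) ≠ 0 := by positivity
      have : ((q:ℝ) + 1) ≠ 0 := by positivity
      rw [Nat.factorial_succ]; push_cast; field_simp
    rw [e1]
    ring
  have hGs : ∀ n : ℕ, ∫ t in (0:ℝ)..1, ((1 / (n.factorial : ℝ)) * G t) ^ 2 ≤ HS 0 1 r f := by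
    intro n
    refine le_trans ?_ (HS_term (by norm_num) le_rfl)
    refine int_mono (by norm_num) (BI.of_continuous (by fun_prop)) (BI.of_continuous (by fun_prop)) fun t _ => ?_
    have h1 : (1:ℝ) ≤ n.factorial := by exact_mod_cast Nat.succ_le_of_lt (Nat.factorial_pos n)
    have h2 : 1 / (n.factorial : ℝ) ≤ 1 := by rw [div_le_one (by positivity)]; exact h1
    rw [mul_pow]
    have h3 : (1 / (n.factorial : ℝ)) ^ 2 ≤ 1 := pow_le_one₀ (by positivity) h2
    nlinarith [sq_nonneg (G t)]
  have hf1 : ContDiff ℝ 1 f := hf.of_le (by exact_mod_cast (by omega : 1 ≤ r))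
  have hfP : PC 0 1 f := PC.of_contDiff hf1
  have hsP := Sh_PC hp hsS
  refine ⟨s, hsS, ?_, ?_, ?_, ?_⟩
  · have h1 : spl N r (q+1) x G 0 = 0 := by
      refine Finset.sum_eq_zero fun j hj => Finset.sum_eq_zero fun i hi => ?_
      have h1 : j < N := by simpa using hj
      have h2 : i < r := by simpa using hi
      have := mj_facts hN hr h1
      have := (hp.mem (i := mj N r j + i) (by omega)).1
      rw [pw_nonpos (by linarith), mul_zero]
    simp only [hs, h1]
    rw [Finset.sum_range_succ']
    simp [hc]
  · have h1 := hdiff 1 (by simp)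
    rw [Finset.sum_eq_zero] at h1
    · linarith
    · intro j hj
      have hj' : j < N := by simpa using hj
      rw [intervalIntegral.integral_congr (g := fun _ => (0:ℝ))]
      · simp
      · intro t ht
        rw [uIcc_of_le (hp.2.2 j hj').le] at ht
        have := hone hj' (ht.2.trans (hp.mem (i := j+1) hj').2)
        rw [r1] at this
        simp only [this, mul_zero]
  · have h1 := hsch (n := q+1) (by omega) hp hm hq hγ (G := fun t => (1 / ((q+1).factorial : ℝ)) * G t)
      (F := fun y => f y - s y) (by fun_prop) (hfP.bi.sub hsP.bi) (fun i hi y hy => hdiff y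
        ⟨(hp.mem hi.le).1.trans hy.1.le, hy.2.le.trans (hp.mem (i := i+1) hi).2⟩)
    rw [← r1] at h1
    refine h1.trans (mul_le_mul_of_nonneg_left ?_ (by positivity))
    rw [r1]; exact hGs _
  · have h1 := hsch (n := q) (by omega) hp hm hq hγ (G := fun t => (1 / (q.factorial : ℝ)) * G t)
      (F := fun y => deriv f y - deriv s y) (by fun_prop) (hfP.bi_deriv.sub hsP.bi_deriv) hdiff'
    rw [r2]
    exact h1.trans (mul_le_mul_of_nonneg_left (hGs _) (by positivity))

theorem approx_small (hr : 2 ≤ r) (hp : IsPartition N x) {f : ℝ → ℝ} (hf : ContDiff ℝ r f) :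
    ∃ s ∈ Sh N r k x, s 0 = f 0 ∧ s 1 = f 1 ∧
      ∫ y in (0:ℝ)..1, (f y - s y) ^ 2 ≤ 18 * HS 0 1 r f ∧
      ∫ y in (0:ℝ)..1, (deriv f y - deriv s y) ^ 2 ≤ 18 * HS 0 1 r f := by
  have hf1 : ContDiff ℝ 1 f := hf.of_le (by exact_mod_cast (by omega : 1 ≤ r))
  have hS : (fun y : ℝ => f 0 + (f 1 - f 0) * y ^ 1) ∈ Sh N r k x :=
    Sh_add (Sh_const _) (Sh_smul _ (Sh_pow (by omega)))
  have hd : ∀ y : ℝ, deriv (fun y : ℝ => f 0 + (f 1 - f 0) * y ^ 1) y = f 1 - f 0 := by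
    intro y
    have := ((hasDerivAt_pow 1 y).const_mul (f 1 - f 0)).const_add (f 0)
    rw [this.deriv]; simp
  have b0 : ∀ y ∈ Icc (0:ℝ) 1, f y ^ 2 ≤ 2 * HS 0 1 r f := fun y hy => by
    simpa using HS_sup (by norm_num) hf (j := 0) (by omega) hy
  have b1 : ∀ y ∈ Icc (0:ℝ) 1, deriv f y ^ 2 ≤ 2 * HS 0 1 r f := fun y hy => by
    simpa [iteratedDeriv_one] using HS_sup (by norm_num) hf (j := 1) (by omega) hy
  have a0 := b0 0 (by simp)
  have a1 := b0 1 (by simp)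
  have hfP : PC 0 1 f := PC.of_contDiff hf1
  refine ⟨_, hS, by simp, by simp, ?_, ?_⟩
  · have := int_mono (by norm_num) (hfP.bi.sub (Sh_PC hp hS).bi).sq (BI.const (18 * HS 0 1 r f))
      fun y hy => by
        have h1 := b0 y hy
        have e : f y - (f 0 + (f 1 - f 0) * y ^ 1) = f y - (1 - y) * f 0 - y * f 1 := by ring
        rw [e]
        have h2 : ((1 - y) * f 0) ^ 2 ≤ f 0 ^ 2 := by
          rw [mul_pow]
          have : (1 - y) ^ 2 ≤ 1 := pow_le_one₀ (by linarith [hy.2]) (by linarith [hy.1])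
          nlinarith [sq_nonneg (f 0)]
        have h3 : (y * f 1) ^ 2 ≤ f 1 ^ 2 := by
          rw [mul_pow]
          have : y ^ 2 ≤ 1 := pow_le_one₀ hy.1 hy.2
          nlinarith [sq_nonneg (f 1)]
        nlinarith [sq_nonneg (f y + (1 - y) * f 0), sq_nonneg (f y + y * f 1),
          sq_nonneg ((1 - y) * f 0 - y * f 1)]
    simpa using this
  · simp only [hd]
    have := int_mono (by norm_num) (hfP.bi_deriv.sub (BI.const (f 1 - f 0))).sq (BI.const (18 * HS 0 1 r f))
      fun y hy => by
        have h1 := b1 y hy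
        nlinarith [sq_nonneg (deriv f y + f 1), sq_nonneg (deriv f y - f 0), sq_nonneg (f 0 + f 1)]
    simpa using this

theorem approx_thm (hr : 2 ≤ r) (hγ : 1 ≤ γ) : ∃ C : ℝ, 0 ≤ C ∧
    ∀ (N k : ℕ) (x : ℕ → ℝ) (h : ℝ), k ≤ r - 2 → IsPartition N x → IsMeshSize N x h →
      QuasiUniform N x h γ → ∀ f : ℝ → ℝ, ContDiff ℝ r f →
    ∃ s ∈ Sh N r k x, s 0 = f 0 ∧ s 1 = f 1 ∧
      ∫ y in (0:ℝ)..1, (f y - s y) ^ 2 ≤ C * (h ^ r) ^ 2 * HS 0 1 r f ∧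
      ∫ y in (0:ℝ)..1, (deriv f y - deriv s y) ^ 2 ≤ C * (h ^ (r-1)) ^ 2 * HS 0 1 r f := by
  set A : ℝ := 2 * r * ((1 + r * (r * γ) ^ (r-1)) * (2 * r) ^ r) with hA
  have hr1 : (1:ℝ) ≤ 2 * r := by
    have : (2:ℝ) ≤ r := by exact_mod_cast hr
    linarith
  refine ⟨A ^ 2 + 18 * ((r:ℝ) ^ r) ^ 2, by positivity, fun N k x h hk hp hm hq f hf => ?_⟩
  have hh := mesh_pos hp hm
  have hh1 := mesh_le_one hp hm
  have hH : 0 ≤ HS 0 1 r f := HS_nonneg (by norm_num)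
  rcases le_or_gt r (N+1) with hN | hN
  · obtain ⟨s, h1, h2, h3, h4, h5⟩ := approx_big hr hN hk hγ hp hm hq hf
    have gen : ∀ n, n ≤ r → (2 * r * ((1 + r * (r * γ) ^ (r-1)) * (2 * r * h) ^ n)) ^ 2 * h ^ 2
        ≤ (A ^ 2 + 18 * ((r:ℝ) ^ r) ^ 2) * (h ^ (n+1)) ^ 2 := by
      intro n hn
      have e1 : (2 * r * ((1 + r * (r * γ) ^ (r-1)) * (2 * r * h) ^ n)) ^ 2 * h ^ 2
          = (2 * r * ((1 + r * (r * γ) ^ (r-1)) * (2 * r) ^ n)) ^ 2 * (h ^ (n+1)) ^ 2 := by ring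
      rw [e1]
      refine mul_le_mul_of_nonneg_right ?_ (by positivity)
      have : (2 * r * ((1 + r * (r * γ) ^ (r-1)) * (2 * r) ^ n)) ^ 2 ≤ A ^ 2 := by
        rw [hA]
        gcongr
      have h0 : (0:ℝ) ≤ 18 * ((r:ℝ) ^ r) ^ 2 := by positivity
      linarith
    have g1 := gen (r-1) (by omega)
    have g2 := gen (r-2) (by omega)
    rw [show r - 1 + 1 = r by omega] at g1
    rw [show r - 2 + 1 = r - 1 by omega] at g2
    exact ⟨s, h1, h2, h3, h4.trans (mul_le_mul_of_nonneg_right g1 hH),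
      h5.trans (mul_le_mul_of_nonneg_right g2 hH)⟩
  · obtain ⟨s, h1, h2, h3, h4, h5⟩ := approx_small (k := k) hr hp hf
    have hrh : 1 ≤ (r:ℝ) * h := by
      have h6 := part_le hm (Nat.zero_le N) le_rfl
      rw [hp.1, hp.2.1] at h6
      have h7 : (N:ℝ) ≤ r := by exact_mod_cast (by omega : N ≤ r)
      push_cast at h6
      nlinarith
    have g1 : (1:ℝ) ≤ ((r:ℝ) ^ r) ^ 2 * (h ^ r) ^ 2 := by
      rw [← mul_pow, ← mul_pow]
      exact one_le_pow₀ (one_le_pow₀ hrh)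
    have g2 : (1:ℝ) ≤ ((r:ℝ) ^ r) ^ 2 * (h ^ (r-1)) ^ 2 := by
      refine g1.trans (mul_le_mul_of_nonneg_left ?_ (by positivity))
      gcongr 1
      exact pow_le_pow_of_le_one hh.le hh1 (by omega)
    refine ⟨s, h1, h2, h3, h4.trans (mul_le_mul_of_nonneg_right ?_ hH),
      h5.trans (mul_le_mul_of_nonneg_right ?_ hH)⟩
    · have : 0 ≤ A ^ 2 * (h ^ r) ^ 2 := by positivity
      linarith
    · have : 0 ≤ A ^ 2 * (h ^ (r-1)) ^ 2 := by positivity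
      linarith
end approx

theorem deriv_congr_Icc {a b : ℝ} {f g : ℝ → ℝ} (h : ∀ y ∈ Icc a b, f y = g y) {y : ℝ}
    (hy : y ∈ Ioo a b) : deriv f y = deriv g y := by
  apply Filter.EventuallyEq.deriv_eq
  filter_upwards [Ioo_mem_nhds hy.1 hy.2] with z hz using h z (Ioo_subset_Icc_self hz)

/-- L² orthonormal bases of the finite element spaces -/
theorem Sh_basis {N r k : ℕ} {x : ℕ → ℝ} (hr : 1 ≤ r) (hp : IsPartition N x) (S : Submodule ℝ (ℝ → ℝ))
    (hS : ∀ φ ∈ S, φ ∈ Sh N r k x) :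
    ∃ (M : ℕ) (pts : Fin M → ℝ) (n : ℕ) (e : Fin n → ℝ → ℝ), (∀ i, pts i ∈ Icc (0:ℝ) 1) ∧ (∀ i, e i ∈ S) ∧
      (∀ i j, ∫ x in (0:ℝ)..1, e i x * e j x = if i = j then 1 else 0) ∧
      (∀ φ ∈ S, ∀ y ∈ Icc (0:ℝ) 1, φ y = lin e (fun i => ∫ x in (0:ℝ)..1, φ x * e i x) y) ∧
      ∃ α : Fin n → Fin M → ℝ, ∀ φ ∈ S, ∀ i, ∫ x in (0:ℝ)..1, φ x * e i x = ∑ k, α i k * φ (pts k) := by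
  obtain ⟨pts, h1, h2⟩ := Sh_points (k := k) hr hp
  obtain ⟨n, e, h3⟩ := ortho_exists (by norm_num : (0:ℝ) < 1) S (fun φ h => (hS φ h).1.continuousOn) pts
    (fun φ h => h2 φ (hS φ h)) h1
  exact ⟨N * r, pts, n, e, h1, h3⟩

theorem poly_inv_unit (r : ℕ) (hr : 1 ≤ r) : ∃ C : ℝ, 0 ≤ C ∧ ∀ p : Polynomial ℝ, p.natDegree ≤ r - 1 →
    ∫ y in (0:ℝ)..1, (p.derivative.eval y) ^ 2 ≤ C * ∫ y in (0:ℝ)..1, (p.eval y) ^ 2 := by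
  have hp : IsPartition 1 (fun i : ℕ => (i:ℝ)) := ⟨by simp, by simp, by simp⟩
  obtain ⟨M, pts, n, e, -, he, ho, hl, -⟩ := Sh_basis (k := 0) hr hp (ShS 1 r 0 (fun i : ℕ => (i:ℝ)))
    (fun _ h => h)
  have heP : ∀ i, PC 0 1 (e i) := fun i => Sh_PC hp (he i)
  refine ⟨∑ i, ∫ y in (0:ℝ)..1, deriv (e i) y ^ 2, Finset.sum_nonneg fun _ _ => int_sq_nonneg (by norm_num),
    fun p hd => ?_⟩
  have hpS : (fun y => p.eval y) ∈ ShS 1 r 0 (fun i : ℕ => (i:ℝ)) :=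
    ⟨(by exact_mod_cast p.contDiff_aeval (𝕜 := ℝ) (0:ℕ) : ContDiff ℝ (0:ℕ) fun y => p.eval y).contDiffOn,
      fun j _ => ⟨p, hd, fun _ _ => rfl⟩⟩
  have h1 := hl _ hpS
  set c : Fin n → ℝ := fun i => ∫ x in (0:ℝ)..1, p.eval x * e i x with hc
  have h2 : ∫ y in (0:ℝ)..1, (p.eval y) ^ 2 = ∑ i, c i ^ 2 := by
    have h3 := lin_norm (by norm_num : (0:ℝ) ≤ 1) (fun i => (heP i).bi) ho c c
    simp only [← pow_two] at h3
    rw [← h3]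
    refine intervalIntegral.integral_congr fun y hy => ?_
    rw [uIcc_of_le (by norm_num)] at hy
    rw [← h1 y hy]
  have h4 : ∫ y in (0:ℝ)..1, (p.derivative.eval y) ^ 2 = ∫ y in (0:ℝ)..1, (∑ i, c i * deriv (e i) y) ^ 2 := by
    apply int_congr_ae (by norm_num)
    filter_upwards [lin_deriv_ae heP c, PC.ae_of (a := 0) (b := 1) ∅ countable_empty fun x hx _ => hx] with y hy hy'
    rw [← hy, ← deriv_congr_Icc h1 hy', Polynomial.deriv]
  have hB : BI 0 1 (fun y => ∑ i, c i * deriv (e i) y) := BI.sum _ fun i _ => (heP i).bi_deriv.const_mul _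
  have hB2 : BI 0 1 (fun y => ∑ i, deriv (e i) y ^ 2) := BI.sum _ fun i _ => (heP i).bi_deriv.sq
  rw [h4, h2]
  have h5 := int_mono (by norm_num) hB.sq (hB2.const_mul (∑ i, c i ^ 2)) fun y _ =>
    Finset.sum_mul_sq_le_sq_mul_sq Finset.univ c (fun i => deriv (e i) y)
  refine h5.trans (le_of_eq ?_)
  rw [intervalIntegral.integral_const_mul, int_sum (by norm_num) _ fun i _ => (heP i).bi_deriv.sq, mul_comm]

theorem poly_inv (r : ℕ) (hr : 1 ≤ r) : ∃ C : ℝ, 0 ≤ C ∧ ∀ p : Polynomial ℝ, p.natDegree ≤ r - 1 →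
    ∀ a b : ℝ, a < b →
    (b - a) ^ 2 * ∫ y in a..b, (p.derivative.eval y) ^ 2 ≤ C * ∫ y in a..b, (p.eval y) ^ 2 := by
  obtain ⟨C, hC, h⟩ := poly_inv_unit r hr
  refine ⟨C, hC, fun p hd a b hab => ?_⟩
  have hL : b - a ≠ 0 := by linarith
  have hL' : 0 < b - a := by linarith
  set q : Polynomial ℝ := p.comp (Polynomial.C (b - a) * Polynomial.X + Polynomial.C a) with hq
  have hqd : q.natDegree ≤ r - 1 := by
    refine Polynomial.natDegree_comp_le.trans ?_
    have : (Polynomial.C (b - a) * Polynomial.X + Polynomial.C a).natDegree ≤ 1 :=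
      Polynomial.natDegree_linear_le
    calc _ ≤ p.natDegree * 1 := Nat.mul_le_mul_left _ this
      _ ≤ _ := by omega
  have h1 := h q hqd
  have e1 : ∀ y, q.eval y = p.eval ((b - a) * y + a) := by intro y; simp [hq]
  have e2 : ∀ y, q.derivative.eval y = (b - a) * p.derivative.eval ((b - a) * y + a) := by
    intro y; simp [hq, Polynomial.derivative_comp]
  simp only [e1, e2, mul_pow] at h1
  rw [intervalIntegral.integral_const_mul,
    intervalIntegral.integral_comp_mul_add (fun y => (p.derivative.eval y) ^ 2) hL a,
    intervalIntegral.integral_comp_mul_add (fun y => (p.eval y) ^ 2) hL a] at h1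
  simp only [mul_zero, zero_add, mul_one, sub_add_cancel, smul_eq_mul] at h1
  have h2 := mul_le_mul_of_nonneg_left h1 hL'.le
  have e3 : ∀ A B : ℝ, (b - a) * (B * ((b - a)⁻¹ * A)) = B * A := by
    intro A B; field_simp
  rw [e3, e3] at h2
  exact h2

section inv
variable {N r k : ℕ} {x : ℕ → ℝ} {h γ : ℝ}

theorem inv_ineq (r : ℕ) (hr : 1 ≤ r) {γ : ℝ} (hγ : 1 ≤ γ) : ∃ C : ℝ, 0 ≤ C ∧
    ∀ (N k : ℕ) (x : ℕ → ℝ) (h : ℝ), IsPartition N x → IsMeshSize N x h →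
      QuasiUniform N x h γ → ∀ φ ∈ Sh N r k x,
      h ^ 2 * ∫ y in (0:ℝ)..1, deriv φ y ^ 2 ≤ C * ∫ y in (0:ℝ)..1, φ y ^ 2 := by
  obtain ⟨C, hC, hI⟩ := poly_inv r hr
  refine ⟨γ ^ 2 * C, by positivity, fun N k x h hp hm hq φ hφ => ?_⟩
  have hh := mesh_pos hp hm
  have hP := Sh_PC hp hφ
  rw [int_cells hp hP.bi_deriv.sq, int_cells hp hP.bi.sq, Finset.mul_sum, Finset.mul_sum]
  refine Finset.sum_le_sum fun j hj => ?_
  have hj' : j < N := by simpa using hj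
  have hc := hp.2.2 j hj'
  obtain ⟨p, hd, he⟩ := hφ.2 j hj'
  have e1 : ∫ y in (x j)..(x (j+1)), deriv φ y ^ 2 = ∫ y in (x j)..(x (j+1)), p.derivative.eval y ^ 2 := by
    apply int_congr_ae hc.le
    refine PC.ae_of ∅ countable_empty fun y hy _ => ?_
    rw [deriv_congr_Icc he hy, Polynomial.deriv]
  have e2 : ∫ y in (x j)..(x (j+1)), φ y ^ 2 = ∫ y in (x j)..(x (j+1)), p.eval y ^ 2 := by
    refine intervalIntegral.integral_congr fun y hy => ?_
    rw [uIcc_of_le hc.le] at hy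
    rw [he y hy]
  rw [e1, e2]
  have h1 := hI p hd _ _ hc
  have h2 := hq j hj'
  have h3 : h ^ 2 ≤ γ ^ 2 * (x (j+1) - x j) ^ 2 := by
    rw [← mul_pow]; gcongr
  calc _ ≤ γ ^ 2 * (x (j+1) - x j) ^ 2 * ∫ y in (x j)..(x (j+1)), p.derivative.eval y ^ 2 :=
        mul_le_mul_of_nonneg_right h3 (int_sq_nonneg hc.le)
    _ = γ ^ 2 * ((x (j+1) - x j) ^ 2 * ∫ y in (x j)..(x (j+1)), p.derivative.eval y ^ 2) := by ring
    _ ≤ γ ^ 2 * (C * ∫ y in (x j)..(x (j+1)), p.eval y ^ 2) := mul_le_mul_of_nonneg_left h1 (by positivity)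
    _ = _ := by ring

/-- projection estimates -/
theorem proj_est (hr : 2 ≤ r) (hγ : 1 ≤ γ) : ∃ C : ℝ, 0 ≤ C ∧
    ∀ (N k : ℕ) (x : ℕ → ℝ) (h : ℝ), k ≤ r - 2 → IsPartition N x → IsMeshSize N x h →
      QuasiUniform N x h γ → ∀ f : ℝ → ℝ, ContDiff ℝ r f → ∀ R ∈ Sh N r k x,
      (∀ s ∈ Sh N r k x, s 0 = f 0 → s 1 = f 1 → ∫ y in (0:ℝ)..1, (f y - R y) * (R y - s y) = 0) →
      ∫ y in (0:ℝ)..1, (R y - f y) ^ 2 ≤ C * (h ^ r) ^ 2 * HS 0 1 r f ∧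
      ∫ y in (0:ℝ)..1, (deriv R y - deriv f y) ^ 2 ≤ C * (h ^ (r-1)) ^ 2 * HS 0 1 r f ∧
      ∀ y ∈ Icc (0:ℝ) 1, (R y - f y) ^ 2 ≤ C * h ^ 2 * HS 0 1 r f := by
  obtain ⟨A, hA, hap⟩ := approx_thm (r := r) (γ := γ) hr hγ
  obtain ⟨B, hB, hinv⟩ := inv_ineq r (by omega) hγ
  refine ⟨3 * A + 2 * A + 2 * B * A, by positivity, fun N k x h hk hp hm hq f hf R hR hort => ?_⟩
  obtain ⟨s, hs, s0, s1, e1, e2⟩ := hap N k x h hk hp hm hq f hf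
  have hh := mesh_pos hp hm
  have hh1 := mesh_le_one hp hm
  have hH : 0 ≤ HS 0 1 r f := HS_nonneg (by norm_num)
  have h01 : (0:ℝ) ≤ 1 := by norm_num
  have hfP : PC 0 1 f := PC.of_contDiff (hf.of_le (by exact_mod_cast (by omega : 1 ≤ r)))
  have hRP := Sh_PC hp hR
  have hsP := Sh_PC hp hs
  have o := hort s hs s0 s1
  have pyth : ∫ y in (0:ℝ)..1, (f y - s y) ^ 2 =
      (∫ y in (0:ℝ)..1, (R y - f y) ^ 2) + ∫ y in (0:ℝ)..1, (R y - s y) ^ 2 := by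
    have h1 : ∀ y, (f y - s y) ^ 2 = ((R y - f y) ^ 2 + (R y - s y) ^ 2) + 2 * ((f y - R y) * (R y - s y)) := by
      intro y; ring
    simp only [h1]
    rw [int_add h01 ((hRP.sub hfP).bi.sq.add (hRP.sub hsP).bi.sq)
      (((hfP.sub hRP).bi.mul (hRP.sub hsP).bi).const_mul 2),
      int_add h01 (hRP.sub hfP).bi.sq (hRP.sub hsP).bi.sq, intervalIntegral.integral_const_mul, o]
    ring
  have n1 : 0 ≤ ∫ y in (0:ℝ)..1, (R y - f y) ^ 2 := int_sq_nonneg (f := fun y => R y - f y) h01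
  have n2 : 0 ≤ ∫ y in (0:ℝ)..1, (R y - s y) ^ 2 := int_sq_nonneg (f := fun y => R y - s y) h01
  have a1 : ∫ y in (0:ℝ)..1, (R y - f y) ^ 2 ≤ A * (h ^ r) ^ 2 * HS 0 1 r f := by linarith
  have a2 : ∫ y in (0:ℝ)..1, (R y - s y) ^ 2 ≤ A * (h ^ r) ^ 2 * HS 0 1 r f := by linarith
  have hpw : h ^ r = h * h ^ (r-1) := by
    rw [← pow_succ']; congr 1; omega
  have a3 : ∫ y in (0:ℝ)..1, (deriv R y - deriv s y) ^ 2 ≤ B * A * (h ^ (r-1)) ^ 2 * HS 0 1 r f := by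
    have h1 := hinv N k x h hp hm hq _ (Sh_sub hR hs)
    have h2 : ∫ y in (0:ℝ)..1, deriv (fun y => R y - s y) y ^ 2 = ∫ y in (0:ℝ)..1, (deriv R y - deriv s y) ^ 2 := by
      apply int_congr_ae h01
      filter_upwards [hRP.deriv_sub_ae hsP] with y hy
      rw [hy]
    rw [h2] at h1
    have h3 := h1.trans (mul_le_mul_of_nonneg_left a2 hB)
    rw [hpw] at h3
    have h4 : h ^ 2 * ∫ y in (0:ℝ)..1, (deriv R y - deriv s y) ^ 2
        ≤ h ^ 2 * (B * A * (h ^ (r-1)) ^ 2 * HS 0 1 r f) := by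
      refine h3.trans (le_of_eq ?_); ring
    exact le_of_mul_le_mul_left h4 (by positivity)
  have a4 : ∫ y in (0:ℝ)..1, (deriv R y - deriv f y) ^ 2 ≤ (2 * A + 2 * B * A) * (h ^ (r-1)) ^ 2 * HS 0 1 r f := by
    have h1 := int_mono h01 (hRP.bi_deriv.sub hfP.bi_deriv).sq
      (((hfP.bi_deriv.sub hsP.bi_deriv).sq.const_mul 2).add ((hRP.bi_deriv.sub hsP.bi_deriv).sq.const_mul 2))
      fun y _ => by nlinarith [sq_nonneg ((deriv f y - deriv s y) + (deriv R y - deriv s y))]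
    rw [int_add h01 ((hfP.bi_deriv.sub hsP.bi_deriv).sq.const_mul 2) ((hRP.bi_deriv.sub hsP.bi_deriv).sq.const_mul 2),
      intervalIntegral.integral_const_mul, intervalIntegral.integral_const_mul] at h1
    linarith
  refine ⟨?_, ?_, fun y hy => ?_⟩
  · refine a1.trans ?_
    have : 0 ≤ (2 * A + 2 * A + 2 * B * A) * (h ^ r) ^ 2 * HS 0 1 r f := by positivity
    linarith
  · refine a4.trans ?_
    have : 0 ≤ (3 * A) * (h ^ (r-1)) ^ 2 * HS 0 1 r f := by positivity
    linarith
  · have h1 := sobolev_sharp (by norm_num) (hRP.sub hfP) hy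
    have h2 : ∫ y in (0:ℝ)..1, deriv (fun y => R y - f y) y ^ 2 = ∫ y in (0:ℝ)..1, (deriv R y - deriv f y) ^ 2 := by
      apply int_congr_ae h01
      filter_upwards [hRP.deriv_sub_ae hfP] with y hy
      rw [hy]
    rw [h2] at h1
    have n3 : 0 ≤ ∫ y in (0:ℝ)..1, (deriv R y - deriv f y) ^ 2 := int_sq_nonneg (f := fun y => deriv R y - deriv f y) h01
    set P := ∫ y in (0:ℝ)..1, (R y - f y) ^ 2
    set Q := ∫ y in (0:ℝ)..1, (deriv R y - deriv f y) ^ 2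
    have q1 : P ≤ h ^ 2 * h ^ 2 * (A * HS 0 1 r f) := by
      have : h ^ r ≤ h ^ 2 := pow_le_pow_of_le_one hh.le hh1 hr
      calc P ≤ A * (h ^ r) ^ 2 * HS 0 1 r f := a1
        _ ≤ A * (h ^ 2) ^ 2 * HS 0 1 r f := by gcongr
        _ = _ := by ring
    have q2 : Q ≤ h ^ 2 * ((2 * A + 2 * B * A) * HS 0 1 r f) := by
      have : h ^ (r-1) ≤ h := by
        calc h ^ (r-1) ≤ h ^ 1 := pow_le_pow_of_le_one hh.le hh1 (by omega)
          _ = h := pow_one h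
      calc Q ≤ (2 * A + 2 * B * A) * (h ^ (r-1)) ^ 2 * HS 0 1 r f := a4
        _ ≤ (2 * A + 2 * B * A) * h ^ 2 * HS 0 1 r f := by gcongr
        _ = _ := by ring
    have hsq : 2 * (Real.sqrt P * Real.sqrt Q) ≤ h⁻¹ ^ 2 * P + h ^ 2 * Q := by
      have t1 := Real.sq_sqrt n1
      have t2 := Real.sq_sqrt n3
      have t3 := sq_nonneg (h⁻¹ * Real.sqrt P - h * Real.sqrt Q)
      have t4 : h⁻¹ * h = 1 := inv_mul_cancel₀ hh.ne'
      have t5 : (h⁻¹ * Real.sqrt P - h * Real.sqrt Q) ^ 2 = h⁻¹ ^ 2 * P + h ^ 2 * Q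
          - 2 * (h⁻¹ * h) * (Real.sqrt P * Real.sqrt Q) := by
        rw [← t1, ← t2]; simp only [Real.sqrt_sq_eq_abs, abs_of_nonneg (Real.sqrt_nonneg _)]; ring
      rw [t5, t4] at t3
      linarith
    have q3 : h⁻¹ ^ 2 * P ≤ h ^ 2 * (A * HS 0 1 r f) := by
      calc h⁻¹ ^ 2 * P ≤ h⁻¹ ^ 2 * (h ^ 2 * h ^ 2 * (A * HS 0 1 r f)) := by gcongr
        _ = _ := by field_simp
    have hh2 : h ^ 2 ≤ 1 := pow_le_one₀ hh.le hh1
    have q4 : h ^ 2 * Q ≤ h ^ 2 * ((2 * A + 2 * B * A) * HS 0 1 r f) := by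
      have : h ^ 2 * Q ≤ 1 * Q := mul_le_mul_of_nonneg_right hh2 n3
      linarith
    have q5 : P ≤ h ^ 2 * (A * HS 0 1 r f) := by
      refine q1.trans ?_
      have : 0 ≤ A * HS 0 1 r f := by positivity
      calc h ^ 2 * h ^ 2 * (A * HS 0 1 r f) ≤ 1 * h ^ 2 * (A * HS 0 1 r f) := by gcongr
        _ = _ := by ring
    have q6 : 0 ≤ A * h ^ 2 * HS 0 1 r f := by positivity
    linarith
end inv

lemma PC.deriv_congr_ae {f g : ℝ → ℝ} (h : ∀ y ∈ Icc (0:ℝ) 1, f y = g y) :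
    ∀ᵐ x ∂volume.restrict (Ioc (0:ℝ) 1), deriv f x = deriv g x := by
  refine PC.ae_of ∅ countable_empty fun x hx _ => deriv_congr_Icc h hx

/-- Weak form of the first equation after the shift `z = 2 + η`. -/
lemma weak1 {η u φ : ℝ → ℝ} (hη : PC 0 1 η) (hu : PC 0 1 u) (hφ : PC 0 1 φ)
    (h0 : u 0 = 0) (h1 : u 1 = 0) :
    ip (deriv u) φ + (1/2) * ip (deriv (fun y => η y * u y)) φ
      = - ∫ y in (0:ℝ)..1, (1/2) * ((2 + η y) * u y) * deriv φ y := by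
  have hP : PC 0 1 (fun y => (1/2) * ((2 + η y) * u y)) :=
    (((PC.const 2).add hη).mul hu).const_mul _
  have hb := hP.by_parts zero_le_one hφ
  simp only [h0, h1, mul_zero, zero_mul, sub_zero, zero_sub] at hb
  rw [← hb]
  unfold ip
  rw [← intervalIntegral.integral_const_mul, ← int_add zero_le_one (hu.bi_deriv.mul hφ.bi)
    (((hη.mul hu).bi_deriv.mul hφ.bi).const_mul _)]
  refine int_congr_ae zero_le_one ?_
  filter_upwards [hη.ae_diff, hu.ae_diff] with y h1 h2
  have e1 : deriv (fun y => (1/2) * ((2 + η y) * u y)) y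
      = (1/2) * (deriv η y * u y + (2 + η y) * deriv u y) :=
    (((h1.hasDerivAt.const_add 2).fun_mul h2.hasDerivAt).const_mul (1/2)).deriv
  have e2 : deriv (fun y => η y * u y) y = deriv η y * u y + η y * deriv u y :=
    (h1.hasDerivAt.fun_mul h2.hasDerivAt).deriv
  rw [e1, e2]; ring

lemma weak2 {η u χ : ℝ → ℝ} (hη : PC 0 1 η) (hu : PC 0 1 u) (hχ : PC 0 1 χ)
    (h0 : χ 0 = 0) (h1 : χ 1 = 0) :
    ip (deriv η) χ + (3/2) * ip (fun y => u y * deriv u y) χ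
      + (1/2) * ip (fun y => η y * deriv η y) χ
      = - ∫ y in (0:ℝ)..1, ((1/4) * (2 + η y)^2 + (3/4) * u y ^ 2) * deriv χ y := by
  have hz := (PC.const (a := 0) (b := 1) 2).add hη
  have hP : PC 0 1 (fun y => (1/4) * ((2 + η y) * (2 + η y)) + (3/4) * (u y * u y)) :=
    ((hz.mul hz).const_mul _).add ((hu.mul hu).const_mul _)
  have hb := hP.by_parts zero_le_one hχ
  simp only [h0, h1, mul_zero, sub_zero, zero_sub] at hb
  have e0 : ∫ y in (0:ℝ)..1, ((1/4) * (2 + η y)^2 + (3/4) * u y ^ 2) * deriv χ y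
     = ∫ y in (0:ℝ)..1, ((1/4) * ((2 + η y) * (2 + η y)) + (3/4) * (u y * u y)) * deriv χ y := by
    refine intervalIntegral.integral_congr fun y _ => ?_
    simp only [sq]
  rw [e0, ← hb]
  unfold ip
  have b1 := hη.bi_deriv.mul hχ.bi
  have b2 := ((hu.bi.mul hu.bi_deriv).mul hχ.bi).const_mul (3/2)
  have b3 := ((hη.bi.mul hη.bi_deriv).mul hχ.bi).const_mul (1/2)
  rw [← intervalIntegral.integral_const_mul, ← intervalIntegral.integral_const_mul,
    ← int_add zero_le_one b1 b2, ← int_add zero_le_one (b1.add b2) b3]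
  refine int_congr_ae zero_le_one ?_
  filter_upwards [hη.ae_diff, hu.ae_diff] with y h1 h2
  have a1 := h1.hasDerivAt.const_add 2
  have a2 := h2.hasDerivAt
  have e1 : deriv (fun y => (1/4) * ((2 + η y) * (2 + η y)) + (3/4) * (u y * u y)) y
      = (1/4) * (deriv η y * (2 + η y) + (2 + η y) * deriv η y)
        + (3/4) * (deriv u y * u y + u y * deriv u y) :=
    (((a1.fun_mul a1).const_mul (1/4)).fun_add ((a2.fun_mul a2).const_mul (3/4))).deriv
  rw [e1]; ring

/-- Testing with an expanded function. -/
lemma test_expand {n : ℕ} {e : Fin n → ℝ → ℝ} (he : ∀ i, PC 0 1 (e i))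
    (ho : ∀ i j, ∫ y in (0:ℝ)..1, e i y * e j y = if i = j then 1 else 0)
    {φ g : ℝ → ℝ} (hg : BI 0 1 g)
    (hφ : ∀ y ∈ Icc (0:ℝ) 1, φ y = lin e (fun i => ∫ s in (0:ℝ)..1, φ s * e i s) y) :
    ∫ y in (0:ℝ)..1, lin e (fun i => ∫ s in (0:ℝ)..1, g s * deriv (e i) s) y * φ y
      = ∫ y in (0:ℝ)..1, g y * deriv φ y := by
  have e1 : ∫ y in (0:ℝ)..1, lin e (fun i => ∫ s in (0:ℝ)..1, g s * deriv (e i) s) y * φ y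
    = ∫ y in (0:ℝ)..1, lin e (fun i => ∫ s in (0:ℝ)..1, g s * deriv (e i) s) y
        * lin e (fun i => ∫ s in (0:ℝ)..1, φ s * e i s) y := by
    refine intervalIntegral.integral_congr fun y hy => ?_
    rw [uIcc_of_le zero_le_one] at hy
    show _ * φ y = _
    rw [hφ y hy]
  have e2 : ∫ y in (0:ℝ)..1, g y * deriv φ y
    = ∫ y in (0:ℝ)..1, g y * deriv (lin e (fun i => ∫ s in (0:ℝ)..1, φ s * e i s)) y := by
    refine int_congr_ae zero_le_one ?_
    filter_upwards [PC.deriv_congr_ae hφ] with y hy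
    rw [hy]
  rw [e1, e2, lin_norm zero_le_one (fun i => (he i).bi) ho, int_mul_deriv_lin zero_le_one he hg]
  exact Finset.sum_congr rfl fun i _ => mul_comm _ _

lemma lin_mem {n : ℕ} {S : Submodule ℝ (ℝ → ℝ)} {e : Fin n → ℝ → ℝ} (he : ∀ i, e i ∈ S)
    (c : Fin n → ℝ) : lin e c ∈ S := by
  have : lin e c = ∑ i, c i • e i := by
    ext y; simp [lin, Finset.sum_apply]
  rw [this]
  exact S.sum_mem fun i _ => S.smul_mem _ (he i)

lemma coord_deriv {ι κ : Type*} [Fintype ι] [Fintype κ] {T : ℝ} {c : ℝ → EuclideanSpace ℝ (ι ⊕ κ)}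
    {c' : EuclideanSpace ℝ (ι ⊕ κ)} {t : ℝ} (h : HasDerivWithinAt c c' (Icc 0 T) t) (i : ι ⊕ κ) :
    HasDerivWithinAt (fun s => c s i) (c' i) (Icc 0 T) t :=
  (EuclideanSpace.proj  i : EuclideanSpace ℝ (ι ⊕ κ) →L[ℝ] ℝ).hasFDerivAt.comp_hasDerivWithinAt t h

lemma lin_hasDerivT {ι : Type*} [Fintype ι] {T t : ℝ} {e : ι → ℝ → ℝ} {a : ℝ → ι → ℝ} {a' : ι → ℝ}
    (h : ∀ i, HasDerivWithinAt (fun s => a s i) (a' i) (Icc 0 T) t) (y : ℝ) :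
    HasDerivWithinAt (fun s => lin e (a s) y) (lin e a' y) (Icc 0 T) t := by
  unfold lin
  exact HasDerivWithinAt.fun_sum fun i _ => (h i).mul_const _

/-- Everything about the two orthonormal bases. -/
structure Bas (N r k : ℕ) (x : ℕ → ℝ) {n m : ℕ} (e : Fin n → ℝ → ℝ) (f : Fin m → ℝ → ℝ) : Prop where
  hp : IsPartition N x
  hr : 1 ≤ r
  me : ∀ i, e i ∈ ShS N r k x
  mf : ∀ j, f j ∈ Sh0S N r k x
  oe : ∀ i j, ∫ y in (0:ℝ)..1, e i y * e j y = if i = j then 1 else 0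
  of : ∀ i j, ∫ y in (0:ℝ)..1, f i y * f j y = if i = j then 1 else 0
  xe : ∀ φ ∈ Sh N r k x, ∀ y ∈ Icc (0:ℝ) 1, φ y = lin e (fun i => ∫ s in (0:ℝ)..1, φ s * e i s) y
  xf : ∀ φ ∈ Sh0 N r k x, ∀ y ∈ Icc (0:ℝ) 1, φ y = lin f (fun i => ∫ s in (0:ℝ)..1, φ s * f i s) y
  pe : ∃ (M : ℕ) (pts : Fin M → ℝ) (α : Fin n → Fin M → ℝ), (∀ l, pts l ∈ Icc (0:ℝ) 1) ∧
    ∀ φ ∈ Sh N r k x, ∀ i, ∫ s in (0:ℝ)..1, φ s * e i s = ∑ l, α i l * φ (pts l)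
  pf : ∃ (M : ℕ) (pts : Fin M → ℝ) (α : Fin m → Fin M → ℝ), (∀ l, pts l ∈ Icc (0:ℝ) 1) ∧
    ∀ φ ∈ Sh0 N r k x, ∀ i, ∫ s in (0:ℝ)..1, φ s * f i s = ∑ l, α i l * φ (pts l)

lemma exists_Bas {N r k : ℕ} {x : ℕ → ℝ} (hr : 1 ≤ r) (hp : IsPartition N x) :
    ∃ (n m : ℕ) (e : Fin n → ℝ → ℝ) (f : Fin m → ℝ → ℝ), Bas N r k x e f := by
  obtain ⟨M, pts, n, e, h1, h2, h3, h4, α, h5⟩ := Sh_basis hr hp (ShS N r k x) (fun φ hφ => hφ)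
  obtain ⟨M', pts', m, f, g1, g2, g3, g4, β, g5⟩ :=
    Sh_basis hr hp (Sh0S N r k x) (fun φ hφ => hφ.1)
  exact ⟨n, m, e, f, hp, hr, h2, g2, h3, g3, h4, g4, ⟨M, pts, α, h1, h5⟩, ⟨M', pts', β, g1, g5⟩⟩

namespace Bas
variable {N r k : ℕ} {x : ℕ → ℝ} {n m : ℕ} {e : Fin n → ℝ → ℝ} {f : Fin m → ℝ → ℝ}

lemma pce (B : Bas N r k x e f) (i : Fin n) : PC 0 1 (e i) := Sh_PC B.hp (B.me i)
lemma pcf (B : Bas N r k x e f) (i : Fin m) : PC 0 1 (f i) := Sh_PC B.hp (B.mf i).1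
lemma f0 (B : Bas N r k x e f) (i : Fin m) : f i 0 = 0 := (B.mf i).2.1
lemma f1 (B : Bas N r k x e f) (i : Fin m) : f i 1 = 0 := (B.mf i).2.2
lemma le (B : Bas N r k x e f) (c : Fin n → ℝ) : lin e c ∈ Sh N r k x := lin_mem B.me c
lemma lf (B : Bas N r k x e f) (c : Fin m → ℝ) : lin f c ∈ Sh0 N r k x := lin_mem B.mf c

lemma G_smooth (B : Bas N r k x e f) : ContDiff ℝ 1 (galG 0 1 e f) :=
  galG_contDiff zero_le_one B.pce B.pcf
lemma G_inner (B : Bas N r k x e f) (v) : inner ℝ v (galG 0 1 e f v) = 0 :=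
  galG_inner zero_le_one B.pce B.pcf B.f0 B.f1 v

lemma exist (B : Bas N r k x e f) {T : ℝ} {c : ℝ → EuclideanSpace ℝ (Fin n ⊕ Fin m)}
    (hc : ∀ t ∈ Icc 0 T, HasDerivWithinAt c (galG 0 1 e f (c t)) (Icc 0 T) t) :
    SolvesSSWGalerkin N r k x T
      (fun t y => -2 + lin e (fun i => c t (Sum.inl i)) y)
      (fun t => lin f (fun i => c t (Sum.inr i)))
      (fun t => lin e (fun i => galG 0 1 e f (c t) (Sum.inl i)))
      (fun t => lin f (fun i => galG 0 1 e f (c t) (Sum.inr i))) := by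
  have hcc : ContinuousOn c (Icc 0 T) := fun t ht => (hc t ht).continuousWithinAt
  have hgc : ∀ i, ContinuousOn (fun t => galG 0 1 e f (c t) i) (Icc 0 T) := fun i =>
    (EuclideanSpace.proj  i : EuclideanSpace ℝ (Fin n ⊕ Fin m) →L[ℝ] ℝ).continuous.comp_continuousOn
      (B.G_smooth.continuous.comp_continuousOn hcc)
  refine ⟨fun t ht => ⟨Sh_add (Sh_const _) (B.le _), B.lf _, B.le _, B.lf _⟩, ?_, ?_, ?_⟩
  · intro y hy t ht
    exact ⟨(lin_hasDerivT (fun i => coord_deriv (hc t ht) (Sum.inl i)) y).const_add (-2),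
      lin_hasDerivT (fun i => coord_deriv (hc t ht) (Sum.inr i)) y⟩
  · intro y hy
    unfold lin
    exact ⟨continuousOn_finsetSum _ fun i _ => (hgc _).mul continuousOn_const,
      continuousOn_finsetSum _ fun i _ => (hgc _).mul continuousOn_const⟩
  · intro t ht
    set Z := lin e (fun i => c t (Sum.inl i)) with hZ
    set U := lin f (fun i => c t (Sum.inr i)) with hU
    have pZ : PC 0 1 Z := lin_PC B.pce _
    have pU : PC 0 1 U := lin_PC B.pcf _
    have pη : PC 0 1 (fun y => -2 + Z y) := (PC.const (-2)).add pZ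
    have mU : U ∈ Sh0 N r k x := B.lf _
    refine ⟨fun φ hφ => ?_, fun χ hχ => ?_⟩
    · have := weak1 pη pU (Sh_PC B.hp hφ) mU.2.1 mU.2.2
      rw [add_assoc, this]
      have h2 := test_expand B.pce B.oe (((pZ.bi.mul pU.bi)).const_mul (1/2)) (B.xe φ hφ)
      have h3 : ip (lin e (fun i => galG 0 1 e f (c t) (Sum.inl i))) φ
        = ∫ y in (0:ℝ)..1, 1/2 * (Z y * U y) * deriv φ y := h2
      rw [h3]
      have h4 : ∀ y, 2 + (-2 + Z y) = Z y := fun y => by ring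
      simp only [h4]
      ring
    · have := weak2 pη pU (Sh_PC B.hp hχ.1) hχ.2.1 hχ.2.2
      have h2 := test_expand B.pcf B.of ((pZ.bi.sq.const_mul (1/4)).add (pU.bi.sq.const_mul (3/4)))
        (B.xf χ hχ)
      have h3 : ip (lin f (fun i => galG 0 1 e f (c t) (Sum.inr i))) χ
        = ∫ y in (0:ℝ)..1, (1/4 * Z y ^ 2 + 3/4 * U y ^ 2) * deriv χ y := h2
      have h4 : ∀ y, 2 + (-2 + Z y) = Z y := fun y => by ring
      simp only [h4] at this
      show ip (lin f (fun i => galG 0 1 e f (c t) (Sum.inr i))) χ + ip (deriv (fun y => -2 + Z y)) χ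
        + 3/2 * ip (fun y => U y * deriv U y) χ
        + 1/2 * ip (fun y => (-2 + Z y) * deriv (fun y => -2 + Z y) y) χ = 0
      rw [h3]
      linarith

/-- coordinate vector of a discrete state -/
def cv (e : Fin n → ℝ → ℝ) (f : Fin m → ℝ → ℝ) (η u : ℝ → ℝ) : EuclideanSpace ℝ (Fin n ⊕ Fin m) :=
  WithLp.toLp 2 (Sum.elim (fun i => ∫ s in (0:ℝ)..1, (2 + η s) * e i s) (fun j => ∫ s in (0:ℝ)..1, u s * f j s))

lemma euc_deriv {ι : Type*} [Fintype ι] {T t : ℝ} {c : ℝ → EuclideanSpace ℝ ι} {c' : EuclideanSpace ℝ ι}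
    (h : ∀ i, HasDerivWithinAt (fun s => c s i) (c' i) (Icc 0 T) t) :
    HasDerivWithinAt c c' (Icc 0 T) t := by
  have h1 : HasDerivWithinAt (fun s => (WithLp.ofLp (c s) : ι → ℝ)) (WithLp.ofLp c') (Icc 0 T) t :=
    hasDerivWithinAt_pi.2 h
  have := ((EuclideanSpace.equiv ι ℝ).symm : (ι → ℝ) →L[ℝ] EuclideanSpace ℝ ι).hasFDerivAt.comp_hasDerivWithinAt t h1
  exact this

lemma pt_deriv {M : ℕ} {T : ℝ} {S : Set (ℝ → ℝ)} {g : ℝ → ℝ} {pts : Fin M → ℝ} {α : Fin M → ℝ}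
    (hpts : ∀ l, pts l ∈ Icc (0:ℝ) 1)
    (hα : ∀ φ ∈ S, ∫ s in (0:ℝ)..1, φ s * g s = ∑ l, α l * φ (pts l))
    {w w' : ℝ → ℝ → ℝ} (hw : ∀ t ∈ Icc 0 T, w t ∈ S) (hw' : ∀ t ∈ Icc 0 T, w' t ∈ S)
    (hd : ∀ y ∈ Icc (0:ℝ) 1, ∀ t ∈ Icc 0 T, HasDerivWithinAt (fun s => w s y) (w' t y) (Icc 0 T) t)
    {t : ℝ} (ht : t ∈ Icc 0 T) :
    HasDerivWithinAt (fun s => ∫ y in (0:ℝ)..1, w s y * g y) (∫ y in (0:ℝ)..1, w' t y * g y) (Icc 0 T) t := by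
  rw [hα _ (hw' t ht)]
  have : HasDerivWithinAt (fun s => ∑ l, α l * w s (pts l)) (∑ l, α l * w' t (pts l)) (Icc 0 T) t :=
    HasDerivWithinAt.fun_sum fun l _ => (hd _ (hpts l) t ht).const_mul _
  exact this.congr (fun s hs => hα _ (hw s hs)) (hα _ (hw t ht))

lemma sol_ode (B : Bas N r k x e f) {T : ℝ} {ηh uh dη du : ℝ → ℝ → ℝ}
    (hs : SolvesSSWGalerkin N r k x T ηh uh dη du) {t : ℝ} (ht : t ∈ Icc 0 T) :
    HasDerivWithinAt (fun s => cv e f (ηh s) (uh s)) (galG 0 1 e f (cv e f (ηh t) (uh t))) (Icc 0 T) t := by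
  obtain ⟨hm, hd, -, hw⟩ := hs
  have mz : ∀ t ∈ Icc 0 T, (fun y => 2 + ηh t y) ∈ Sh N r k x := fun t ht =>
    Sh_add (Sh_const 2) (hm t ht).1
  have ez := B.xe _ (mz t ht)
  have eu := B.xf _ (hm t ht).2.1
  have pη := Sh_PC B.hp (hm t ht).1
  have pu := Sh_PC B.hp (hm t ht).2.1.1
  refine euc_deriv fun i => ?_
  rcases i with i | j
  · obtain ⟨M, pts, α, hpts, hα⟩ := B.pe
    have := pt_deriv hpts (fun φ hφ => hα φ hφ i) mz (fun t ht => (hm t ht).2.2.1)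
      (fun y hy t ht => ((hd y hy t ht).1.const_add 2)) ht
    refine this.congr_deriv ?_
    have h1 := (hw t ht).1 (e i) (B.me i)
    rw [add_assoc, weak1 pη pu (B.pce i) (hm t ht).2.1.2.1 (hm t ht).2.1.2.2] at h1
    have h2 : ∫ y in (0:ℝ)..1, dη t y * e i y = ∫ y in (0:ℝ)..1, (1/2) * ((2 + ηh t y) * uh t y) * deriv (e i) y := by
      unfold ip at h1; linarith
    rw [h2]
    show _ = ∫ y in (0:ℝ)..1, 1/2 * (lin e (fun i => ∫ s in (0:ℝ)..1, (2 + ηh t s) * e i s) y * lin f (fun j => ∫ s in (0:ℝ)..1, uh t s * f j s) y) * deriv (e i) y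
    refine intervalIntegral.integral_congr fun y hy => ?_
    rw [uIcc_of_le zero_le_one] at hy
    show 1/2 * ((2 + ηh t y) * uh t y) * deriv (e i) y = _
    rw [ez y hy, eu y hy]
  · obtain ⟨M, pts, α, hpts, hα⟩ := B.pf
    have := pt_deriv hpts (fun φ hφ => hα φ hφ j) (fun t ht => (hm t ht).2.1) (fun t ht => (hm t ht).2.2.2)
      (fun y hy t ht => (hd y hy t ht).2) ht
    refine this.congr_deriv ?_
    have h1 := (hw t ht).2 (f j) (B.mf j)
    have h5 := weak2 pη pu (B.pcf j) (B.f0 j) (B.f1 j)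
    have h2 : ∫ y in (0:ℝ)..1, du t y * f j y = ∫ y in (0:ℝ)..1, ((1/4) * (2 + ηh t y)^2 + (3/4) * uh t y ^ 2) * deriv (f j) y := by
      unfold ip at h1 h5; linarith
    rw [h2]
    show _ = ∫ y in (0:ℝ)..1, (1/4 * lin e (fun i => ∫ s in (0:ℝ)..1, (2 + ηh t s) * e i s) y ^ 2 + 3/4 * lin f (fun j => ∫ s in (0:ℝ)..1, uh t s * f j s) y ^ 2) * deriv (f j) y
    refine intervalIntegral.integral_congr fun y hy => ?_
    rw [uIcc_of_le zero_le_one] at hy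
    show (1/4 * (2 + ηh t y)^2 + 3/4 * uh t y ^ 2) * deriv (f j) y = _
    rw [ez y hy, eu y hy]

lemma proj_coord {g φ w : ℝ → ℝ} {S : Set (ℝ → ℝ)} (hg : BI 0 1 g) (hφ : BI 0 1 φ) (hw : BI 0 1 w)
    (hmem : w ∈ S) (h : ∀ χ ∈ S, ip (fun y => g y - φ y) χ = 0) :
    ∫ y in (0:ℝ)..1, φ y * w y = ∫ y in (0:ℝ)..1, g y * w y := by
  have := h w hmem
  unfold ip at this
  have e : ∫ y in (0:ℝ)..1, (g y - φ y) * w y = (∫ y in (0:ℝ)..1, g y * w y) - ∫ y in (0:ℝ)..1, φ y * w y := by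
    rw [← int_sub zero_le_one (hg.mul hw) (hφ.mul hw)]
    exact intervalIntegral.integral_congr fun y _ => by show _ = _; ring
  linarith

lemma init (B : Bas N r k x e f) {η0 u0 η u : ℝ → ℝ} (hη0 : BI 0 1 η0) (hu0 : BI 0 1 u0)
    (h1 : IsL2ProjOn (Sh N r k x) η0 η) (h2 : IsL2ProjOn (Sh0 N r k x) u0 u) :
    cv e f η u = cv e f η0 u0 := by
  have bη := (Sh_PC B.hp h1.1).bi
  have bu := (Sh_PC B.hp h2.1.1).bi
  unfold cv
  congr 1
  ext i
  rcases i with i | j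
  · refine proj_coord (S := Sh N r k x) (g := fun y => 2 + η0 y) (φ := fun y => 2 + η y) ((BI.const 2).add hη0) ((BI.const 2).add bη) (B.pce i).bi (B.me i) fun χ hχ => ?_
    rw [← h1.2 χ hχ]
    unfold ip
    exact intervalIntegral.integral_congr fun y _ => by show _ = _; ring
  · exact proj_coord hu0 bu (B.pcf j).bi (B.mf j) h2.2

lemma unique (B : Bas N r k x e f) {T : ℝ} {η0 u0 : ℝ → ℝ} (hT : 0 < T) (hη0 : BI 0 1 η0) (hu0 : BI 0 1 u0)
    {ηh uh dη du ηh' uh' dη' du' : ℝ → ℝ → ℝ}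
    (hs : SolvesSSWGalerkin N r k x T ηh uh dη du)
    (h1 : IsL2ProjOn (Sh N r k x) η0 (ηh 0)) (h2 : IsL2ProjOn (Sh0 N r k x) u0 (uh 0))
    (hs' : SolvesSSWGalerkin N r k x T ηh' uh' dη' du')
    (h1' : IsL2ProjOn (Sh N r k x) η0 (ηh' 0)) (h2' : IsL2ProjOn (Sh0 N r k x) u0 (uh' 0)) :
    ∀ t ∈ Icc 0 T, ∀ y ∈ Icc (0:ℝ) 1, ηh t y = ηh' t y ∧ uh t y = uh' t y := by
  intro t ht y hy
  have key := ode_unique (T := T) B.G_smooth B.G_inner (c := fun s => cv e f (ηh s) (uh s))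
    (d := fun s => cv e f (ηh' s) (uh' s))
    (by show cv _ _ _ _ = cv _ _ _ _; rw [B.init hη0 hu0 h1 h2, B.init hη0 hu0 h1' h2'])
    (fun t ht => B.sol_ode hs ht) (fun t ht => B.sol_ode hs' ht) t ht
  have k1 : ∀ i, ∫ s in (0:ℝ)..1, (2 + ηh t s) * e i s = ∫ s in (0:ℝ)..1, (2 + ηh' t s) * e i s :=
    fun i => congrArg (fun v : EuclideanSpace ℝ (Fin n ⊕ Fin m) => v (Sum.inl i)) key
  have k2 : ∀ i, ∫ s in (0:ℝ)..1, uh t s * f i s = ∫ s in (0:ℝ)..1, uh' t s * f i s :=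
    fun i => congrArg (fun v : EuclideanSpace ℝ (Fin n ⊕ Fin m) => v (Sum.inr i)) key
  have a1 := B.xe _ (Sh_add (Sh_const 2) (hs.1 t ht).1) y hy
  have a2 := B.xe _ (Sh_add (Sh_const 2) (hs'.1 t ht).1) y hy
  have b1 := B.xf _ (hs.1 t ht).2.1 y hy
  have b2 := B.xf _ (hs'.1 t ht).2.1 y hy
  simp only [k1] at a1
  simp only [k2] at b1
  exact ⟨by linarith, by linarith⟩

/-- existence with initial values -/
lemma exist_init (B : Bas N r k x e f) {T : ℝ} {η0 u0 : ℝ → ℝ} (hT : 0 < T) (hη0 : BI 0 1 η0) (hu0 : BI 0 1 u0) :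
    ∃ c : ℝ → EuclideanSpace ℝ (Fin n ⊕ Fin m),
      c 0 = cv e f η0 u0 ∧
      (∀ t ∈ Icc 0 T, HasDerivWithinAt c (galG 0 1 e f (c t)) (Icc 0 T) t) ∧
      IsL2ProjOn (Sh N r k x) η0 (fun y => -2 + lin e (fun i => c 0 (Sum.inl i)) y) ∧
      IsL2ProjOn (Sh0 N r k x) u0 (lin f (fun i => c 0 (Sum.inr i))) := by
  obtain ⟨c, hc0, hc⟩ := ode_exists hT.le B.G_smooth B.G_inner (cv e f η0 u0)
  refine ⟨c, hc0, hc, ⟨Sh_add (Sh_const _) (B.le _), ?_⟩, ⟨B.lf _, ?_⟩⟩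
  · intro χ hχ
    rw [hc0]
    show ip (fun y => η0 y - (-2 + lin e (fun i => ∫ s in (0:ℝ)..1, (2 + η0 s) * e i s) y)) χ = 0
    set L := lin e (fun i => ∫ s in (0:ℝ)..1, (2 + η0 s) * e i s) with hL
    have pL : BI 0 1 L := lin_BI (fun i => (B.pce i).bi) _
    have bχ := (Sh_PC B.hp hχ).bi
    have bz : BI 0 1 (fun y => 2 + η0 y) := (BI.const 2).add hη0
    unfold ip
    have e1 : ∫ y in (0:ℝ)..1, (η0 y - (-2 + L y)) * χ y
      = ∫ y in (0:ℝ)..1, ((2 + η0 y) - L y) * lin e (fun i => ∫ s in (0:ℝ)..1, χ s * e i s) y := by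
      refine intervalIntegral.integral_congr fun y hy => ?_
      rw [uIcc_of_le zero_le_one] at hy
      show (η0 y - (-2 + L y)) * χ y = _
      rw [B.xe χ hχ y hy]; ring
    rw [e1, int_lin_mul zero_le_one (fun i => (B.pce i).bi) (bz.sub pL)]
    refine Finset.sum_eq_zero fun i _ => ?_
    have e2 : ∫ y in (0:ℝ)..1, ((2 + η0 y) - L y) * e i y = 0 := by
      have : ∫ y in (0:ℝ)..1, ((2 + η0 y) - L y) * e i y
        = (∫ y in (0:ℝ)..1, (2 + η0 y) * e i y) - ∫ y in (0:ℝ)..1, L y * e i y := by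
        rw [← int_sub zero_le_one (bz.mul (B.pce i).bi) (pL.mul (B.pce i).bi)]
        exact intervalIntegral.integral_congr fun y _ => by show _ = _; ring
      rw [this, lin_ortho zero_le_one (fun i => (B.pce i).bi) B.oe, sub_self]
    rw [e2, mul_zero]
  · intro χ hχ
    rw [hc0]
    show ip (fun y => u0 y - lin f (fun i => ∫ s in (0:ℝ)..1, u0 s * f i s) y) χ = 0
    set L := lin f (fun i => ∫ s in (0:ℝ)..1, u0 s * f i s) with hL
    have pL : BI 0 1 L := lin_BI (fun i => (B.pcf i).bi) _
    unfold ip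
    have e1 : ∫ y in (0:ℝ)..1, (u0 y - L y) * χ y
      = ∫ y in (0:ℝ)..1, (u0 y - L y) * lin f (fun i => ∫ s in (0:ℝ)..1, χ s * f i s) y := by
      refine intervalIntegral.integral_congr fun y hy => ?_
      rw [uIcc_of_le zero_le_one] at hy
      show (u0 y - L y) * χ y = _
      rw [B.xf χ hχ y hy]
    rw [e1, int_lin_mul zero_le_one (fun i => (B.pcf i).bi) (hu0.sub pL)]
    refine Finset.sum_eq_zero fun i _ => ?_
    have e2 : ∫ y in (0:ℝ)..1, (u0 y - L y) * f i y = 0 := by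
      have : ∫ y in (0:ℝ)..1, (u0 y - L y) * f i y
        = (∫ y in (0:ℝ)..1, u0 y * f i y) - ∫ y in (0:ℝ)..1, L y * f i y := by
        rw [← int_sub zero_le_one (hu0.mul (B.pcf i).bi) (pL.mul (B.pcf i).bi)]
        exact intervalIntegral.integral_congr fun y _ => by show _ = _; ring
      rw [this, lin_ortho zero_le_one (fun i => (B.pcf i).bi) B.of, sub_self]
    rw [e2, mul_zero]
end Bas

lemma yng {L a x y : ℝ} (h : |a| ≤ L) : a * x * y ≤ L / 2 * (x ^ 2 + y ^ 2) := by
  have h1 : a * x * y ≤ |a| * (|x| * |y|) := by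
    rw [← abs_mul, ← abs_mul, mul_assoc]; exact le_abs_self _
  have h2 : |x| * |y| ≤ (x ^ 2 + y ^ 2) / 2 := by
    nlinarith [sq_nonneg (|x| - |y|), sq_abs x, sq_abs y]
  have h3 : |a| * (|x| * |y|) ≤ L * ((x ^ 2 + y ^ 2) / 2) :=
    mul_le_mul h h2 (by positivity) ((abs_nonneg a).trans h)
  linarith

lemma yngh {L a x y h : ℝ} (hh : 0 ≤ h) (hL : 0 ≤ L) (ha : |a| ≤ L * h) :
    a * x * y ≤ L / 2 * (x ^ 2 + h ^ 2 * y ^ 2) := by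
  have h1 : a * x * y ≤ |a| * (|x| * |y|) := by
    rw [← abs_mul, ← abs_mul, mul_assoc]; exact le_abs_self _
  have h2 : |x| * (h * |y|) ≤ (x ^ 2 + h ^ 2 * y ^ 2) / 2 := by
    nlinarith [sq_nonneg (|x| - h * |y|), sq_abs x, sq_abs y]
  have h3 : |a| * (|x| * |y|) ≤ L * h * (|x| * |y|) :=
    mul_le_mul_of_nonneg_right ha (by positivity)
  have h4 := mul_le_mul_of_nonneg_left h2 hL
  nlinarith

/-- pointwise bound of the error integrand -/
lemma err_pt {L h z' u' rz ru dz du sz su gz gu gz' gu' : ℝ} (hh : 0 ≤ h) (hL : 0 ≤ L)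
    (hz' : |z'| ≤ L) (hu' : |u'| ≤ L)
    (hrz : |rz| ≤ L) (hru : |ru| ≤ L) (hdz : |dz| ≤ L * h) (hdu : |du| ≤ L * h) :
    -(z' * gu * gz) - (1/2) * (u' * gz * gz) - (3/2) * (u' * gu * gu)
      - (z' * du + sz * ru + dz * u' + rz * su) * gz
      - (dz * z' + rz * sz + 3 * (du * u' + ru * su)) * gu
      + dz * (gu * gz' + gz * gu') + du * (gz * gz' + 3 * (gu * gu'))
    ≤ 10 * L * (gz ^ 2 + gu ^ 2) + 2 * L * (dz ^ 2 + du ^ 2 + sz ^ 2 + su ^ 2)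
      + 2 * L * (h ^ 2 * (gz' ^ 2 + gu' ^ 2)) := by
  have n1 : |-z'| ≤ L := by rwa [abs_neg]
  have n2 : |-u'| ≤ L := by rwa [abs_neg]
  have n3 : |-rz| ≤ L := by rwa [abs_neg]
  have n4 : |-ru| ≤ L := by rwa [abs_neg]
  have a1 := yng (x := gu) (y := gz) n1
  have a2 := yng (x := gz) (y := gz) n2
  have a3 := yng (x := gu) (y := gu) n2
  have a4 := yng (x := du) (y := gz) n1
  have a5 := yng (x := sz) (y := gz) n4
  have a6 := yng (x := dz) (y := gz) n2
  have a7 := yng (x := su) (y := gz) n3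
  have b4 := yng (x := dz) (y := gu) n1
  have b5 := yng (x := sz) (y := gu) n3
  have b6 := yng (x := du) (y := gu) n2
  have b7 := yng (x := su) (y := gu) n4
  have c1 := yngh (x := gu) (y := gz') hh hL hdz
  have c2 := yngh (x := gz) (y := gu') hh hL hdz
  have c3 := yngh (x := gz) (y := gz') hh hL hdu
  have c4 := yngh (x := gu) (y := gu') hh hL hdu
  have p1 := mul_nonneg hL (sq_nonneg gz)
  have p2 := mul_nonneg hL (sq_nonneg gu)
  have p3 := mul_nonneg hL (sq_nonneg dz)
  have p4 := mul_nonneg hL (sq_nonneg du)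
  have p5 := mul_nonneg hL (sq_nonneg sz)
  have p6 := mul_nonneg hL (sq_nonneg su)
  have p7 := mul_nonneg hL (mul_nonneg (sq_nonneg h) (sq_nonneg gz'))
  have p8 := mul_nonneg hL (mul_nonneg (sq_nonneg h) (sq_nonneg gu'))
  linarith [a1, a2, a3, a4, a5, a6, a7, b4, b5, b6, b7, c1, c2, c3, c4, p1, p2, p3, p4, p5, p6, p7, p8]

lemma err_core {L h : ℝ} {Z U Rz Ru gz gu : ℝ → ℝ} (hh : 0 ≤ h) (hL : 0 ≤ L)
    (pZ : PC 0 1 Z) (pU : PC 0 1 U) (pRz : PC 0 1 Rz) (pRu : PC 0 1 Ru)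
    (pgz : PC 0 1 gz) (pgu : PC 0 1 gu)
    (U0 : U 0 = 0) (U1 : U 1 = 0) (Ru0 : Ru 0 = 0) (Ru1 : Ru 1 = 0) (gu0 : gu 0 = 0) (gu1 : gu 1 = 0)
    (bz' : ∀ y ∈ Icc (0:ℝ) 1, |deriv Z y| ≤ L) (bu' : ∀ y ∈ Icc (0:ℝ) 1, |deriv U y| ≤ L)
    (brz : ∀ y ∈ Icc (0:ℝ) 1, |Rz y| ≤ L) (bru : ∀ y ∈ Icc (0:ℝ) 1, |Ru y| ≤ L)
    (bdz : ∀ y ∈ Icc (0:ℝ) 1, |Rz y - Z y| ≤ L * h) (bdu : ∀ y ∈ Icc (0:ℝ) 1, |Ru y - U y| ≤ L * h) :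
    (∫ y in (0:ℝ)..1, ((Rz y + gz y) * (Ru y + gu y) - Z y * U y) * deriv gz y)
      + (∫ y in (0:ℝ)..1, (1/2) * ((Rz y + gz y)^2 - Z y ^ 2 + 3 * ((Ru y + gu y)^2 - U y ^ 2)) * deriv gu y)
    ≤ 10 * L * ((∫ y in (0:ℝ)..1, gz y ^ 2) + ∫ y in (0:ℝ)..1, gu y ^ 2)
      + 2 * L * ((∫ y in (0:ℝ)..1, (Rz y - Z y) ^ 2) + (∫ y in (0:ℝ)..1, (Ru y - U y) ^ 2)
        + (∫ y in (0:ℝ)..1, (deriv Rz y - deriv Z y) ^ 2) + ∫ y in (0:ℝ)..1, (deriv Ru y - deriv U y) ^ 2)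
      + 2 * L * (h ^ 2 * ((∫ y in (0:ℝ)..1, deriv gz y ^ 2) + ∫ y in (0:ℝ)..1, deriv gu y ^ 2)) := by
  let W : ℝ → ℝ := fun y => Z y * (gu y * gz y) + (1/2) * (U y * (gz y * gz y)) + (3/2) * (U y * (gu y * gu y))
    + (1/2) * (gz y * gz y * gu y) + (1/2) * (gu y * gu y * gu y)
    + (Rz y * Ru y - Z y * U y) * gz y
    + (1/2) * (((Rz y * Rz y - Z y * Z y) + 3 * (Ru y * Ru y - U y * U y)) * gu y)
  have pW : PC 0 1 W :=
    ((((((pZ.mul (pgu.mul pgz)).add ((pU.mul (pgz.mul pgz)).const_mul (1/2))).add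
      ((pU.mul (pgu.mul pgu)).const_mul (3/2))).add (((pgz.mul pgz).mul pgu).const_mul (1/2))).add
      (((pgu.mul pgu).mul pgu).const_mul (1/2))).add
      (((pRz.mul pRu).sub (pZ.mul pU)).mul pgz)).add
      (((((pRz.mul pRz).sub (pZ.mul pZ)).add (((pRu.mul pRu).sub (pU.mul pU)).const_mul 3)).mul pgu).const_mul (1/2))
  have hW : ∫ y in (0:ℝ)..1, deriv W y = 0 := by
    rw [pW.int_deriv zero_le_one]
    simp only [W, U0, U1, Ru0, Ru1, gu0, gu1]; ring
  have bdZ := pRz.bi.sub pZ.bi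
  have bdU := pRu.bi.sub pU.bi
  have bsZ := pRz.bi_deriv.sub pZ.bi_deriv
  have bsU := pRu.bi_deriv.sub pU.bi_deriv
  have I1 : BI 0 1 (fun y => ((Rz y + gz y) * (Ru y + gu y) - Z y * U y) * deriv gz y) :=
    (((pRz.bi.add pgz.bi).mul (pRu.bi.add pgu.bi)).sub (pZ.bi.mul pU.bi)).mul pgz.bi_deriv
  have I2 : BI 0 1 (fun y => (1/2) * ((Rz y + gz y)^2 - Z y ^ 2 + 3 * ((Ru y + gu y)^2 - U y ^ 2)) * deriv gu y) :=
    (((((pRz.bi.add pgz.bi).sq.sub pZ.bi.sq).add (((pRu.bi.add pgu.bi).sq.sub pU.bi.sq).const_mul 3)).const_mul (1/2)).mul pgu.bi_deriv)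
  have A1 := (pgz.bi.sq.add pgu.bi.sq).const_mul (10 * L)
  have A2 := (((bdZ.sq.add bdU.sq).add bsZ.sq).add bsU.sq).const_mul (2 * L)
  have A3 := ((pgz.bi_deriv.sq.add pgu.bi_deriv.sq).const_mul (h ^ 2)).const_mul (2 * L)
  have key : (∫ y in (0:ℝ)..1, (((Rz y + gz y) * (Ru y + gu y) - Z y * U y) * deriv gz y
      + (1/2) * ((Rz y + gz y)^2 - Z y ^ 2 + 3 * ((Ru y + gu y)^2 - U y ^ 2)) * deriv gu y))
    ≤ ∫ y in (0:ℝ)..1, ((10 * L * (gz y ^ 2 + gu y ^ 2) + 2 * L * ((Rz y - Z y) ^ 2 + (Ru y - U y) ^ 2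
        + (deriv Rz y - deriv Z y) ^ 2 + (deriv Ru y - deriv U y) ^ 2)
        + 2 * L * (h ^ 2 * (deriv gz y ^ 2 + deriv gu y ^ 2))) + deriv W y) := by
    refine int_mono_ae zero_le_one (I1.add I2) (((A1.add A2).add A3).add pW.bi_deriv) ?_
    filter_upwards [pZ.ae_diff, pU.ae_diff, pRz.ae_diff, pRu.ae_diff, pgz.ae_diff, pgu.ae_diff,
      ae_restrict_mem measurableSet_Ioc] with y d1 d2 d3 d4 d5 d6 hy
    have hy' : y ∈ Icc (0:ℝ) 1 := ⟨hy.1.le, hy.2⟩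
    have h1 := d1.hasDerivAt
    have h2 := d2.hasDerivAt
    have h3 := d3.hasDerivAt
    have h4 := d4.hasDerivAt
    have h5 := d5.hasDerivAt
    have h6 := d6.hasDerivAt
    have eW := (((((((h1.fun_mul (h6.fun_mul h5)).fun_add ((h2.fun_mul (h5.fun_mul h5)).const_mul (1/2))).fun_add
      ((h2.fun_mul (h6.fun_mul h6)).const_mul (3/2))).fun_add (((h5.fun_mul h5).fun_mul h6).const_mul (1/2))).fun_add
      (((h6.fun_mul h6).fun_mul h6).const_mul (1/2))).fun_add
      (((h3.fun_mul h4).fun_sub (h1.fun_mul h2)).fun_mul h5)).fun_add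
      (((((h3.fun_mul h3).fun_sub (h1.fun_mul h1)).fun_add (((h4.fun_mul h4).fun_sub (h2.fun_mul h2)).const_mul 3)).fun_mul h6).const_mul (1/2))).deriv
    have eW' : deriv W y = _ := eW
    rw [eW']
    have := err_pt (gz := gz y) (gu := gu y) (gz' := deriv gz y) (gu' := deriv gu y)
      (sz := deriv Rz y - deriv Z y) (su := deriv Ru y - deriv U y) hh hL (bz' y hy') (bu' y hy')
      (brz y hy') (bru y hy') (bdz y hy') (bdu y hy')
    linear_combination this
  rw [int_add zero_le_one I1 I2, int_add zero_le_one ((A1.add A2).add A3) pW.bi_deriv, hW,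
    int_add zero_le_one (A1.add A2) A3, int_add zero_le_one A1 A2,
    intervalIntegral.integral_const_mul, intervalIntegral.integral_const_mul,
    intervalIntegral.integral_const_mul, intervalIntegral.integral_const_mul,
    int_add zero_le_one pgz.bi.sq pgu.bi.sq, int_add zero_le_one pgz.bi_deriv.sq pgu.bi_deriv.sq,
    int_add zero_le_one ((bdZ.sq.add bdU.sq).add bsZ.sq) bsU.sq,
    int_add zero_le_one (bdZ.sq.add bdU.sq) bsZ.sq, int_add zero_le_one bdZ.sq bdU.sq] at key
  linarith

lemma orth_gen {n : ℕ} {e : Fin n → ℝ → ℝ} (he : ∀ i, BI 0 1 (e i))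
    (ho : ∀ i j, ∫ y in (0:ℝ)..1, e i y * e j y = if i = j then 1 else 0) {g w : ℝ → ℝ} (hg : BI 0 1 g)
    (hw : ∀ y ∈ Icc (0:ℝ) 1, w y = lin e (fun i => ∫ s in (0:ℝ)..1, w s * e i s) y) :
    ∫ y in (0:ℝ)..1, (g y - lin e (fun i => ∫ s in (0:ℝ)..1, g s * e i s) y) * w y = 0 := by
  set L := lin e (fun i => ∫ s in (0:ℝ)..1, g s * e i s) with hL
  have pL : BI 0 1 L := lin_BI he _
  have e1 : ∫ y in (0:ℝ)..1, (g y - L y) * w y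
      = ∫ y in (0:ℝ)..1, (g y - L y) * lin e (fun i => ∫ s in (0:ℝ)..1, w s * e i s) y := by
    refine intervalIntegral.integral_congr fun y hy => ?_
    rw [uIcc_of_le zero_le_one] at hy
    show (g y - L y) * w y = _
    rw [hw y hy]
  rw [e1, int_lin_mul zero_le_one he (hg.sub pL)]
  refine Finset.sum_eq_zero fun i _ => ?_
  have : ∫ y in (0:ℝ)..1, (g y - L y) * e i y
      = (∫ y in (0:ℝ)..1, g y * e i y) - ∫ y in (0:ℝ)..1, L y * e i y := by
    rw [← int_sub zero_le_one (hg.mul (he i)) (pL.mul (he i))]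
    exact intervalIntegral.integral_congr fun y _ => by show _ = _; ring
  rw [this, lin_ortho zero_le_one he ho, sub_self, mul_zero]

lemma wk_z {Z U Z1 e : ℝ → ℝ} (hZ : ContDiff ℝ 1 Z) (hU : ContDiff ℝ 1 U) (he : PC 0 1 e)
    (h0 : U 0 = 0) (h1 : U 1 = 0) (hz : ∀ y ∈ Icc (0:ℝ) 1, Z1 y = - Gz Z U y) :
    ∫ y in (0:ℝ)..1, Z1 y * e y = ∫ y in (0:ℝ)..1, (1/2) * (Z y * U y) * deriv e y := by
  have pZ := PC.of_contDiff (a := 0) (b := 1) hZ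
  have pU := PC.of_contDiff (a := 0) (b := 1) hU
  have hb := ((pZ.mul pU).const_mul (1/2)).by_parts zero_le_one he
  simp only [h0, h1, mul_zero, zero_mul, zero_sub, sub_zero] at hb
  have e1 : ∫ y in (0:ℝ)..1, Z1 y * e y = - ∫ y in (0:ℝ)..1, deriv (fun y => 1/2 * (Z y * U y)) y * e y := by
    rw [← intervalIntegral.integral_neg]
    refine intervalIntegral.integral_congr fun y hy => ?_
    rw [uIcc_of_le zero_le_one] at hy
    show Z1 y * e y = _
    have d1 := (hZ.differentiable one_ne_zero y).hasDerivAt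
    have d2 := (hU.differentiable one_ne_zero y).hasDerivAt
    rw [hz y hy, ((d1.fun_mul d2).const_mul (1/2)).deriv, Gz]; ring
  rw [e1, hb, neg_neg]

lemma wk_u {Z U U1 e : ℝ → ℝ} (hZ : ContDiff ℝ 1 Z) (hU : ContDiff ℝ 1 U) (he : PC 0 1 e)
    (h0 : e 0 = 0) (h1 : e 1 = 0) (hz : ∀ y ∈ Icc (0:ℝ) 1, U1 y = - Gu Z U y) :
    ∫ y in (0:ℝ)..1, U1 y * e y = ∫ y in (0:ℝ)..1, ((1/4) * Z y ^ 2 + (3/4) * U y ^ 2) * deriv e y := by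
  have pZ := PC.of_contDiff (a := 0) (b := 1) hZ
  have pU := PC.of_contDiff (a := 0) (b := 1) hU
  have hb := (((pZ.mul pZ).const_mul (1/4)).add ((pU.mul pU).const_mul (3/4))).by_parts zero_le_one he
  simp only [h0, h1, mul_zero, zero_sub, sub_zero] at hb
  have e1 : ∫ y in (0:ℝ)..1, U1 y * e y
      = - ∫ y in (0:ℝ)..1, deriv (fun y => 1/4 * (Z y * Z y) + 3/4 * (U y * U y)) y * e y := by
    rw [← intervalIntegral.integral_neg]
    refine intervalIntegral.integral_congr fun y hy => ?_
    rw [uIcc_of_le zero_le_one] at hy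
    show U1 y * e y = _
    have d1 := (hZ.differentiable one_ne_zero y).hasDerivAt
    have d2 := (hU.differentiable one_ne_zero y).hasDerivAt
    rw [hz y hy, (((d1.fun_mul d1).const_mul (1/4)).fun_add ((d2.fun_mul d2).const_mul (3/4))).deriv, Gu]; ring
  rw [e1, hb, neg_neg]
  refine intervalIntegral.integral_congr fun y hy => ?_
  show _ = _
  ring

/-- derivative of the moments in time -/
lemma mom_deriv {T : ℝ} {Z Z1 : ℝ → ℝ → ℝ} {e : ℝ → ℝ} (he : ContinuousOn e (Icc 0 1))
    (hd : ∀ t ∈ Icc 0 T, ∀ y ∈ Icc (0:ℝ) 1, HasDerivWithinAt (fun s => Z s y) (Z1 t y) (Icc 0 T) t)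
    (hc : ContinuousOn (fun p : ℝ × ℝ => Z1 p.1 p.2) (Icc 0 T ×ˢ Icc 0 1))
    (hs : ∀ t ∈ Icc 0 T, Continuous (Z t)) {t : ℝ} (ht : t ∈ Icc 0 T) :
    HasDerivWithinAt (fun s => ∫ y in (0:ℝ)..1, Z s y * e y) (∫ y in (0:ℝ)..1, Z1 t y * e y) (Icc 0 T) t := by
  refine int_hasDeriv (f := fun s y => Z s y * e y) (f1 := fun s y => Z1 s y * e y) ?_ ?_ ?_ t ht
  · exact fun t ht y hy => (hd t ht y hy).mul_const _
  · exact hc.mul (he.comp continuousOn_snd fun p hp => hp.2)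
  · exact fun t ht => (hs t ht).continuousOn.mul he

lemma abs_le_of_sq {a x : ℝ} (h : a ^ 2 ≤ x) : |a| ≤ 1 + x := by
  have hx : 0 ≤ x := (sq_nonneg a).trans h
  refine abs_le_of_sq_le_sq (a := a) (b := 1 + x) ?_ (by linarith)
  nlinarith

lemma abs_le_of_sq_h {a x h : ℝ} (hh : 0 ≤ h) (hx : 0 ≤ x) (H : a ^ 2 ≤ h ^ 2 * x) : |a| ≤ (1 + x) * h := by
  refine abs_le_of_sq_le_sq (a := a) (b := (1 + x) * h) ?_ (by positivity)
  nlinarith [mul_nonneg (sq_nonneg h) hx, mul_nonneg (sq_nonneg h) (sq_nonneg x), sq_nonneg h]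

lemma lin_addv {n : ℕ} {e : Fin n → ℝ → ℝ} (a b : Fin n → ℝ) (y : ℝ) :
    lin e b y = lin e a y + lin e (fun i => b i - a i) y := by
  unfold lin
  rw [← Finset.sum_add_distrib]
  exact Finset.sum_congr rfl fun i _ => by ring

/-- The differential inequality at a fixed time. -/
lemma err_step {r : ℕ} {γ : ℝ} (hr : 2 ≤ r) (hγ : 1 ≤ γ) {K : ℝ} (hK : 0 ≤ K) :
    ∃ K1 e0 D : ℝ, 0 ≤ K1 ∧ 0 ≤ e0 ∧ 0 ≤ D ∧ ∀ (N k : ℕ) (x : ℕ → ℝ) (h : ℝ), k ≤ r - 2 → IsPartition N x → IsMeshSize N x h →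
      QuasiUniform N x h γ → ∀ (n m : ℕ) (e : Fin n → ℝ → ℝ) (f : Fin m → ℝ → ℝ), Bas N r k x e f →
      ∀ Z U : ℝ → ℝ, ContDiff ℝ r Z → ContDiff ℝ r U → U 0 = 0 → U 1 = 0 → HS 0 1 r Z + HS 0 1 r U ≤ K →
      ∀ (a : Fin n → ℝ) (b : Fin m → ℝ) (Rz Ru : ℝ → ℝ),
        Rz = lin e (fun i => ∫ s in (0:ℝ)..1, Z s * e i s) → Ru = lin f (fun i => ∫ s in (0:ℝ)..1, U s * f i s) →
      (∫ y in (0:ℝ)..1, ((Rz y + lin e a y) * (Ru y + lin f b y) - Z y * U y) * deriv (lin e a) y)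
      + (∫ y in (0:ℝ)..1, (1/2) * ((Rz y + lin e a y)^2 - Z y ^ 2 + 3 * ((Ru y + lin f b y)^2 - U y ^ 2)) * deriv (lin f b) y)
      ≤ K1 * (∑ i, a i ^ 2 + ∑ j, b j ^ 2) + e0 * (h ^ (r-1)) ^ 2 ∧
      ∫ y in (0:ℝ)..1, (Rz y - Z y) ^ 2 ≤ D * (h ^ (r-1)) ^ 2 ∧
      ∫ y in (0:ℝ)..1, (Ru y - U y) ^ 2 ≤ D * (h ^ (r-1)) ^ 2 := by
  obtain ⟨Cp, hCp, Hp⟩ := proj_est hr hγ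
  obtain ⟨Ci, hCi, Hi⟩ := inv_ineq r (by omega) hγ
  set L := 2 + 2 * K + Cp * K with hLdef
  have hCK : 0 ≤ Cp * K := mul_nonneg hCp hK
  have hL : 0 ≤ L := by positivity
  refine ⟨10 * L + 2 * L * Ci, 2 * L * (4 * (Cp * K)), Cp * K, by positivity, by positivity, hCK, ?_⟩
  intro N k x h hk hp hm hq n m e f B Z U cZ cU U0 U1 hHS a b Rz Ru eRz eRu
  have hh := mesh_pos hp hm
  have hh1 := mesh_le_one hp hm
  have hZK : HS 0 1 r Z ≤ K := by linarith [HS_nonneg (a := 0) (b := 1) (m := r) (f := U) zero_le_one]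
  have hUK : HS 0 1 r U ≤ K := by linarith [HS_nonneg (a := 0) (b := 1) (m := r) (f := Z) zero_le_one]
  have cZ1 : ContDiff ℝ 1 Z := cZ.of_le (by exact_mod_cast (by omega : 1 ≤ r))
  have cU1 : ContDiff ℝ 1 U := cU.of_le (by exact_mod_cast (by omega : 1 ≤ r))
  have pZ := PC.of_contDiff (a := 0) (b := 1) cZ1
  have pU := PC.of_contDiff (a := 0) (b := 1) cU1
  have mRz : Rz ∈ Sh N r k x := by rw [eRz]; exact B.le _
  have mRu : Ru ∈ Sh0 N r k x := by rw [eRu]; exact B.lf _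
  obtain ⟨z1, z2, z3⟩ := Hp N k x h hk hp hm hq Z cZ Rz mRz (fun s hs _ _ => by
    rw [eRz]
    exact orth_gen (fun i => (B.pce i).bi) B.oe pZ.bi (B.xe _ (Sh_sub (eRz ▸ mRz) hs)))
  obtain ⟨u1, u2, u3⟩ := Hp N k x h hk hp hm hq U cU Ru mRu.1 (fun s hs s0 s1 => by
    rw [eRu]
    have hmem : (fun y => lin f (fun i => ∫ s in (0:ℝ)..1, U s * f i s) y - s y) ∈ Sh0 N r k x := by
      have h2 := eRu ▸ mRu
      exact ⟨Sh_sub h2.1 hs, by show _ - _ = (0:ℝ); rw [h2.2.1, s0, U0, sub_zero], by show _ - _ = (0:ℝ); rw [h2.2.2, s1, U1, sub_zero]⟩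
    exact orth_gen (fun i => (B.pcf i).bi) B.of pU.bi (B.xf _ hmem))
  have H0 : 0 ≤ (h ^ (r-1)) ^ 2 := sq_nonneg _
  have Hle : (h ^ r) ^ 2 ≤ (h ^ (r-1)) ^ 2 := by
    have : h ^ r ≤ h ^ (r-1) := pow_le_pow_of_le_one hh.le hh1 (by omega)
    exact pow_le_pow_left₀ (by positivity) this 2
  have bnd : ∀ {q H X : ℝ}, q ≤ Cp * H * X → 0 ≤ H → X ≤ K → H ≤ (h ^ (r-1)) ^ 2 → q ≤ Cp * K * (h ^ (r-1)) ^ 2 := by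
    intro q H X h1 h2 h3 h4
    calc q ≤ Cp * H * X := h1
      _ ≤ Cp * H * K := mul_le_mul_of_nonneg_left h3 (by positivity)
      _ = Cp * K * H := by ring
      _ ≤ _ := mul_le_mul_of_nonneg_left h4 hCK
  have Z1 := bnd z1 (by positivity) hZK Hle
  have Z2 := bnd z2 (by positivity) hZK le_rfl
  have V1 := bnd u1 (by positivity) hUK Hle
  have V2 := bnd u2 (by positivity) hUK le_rfl
  refine ⟨?_, Z1, V1⟩
  have sup : ∀ g : ℝ → ℝ, ContDiff ℝ r g → HS 0 1 r g ≤ K → ∀ y ∈ Icc (0:ℝ) 1,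
      |g y| ≤ 1 + 2 * K ∧ |deriv g y| ≤ 1 + 2 * K := by
    intro g cg hg y hy
    have h0 := HS_sup (a := 0) (b := 1) (by norm_num) (j := 0) cg (by omega) hy
    have h1 := HS_sup (a := 0) (b := 1) (by norm_num) (j := 1) cg (by omega) hy
    rw [iteratedDeriv_zero] at h0
    rw [iteratedDeriv_one] at h1
    exact ⟨abs_le_of_sq (by linarith), abs_le_of_sq (by linarith)⟩
  have dif : ∀ g R : ℝ → ℝ, HS 0 1 r g ≤ K → (∀ y ∈ Icc (0:ℝ) 1, (R y - g y) ^ 2 ≤ Cp * h ^ 2 * HS 0 1 r g) →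
      ∀ y ∈ Icc (0:ℝ) 1, |R y - g y| ≤ (1 + Cp * K) * h := by
    intro g R hg H y hy
    refine abs_le_of_sq_h hh.le hCK ((H y hy).trans ?_)
    calc Cp * h ^ 2 * HS 0 1 r g ≤ Cp * h ^ 2 * K := mul_le_mul_of_nonneg_left hg (by positivity)
      _ = _ := by ring
  have dz := dif Z Rz hZK z3
  have du := dif U Ru hUK u3
  have sz := sup Z cZ hZK
  have su := sup U cU hUK
  have wid : ∀ {q : ℝ}, q ≤ (1 + Cp * K) * h → q ≤ L * h := fun {q} hq =>
    hq.trans (mul_le_mul_of_nonneg_right (by rw [hLdef]; linarith) hh.le)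
  have rb : ∀ {p q : ℝ}, |p| ≤ 1 + 2 * K → |q - p| ≤ (1 + Cp * K) * h → |q| ≤ L := by
    intro p q h1 h2
    have h3 : |q| ≤ |q - p| + |p| := by simpa using abs_add_le (q - p) p
    have h4 : (1 + Cp * K) * h ≤ (1 + Cp * K) * 1 := mul_le_mul_of_nonneg_left hh1 (by positivity)
    rw [hLdef]; linarith
  have core := err_core (L := L) (h := h) hh.le hL pZ pU (Sh_PC hp mRz) (Sh_PC hp mRu.1)
    (lin_PC B.pce a) (lin_PC B.pcf b) U0 U1 mRu.2.1 mRu.2.2 (B.lf b).2.1 (B.lf b).2.2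
    (fun y hy => (sz y hy).2.trans (by rw [hLdef]; linarith)) (fun y hy => (su y hy).2.trans (by rw [hLdef]; linarith))
    (fun y hy => rb (sz y hy).1 (dz y hy)) (fun y hy => rb (su y hy).1 (du y hy))
    (fun y hy => wid (dz y hy)) (fun y hy => wid (du y hy))
  have i1 := Hi N k x h hp hm hq _ (B.le a)
  have i2 := Hi N k x h hp hm hq _ (B.lf b).1
  have na : ∫ y in (0:ℝ)..1, lin e a y ^ 2 = ∑ i, a i ^ 2 := by
    simp only [sq]; exact lin_norm zero_le_one (fun i => (B.pce i).bi) B.oe a a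
  have nb : ∫ y in (0:ℝ)..1, lin f b y ^ 2 = ∑ i, b i ^ 2 := by
    simp only [sq]; exact lin_norm zero_le_one (fun i => (B.pcf i).bi) B.of b b
  rw [na] at i1 core
  rw [nb] at i2 core
  refine core.trans ?_
  have j1 := mul_le_mul_of_nonneg_left (add_le_add i1 i2) (by positivity : 0 ≤ 2 * L)
  have j2 := mul_le_mul_of_nonneg_left (add_le_add (add_le_add (add_le_add Z1 V1) Z2) V2) (by positivity : 0 ≤ 2 * L)
  linarith

/-- The error estimate. -/
theorem err_est {T : ℝ} {r : ℕ} {γ : ℝ} {Z U Z1 U1 : ℝ → ℝ → ℝ} (hS : Sol T r Z U Z1 U1) (hT : 0 < T) (hr : 2 ≤ r)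
    (hγ : 1 ≤ γ) :
    ∃ C : ℝ, ∀ (N k : ℕ) (x : ℕ → ℝ) (h : ℝ), k ≤ r - 2 → IsPartition N x → IsMeshSize N x h →
      QuasiUniform N x h γ → ∀ (n m : ℕ) (e : Fin n → ℝ → ℝ) (f : Fin m → ℝ → ℝ), Bas N r k x e f →
      ∀ c : ℝ → EuclideanSpace ℝ (Fin n ⊕ Fin m),
        (∀ t ∈ Icc 0 T, HasDerivWithinAt c (galG 0 1 e f (c t)) (Icc 0 T) t) →
        (∀ i, c 0 (Sum.inl i) = ∫ s in (0:ℝ)..1, Z 0 s * e i s) →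
        (∀ j, c 0 (Sum.inr j) = ∫ s in (0:ℝ)..1, U 0 s * f j s) →
        ∀ t ∈ Icc 0 T,
          nrm (fun y => Z t y - lin e (fun i => c t (Sum.inl i)) y)
            + nrm (fun y => U t y - lin f (fun i => c t (Sum.inr i)) y) ≤ C * h ^ (r - 1) := by
  obtain ⟨K, hK⟩ := REG hS hT hr
  have hK0 : 0 ≤ K := by
    have := hK 0 ⟨le_rfl, hT.le⟩
    linarith [HS_nonneg (a := 0) (b := 1) (m := r) (f := Z 0) zero_le_one,
      HS_nonneg (a := 0) (b := 1) (m := r) (f := U 0) zero_le_one]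
  obtain ⟨K1, e0, D, hK1, he0, hD, step⟩ := err_step (γ := γ) hr hγ hK0
  set D2 := 2 * D + 2 * (e0 * T * Real.exp (K1 * T)) with hD2
  have hD20 : 0 ≤ D2 := by positivity
  refine ⟨2 * √D2, ?_⟩
  intro N k x h hk hp hm hq n m e f B c hc hc0 hc0'
  have hh := mesh_pos hp hm
  have st := step N k x h hk hp hm hq n m e f B
  set H := (h ^ (r-1)) ^ 2 with hH
  have H0 : 0 ≤ H := sq_nonneg _
  have cZ : ∀ t ∈ Icc 0 T, ContDiff ℝ 1 (Z t) := fun t ht => (hS.cz t ht).of_le (by exact_mod_cast (by omega : 1 ≤ r))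
  have cU : ∀ t ∈ Icc 0 T, ContDiff ℝ 1 (U t) := fun t ht => (hS.cu t ht).of_le (by exact_mod_cast (by omega : 1 ≤ r))
  let qz : ℝ → Fin n → ℝ := fun t i => ∫ s in (0:ℝ)..1, Z t s * e i s
  let qu : ℝ → Fin m → ℝ := fun t i => ∫ s in (0:ℝ)..1, U t s * f i s
  let a : ℝ → Fin n → ℝ := fun t i => c t (Sum.inl i) - qz t i
  let b : ℝ → Fin m → ℝ := fun t i => c t (Sum.inr i) - qu t i
  let E : ℝ → ℝ := fun t => ∑ i, a t i ^ 2 + ∑ j, b t j ^ 2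
  let E' : ℝ → ℝ := fun t =>
    (∫ y in (0:ℝ)..1, ((lin e (qz t) y + lin e (a t) y) * (lin f (qu t) y + lin f (b t) y) - Z t y * U t y) * deriv (lin e (a t)) y)
      + (∫ y in (0:ℝ)..1, (1/2) * ((lin e (qz t) y + lin e (a t) y)^2 - Z t y ^ 2 + 3 * ((lin f (qu t) y + lin f (b t) y)^2 - U t y ^ 2)) * deriv (lin f (b t)) y)
  have lz : ∀ t y, lin e (fun i => c t (Sum.inl i)) y = lin e (qz t) y + lin e (a t) y := fun t y =>
    lin_addv (qz t) _ y
  have lu : ∀ t y, lin f (fun i => c t (Sum.inr i)) y = lin f (qu t) y + lin f (b t) y := fun t y =>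
    lin_addv (qu t) _ y
  have hE' : ∀ t ∈ Icc 0 T, E' t ≤ K1 * E t + e0 * H := fun t ht =>
    (st (Z t) (U t) (hS.cz t ht) (hS.cu t ht) (hS.b0 t ht) (hS.b1 t ht) (hK t ht) (a t) (b t) _ _ rfl rfl).1
  have hdE : ∀ t ∈ Icc 0 T, HasDerivWithinAt E (E' t) (Icc 0 T) t := by
    intro t ht
    have pZ := PC.of_contDiff (a := 0) (b := 1) (cZ t ht)
    have pU := PC.of_contDiff (a := 0) (b := 1) (cU t ht)
    have bRz : BI 0 1 (fun y => lin e (qz t) y + lin e (a t) y) :=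
      (lin_PC B.pce (qz t)).bi.add (lin_PC B.pce (a t)).bi
    have bRu : BI 0 1 (fun y => lin f (qu t) y + lin f (b t) y) :=
      (lin_PC B.pcf (qu t)).bi.add (lin_PC B.pcf (b t)).bi
    have G1 := (bRz.mul bRu).sub (pZ.bi.mul pU.bi)
    have G2 := ((bRz.sq.sub pZ.bi.sq).add ((bRu.sq.sub pU.bi.sq).const_mul 3)).const_mul (1/2)
    have da : ∀ i, HasDerivWithinAt (fun s => a s i)
        ((1/2) * ∫ y in (0:ℝ)..1, ((lin e (qz t) y + lin e (a t) y) * (lin f (qu t) y + lin f (b t) y) - Z t y * U t y) * deriv (e i) y)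
        (Icc 0 T) t := by
      intro i
      have h1 := coord_deriv (hc t ht) (Sum.inl i)
      have h2 := mom_deriv (B.pce i).1 hS.dz hS.jz1 (fun t ht => (cZ t ht).continuous) ht
      refine (h1.fun_sub h2).congr_deriv ?_
      rw [wk_z (cZ t ht) (cU t ht) (B.pce i) (hS.b0 t ht) (hS.b1 t ht) (hS.pz t ht)]
      have h3 : galG 0 1 e f (c t) (Sum.inl i) = ∫ y in (0:ℝ)..1, 1/2 * (lin e (fun i => c t (Sum.inl i)) y * lin f (fun j => c t (Sum.inr j)) y) * deriv (e i) y := rfl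
      rw [h3]
      simp only [lz, lu]
      rw [← int_sub zero_le_one (((bRz.mul bRu).const_mul (1/2)).mul (B.pce i).bi_deriv) (((pZ.bi.mul pU.bi).const_mul (1/2)).mul (B.pce i).bi_deriv),
        ← intervalIntegral.integral_const_mul]
      exact intervalIntegral.integral_congr fun y _ => by show _ = _; ring
    have db : ∀ i, HasDerivWithinAt (fun s => b s i)
        ((1/2) * ∫ y in (0:ℝ)..1, (1/2) * ((lin e (qz t) y + lin e (a t) y)^2 - Z t y ^ 2 + 3 * ((lin f (qu t) y + lin f (b t) y)^2 - U t y ^ 2)) * deriv (f i) y)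
        (Icc 0 T) t := by
      intro i
      have h1 := coord_deriv (hc t ht) (Sum.inr i)
      have h2 := mom_deriv (B.pcf i).1 hS.du hS.ju1 (fun t ht => (cU t ht).continuous) ht
      refine (h1.fun_sub h2).congr_deriv ?_
      rw [wk_u (cZ t ht) (cU t ht) (B.pcf i) (B.f0 i) (B.f1 i) (hS.pu t ht)]
      have h3 : galG 0 1 e f (c t) (Sum.inr i) = ∫ y in (0:ℝ)..1, (1/4 * lin e (fun i => c t (Sum.inl i)) y ^ 2 + 3/4 * lin f (fun j => c t (Sum.inr j)) y ^ 2) * deriv (f i) y := rfl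
      rw [h3]
      simp only [lz, lu]
      rw [← int_sub zero_le_one (((bRz.sq.const_mul (1/4)).add (bRu.sq.const_mul (3/4))).mul (B.pcf i).bi_deriv) (((pZ.bi.sq.const_mul (1/4)).add (pU.bi.sq.const_mul (3/4))).mul (B.pcf i).bi_deriv),
        ← intervalIntegral.integral_const_mul]
      exact intervalIntegral.integral_congr fun y _ => by show _ = _; ring
    have hsum := (HasDerivWithinAt.fun_sum (u := Finset.univ) fun i _ => (da i).fun_pow 2).fun_add
      (HasDerivWithinAt.fun_sum (u := Finset.univ) fun i _ => (db i).fun_pow 2)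
    refine hsum.congr_deriv ?_
    show _ = (∫ y in (0:ℝ)..1, ((lin e (qz t) y + lin e (a t) y) * (lin f (qu t) y + lin f (b t) y) - Z t y * U t y) * deriv (lin e (a t)) y)
      + (∫ y in (0:ℝ)..1, (1/2) * ((lin e (qz t) y + lin e (a t) y)^2 - Z t y ^ 2 + 3 * ((lin f (qu t) y + lin f (b t) y)^2 - U t y ^ 2)) * deriv (lin f (b t)) y)
    rw [int_mul_deriv_lin zero_le_one B.pce G1, int_mul_deriv_lin zero_le_one B.pcf G2]
    congr 1
    · refine Finset.sum_congr rfl fun i _ => ?_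
      norm_num; ring
    · refine Finset.sum_congr rfl fun i _ => ?_
      norm_num; ring
  have hE0 : E 0 = 0 := by
    have h1 : ∀ i, a 0 i = 0 := fun i => sub_eq_zero.2 (hc0 i)
    have h2 : ∀ i, b 0 i = 0 := fun i => sub_eq_zero.2 (hc0' i)
    simp [E, h1, h2]
  intro t ht
  have gr := gronwall_lin hK1 (mul_nonneg he0 H0) hdE hE' t ht
  rw [hE0, zero_add] at gr
  have gr2 : E t ≤ e0 * T * Real.exp (K1 * T) * H := by
    refine gr.trans ?_
    have h1 : e0 * H * t ≤ e0 * H * T := mul_le_mul_of_nonneg_left ht.2 (by positivity)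
    have h2 : Real.exp (K1 * t) ≤ Real.exp (K1 * T) := Real.exp_le_exp.2 (mul_le_mul_of_nonneg_left ht.2 hK1)
    calc e0 * H * t * Real.exp (K1 * t) ≤ e0 * H * T * Real.exp (K1 * T) :=
          mul_le_mul h1 h2 (by positivity) (by positivity)
      _ = _ := by ring
  obtain ⟨-, r1, r2⟩ := st (Z t) (U t) (hS.cz t ht) (hS.cu t ht) (hS.b0 t ht) (hS.b1 t ht) (hK t ht) (a t) (b t) _ _ rfl rfl
  have na : ∫ y in (0:ℝ)..1, lin e (a t) y ^ 2 = ∑ i, a t i ^ 2 := by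
    simp only [sq]; exact lin_norm zero_le_one (fun i => (B.pce i).bi) B.oe _ _
  have nb : ∫ y in (0:ℝ)..1, lin f (b t) y ^ 2 = ∑ i, b t i ^ 2 := by
    simp only [sq]; exact lin_norm zero_le_one (fun i => (B.pcf i).bi) B.of _ _
  have sa : 0 ≤ ∑ i, a t i ^ 2 := Finset.sum_nonneg fun i _ => sq_nonneg _
  have sb : 0 ≤ ∑ i, b t i ^ 2 := Finset.sum_nonneg fun i _ => sq_nonneg _
  have ea : ∑ i, a t i ^ 2 ≤ E t := by show _ ≤ _ + _; linarith
  have eb : ∑ i, b t i ^ 2 ≤ E t := by show _ ≤ _ + _; linarith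
  have fin : ∀ {S R g : ℝ → ℝ}, BI 0 1 S → BI 0 1 R → BI 0 1 g → (∫ y in (0:ℝ)..1, (R y - S y) ^ 2) ≤ D * H →
      (∫ y in (0:ℝ)..1, g y ^ 2) ≤ e0 * T * Real.exp (K1 * T) * H →
      nrm (fun y => S y - (R y + g y)) ≤ √D2 * h ^ (r-1) := by
    intro S R g hS hR hg h1 h2
    have : ∫ y in (0:ℝ)..1, (S y - (R y + g y)) ^ 2 ≤ ∫ y in (0:ℝ)..1, (2 * (R y - S y) ^ 2 + 2 * g y ^ 2) := by
      refine int_mono zero_le_one (hS.sub (hR.add hg)).sq (((hR.sub hS).sq.const_mul 2).add (hg.sq.const_mul 2)) fun y _ => ?_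
      nlinarith [sq_nonneg (R y - S y - g y)]
    rw [int_add zero_le_one ((hR.sub hS).sq.const_mul 2) (hg.sq.const_mul 2), intervalIntegral.integral_const_mul,
      intervalIntegral.integral_const_mul] at this
    unfold nrm
    have h3 : ∫ y in (0:ℝ)..1, (S y - (R y + g y)) ^ 2 ≤ D2 * H := by rw [hD2]; linarith
    refine (Real.sqrt_le_sqrt h3).trans ?_
    rw [Real.sqrt_mul hD20, hH, Real.sqrt_sq (by positivity)]
  have f1 := fin (PC.of_contDiff (a := 0) (b := 1) (cZ t ht)).bi (lin_PC B.pce (qz t)).bi (lin_PC B.pce (a t)).bi r1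
    (by rw [na]; exact ea.trans gr2)
  have f2 := fin (PC.of_contDiff (a := 0) (b := 1) (cU t ht)).bi (lin_PC B.pcf (qu t)).bi (lin_PC B.pcf (b t)).bi r2
    (by rw [nb]; exact eb.trans gr2)
  simp only [lz, lu]
  linarith

lemma ext_fam {T : ℝ} {r : ℕ} {w : ℝ → ℝ → ℝ}
    (h : ∀ t ∈ Icc (0:ℝ) T, ContDiffOn ℝ r (fun y => w y t) (Icc (0:ℝ) 1)) :
    ∃ W : ℝ → ℝ → ℝ, (∀ t ∈ Icc (0:ℝ) T, ContDiff ℝ r (W t)) ∧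
      ∀ t ∈ Icc (0:ℝ) T, ∀ y ∈ Icc (0:ℝ) 1, W t y = w y t := by
  have : ∀ t, ∃ g : ℝ → ℝ, t ∈ Icc (0:ℝ) T → ContDiff ℝ r g ∧ ∀ y ∈ Icc (0:ℝ) 1, g y = w y t := by
    intro t
    by_cases ht : t ∈ Icc (0:ℝ) T
    · obtain ⟨g, h1, h2⟩ := ext_contDiff r _ (h t ht)
      exact ⟨g, fun _ => ⟨h1, h2⟩⟩
    · exact ⟨0, fun h => absurd h ht⟩
  choose W hW using this
  exact ⟨W, fun t ht => (hW t ht).1, fun t ht => (hW t ht).2⟩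

lemma dW_eq {g G : ℝ → ℝ} (h : ∀ y ∈ Icc (0:ℝ) 1, G y = g y) (hG : ContDiff ℝ 1 G) {y : ℝ}
    (hy : y ∈ Icc (0:ℝ) 1) : derivWithin g (Icc (0:ℝ) 1) y = deriv G y := by
  rw [derivWithin_congr (fun z hz => (h z hz).symm) (h y hy).symm]
  exact (hG.differentiable one_ne_zero y).derivWithin (uniqueDiffOn_Icc zero_lt_one y hy)

lemma swap_cont {T : ℝ} {w : ℝ → ℝ → ℝ}
    (h : ContinuousOn (fun p : ℝ × ℝ => w p.1 p.2) ((Icc (0:ℝ) 1) ×ˢ (Icc (0:ℝ) T))) :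
    ContinuousOn (fun p : ℝ × ℝ => w p.2 p.1) ((Icc (0:ℝ) T) ×ˢ (Icc (0:ℝ) 1)) :=
  h.comp (f := fun p : ℝ × ℝ => (p.2, p.1)) (by fun_prop) fun p hp => ⟨hp.2, hp.1⟩

lemma mk_Sol {r : ℕ} (hr : 2 ≤ r) {T : ℝ} {ηs us : ℕ → ℝ → ℝ → ℝ}
    (hη : SmoothChain T r 1 ηs) (hu : SmoothChain T r 1 us)
    (hsol : SSW T (ηs 0) (us 0) (ηs 1) (us 1)) :
    ∃ Z U Z1 U1 : ℝ → ℝ → ℝ, Sol T r Z U Z1 U1 ∧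
      (∀ t ∈ Icc (0:ℝ) T, ∀ y ∈ Icc (0:ℝ) 1, Z t y = 2 + ηs 0 y t) ∧
      (∀ t ∈ Icc (0:ℝ) T, ∀ y ∈ Icc (0:ℝ) 1, U t y = us 0 y t) := by
  obtain ⟨A, hA, eA⟩ := ext_fam (hη.2.1 0 (by norm_num))
  obtain ⟨U, hU, eU⟩ := ext_fam (hu.2.1 0 (by norm_num))
  have eZ : ∀ t ∈ Icc (0:ℝ) T, ∀ y ∈ Icc (0:ℝ) 1, 2 + A t y = 2 + ηs 0 y t := fun t ht y hy => by
    rw [eA t ht y hy]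
  have hr1 : (1 : WithTop ℕ∞) ≤ r := by exact_mod_cast (by omega : 1 ≤ r)
  have pde : ∀ t ∈ Icc (0:ℝ) T, ∀ y ∈ Icc (0:ℝ) 1,
      ηs 1 y t = - Gz (fun y => 2 + A t y) (U t) y ∧ us 1 y t = - Gu (fun y => 2 + A t y) (U t) y := by
    intro t ht y hy
    obtain ⟨p1, p2⟩ := hsol.1 y hy t ht
    have cA := (hA t ht).of_le hr1
    have cU := (hU t ht).of_le hr1
    rw [dW_eq (g := fun z => us 0 z t) (eU t ht) cU hy,
      dW_eq (g := fun z => ηs 0 z t * us 0 z t) (G := fun z => A t z * U t z)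
        (fun z hz => by rw [eA t ht z hz, eU t ht z hz]) (cA.mul cU) hy] at p1
    rw [dW_eq (g := fun z => us 0 z t) (eU t ht) cU hy, dW_eq (g := fun z => ηs 0 z t) (eA t ht) cA hy,
      ← eA t ht y hy, ← eU t ht y hy] at p2
    have dA := (cA.differentiable one_ne_zero y).hasDerivAt
    have dU := (cU.differentiable one_ne_zero y).hasDerivAt
    rw [(dA.fun_mul dU).deriv] at p1
    have dZ : deriv (fun y => 2 + A t y) y = deriv (A t) y := (dA.const_add 2).deriv
    constructor
    · rw [Gz, dZ]; linarith
    · rw [Gu, dZ]; linarith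
  refine ⟨fun t y => 2 + A t y, U, fun t y => ηs 1 y t, fun t y => us 1 y t, ?_, eZ, eU⟩
  refine ⟨fun t ht => contDiff_const.add (hA t ht), hU, ?_, ?_, ?_, ?_, ?_, ?_,
    fun t ht y hy => (pde t ht y hy).1, fun t ht y hy => (pde t ht y hy).2, ?_, ?_⟩
  · intro t ht y hy
    exact ((hη.1 0 one_pos y hy t ht).const_add 2).congr (fun s hs => eZ s hs y hy) (eZ t ht y hy)
  · intro t ht y hy
    exact (hu.1 0 one_pos y hy t ht).congr (fun s hs => eU s hs y hy) (eU t ht y hy)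
  · exact (continuousOn_const.add (swap_cont (hη.2.2 0 (by norm_num)))).congr
      fun p hp => eZ p.1 hp.1 p.2 hp.2
  · exact (swap_cont (hu.2.2 0 (by norm_num))).congr fun p hp => eU p.1 hp.1 p.2 hp.2
  · exact swap_cont (hη.2.2 1 le_rfl)
  · exact swap_cont (hu.2.2 1 le_rfl)
  · intro t ht
    rw [eU t ht 0 ⟨le_rfl, zero_le_one⟩]; exact (hsol.2 t ht).1
  · intro t ht
    rw [eU t ht 1 ⟨zero_le_one, le_rfl⟩]; exact (hsol.2 t ht).2

lemma nrm_congr {f g : ℝ → ℝ} (h : ∀ y ∈ Icc (0:ℝ) 1, f y = g y) : nrm f = nrm g := by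
  unfold nrm
  congr 1
  refine intervalIntegral.integral_congr fun y hy => ?_
  rw [uIcc_of_le zero_le_one] at hy
  show f y ^ 2 = g y ^ 2
  rw [h y hy]

theorem stmt_2 (r k : ℕ) (hr : 2 ≤ r) (hk : k ≤ r - 2)
    (γ T : ℝ) (hγ : 1 ≤ γ) (hT : 0 < T)
    (ηs us : ℕ → ℝ → ℝ → ℝ)
    (hηsm : SmoothChain T r 1 ηs) (husm : SmoothChain T r 1 us)
    (hsol : SSW T (ηs 0) (us 0) (ηs 1) (us 1)) :
    ∃ C : ℝ, ∀ (N : ℕ) (x : ℕ → ℝ) (h : ℝ),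
      IsPartition N x → IsMeshSize N x h → QuasiUniform N x h γ →
      (∃ ηh uh dηh duh : ℝ → ℝ → ℝ,
        SolvesSSWGalerkin N r k x T ηh uh dηh duh ∧
        IsL2ProjOn (Sh N r k x) (fun y => ηs 0 y 0) (ηh 0) ∧
        IsL2ProjOn (Sh0 N r k x) (fun y => us 0 y 0) (uh 0) ∧
        ∀ t ∈ Icc (0:ℝ) T,
          nrm (fun y => ηs 0 y t - ηh t y) + nrm (fun y => us 0 y t - uh t y)
            ≤ C * h ^ (r - 1)) ∧
      (∀ ηh uh dηh duh ηh' uh' dηh' duh' : ℝ → ℝ → ℝ,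
        SolvesSSWGalerkin N r k x T ηh uh dηh duh →
        IsL2ProjOn (Sh N r k x) (fun y => ηs 0 y 0) (ηh 0) →
        IsL2ProjOn (Sh0 N r k x) (fun y => us 0 y 0) (uh 0) →
        SolvesSSWGalerkin N r k x T ηh' uh' dηh' duh' →
        IsL2ProjOn (Sh N r k x) (fun y => ηs 0 y 0) (ηh' 0) →
        IsL2ProjOn (Sh0 N r k x) (fun y => us 0 y 0) (uh' 0) →
        ∀ t ∈ Icc (0:ℝ) T, ∀ y ∈ Icc (0:ℝ) 1,
          ηh t y = ηh' t y ∧ uh t y = uh' t y) := by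
  obtain ⟨Z, U, Z1, U1, hS, eZ, eU⟩ := mk_Sol hr hηsm husm hsol
  obtain ⟨C, hC⟩ := err_est (γ := γ) hS hT hr hγ
  have t0 : (0:ℝ) ∈ Icc (0:ℝ) T := ⟨le_rfl, hT.le⟩
  have b1 : BI 0 1 (fun y => ηs 0 y 0) := BI.of_continuousOn (hηsm.2.1 0 (by norm_num) 0 t0).continuousOn
  have b2 : BI 0 1 (fun y => us 0 y 0) := BI.of_continuousOn (husm.2.1 0 (by norm_num) 0 t0).continuousOn
  refine ⟨C, fun N x h hp hm hq => ?_⟩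
  obtain ⟨n, m, e, f, B⟩ := exists_Bas (N := N) (r := r) (k := k) (x := x) (by omega) hp
  refine ⟨?_, fun ηh uh dηh duh ηh' uh' dηh' duh' a1 a2 a3 a4 a5 a6 =>
    B.unique hT b1 b2 a1 a2 a3 a4 a5 a6⟩
  obtain ⟨c, hc0, hc, i1, i2⟩ := B.exist_init (T := T) hT b1 b2
  refine ⟨_, _, _, _, B.exist hc, i1, i2, fun t ht => ?_⟩
  have h1 := hC N k x h hk hp hm hq n m e f B c hc
    (fun i => by
      rw [hc0]
      show ∫ s in (0:ℝ)..1, (2 + ηs 0 s 0) * e i s = _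
      refine intervalIntegral.integral_congr fun y hy => ?_
      rw [uIcc_of_le zero_le_one] at hy
      show _ = Z 0 y * e i y
      rw [eZ 0 t0 y hy])
    (fun j => by
      rw [hc0]
      show ∫ s in (0:ℝ)..1, us 0 s 0 * f j s = _
      refine intervalIntegral.integral_congr fun y hy => ?_
      rw [uIcc_of_le zero_le_one] at hy
      show _ = U 0 y * f j y
      rw [eU 0 t0 y hy]) t ht
  refine le_of_eq_of_le ?_ h1
  congr 1
  · refine nrm_congr fun y hy => ?_
    rw [eZ t ht y hy]; ring
  · refine nrm_congr fun y hy => ?_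
    rw [eU t ht y hy]
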